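/- Under Assumptions A1–A3 (fractional-linear BPRE), fix t ∈ (0,1), λ ≥ 0 and set F_{n,t}(λ) := f_{0,⌊nt⌋}(s f_{⌊nt⌋,n}(f(0))) − f_{0,⌊nt⌋}(s f_{⌊nt⌋,n}(0)) with s = exp(−λ e^{−S_{⌊nt⌋}}), so that E[e^{−λ Z_{⌊nt⌋} e^{−S_{⌊nt⌋}}}; T = n+1] = E[F_{n,t}(λ)]. Then for each fixed j ∈ ℕ_0, lim_{n→∞} n^{3/2} E[F_{n,t}(λ); τ(n) = j] = K_1 E[ e^{−S_j} 1{τ(j) = j} X_f(1) A_j*(λ) ], where X_f(1) = f(0)/(1 − f(0)), K_1 is the constant from E[e^{−S_n}; L_n ≥ 0] ∼ K_1 n^{−3/2}, and A_j*(λ) := ⨌ Θ*(a_j, b_j, λ; u, v, −z) P⁺(B⁺ ∈ du) P_z⁻(V_∞(f(0), 0) ∈ dv) ν_1(dz), with a_j = e^{−S_j}, b_j = Σ_{i=0}^{j−1} η_{i+1} e^{−S_i}. -/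

import Mathlib

open MeasureTheory ProbabilityTheory Filter Set Topology

noncomputable section

namespace BPREpaper

variable {Ω : Type*} [MeasurableSpace Ω]

/-- The random walk `S n = X 1 + ... + X n` (increments indexed from `1`, `S 0 = 0`). -/
def walk (X : ℕ → Ω → ℝ) (n : ℕ) (ω : Ω) : ℝ := ∑ i ∈ Finset.Icc 1 n, X i ω

/-- `Mwalk X n = max (S 1, ..., S n)` for `n ≥ 1` (junk value `0` for `n = 0`). -/
def Mwalk (X : ℕ → Ω → ℝ) : ℕ → Ω → ℝ
  | 0, _ => 0
  | n + 1, ω =>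
      (Finset.Icc 1 (n + 1)).sup' (Finset.nonempty_Icc.mpr (by omega)) fun i => walk X i ω

/-- `Lwalk X n = min (S 1, ..., S n)` for `n ≥ 1` (junk value `0` for `n = 0`). -/
def Lwalk (X : ℕ → Ω → ℝ) : ℕ → Ω → ℝ
  | 0, _ => 0
  | n + 1, ω =>
      (Finset.Icc 1 (n + 1)).inf' (Finset.nonempty_Icc.mpr (by omega)) fun i => walk X i ω

/-- minimum of `S 0, S 1, ..., S n`. -/
def minWalk (X : ℕ → Ω → ℝ) (n : ℕ) (ω : Ω) : ℝ :=
  (Finset.range (n + 1)).inf' (by simp) fun i => walk X i ω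

/-- `τ(n)`: the first moment at which the minimum of `S 0, ..., S n` is attained. -/
def tauWalk (X : ℕ → Ω → ℝ) (n : ℕ) (ω : Ω) : ℕ :=
  sInf {i : ℕ | walk X i ω = minWalk X n ω}

/-- The renewal function `u(x) = 1 + ∑_{k ≥ 1} P(-S_k ≤ x, M_k < 0)` for `x ≥ 0`,
`u(x) = 0` for `x < 0`. -/
def uFun (μ : Measure Ω) (X : ℕ → Ω → ℝ) (x : ℝ) : ℝ :=
  if 0 ≤ x then
    1 + ∑' k : ℕ, (μ {ω | -walk X (k + 1) ω ≤ x ∧ Mwalk X (k + 1) ω < 0}).toReal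
  else 0

/-- The renewal function `v(x) = 1 + ∑_{k ≥ 1} P(-S_k > x, L_k ≥ 0)` for `x ≤ 0`,
`v(x) = 0` for `x > 0`. -/
def vFun (μ : Measure Ω) (X : ℕ → Ω → ℝ) (x : ℝ) : ℝ :=
  if x ≤ 0 then
    1 + ∑' k : ℕ, (μ {ω | x < -walk X (k + 1) ω ∧ 0 ≤ Lwalk X (k + 1) ω}).toReal
  else 0

/-- The event `{∀ 1 ≤ i ≤ n, x + S_i ≥ 0} = {L_n ≥ 0}` for the walk started at `x`. -/
def posSet (X : ℕ → Ω → ℝ) (x : ℝ) (n : ℕ) : Set Ω :=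
  {ω | ∀ i ∈ Finset.Icc 1 n, 0 ≤ x + walk X i ω}

/-- The event `{∀ 1 ≤ i ≤ n, x + S_i < 0} = {M_n < 0}` for the walk started at `x`. -/
def negSet (X : ℕ → Ω → ℝ) (x : ℝ) (n : ℕ) : Set Ω :=
  {ω | ∀ i ∈ Finset.Icc 1 n, x + walk X i ω < 0}

/-- A distribution on `ℝ` is non-lattice: it is not concentrated on any arithmetic
progression `a + hℤ`. -/
def NonLattice (ν : Measure ℝ) : Prop :=
  ¬ ∃ a h : ℝ, ν {x | ∃ k : ℤ, x = a + k * h} = 1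

/-- `ν` is an `α`-stable law on `ℝ`. -/
def IsStableLaw (α : ℝ) (ν : Measure ℝ) : Prop :=
  ∀ a b : ℝ, 0 < a → 0 < b → ∃ c d : ℝ, 0 < c ∧ a ^ α + b ^ α = c ^ α ∧
    ((ν.map (fun x => a * x)).prod (ν.map (fun x => b * x))).map (fun p : ℝ × ℝ => p.1 + p.2)
      = ν.map (fun x => c * x + d)

/-- Weak convergence of a sequence of laws on `ℝ`, tested against bounded continuous
functions. -/
def WeakTendsto (μs : ℕ → Measure ℝ) (ν : Measure ℝ) : Prop :=
  ∀ g : BoundedContinuousFunction ℝ ℝ,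
    Tendsto (fun n => ∫ x, g x ∂(μs n)) atTop (𝓝 (∫ x, g x ∂ν))

/-- Assumption A4: there are norming constants `c n → ∞` such that `S n / c n` converges in
distribution to an `α`-stable law concentrated neither on `[0,∞)` nor on `(-∞,0]`; the
increment distribution is non-lattice. -/
def AssumptionA4 (μ : Measure Ω) (X : ℕ → Ω → ℝ) (c : ℕ → ℝ) : Prop :=
  Tendsto c atTop atTop ∧ NonLattice (μ.map (X 1)) ∧
    ∃ (α : ℝ) (ν : Measure ℝ), IsProbabilityMeasure ν ∧ IsStableLaw α ν ∧
      0 < ν (Set.Iio 0) ∧ 0 < ν (Set.Ioi 0) ∧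
      WeakTendsto (fun n => μ.map fun ω => walk X n ω / c n) ν

/-- A family of random elements indexed by `ι` which is i.i.d. (the common distribution
being that of the element with index `i0`). -/
def IIDfam {ι : Type*} {E : Type*} [MeasurableSpace E] (μ : Measure Ω) (Q : ι → Ω → E)
    (i0 : ι) : Prop :=
  (∀ i, Measurable (Q i)) ∧ iIndepFun Q μ ∧
    ∀ i, IdentDistrib (Q i) (Q i0) μ μ

/-- An i.i.d. sequence indexed by `ℕ` (indices from `1` are the relevant ones). -/
def IIDseq {E : Type*} [MeasurableSpace E] (μ : Measure Ω) (Q : ℕ → Ω → E) : Prop :=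
  IIDfam μ Q 1

/-- `P` is the h-transform measure `P_x⁺`: for every `n` and every bounded
`F n`-measurable `g`, `E_P[g] = u(x)⁻¹ E_x[g · u(S_n); L_n ≥ 0]`. -/
def IsPplus (μ : Measure Ω) (X : ℕ → Ω → ℝ) (F : ℕ → MeasurableSpace Ω) (x : ℝ)
    (P : Measure Ω) : Prop :=
  IsProbabilityMeasure P ∧
    ∀ (n : ℕ) (g : Ω → ℝ), Measurable[F n] g → (∃ C, ∀ ω, |g ω| ≤ C) →
      ∫ ω, g ω ∂P =
        (uFun μ X x)⁻¹ * ∫ ω in posSet X x n, g ω * uFun μ X (x + walk X n ω) ∂μ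

/-- `P` is the h-transform measure `P_x⁻`: for every `n` and every bounded
`F n`-measurable `g`, `E_P[g] = v(x)⁻¹ E_x[g · v(S_n); M_n < 0]`. -/
def IsPminus (μ : Measure Ω) (X : ℕ → Ω → ℝ) (F : ℕ → MeasurableSpace Ω) (x : ℝ)
    (P : Measure Ω) : Prop :=
  IsProbabilityMeasure P ∧
    ∀ (n : ℕ) (g : Ω → ℝ), Measurable[F n] g → (∃ C, ∀ ω, |g ω| ≤ C) →
      ∫ ω, g ω ∂P =
        (vFun μ X x)⁻¹ * ∫ ω in negSet X x n, g ω * vFun μ X (x + walk X n ω) ∂μ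

/-- The filtration generated by the environment `Q 1, ..., Q n`. -/
def envFiltration {E : Type*} [MeasurableSpace E] (Q : ℕ → Ω → E) (n : ℕ) :
    MeasurableSpace Ω :=
  ⨆ i ∈ Finset.Icc 1 n, MeasurableSpace.comap (Q i) inferInstance

/-- The σ-algebra generated by the whole environment `Q 1, Q 2, ...`. -/
def envSigma {E : Type*} [MeasurableSpace E] (Q : ℕ → Ω → E) : MeasurableSpace Ω :=
  ⨆ i, MeasurableSpace.comap (Q (i + 1)) inferInstance




/-- Probability generating function of the (random) offspring law `Q n`. -/
def pgf (Q : ℕ → Ω → Measure ℕ) (n : ℕ) (ω : Ω) (s : ℝ) : ℝ :=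
  ∑' i : ℕ, (Q n ω {i}).toReal * s ^ i

/-- Mean `m(Q_n)` of the offspring law `Q n`. -/
def meanQ (Q : ℕ → Ω → Measure ℕ) (n : ℕ) (ω : Ω) : ℝ :=
  ∑' i : ℕ, (i : ℝ) * (Q n ω {i}).toReal

/-- `X_n = log f_n'(1)`, the increments of the associated random walk. -/
def Xenv (Q : ℕ → Ω → Measure ℕ) (n : ℕ) (ω : Ω) : ℝ := Real.log (meanQ Q n ω)

/-- `η_n = f_n''(1) / (2 f_n'(1)^2)`. -/
def etaEnv (Q : ℕ → Ω → Measure ℕ) (n : ℕ) (ω : Ω) : ℝ :=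
  (∑' i : ℕ, ((i : ℝ) * ((i : ℝ) - 1)) * (Q n ω {i}).toReal) / (2 * meanQ Q n ω ^ 2)

/-- The associated random walk `S_n = X_1 + ... + X_n`. -/
def Senv (Q : ℕ → Ω → Measure ℕ) : ℕ → Ω → ℝ := walk (Xenv Q)

/-- The composition `f_{j,n}(s) = f_{j+1}(f_{j+2}(⋯ f_n(s) ⋯))`, with `f_{j,n} = id` for
`n ≤ j`. -/
def pgfComp (Q : ℕ → Ω → Measure ℕ) (j : ℕ) : ℕ → Ω → ℝ → ℝ
  | 0, _, s => s
  | n + 1, ω, s => if n + 1 ≤ j then s else pgfComp Q j n ω (pgf Q (n + 1) ω s)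

/-- `b_n = ∑_{i=0}^{n-1} η_{i+1} e^{-S_i}`. -/
def bEnv (Q : ℕ → Ω → Measure ℕ) (n : ℕ) (ω : Ω) : ℝ :=
  ∑ i ∈ Finset.range n, etaEnv Q (i + 1) ω * Real.exp (-(Senv Q i ω))

/-- `B⁺ = ∑_{i=0}^∞ η_{i+1} e^{-S_i}`. -/
def Bplus (Q : ℕ → Ω → Measure ℕ) (ω : Ω) : ℝ :=
  ∑' i : ℕ, etaEnv Q (i + 1) ω * Real.exp (-(Senv Q i ω))

/-- `B⁻ = ∑_{i=1}^∞ η_i e^{S_i}`. -/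
def Bminus (Q : ℕ → Ω → Measure ℕ) (ω : Ω) : ℝ :=
  ∑' i : ℕ, etaEnv Q (i + 1) ω * Real.exp (Senv Q (i + 1) ω)

/-- `V_∞(r) = 1 / (B⁻ + (1 - r)⁻¹)`. -/
def Vinf (Q : ℕ → Ω → Measure ℕ) (r : ℝ) (ω : Ω) : ℝ := (Bminus Q ω + (1 - r)⁻¹)⁻¹

/-- All the offspring generating functions are fractional linear:
`1/(1 - f_n(s)) = e^{-X_n}/(1-s) + η_n`. -/
def FracLinear (Q : ℕ → Ω → Measure ℕ) : Prop :=
  ∀ n, 1 ≤ n → ∀ ω : Ω, ∀ s : ℝ, 0 ≤ s → s < 1 →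
    (1 - pgf Q n ω s)⁻¹ = Real.exp (-(Xenv Q n ω)) / (1 - s) + etaEnv Q n ω

/-- Assumption A1 with explicit constant `χ`. -/
def AssumptionA1With (μ : Measure Ω) (Q : ℕ → Ω → Measure ℕ) (χ : ℝ) : Prop :=
  0 < χ ∧ χ < 1 / 2 ∧ ∀ n, 1 ≤ n →
    ∀ᵐ ω ∂μ, χ ≤ pgf Q n ω 0 ∧ pgf Q n ω 0 ≤ 1 - χ ∧ χ ≤ etaEnv Q n ω

/-- Assumption A1: for some `χ ∈ (0,1/2)`, `χ ≤ f(0) ≤ 1 - χ` and `η ≥ χ` a.s. -/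
def AssumptionA1 (μ : Measure Ω) (Q : ℕ → Ω → Measure ℕ) : Prop :=
  ∃ χ : ℝ, AssumptionA1With μ Q χ

/-- Assumption A2: `X` has zero mean, finite positive variance and is non-lattice. -/
def AssumptionA2 (μ : Measure Ω) (Q : ℕ → Ω → Measure ℕ) : Prop :=
  Integrable (Xenv Q 1) μ ∧ (∫ ω, Xenv Q 1 ω ∂μ) = 0 ∧
    Integrable (fun ω => Xenv Q 1 ω ^ 2) μ ∧ 0 < ∫ ω, Xenv Q 1 ω ^ 2 ∂μ ∧
    NonLattice (μ.map (Xenv Q 1))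

/-- `ζ(a) = ∑_{y ≥ a} y² Q({y}) / m(Q)²`. -/
def zetaEnv (Q : ℕ → Ω → Measure ℕ) (a : ℕ) (ω : Ω) : ℝ :=
  (∑' y : ℕ, if a ≤ y then (y : ℝ) ^ 2 * (Q 1 ω {y}).toReal else 0) / meanQ Q 1 ω ^ 2

/-- Assumption A3: `E[(log⁺ ζ(a))^{2+ε}] < ∞` for some `ε > 0`, `a ∈ ℕ`. -/
def AssumptionA3 (μ : Measure Ω) (Q : ℕ → Ω → Measure ℕ) : Prop :=
  ∃ ε : ℝ, 0 < ε ∧ ∃ a : ℕ, 1 ≤ a ∧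
    Integrable (fun ω => Real.log (max (zetaEnv Q a ω) 1) ^ (2 + ε)) μ

/-- The extinction moment `T = min {k ≥ 0 : Z_k = 0}`. -/
def extinctTime (Z : ℕ → Ω → ℕ) (ω : Ω) : ℕ := sInf {k | Z k ω = 0}

/-- The branching property of `Z` in the environment `Q` (started from one particle):
given the environment and `Z_k`, the conditional generating function of `Z_n` is
`f_{k,n}(s)^{Z_k}`; the state `0` is absorbing. -/
def BranchingProperty (μ : Measure Ω) (Q : ℕ → Ω → Measure ℕ) (Z : ℕ → Ω → ℕ) : Prop :=
  (∀ ω, Z 0 ω = 1) ∧ (∀ n, Measurable (Z n)) ∧ (∀ n ω, Z n ω = 0 → Z (n + 1) ω = 0) ∧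
    ∀ k n : ℕ, k ≤ n → ∀ s : ℝ, 0 ≤ s → s ≤ 1 →
      (μ[fun ω => s ^ Z n ω | envSigma Q ⊔ MeasurableSpace.comap (Z k) inferInstance])
        =ᵐ[μ] fun ω => pgfComp Q k n ω s ^ Z k ω



/-- `l(y) = y 1{0 ≤ y ≤ 1} + 1{y > 1}`. -/
def lfun (y : ℝ) : ℝ := if y < 0 then 0 else if y ≤ 1 then y else 1

/-- `κ(y) = y 1{y > 0}`. -/
def kappa (y : ℝ) : ℝ := if 0 < y then y else 0

/-- `θ*(α,β,λ; u, v, x)`. -/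
def thetaStar (α β lam u v x : ℝ) : ℝ :=
  lfun v / (α * Real.exp (-x) + (lam * α * Real.exp (-x) + lfun v) * (β + α * kappa u))

/-- `ω*(λ; u, v, x)`. -/
def omegaStar (lam u v x : ℝ) : ℝ :=
  lfun v / (1 + (lam + lfun v * Real.exp x) * kappa u)

/-- `F_{n,t}(λ) = f_{0,⌊nt⌋}(s f_{⌊nt⌋,n}(f(0))) - f_{0,⌊nt⌋}(s f_{⌊nt⌋,n}(0))` with
`s = e^{-λ e^{-S_{⌊nt⌋}}}` and `f = f_{n+1}`. -/
def Fnt {Ω : Type*} [MeasurableSpace Ω] (Q : ℕ → Ω → Measure ℕ) (t : ℝ) (n : ℕ)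
    (lam : ℝ) (ω : Ω) : ℝ :=
  pgfComp Q 0 ⌊(n : ℝ) * t⌋₊ ω
      (Real.exp (-lam * Real.exp (-(Senv Q ⌊(n : ℝ) * t⌋₊ ω))) *
        pgfComp Q ⌊(n : ℝ) * t⌋₊ n ω (pgf Q (n + 1) ω 0)) -
    pgfComp Q 0 ⌊(n : ℝ) * t⌋₊ ω
      (Real.exp (-lam * Real.exp (-(Senv Q ⌊(n : ℝ) * t⌋₊ ω))) *
        pgfComp Q ⌊(n : ℝ) * t⌋₊ n ω 0)

/-! ### Random walks killed outside a set -/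

/-- The law at time `n` of the walk with step law `ν` started at `x` and killed when it
leaves `H`. -/
def killed (ν : Measure ℝ) (H : Set ℝ) (x : ℝ) : ℕ → Measure ℝ
  | 0 => Measure.dirac x
  | n + 1 => (Measure.conv (killed ν H x n) ν).restrict H

instance isFiniteMeasure_killed (ν : Measure ℝ) [IsFiniteMeasure ν] (H : Set ℝ) (x : ℝ) (n : ℕ) :
    IsFiniteMeasure (killed ν H x n) := by
  induction n with
  | zero => unfold killed; infer_instance
  | succ n ih => unfold killed; infer_instance

lemma conv_compl_eq_zero {H : Set ℝ} (hH : MeasurableSet H) (hadd : ∀ x ∈ H, ∀ y ∈ H, x + y ∈ H)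
    (m n : Measure ℝ) [IsFiniteMeasure m] [IsFiniteMeasure n] (hm : m Hᶜ = 0) (hn : n Hᶜ = 0) :
    (Measure.conv m n) Hᶜ = 0 := by
  rw [Measure.conv, Measure.map_apply (by fun_prop) hH.compl]
  refine measure_mono_null (t := (Hᶜ ×ˢ univ) ∪ (univ ×ˢ Hᶜ)) ?_ ?_
  · rintro ⟨x, y⟩ h
    by_contra hc
    simp only [mem_union, mem_prod, mem_compl_iff, mem_univ, and_true, true_and, not_or,
      not_not] at hc
    exact h (hadd x hc.1 y hc.2)
  · rw [measure_union_null_iff]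
    simp [Measure.prod_prod, hm, hn]

lemma charFun_add_measure (m n : Measure ℝ) [IsFiniteMeasure m] [IsFiniteMeasure n] :
    charFun (m + n) = charFun m + charFun n := by
  ext t
  simp only [charFun_apply, Pi.add_apply]
  rw [integral_add_measure] <;>
  · refine (integrable_const (1 : ℝ)).mono' (by fun_prop) ?_
    filter_upwards with x
    rw [Complex.norm_exp_ofReal_mul_I]

lemma charFun_conv_eq (m n : Measure ℝ) [IsFiniteMeasure m] [IsFiniteMeasure n] :
    charFun (Measure.conv m n) = charFun m * charFun n := by
  ext t
  simp [charFun_conv]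

/-- Characteristic functions of finite signed measures carried by `H`. -/
def signedOn (H : Set ℝ) : AddSubgroup (ℝ → ℂ) where
  carrier := {f | ∃ m n : Measure ℝ, IsFiniteMeasure m ∧ IsFiniteMeasure n ∧ m Hᶜ = 0 ∧
    n Hᶜ = 0 ∧ f = charFun m - charFun n}
  zero_mem' := ⟨0, 0, inferInstance, inferInstance, by simp, by simp, by simp⟩
  add_mem' := by
    rintro f g ⟨m, n, _, _, hm, hn, rfl⟩ ⟨m', n', _, _, hm', hn', rfl⟩
    refine ⟨m + m', n + n', inferInstance, inferInstance, by simp [hm, hm'], by simp [hn, hn'], ?_⟩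
    rw [charFun_add_measure, charFun_add_measure]
    ring
  neg_mem' := by
    rintro f ⟨m, n, _, _, hm, hn, rfl⟩
    exact ⟨n, m, inferInstance, inferInstance, hn, hm, by simp⟩

lemma charFun_mem_signedOn {H : Set ℝ} (m : Measure ℝ) [IsFiniteMeasure m] (hm : m Hᶜ = 0) :
    charFun m ∈ signedOn H :=
  ⟨m, 0, inferInstance, inferInstance, hm, by simp, by ext t; simp⟩

lemma mul_mem_signedOn {H : Set ℝ} (hH : MeasurableSet H)
    (hadd : ∀ x ∈ H, ∀ y ∈ H, x + y ∈ H) {f g : ℝ → ℂ} (hf : f ∈ signedOn H)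
    (hg : g ∈ signedOn H) : f * g ∈ signedOn H := by
  obtain ⟨m, n, _, _, hm, hn, rfl⟩ := hf
  obtain ⟨m', n', _, _, hm', hn', rfl⟩ := hg
  refine ⟨Measure.conv m m' + Measure.conv n n', Measure.conv m n' + Measure.conv n m',
    inferInstance, inferInstance, ?_, ?_, ?_⟩
  · simp [conv_compl_eq_zero hH hadd, *]
  · simp [conv_compl_eq_zero hH hadd, *]
  · simp only [charFun_add_measure, charFun_conv_eq]
    ring

lemma eq_zero_of_mem_signedOn {H K : Set ℝ} (hHK : Disjoint H K)
    {f : ℝ → ℂ} (hf : f ∈ signedOn H) (hf' : f ∈ signedOn K) : f = 0 := by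
  obtain ⟨m, n, _, _, hm, hn, rfl⟩ := hf
  obtain ⟨m', n', _, _, hm', hn', h⟩ := hf'
  have h1 : charFun (m + n') = charFun (m' + n) := by
    rw [charFun_add_measure, charFun_add_measure]
    linear_combination h
  have h2 : m + n' = m' + n := Measure.ext_of_charFun h1
  have hKH : ∀ k : Measure ℝ, k Kᶜ = 0 → k.restrict H = 0 := fun k hk => by
    rw [Measure.restrict_eq_zero]
    exact measure_mono_null hHK.subset_compl_right hk
  have hr : ∀ k : Measure ℝ, k Hᶜ = 0 → k.restrict H = k := fun k hk =>
    Measure.restrict_eq_self_of_ae_mem (by rw [ae_iff]; exact hk)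
  have h3 := congrArg (fun k : Measure ℝ => k.restrict H) h2
  simp only [Measure.restrict_add, hKH _ hm', hKH _ hn', hr _ hm, hr _ hn, add_zero,
    zero_add] at h3
  rw [h3, sub_self]

/-- Power series whose coefficients are characteristic functions of signed measures on `H`. -/
def seriesOn (H : Set ℝ) : AddSubgroup (PowerSeries (ℝ → ℂ)) where
  carrier := {f | ∀ n, PowerSeries.coeff n f ∈ signedOn H}
  zero_mem' := fun n => by simp [zero_mem]
  add_mem' := fun hf hg n => by simpa using add_mem (hf n) (hg n)
  neg_mem' := fun hf n => by simpa using hf n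

lemma mul_mem_seriesOn {H : Set ℝ} (hH : MeasurableSet H)
    (hadd : ∀ x ∈ H, ∀ y ∈ H, x + y ∈ H) {f g : PowerSeries (ℝ → ℂ)} (hf : f ∈ seriesOn H)
    (hg : g ∈ seriesOn H) : f * g ∈ seriesOn H := fun n => by
  rw [PowerSeries.coeff_mul]
  exact sum_mem fun p _ => mul_mem_signedOn hH hadd (hf _) (hg _)

lemma eq_zero_of_mem_seriesOn {H K : Set ℝ} (hHK : Disjoint H K)
    {f : PowerSeries (ℝ → ℂ)} (hf : f ∈ seriesOn H) (hf' : f ∈ seriesOn K) : f = 0 := by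
  ext1 n
  simpa using eq_zero_of_mem_signedOn hHK (hf n) (hf' n)

lemma derivative_mem_seriesOn {H : Set ℝ} {f : PowerSeries (ℝ → ℂ)} (hf : f ∈ seriesOn H) :
    PowerSeries.derivative (ℝ → ℂ) f ∈ seriesOn H := fun n => by
  rw [PowerSeries.coeff_derivative]
  have : PowerSeries.coeff (n + 1) f * ((n : ℝ → ℂ) + 1) = (n + 1) • PowerSeries.coeff (n + 1) f := by
    rw [nsmul_eq_mul]; push_cast; ring
  rw [this]
  exact nsmul_mem (hf (n + 1)) (n + 1)

/-- Generating series of the characteristic functions of a sequence of measures. -/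
def cfSeries (m : ℕ → Measure ℝ) : PowerSeries (ℝ → ℂ) := PowerSeries.mk fun n => charFun (m n)

/-- The law of the position at which the walk killed outside `H` leaves `H` at time `n`. -/
def exitLaw (ν : Measure ℝ) (H : Set ℝ) (x : ℝ) : ℕ → Measure ℝ
  | 0 => 0
  | n + 1 => (Measure.conv (killed ν H x n) ν).restrict Hᶜ

instance isFiniteMeasure_exitLaw (ν : Measure ℝ) [IsFiniteMeasure ν] (H : Set ℝ) (x : ℝ) (n : ℕ) :
    IsFiniteMeasure (exitLaw ν H x n) := by
  cases n <;> unfold exitLaw <;> infer_instance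

lemma charFun_zero_measure_eq : charFun (0 : Measure ℝ) = 0 := by
  ext t
  simp

lemma restrict_compl_self {H : Set ℝ} (hH : MeasurableSet H) (m : Measure ℝ) :
    m.restrict H Hᶜ = 0 := by
  rw [Measure.restrict_apply hH.compl]
  simp

lemma cfSeries_mem {H : Set ℝ} (m : ℕ → Measure ℝ) [∀ n, IsFiniteMeasure (m n)]
    (h : ∀ n, m n Hᶜ = 0) : cfSeries m ∈ seriesOn H := fun n => by
  simpa [cfSeries] using charFun_mem_signedOn (m n) (h n)

lemma charFun_dirac_zero_eq_one : charFun (Measure.dirac (0 : ℝ)) = 1 := by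
  ext t
  simp [charFun_dirac]

lemma one_mem_seriesOn {H : Set ℝ} (hH : MeasurableSet H) (h0 : (0 : ℝ) ∈ H) :
    (1 : PowerSeries (ℝ → ℂ)) ∈ seriesOn H := fun n => by
  rw [PowerSeries.coeff_one]
  split_ifs
  · rw [← charFun_dirac_zero_eq_one]
    refine charFun_mem_signedOn _ ?_
    rw [Measure.dirac_apply' _ hH.compl]
    simp [h0]
  · exact zero_mem _

lemma killed_compl (ν : Measure ℝ) {H : Set ℝ} (hH : MeasurableSet H) {x : ℝ} (hx : x ∈ H) (n : ℕ) :
    killed ν H x n Hᶜ = 0 := by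
  cases n with
  | zero => rw [killed, Measure.dirac_apply' _ hH.compl]; simp [hx]
  | succ n => rw [killed, Measure.restrict_apply hH.compl]; simp

/-- Convolution powers. -/
def convPow (ν : Measure ℝ) (n : ℕ) : Measure ℝ := killed ν univ 0 n

lemma convPow_succ (ν : Measure ℝ) (n : ℕ) : convPow ν (n + 1) = Measure.conv (convPow ν n) ν := by
  simp [convPow, killed]

section CharFunPowerSeries

variable (ν : Measure ℝ) [IsFiniteMeasure ν]

lemma cfSeries_killed_mul {H : Set ℝ} (hH : MeasurableSet H) (x : ℝ) :
    cfSeries (killed ν H x) * (1 - PowerSeries.X * PowerSeries.C (charFun ν)) =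
      PowerSeries.C (charFun (Measure.dirac x)) - cfSeries (exitLaw ν H x) := by
  ext1 n
  cases n with
  | zero =>
    simp [cfSeries, killed, exitLaw, mul_sub, ← mul_assoc, charFun_zero_measure_eq]
  | succ n =>
    have h : charFun (killed ν H x n) * charFun ν =
        charFun (killed ν H x (n + 1)) + charFun (exitLaw ν H x (n + 1)) := by
      rw [← charFun_conv_eq, ← charFun_add_measure, killed, exitLaw,
        Measure.restrict_add_restrict_compl hH]
    rw [mul_sub, ← mul_assoc, mul_one, map_sub, map_sub, PowerSeries.coeff_mul_C,
      PowerSeries.coeff_succ_mul_X, PowerSeries.coeff_C, if_neg (by omega)]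
    simp only [cfSeries, PowerSeries.coeff_mk]
    rw [h]
    ring

lemma cfSeries_exitLaw_mem {H : Set ℝ} (hH : MeasurableSet H) (x : ℝ) :
    cfSeries (exitLaw ν H x) ∈ seriesOn Hᶜ := by
  refine cfSeries_mem _ fun n => ?_
  cases n with
  | zero => simp [exitLaw]
  | succ n => rw [exitLaw, Measure.restrict_apply hH.compl.compl]; simp

lemma cfSeries_killed_neg_sub_one_mem :
    cfSeries (killed ν (Iio 0) 0) - 1 ∈ seriesOn (Iio 0) := fun n => by
  rw [map_sub, PowerSeries.coeff_one, cfSeries, PowerSeries.coeff_mk]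
  cases n with
  | zero => simp [killed, charFun_dirac_zero_eq_one, zero_mem]
  | succ n =>
    simp only [Nat.add_eq_zero_iff, one_ne_zero, and_false, if_false, sub_zero]
    refine charFun_mem_signedOn _ ?_
    exact restrict_compl_self measurableSet_Iio _

lemma add_mem_Ici {x y : ℝ} (hx : x ∈ Ici (0 : ℝ)) (hy : y ∈ Ici (0 : ℝ)) :
    x + y ∈ Ici (0 : ℝ) := add_nonneg (mem_Ici.1 hx) (mem_Ici.1 hy)

lemma add_mem_Iio {x y : ℝ} (hx : x ∈ Iio (0 : ℝ)) (hy : y ∈ Iio (0 : ℝ)) :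
    x + y ∈ Iio (0 : ℝ) := add_neg (mem_Iio.1 hx) (mem_Iio.1 hy)

lemma exit_pos_mem (x : ℝ) : cfSeries (exitLaw ν (Ici 0) x) ∈ seriesOn (Iio 0) := by
  simpa using cfSeries_exitLaw_mem ν (measurableSet_Ici (a := (0 : ℝ))) x

lemma exit_neg_mem (x : ℝ) : cfSeries (exitLaw ν (Iio 0) x) ∈ seriesOn (Ici 0) := by
  simpa using cfSeries_exitLaw_mem ν (measurableSet_Iio (a := (0 : ℝ))) x

lemma killed_pos_mem {x : ℝ} (hx : 0 ≤ x) :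
    cfSeries (killed ν (Ici 0) x) ∈ seriesOn (Ici 0) :=
  cfSeries_mem _ (killed_compl ν measurableSet_Ici hx)

lemma disjoint_Ici_Iio : Disjoint (Ici (0 : ℝ)) (Iio 0) := by
  rw [disjoint_comm]
  exact disjoint_left.2 fun x h1 h2 => not_le.2 (mem_Iio.1 h1) (mem_Ici.1 h2)

/-- Wiener–Hopf factorization. -/
lemma wiener_hopf :
    (1 - cfSeries (exitLaw ν (Ici 0) 0)) * cfSeries (killed ν (Iio 0) 0) = 1 ∧
    cfSeries (killed ν (Ici 0) 0) * (1 - cfSeries (exitLaw ν (Iio 0) 0)) = 1 := by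
  have hP := cfSeries_killed_mul ν (measurableSet_Ici (a := (0 : ℝ))) 0
  have hN := cfSeries_killed_mul ν (measurableSet_Iio (a := (0 : ℝ))) 0
  rw [charFun_dirac_zero_eq_one, map_one] at hP hN
  have h0 := exit_pos_mem ν 0
  have h1 := exit_neg_mem ν 0
  have h2 := killed_pos_mem ν le_rfl
  have h3 := cfSeries_killed_neg_sub_one_mem ν
  set P := cfSeries (killed ν (Ici 0) 0)
  set N := cfSeries (killed ν (Iio 0) 0)
  set a := cfSeries (exitLaw ν (Ici 0) 0)
  set b := cfSeries (exitLaw ν (Iio 0) 0)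
  have e1 : (1 - a) * N - 1 = (N - 1) - a * (N - 1) - a := by ring
  have e2 : (1 - a) * N - 1 = P - 1 - P * b := by linear_combination P * hN - N * hP
  have hz : (1 - a) * N - 1 = 0 := by
    refine eq_zero_of_mem_seriesOn disjoint_Ici_Iio ?_ ?_
    · rw [e2]
      exact sub_mem (sub_mem h2 (one_mem_seriesOn measurableSet_Ici (by simp)))
        (mul_mem_seriesOn measurableSet_Ici (fun x hx y hy => add_mem_Ici hx hy) h2 h1)
    · rw [e1]
      exact sub_mem (sub_mem h3 (mul_mem_seriesOn measurableSet_Iio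
        (fun x hx y hy => add_mem_Iio hx hy) h0 h3)) h0
  refine ⟨sub_eq_zero.1 hz, ?_⟩
  rw [e2] at hz
  linear_combination hz

instance (n : ℕ) : IsFiniteMeasure (convPow ν n) := by unfold convPow; infer_instance

lemma charFun_convPow (n : ℕ) : charFun (convPow ν n) = charFun ν ^ n := by
  induction n with
  | zero => simp [convPow, killed, charFun_dirac_zero_eq_one]
  | succ n ih => rw [convPow_succ, charFun_conv_eq, ih, pow_succ]

/-- Series form of the Spitzer–Baxter identities. -/
lemma spitzer_series :
    PowerSeries.derivative (ℝ → ℂ) (cfSeries (killed ν (Ici 0) 0)) =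
      cfSeries (killed ν (Ici 0) 0) *
        cfSeries (fun n => (convPow ν (n + 1)).restrict (Ici 0)) ∧
    PowerSeries.derivative (ℝ → ℂ) (cfSeries (killed ν (Iio 0) 0)) =
      cfSeries (killed ν (Iio 0) 0) *
        cfSeries (fun n => (convPow ν (n + 1)).restrict (Iio 0)) := by
  obtain ⟨w1, w2⟩ := wiener_hopf ν
  have hP := cfSeries_killed_mul ν (measurableSet_Ici (a := (0 : ℝ))) 0
  rw [charFun_dirac_zero_eq_one, map_one] at hP
  have h0 := exit_pos_mem ν 0
  have h1 := exit_neg_mem ν 0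
  have h2 := derivative_mem_seriesOn (killed_pos_mem ν le_rfl)
  have h3 := derivative_mem_seriesOn (cfSeries_killed_neg_sub_one_mem ν)
  have hAp : cfSeries (fun n => (convPow ν (n + 1)).restrict (Ici 0)) ∈ seriesOn (Ici 0) :=
    cfSeries_mem _ fun n => restrict_compl_self measurableSet_Ici _
  have hAm : cfSeries (fun n => (convPow ν (n + 1)).restrict (Iio 0)) ∈ seriesOn (Iio 0) :=
    cfSeries_mem _ fun n => restrict_compl_self measurableSet_Iio _
  have hA : cfSeries (fun n => (convPow ν (n + 1)).restrict (Ici 0)) +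
      cfSeries (fun n => (convPow ν (n + 1)).restrict (Iio 0)) =
      PowerSeries.C (charFun ν) * cfSeries (convPow ν) := by
    ext1 n
    simp only [cfSeries, map_add, PowerSeries.coeff_mk, PowerSeries.coeff_C_mul]
    rw [← charFun_add_measure, ← compl_Ici, Measure.restrict_add_restrict_compl measurableSet_Ici,
      charFun_convPow, charFun_convPow, pow_succ']
  have hG : cfSeries (convPow ν) * (1 - PowerSeries.X * PowerSeries.C (charFun ν)) = 1 := by
    have := cfSeries_killed_mul ν MeasurableSet.univ 0
    rw [charFun_dirac_zero_eq_one, map_one] at this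
    have h : cfSeries (exitLaw ν univ 0) = 0 := by
      ext1 n
      cases n <;> simp [cfSeries, exitLaw, charFun_zero_measure_eq]
    rw [h, sub_zero] at this
    exact this
  rw [map_sub, Derivation.map_one_eq_zero, sub_zero] at h3
  set P := cfSeries (killed ν (Ici 0) 0)
  set N := cfSeries (killed ν (Iio 0) 0)
  set a := cfSeries (exitLaw ν (Ici 0) 0)
  set b := cfSeries (exitLaw ν (Iio 0) 0)
  set G := cfSeries (convPow ν)
  set Ap := cfSeries (fun n => (convPow ν (n + 1)).restrict (Ici 0))
  set Am := cfSeries (fun n => (convPow ν (n + 1)).restrict (Iio 0))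
  set D := PowerSeries.derivative (ℝ → ℂ)
  set W := 1 - PowerSeries.X * PowerSeries.C (charFun ν) with hW
  have hWf : W = (1 - a) * (1 - b) := by
    rw [← hP]; linear_combination (-W) * w2
  have hPN : G = P * N := by
    have h : P * N * W = 1 := by
      rw [hWf]; linear_combination w2 * ((1 - a) * N) + w1
    calc G = G * (P * N * W) := by rw [h, mul_one]
      _ = (G * W) * (P * N) := by ring
      _ = P * N := by rw [hG, one_mul]
  have hdW : D W = - PowerSeries.C (charFun ν) := by
    rw [hW]
    simp only [D, map_sub, Derivation.map_one_eq_zero, Derivation.leibniz, PowerSeries.derivative_C,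
      PowerSeries.derivative_X, smul_eq_mul, mul_one, mul_zero, zero_add, zero_sub]
  have hdG : D G * W = PowerSeries.C (charFun ν) * G := by
    have h := congrArg D hG
    rw [Derivation.leibniz, Derivation.map_one_eq_zero, hdW] at h
    simp only [smul_eq_mul] at h
    linear_combination h
  have hd : (1 - b) * D P + (1 - a) * D N = Ap + Am := by
    rw [hA, ← hdG, hPN, Derivation.leibniz, hWf]
    simp only [smul_eq_mul]
    linear_combination (-(1 - a) * D N) * w2 - (1 - b) * D P * w1
  have hz : (1 - b) * D P - Ap = 0 := by
    refine eq_zero_of_mem_seriesOn disjoint_Ici_Iio ?_ ?_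
    · rw [sub_mul, one_mul]
      exact sub_mem (sub_mem h2 (mul_mem_seriesOn measurableSet_Ici
        (fun x hx y hy => add_mem_Ici hx hy) h1 h2)) hAp
    · have : (1 - b) * D P - Ap = Am - (D N - a * D N) := by linear_combination hd
      rw [this]
      exact sub_mem hAm (sub_mem h3 (mul_mem_seriesOn measurableSet_Iio
        (fun x hx y hy => add_mem_Iio hx hy) h0 h3))
  constructor
  · linear_combination P * hz - D P * w2
  · linear_combination N * hd - N * hz - D N * w1

lemma charFun_sum_measure {ι : Type*} (s : Finset ι) (m : ι → Measure ℝ)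
    [∀ i, IsFiniteMeasure (m i)] : charFun (∑ i ∈ s, m i) = ∑ i ∈ s, charFun (m i) := by
  classical
  induction s using Finset.induction_on with
  | empty => ext t; simp
  | insert i s hi ih => rw [Finset.sum_insert hi, Finset.sum_insert hi, charFun_add_measure, ih]

lemma charFun_nsmul (n : ℕ) (m : Measure ℝ) [IsFiniteMeasure m] :
    charFun (n • m) = n • charFun m := by
  have := charFun_sum_measure (Finset.range n) fun _ => m
  simpa using this

lemma spitzer_aux {m d : ℕ → Measure ℝ} [∀ n, IsFiniteMeasure (m n)] [∀ n, IsFiniteMeasure (d n)]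
    (h : PowerSeries.derivative (ℝ → ℂ) (cfSeries m) = cfSeries m * cfSeries d) (n : ℕ) :
    (n + 1) • m (n + 1) = ∑ p ∈ Finset.HasAntidiagonal.antidiagonal n, Measure.conv (m p.1) (d p.2) := by
  have h1 := congrArg (PowerSeries.coeff n) h
  rw [PowerSeries.coeff_derivative, PowerSeries.coeff_mul] at h1
  simp only [cfSeries, PowerSeries.coeff_mk] at h1
  apply Measure.ext_of_charFun
  rw [charFun_nsmul, charFun_sum_measure]
  simp only [charFun_conv_eq]
  rw [← h1, nsmul_eq_mul]
  push_cast
  ring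

/-- Spitzer–Baxter identity for the walk killed on `(-∞, 0)`. -/
lemma spitzer_pos (n : ℕ) : (n + 1) • killed ν (Ici 0) 0 (n + 1) =
    ∑ p ∈ Finset.HasAntidiagonal.antidiagonal n, Measure.conv (killed ν (Ici 0) 0 p.1)
      ((convPow ν (p.2 + 1)).restrict (Ici 0)) :=
  spitzer_aux (spitzer_series ν).1 n

/-- Spitzer–Baxter identity for the walk killed on `[0, ∞)`. -/
lemma spitzer_neg (n : ℕ) : (n + 1) • killed ν (Iio 0) 0 (n + 1) =
    ∑ p ∈ Finset.HasAntidiagonal.antidiagonal n, Measure.conv (killed ν (Iio 0) 0 p.1)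
      ((convPow ν (p.2 + 1)).restrict (Iio 0)) :=
  spitzer_aux (spitzer_series ν).2 n

/-- Decomposition of the walk started at `x` and killed on `(-∞, 0)` at its minimum. -/
lemma killed_pos_eq_sum {x : ℝ} (hx : 0 ≤ x) (n : ℕ) : killed ν (Ici 0) x n =
    ∑ p ∈ Finset.HasAntidiagonal.antidiagonal n, Measure.conv
      ((Measure.conv (Measure.dirac x) (killed ν (Iio 0) 0 p.1)).restrict (Ici 0))
      (killed ν (Ici 0) 0 p.2) := by
  set r : ℕ → Measure ℝ := fun n =>
    (Measure.conv (Measure.dirac x) (killed ν (Iio 0) 0 n)).restrict (Ici 0)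
  set r' : ℕ → Measure ℝ := fun n =>
    (Measure.conv (Measure.dirac x) (killed ν (Iio 0) 0 n)).restrict (Iio 0)
  have hrr : PowerSeries.C (charFun (Measure.dirac x)) * cfSeries (killed ν (Iio 0) 0) =
      cfSeries r + cfSeries r' := by
    ext1 n
    simp only [cfSeries, PowerSeries.coeff_C_mul, PowerSeries.coeff_mk, map_add, r, r']
    rw [← charFun_add_measure, ← compl_Ici, Measure.restrict_add_restrict_compl measurableSet_Ici,
      charFun_conv_eq]
  suffices h : cfSeries (killed ν (Ici 0) x) = cfSeries r * cfSeries (killed ν (Ici 0) 0) by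
    have h1 := congrArg (PowerSeries.coeff n) h
    rw [PowerSeries.coeff_mul] at h1
    simp only [cfSeries, PowerSeries.coeff_mk] at h1
    apply Measure.ext_of_charFun
    rw [charFun_sum_measure, h1]
    simp only [charFun_conv_eq]
    rfl
  obtain ⟨w1, w2⟩ := wiener_hopf ν
  have hP := cfSeries_killed_mul ν (measurableSet_Ici (a := (0 : ℝ))) 0
  have hN := cfSeries_killed_mul ν (measurableSet_Iio (a := (0 : ℝ))) 0
  have hX := cfSeries_killed_mul ν (measurableSet_Ici (a := (0 : ℝ))) x
  rw [charFun_dirac_zero_eq_one, map_one] at hP hN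
  have h0 := exit_pos_mem ν x
  have h1 := exit_neg_mem ν 0
  have h2 := killed_pos_mem ν hx
  have h3 := cfSeries_killed_neg_sub_one_mem ν
  have hr : cfSeries r ∈ seriesOn (Ici 0) :=
    cfSeries_mem _ fun n => restrict_compl_self measurableSet_Ici _
  have hr' : cfSeries r' ∈ seriesOn (Iio 0) :=
    cfSeries_mem _ fun n => restrict_compl_self measurableSet_Iio _
  set P := cfSeries (killed ν (Ici 0) 0)
  set N := cfSeries (killed ν (Iio 0) 0)
  set a := cfSeries (exitLaw ν (Ici 0) 0)
  set b := cfSeries (exitLaw ν (Iio 0) 0)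
  set ax := cfSeries (exitLaw ν (Ici 0) x)
  set Px := cfSeries (killed ν (Ici 0) x)
  set δ := PowerSeries.C (charFun (Measure.dirac x))
  set R := cfSeries r
  set R' := cfSeries r'
  set W := 1 - PowerSeries.X * PowerSeries.C (charFun ν) with hW
  have key : Px * (1 - b) - R = R' - ax * (N - 1) - ax := by
    linear_combination N * hX - Px * hN + hrr
  have hz : Px * (1 - b) - R = 0 := by
    refine eq_zero_of_mem_seriesOn disjoint_Ici_Iio ?_ ?_
    · rw [mul_sub, mul_one]
      exact sub_mem (sub_mem h2 (mul_mem_seriesOn measurableSet_Ici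
        (fun x hx y hy => add_mem_Ici hx hy) h2 h1)) hr
    · rw [key]
      exact sub_mem (sub_mem hr' (mul_mem_seriesOn measurableSet_Iio
        (fun x hx y hy => add_mem_Iio hx hy) h0 h3)) h0
  linear_combination P * hz - Px * w2

end CharFunPowerSeries

/-! ### Local limit theorem for the unconditioned walk -/

/-- `ν` is a centred non-lattice law with standard deviation `σ > 0`. -/
structure IsStep (ν : Measure ℝ) (σ : ℝ) : Prop where
  prob : IsProbabilityMeasure ν
  mean : ∫ x, x ∂ν = 0
  sq : ∫ x, x ^ 2 ∂ν = σ ^ 2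
  pos : 0 < σ
  nonLattice : NonLattice ν

lemma norm_charFun_lt_one {ν : Measure ℝ} [IsProbabilityMeasure ν] (hν : NonLattice ν) {t : ℝ}
    (ht : t ≠ 0) : ‖charFun ν t‖ < 1 := by
  refine lt_of_le_of_ne (norm_charFun_le_one t) fun h1 => hν ?_
  set a := Complex.arg (charFun ν t)
  have h2 : charFun ν t = Complex.exp (a * Complex.I) := by
    have := Complex.norm_mul_exp_arg_mul_I (charFun ν t)
    rw [h1] at this
    simpa using this.symm
  have hint : Integrable (fun x : ℝ => Complex.exp ((t * x - a : ℝ) * Complex.I)) ν := by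
    refine (integrable_const (1 : ℝ)).mono' (by fun_prop) ?_
    filter_upwards with x
    rw [Complex.norm_exp_ofReal_mul_I]
  have h3 : ∫ x : ℝ, Complex.exp ((t * x - a : ℝ) * Complex.I) ∂ν = 1 := by
    have : ∀ x : ℝ, Complex.exp ((t * x - a : ℝ) * Complex.I) =
        Complex.exp (-(a * Complex.I)) * Complex.exp (t * x * Complex.I) := fun x => by
      rw [← Complex.exp_add]; congr 1; push_cast; ring
    simp_rw [this]
    rw [integral_const_mul, ← charFun_apply_real, h2, ← Complex.exp_add]
    simp
  have hcos : ∀ x : ℝ, (Complex.exp ((t * x - a : ℝ) * Complex.I)).re = Real.cos (t * x - a) :=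
    fun x => Complex.exp_ofReal_mul_I_re _
  have h4 : ∫ x : ℝ, (1 - Real.cos (t * x - a)) ∂ν = 0 := by
    have h5 : ∫ x : ℝ, Real.cos (t * x - a) ∂ν = 1 := by
      have := congrArg Complex.re h3
      rw [← RCLike.re_eq_complex_re, ← integral_re hint] at this
      simpa only [RCLike.re_eq_complex_re, hcos, Complex.one_re] using this
    rw [integral_sub (integrable_const _), h5]
    · simp
    · simpa only [RCLike.re_eq_complex_re, hcos] using hint.re
  have hci : Integrable (fun x : ℝ => 1 - Real.cos (t * x - a)) ν :=
    (integrable_const _).sub (by simpa only [RCLike.re_eq_complex_re, hcos] using hint.re)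
  have h5 := (integral_eq_zero_iff_of_nonneg
    (fun x => sub_nonneg.2 (Real.cos_le_one (t * x - a))) hci).1 h4
  refine ⟨a / t, 2 * Real.pi / t, ?_⟩
  have : ∀ᵐ x ∂ν, x ∈ {x | ∃ k : ℤ, x = a / t + k * (2 * Real.pi / t)} := by
    filter_upwards [h5] with x hx
    have : Real.cos (t * x - a) = 1 := by
      simp only [Pi.zero_apply] at hx
      linarith
    obtain ⟨k, hk⟩ := (Real.cos_eq_one_iff _).1 this
    refine ⟨k, ?_⟩
    field_simp
    linarith
  have hm : MeasurableSet {x : ℝ | ∃ k : ℤ, x = a / t + k * (2 * Real.pi / t)} :=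
    ((Set.countable_range (fun k : ℤ => a / t + k * (2 * Real.pi / t))).mono
      (by rintro x ⟨k, rfl⟩; exact ⟨k, rfl⟩)).measurableSet
  exact (mem_ae_iff_prob_eq_one hm).1 this

section LocalLimit

variable {ν : Measure ℝ} {σ : ℝ}

lemma charFun_scaled (t : ℝ) :
    charFun (ν.map (fun x => σ⁻¹ * x)) t = charFun ν (σ⁻¹ * t) := by
  rw [charFun_map_mul]

lemma IsStep.scaled_mean (h : IsStep ν σ) : ∫ x, σ⁻¹ * x ∂ν = 0 := by
  rw [integral_const_mul, h.mean, mul_zero]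

lemma IsStep.scaled_sq (h : IsStep ν σ) : ∫ x, ((fun x => σ⁻¹ * x) ^ 2 : ℝ → ℝ) x ∂ν = 1 := by
  have := h.pos
  simp only [Pi.pow_apply, mul_pow]
  rw [integral_const_mul, h.sq]
  field_simp

lemma IsStep.tendsto_charFun_pow (h : IsStep ν σ) (x : ℝ) :
    Tendsto (fun n : ℕ => charFun ν ((√n)⁻¹ * x) ^ n) atTop
      (𝓝 (Complex.exp (-(σ * x : ℂ) ^ 2 / 2))) := by
  have := h.prob
  have h1 := tendsto_charFun_inv_sqrt_mul_pow (P := ν) (X := fun x => σ⁻¹ * x) (by fun_prop)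
    h.scaled_mean h.scaled_sq (σ * x)
  simp only [charFun_scaled] at h1
  have : ∀ n : ℕ, σ⁻¹ * ((√n)⁻¹ * (σ * x)) = (√n)⁻¹ * x := fun n => by
    have := h.pos.ne'
    field_simp
  simp only [this] at h1
  exact_mod_cast h1

lemma IsStep.norm_charFun_le_exp (h : IsStep ν σ) (A : ℝ) :
    ∃ c > 0, ∀ t, |t| ≤ A → ‖charFun ν t‖ ≤ Real.exp (-c * t ^ 2) := by
  have := h.prob
  have hσ := h.pos
  obtain ⟨δ, hδ0, hδ⟩ : ∃ δ > 0, ∀ t, |t| < δ →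
      ‖charFun ν t‖ ≤ Real.exp (-(σ ^ 2 / 4) * t ^ 2) := by
    have h1 := taylor_charFun_two (P := ν) (X := fun x => σ⁻¹ * x) (by fun_prop)
      h.scaled_mean h.scaled_sq
    have h2 := h1.def (show (0 : ℝ) < 1 / 4 by norm_num)
    obtain ⟨ε, hε, h3⟩ := Metric.eventually_nhds_iff.1 h2
    refine ⟨min ε 1 / σ, by positivity, fun t ht => ?_⟩
    have h4 : |σ * t| < min ε 1 := by
      rw [abs_mul, abs_of_pos hσ]; rw [lt_div_iff₀ hσ] at ht; linarith
    have h5 := h3 (y := σ * t) (by rw [dist_zero_right]; exact h4.trans_le (min_le_left _ _))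
    rw [charFun_scaled, inv_mul_cancel_left₀ hσ.ne'] at h5
    have h6 : (σ * t) ^ 2 ≤ 1 := by
      rw [← sq_abs]; exact pow_le_one₀ (abs_nonneg _) (h4.le.trans (min_le_right _ _))
    have h7 : ‖(1 - ((σ * t : ℝ) : ℂ) ^ 2 / 2)‖ = 1 - (σ * t) ^ 2 / 2 := by
      rw [show (1 - ((σ * t : ℝ) : ℂ) ^ 2 / 2) = ((1 - (σ * t) ^ 2 / 2 : ℝ) : ℂ) by push_cast; ring,
        Complex.norm_real, Real.norm_of_nonneg (by linarith)]
    have h8 : ‖((σ * t : ℝ) : ℝ) ^ 2‖ = (σ * t) ^ 2 := by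
      rw [Real.norm_of_nonneg (by positivity)]
    have h9 := norm_le_norm_add_norm_sub' (charFun ν t) (1 - ((σ * t : ℝ) : ℂ) ^ 2 / 2)
    have h10 := Real.add_one_le_exp (-(σ ^ 2 / 4) * t ^ 2)
    rw [h8] at h5
    rw [h7] at h9
    nlinarith
  obtain ⟨m, hm0, hm1, hm⟩ : ∃ m : ℝ, 0 < m ∧ m < 1 ∧
      ∀ t, δ ≤ |t| → |t| ≤ A → ‖charFun ν t‖ ≤ m := by
    have hK : IsCompact {t : ℝ | δ ≤ |t| ∧ |t| ≤ A} := by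
      refine Metric.isCompact_of_isClosed_isBounded ?_ ?_
      · exact (isClosed_le continuous_const continuous_abs).inter
          (isClosed_le continuous_abs continuous_const)
      · exact (Metric.isBounded_closedBall (x := (0 : ℝ)) (r := A)).subset fun t ht => by
          simpa using ht.2
    rcases eq_empty_or_nonempty {t : ℝ | δ ≤ |t| ∧ |t| ≤ A} with he | hne
    · exact ⟨1 / 2, by norm_num, by norm_num, fun t h1 h2 =>
        absurd (show t ∈ {t : ℝ | δ ≤ |t| ∧ |t| ≤ A} from ⟨h1, h2⟩) (by simp [he])⟩
    · obtain ⟨t0, ht0, hmax⟩ := hK.exists_isMaxOn hne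
        (f := fun t => ‖charFun ν t‖) (continuous_charFun.norm.continuousOn)
      have hlt : ‖charFun ν t0‖ < 1 := norm_charFun_lt_one h.nonLattice fun h0 => by
        rw [h0] at ht0; simp at ht0; linarith [ht0.1]
      refine ⟨max ‖charFun ν t0‖ (1 / 2), by positivity, max_lt hlt (by norm_num),
        fun t h1 h2 => (hmax (show t ∈ {t : ℝ | δ ≤ |t| ∧ |t| ≤ A} from ⟨h1, h2⟩)).trans
          (le_max_left _ _)⟩
  have hl : 0 < -Real.log m := by linarith [Real.log_neg hm0 hm1]
  refine ⟨min (σ ^ 2 / 4) (-Real.log m / (A ^ 2 + 1)), by positivity, fun t ht => ?_⟩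
  rcases lt_or_ge |t| δ with h1 | h1
  · refine (hδ t h1).trans (Real.exp_le_exp.2 ?_)
    nlinarith [min_le_left (σ ^ 2 / 4) (-Real.log m / (A ^ 2 + 1)), sq_nonneg t]
  · refine (hm t h1 ht).trans ?_
    rw [← Real.exp_log hm0, Real.exp_le_exp, Real.exp_log hm0]
    have h2 : t ^ 2 ≤ A ^ 2 + 1 := by
      rw [← sq_abs]; nlinarith [abs_nonneg t]
    have h3 : min (σ ^ 2 / 4) (-Real.log m / (A ^ 2 + 1)) * t ^ 2 ≤ -Real.log m := by
      calc _ ≤ -Real.log m / (A ^ 2 + 1) * (A ^ 2 + 1) := by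
            gcongr
            exact min_le_right _ _
        _ = -Real.log m := by field_simp
    linarith

/-- Laplace-type asymptotics of integrals against powers of the characteristic function. -/
lemma IsStep.tendsto_integral_charFun_pow (h : IsStep ν σ) {A : ℝ} {ψ : ℝ → ℂ}
    (hψm : Measurable ψ) {C : ℝ} (hψb : ∀ t, ‖ψ t‖ ≤ C) (hψs : ∀ t, A < |t| → ψ t = 0)
    (hψc : ContinuousAt ψ 0) :
    Tendsto (fun n : ℕ => (√n : ℂ) * ∫ t, ψ t * charFun ν t ^ n) atTop
      (𝓝 (ψ 0 * ∫ x : ℝ, Complex.exp (-(σ * x : ℂ) ^ 2 / 2))) := by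
  have := h.prob
  obtain ⟨c, hc, hcb⟩ := h.norm_charFun_le_exp A
  have h1 : ∀ᶠ n : ℕ in atTop, ∫ x : ℝ, ψ ((√n)⁻¹ * x) * charFun ν ((√n)⁻¹ * x) ^ n =
      (√n : ℂ) * ∫ t, ψ t * charFun ν t ^ n := by
    filter_upwards with n
    rw [Measure.integral_comp_inv_mul_left (fun t => ψ t * charFun ν t ^ n) (√n),
      abs_of_nonneg (Real.sqrt_nonneg _)]
    rfl
  refine Tendsto.congr' h1 ?_
  rw [← integral_const_mul]
  have hC : 0 ≤ C := (norm_nonneg _).trans (hψb 0)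
  refine tendsto_integral_filter_of_dominated_convergence (fun x => C * Real.exp (-c * x ^ 2))
    ?_ ?_ ?_ ?_
  · filter_upwards with n
    have := measurable_charFun (μ := ν)
    exact Measurable.aestronglyMeasurable (by fun_prop)
  · filter_upwards [eventually_gt_atTop 0] with n hn
    filter_upwards with x
    rcases lt_or_ge A |(√n)⁻¹ * x| with h2 | h2
    · rw [hψs _ h2, zero_mul, norm_zero]; positivity
    · rw [norm_mul, norm_pow]
      have h3 := hcb _ h2
      have h4 : Real.exp (-c * x ^ 2) = Real.exp (-c * ((√n)⁻¹ * x) ^ 2) ^ n := by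
        rw [← Real.exp_nat_mul]
        congr 1
        have : (√n) ^ 2 = (n : ℝ) := Real.sq_sqrt (by positivity)
        rw [mul_pow, inv_pow, this]
        field_simp
      rw [h4]
      gcongr
      exact hψb _
  · exact (integrable_exp_neg_mul_sq hc).const_mul C
  · filter_upwards with x
    refine Tendsto.mul ?_ (h.tendsto_charFun_pow x)
    refine hψc.tendsto.comp ?_
    have : Tendsto (fun n : ℕ => (√(n : ℝ))⁻¹) atTop (𝓝 0) :=
      tendsto_inv_atTop_zero.comp (Real.tendsto_sqrt_atTop.comp tendsto_natCast_atTop_atTop)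
    simpa using this.mul_const x

end LocalLimit

lemma tendsto_of_forall_le_tendsto {a : ℕ → ℝ} {U L : ℕ → ℕ → ℝ} {B B' : ℕ → ℝ} {l : ℝ}
    (hU : ∀ k, ∀ᶠ n in atTop, a n ≤ U k n) (hUB : ∀ k, Tendsto (U k) atTop (𝓝 (B k)))
    (hB : Tendsto B atTop (𝓝 l)) (hL : ∀ k, ∀ᶠ n in atTop, L k n ≤ a n)
    (hLB : ∀ k, Tendsto (L k) atTop (𝓝 (B' k))) (hB' : Tendsto B' atTop (𝓝 l)) :
    Tendsto a atTop (𝓝 l) := by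
  refine tendsto_order.2 ⟨fun x hx => ?_, fun x hx => ?_⟩
  · obtain ⟨k, hk⟩ := (hB'.eventually (lt_mem_nhds hx)).exists
    filter_upwards [(hLB k).eventually (lt_mem_nhds hk), hL k] with n h1 h2
    exact h1.trans_le h2
  · obtain ⟨k, hk⟩ := (hB.eventually (gt_mem_nhds hx)).exists
    filter_upwards [(hUB k).eventually (gt_mem_nhds hk), hU k] with n h1 h2
    exact h2.trans_lt h1

/-- The triangle function. -/
def tri (t : ℝ) : ℝ := max (1 - |t|) 0

lemma continuous_tri : Continuous tri := by unfold tri; fun_prop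

lemma tri_nonneg (t : ℝ) : 0 ≤ tri t := le_max_right _ _

lemma tri_le_one (t : ℝ) : tri t ≤ 1 := max_le (by linarith [abs_nonneg t]) zero_le_one

lemma tri_eq_zero {t : ℝ} (h : 1 ≤ |t|) : tri t = 0 := max_eq_right (by linarith)

lemma integrable_tri : Integrable tri := by
  refine continuous_tri.integrable_of_hasCompactSupport
    (HasCompactSupport.intro (isCompact_Icc (a := -1) (b := 1)) fun t ht => tri_eq_zero ?_)
  by_contra! h
  exact ht ⟨by linarith [(abs_lt.1 h).1], (abs_lt.1 h).2.le⟩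

/-- The Fejér kernel, as the Fourier transform of the triangle function. -/
def fejer (y : ℝ) : ℝ := ∫ t, tri t * Real.cos (t * y)

lemma integrable_tri_mul_cos (y : ℝ) : Integrable fun t => tri t * Real.cos (t * y) := by
  refine integrable_tri.mono' (by have := continuous_tri; fun_prop) ?_
  filter_upwards with t
  rw [norm_mul, Real.norm_of_nonneg (tri_nonneg t)]
  exact mul_le_of_le_one_right (tri_nonneg t) (Real.abs_cos_le_one _)

lemma fejer_eq {y : ℝ} (hy : y ≠ 0) : fejer y = 2 * (1 - Real.cos y) / y ^ 2 := by
  have hs : ∀ t, t ∉ Ioc (-1 : ℝ) 1 → tri t * Real.cos (t * y) = 0 := fun t ht => by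
    rw [tri_eq_zero, zero_mul]
    by_contra! h
    exact ht ⟨(abs_lt.1 h).1, (abs_lt.1 h).2.le⟩
  rw [fejer, ← setIntegral_eq_integral_of_forall_compl_eq_zero hs,
    ← intervalIntegral.integral_of_le (by norm_num),
    ← intervalIntegral.integral_add_adjacent_intervals (b := 0)
      (integrable_tri_mul_cos y).intervalIntegrable (integrable_tri_mul_cos y).intervalIntegrable]
  have h1 : ∫ t in (0 : ℝ)..1, tri t * Real.cos (t * y) = (1 - Real.cos y) / y ^ 2 := by
    have : EqOn (fun t => tri t * Real.cos (t * y)) (fun t => (1 - t) * Real.cos (t * y))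
        (uIcc 0 1) := fun t ht => by
      rw [uIcc_of_le zero_le_one] at ht
      simp only [tri]
      rw [abs_of_nonneg ht.1, max_eq_left (by linarith [ht.2])]
    rw [intervalIntegral.integral_congr this,
      intervalIntegral.integral_eq_sub_of_hasDerivAt
        (f := fun t => (1 - t) * (Real.sin (t * y) / y) - Real.cos (t * y) / y ^ 2)]
    · simp; ring
    · intro t _
      have h1 := ((hasDerivAt_id t).const_sub 1).mul
        ((((hasDerivAt_id t).mul_const y).sin).div_const y)
      have h2 := (((hasDerivAt_id t).mul_const y).cos).div_const (y ^ 2)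
      convert! h1.sub h2 using 1
      simp; field_simp; ring
    · exact Continuous.intervalIntegrable (by fun_prop) _ _
  have h2 : ∫ t in (-1 : ℝ)..0, tri t * Real.cos (t * y) = (1 - Real.cos y) / y ^ 2 := by
    have h := intervalIntegral.integral_comp_neg (a := (0 : ℝ)) (b := 1)
      fun t => tri t * Real.cos (t * y)
    rw [neg_zero] at h
    rw [← h1, ← h]
    refine intervalIntegral.integral_congr fun t _ => ?_
    simp [tri]
  rw [h1, h2]
  ring

lemma fejer_nonneg (y : ℝ) : 0 ≤ fejer y := by
  rcases eq_or_ne y 0 with rfl | hy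
  · refine integral_nonneg fun t => ?_
    simpa using tri_nonneg t
  · rw [fejer_eq hy]
    have := Real.cos_le_one y
    have : 0 ≤ 1 - Real.cos y := by linarith
    positivity

lemma continuous_fejer : Continuous fejer := by
  refine continuous_of_dominated (bound := tri) ?_ ?_ integrable_tri ?_
  · intro y; exact (integrable_tri_mul_cos y).aestronglyMeasurable
  · intro y
    filter_upwards with t
    rw [norm_mul, Real.norm_of_nonneg (tri_nonneg t)]
    exact mul_le_of_le_one_right (tri_nonneg t) (Real.abs_cos_le_one _)
  · filter_upwards with t
    fun_prop

lemma fejer_le (y : ℝ) : fejer y ≤ ∫ t, tri t :=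
  integral_mono (integrable_tri_mul_cos y) integrable_tri fun t =>
    mul_le_of_le_one_right (tri_nonneg t) (Real.cos_le_one _)

lemma integrable_fejer : Integrable fejer := by
  refine (integrable_inv_one_add_sq.const_mul ((∫ t, tri t) + 4)).mono'
    continuous_fejer.aestronglyMeasurable ?_
  filter_upwards with y
  rw [Real.norm_of_nonneg (fejer_nonneg y), ← div_eq_mul_inv, le_div_iff₀ (by positivity)]
  have h1 := fejer_le y
  rcases eq_or_ne y 0 with rfl | hy
  · simp only [ne_eq, OfNat.ofNat_ne_zero, not_false_eq_true, zero_pow, add_zero, mul_one]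
    linarith
  · have h2 : fejer y * y ^ 2 ≤ 4 := by
      rw [fejer_eq hy, div_mul_cancel₀ _ (by positivity)]
      linarith [Real.neg_one_le_cos y]
    linarith

/-- Total mass of the Fejér kernel. -/
def fejerMass : ℝ := ∫ y, fejer y

lemma fejerMass_pos : 0 < fejerMass := by
  refine (integral_pos_iff_support_of_nonneg fejer_nonneg integrable_fejer).2 ?_
  have : Ioo 0 1 ⊆ Function.support fejer := fun y hy => by
    rw [Function.mem_support, fejer_eq hy.1.ne']
    have : Real.cos y ≠ 1 := fun h => by
      rw [Real.cos_eq_one_iff_of_lt_of_lt] at h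
      · exact hy.1.ne' h
      · linarith [Real.pi_pos, hy.1]
      · linarith [Real.pi_gt_three, hy.2]
    have h3 : 1 - Real.cos y ≠ 0 := sub_ne_zero.2 this.symm
    have := hy.1.ne'
    positivity
  exact lt_of_lt_of_le (by simp) (measure_mono this)

/-- The rescaled Fejér kernel. -/
def fejerK (A y : ℝ) : ℝ := A * fejer (A * y)

lemma fejerK_nonneg {A : ℝ} (hA : 0 < A) (y : ℝ) : 0 ≤ fejerK A y :=
  mul_nonneg hA.le (fejer_nonneg _)

lemma continuous_fejerK (A : ℝ) : Continuous (fejerK A) := by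
  have := continuous_fejer
  unfold fejerK; fun_prop

lemma fejerK_le {A : ℝ} (hA : 0 < A) (y : ℝ) : fejerK A y ≤ A * ∫ t, tri t :=
  mul_le_mul_of_nonneg_left (fejer_le _) hA.le

lemma integrable_fejerK {A : ℝ} (hA : 0 < A) : Integrable (fejerK A) :=
  (integrable_fejer.comp_mul_left' hA.ne').const_mul A

lemma integral_fejerK {A : ℝ} (hA : 0 < A) : ∫ y, fejerK A y = fejerMass := by
  simp only [fejerK]
  rw [integral_const_mul, Measure.integral_comp_mul_left, abs_of_pos (inv_pos.2 hA), smul_eq_mul,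
    mul_inv_cancel_left₀ hA.ne', fejerMass]

lemma fejerK_eq {A : ℝ} (hA : 0 < A) (y : ℝ) :
    fejerK A y = ∫ t, tri (A⁻¹ * t) * Real.cos (t * y) := by
  have h := Measure.integral_comp_inv_mul_left (fun t => tri t * Real.cos (t * (A * y))) A
  rw [abs_of_pos hA, smul_eq_mul] at h
  rw [fejerK, fejer, ← h]
  refine integral_congr_ae ?_
  filter_upwards with t
  rw [show A⁻¹ * t * (A * y) = t * y by field_simp]

/-- Mass of the Fejér kernel on `[-R, R]`. -/
def fejerBall (R : ℝ) : ℝ := ∫ y in Icc (-R) R, fejer y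

lemma setIntegral_fejerK {A : ℝ} (hA : 0 < A) (δ : ℝ) :
    ∫ y in Icc (-δ) δ, fejerK A y = fejerBall (A * δ) := by
  rw [← integral_indicator measurableSet_Icc, fejerBall, ← integral_indicator measurableSet_Icc]
  have h := Measure.integral_comp_mul_left
    (fun y => (Icc (-(A * δ)) (A * δ)).indicator fejer y) A
  rw [abs_of_pos (inv_pos.2 hA), smul_eq_mul] at h
  rw [← mul_inv_cancel_left₀ hA.ne' (∫ y, (Icc (-(A * δ)) (A * δ)).indicator fejer y), ← h,
    ← integral_const_mul]
  refine integral_congr_ae ?_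
  filter_upwards with y
  have : y ∈ Icc (-δ) δ ↔ A * y ∈ Icc (-(A * δ)) (A * δ) := by
    simp only [mem_Icc, ← mul_neg, mul_le_mul_iff_right₀ hA]
  by_cases hy : y ∈ Icc (-δ) δ
  · rw [indicator_of_mem hy, indicator_of_mem (this.1 hy), fejerK]
  · rw [indicator_of_notMem hy, indicator_of_notMem (fun h => hy (this.2 h)), mul_zero]

lemma tendsto_fejerBall : Tendsto (fun k : ℕ => fejerBall (k + 1)) atTop (𝓝 fejerMass) := by
  have h := tendsto_setIntegral_of_monotone (μ := volume) (f := fejer)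
    (s := fun k : ℕ => Icc (-((k : ℝ) + 1)) (k + 1)) (fun _ => measurableSet_Icc)
    (fun i j hij => by
      have : (i : ℝ) ≤ j := by exact_mod_cast hij
      exact Icc_subset_Icc (by linarith) (by linarith))
    integrable_fejer.integrableOn
  have hu : ⋃ k : ℕ, Icc (-((k : ℝ) + 1)) (k + 1) = univ := by
    refine eq_univ_of_forall fun x => mem_iUnion.2 ?_
    obtain ⟨k, hk⟩ := exists_nat_ge |x|
    have := abs_le.1 hk
    exact ⟨k, by linarith [this.1], by linarith [this.2]⟩
  rw [hu, setIntegral_univ] at h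
  exact h

lemma integral_fejerK_convPow (ν : Measure ℝ) [IsProbabilityMeasure ν] {A : ℝ} (hA : 0 < A)
    (n : ℕ) (z : ℝ) : ∫ x, fejerK A (x - z) ∂convPow ν n =
      (∫ t : ℝ, (tri (A⁻¹ * t) * Complex.exp (-(t * z * Complex.I))) * charFun ν t ^ n).re := by
  have htri := continuous_tri
  have hti : Integrable fun t : ℝ => tri (A⁻¹ * t) :=
    integrable_tri.comp_mul_left' (inv_ne_zero hA.ne')
  have h1 : ∀ t : ℝ, (tri (A⁻¹ * t) * Complex.exp (-(t * z * Complex.I))) * charFun ν t ^ n =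
      ∫ x : ℝ, (tri (A⁻¹ * t) : ℂ) * Complex.exp ((t * (x - z) : ℝ) * Complex.I)
        ∂convPow ν n := fun t => by
    rw [← Pi.pow_apply, ← charFun_convPow, charFun_apply_real, ← integral_const_mul]
    refine integral_congr_ae ?_
    filter_upwards with x
    rw [mul_assoc, ← Complex.exp_add]
    congr 2
    push_cast; ring
  have hint : Integrable (fun p : ℝ × ℝ => (tri (A⁻¹ * p.1) : ℂ) *
      Complex.exp ((p.1 * (p.2 - z) : ℝ) * Complex.I)) (volume.prod (convPow ν n)) := by
    refine (hti.comp_fst (convPow ν n)).mono'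
      (Continuous.aestronglyMeasurable (by fun_prop)) ?_
    filter_upwards with p
    rw [norm_mul, Complex.norm_exp_ofReal_mul_I, mul_one, Complex.norm_real,
      Real.norm_of_nonneg (tri_nonneg _)]
  simp_rw [h1]
  rw [integral_integral_swap hint, ← RCLike.re_eq_complex_re, ← integral_re hint.integral_prod_right]
  refine integral_congr_ae ?_
  filter_upwards with x
  have hx : Integrable fun t : ℝ =>
      (tri (A⁻¹ * t) : ℂ) * Complex.exp ((t * (x - z) : ℝ) * Complex.I) := by
    refine hti.mono' (Continuous.aestronglyMeasurable (by fun_prop)) ?_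
    filter_upwards with t
    rw [norm_mul, Complex.norm_exp_ofReal_mul_I, mul_one, Complex.norm_real,
      Real.norm_of_nonneg (tri_nonneg _)]
  rw [← integral_re hx, fejerK_eq hA]
  refine integral_congr_ae ?_
  filter_upwards with t
  rw [RCLike.re_eq_complex_re, Complex.re_ofReal_mul, Complex.exp_ofReal_mul_I_re]

section Smoothing

variable {ν : Measure ℝ} {σ : ℝ}

/-- The Gaussian integral which governs the local limit theorem. -/
def gaussMass (σ : ℝ) : ℝ := ∫ x : ℝ, Real.exp (-(σ * x) ^ 2 / 2)

lemma IsStep.tendsto_fejerK (h : IsStep ν σ) {A : ℝ} (hA : 0 < A) (z : ℝ) :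
    Tendsto (fun n : ℕ => √n * ∫ x, fejerK A (x - z) ∂convPow ν n) atTop (𝓝 (gaussMass σ)) := by
  have := h.prob
  have htri := continuous_tri
  have h1 := h.tendsto_integral_charFun_pow (A := A) (C := 1)
    (ψ := fun t => tri (A⁻¹ * t) * Complex.exp (-(t * z * Complex.I)))
    (Continuous.measurable (by fun_prop)) (fun t => ?_) (fun t ht => ?_)
    (Continuous.continuousAt (by fun_prop))
  · have h2 := (Complex.continuous_re.tendsto _).comp h1
    refine Tendsto.congr (fun n => ?_) (h2.trans (le_of_eq ?_))
    · rw [integral_fejerK_convPow ν hA, Function.comp, Complex.re_ofReal_mul]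
    · congr 1
      have : ∀ x : ℝ, Complex.exp (-(σ * x : ℂ) ^ 2 / 2) =
          ((Real.exp (-(σ * x) ^ 2 / 2) : ℝ) : ℂ) := fun x => by push_cast; rfl
      simp_rw [this]
      rw [integral_complex_ofReal]
      simp [tri, gaussMass]
  · rw [norm_mul, Complex.norm_real, Real.norm_of_nonneg (tri_nonneg _),
      show -(t * z * Complex.I) = ((-(t * z) : ℝ) : ℂ) * Complex.I by push_cast; ring,
      Complex.norm_exp_ofReal_mul_I, mul_one]
    exact tri_le_one _
  · rw [tri_eq_zero, Complex.ofReal_zero, zero_mul]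
    rw [abs_mul, abs_of_pos (inv_pos.2 hA), inv_mul_eq_div, le_div_iff₀ hA, one_mul]
    exact ht.le

lemma IsStep.exists_fejerK_le (h : IsStep ν σ) {A : ℝ} (hA : 0 < A) :
    ∃ C, ∀ n : ℕ, ∀ z, √n * ∫ x, fejerK A (x - z) ∂convPow ν n ≤ C := by
  have := h.prob
  obtain ⟨c, hc, hcb⟩ := h.norm_charFun_le_exp A
  refine ⟨√(Real.pi / c), fun n z => ?_⟩
  rcases Nat.eq_zero_or_pos n with rfl | hn
  · simp
  have hn' : (0 : ℝ) < n := by exact_mod_cast hn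
  rw [integral_fejerK_convPow ν hA]
  have h1 : ‖∫ t : ℝ, (tri (A⁻¹ * t) * Complex.exp (-(t * z * Complex.I))) * charFun ν t ^ n‖ ≤
      ∫ t : ℝ, Real.exp (-(c * n) * t ^ 2) := by
    refine norm_integral_le_of_norm_le (integrable_exp_neg_mul_sq (by positivity)) ?_
    filter_upwards with t
    rw [norm_mul, norm_mul, Complex.norm_real, Real.norm_of_nonneg (tri_nonneg _),
      show -(t * z * Complex.I) = ((-(t * z) : ℝ) : ℂ) * Complex.I by push_cast; ring,
      Complex.norm_exp_ofReal_mul_I, mul_one, norm_pow]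
    rcases le_or_gt |t| A with h2 | h2
    · calc tri (A⁻¹ * t) * ‖charFun ν t‖ ^ n ≤ 1 * Real.exp (-c * t ^ 2) ^ n := by
            gcongr
            · exact tri_le_one _
            · exact hcb t h2
        _ = _ := by
            rw [one_mul, ← Real.exp_nat_mul]
            congr 1; ring
    · rw [tri_eq_zero, zero_mul]
      · positivity
      rw [abs_mul, abs_of_pos (inv_pos.2 hA), inv_mul_eq_div, le_div_iff₀ hA, one_mul]
      exact h2.le
  rw [integral_gaussian] at h1
  calc _ ≤ √n * √(Real.pi / (c * n)) := by
        gcongr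
        exact (Complex.re_le_norm _).trans h1
    _ = √(Real.pi / c) := by
        rw [← Real.sqrt_mul hn'.le]
        congr 1
        field_simp

lemma integral_smoothed (ν : Measure ℝ) [IsProbabilityMeasure ν] {A : ℝ} (hA : 0 < A)
    {f : ℝ → ℝ} (hf : Integrable f) (n : ℕ) :
    ∫ x, (∫ z, f z * fejerK A (x - z)) ∂convPow ν n =
      ∫ z, f z * ∫ x, fejerK A (x - z) ∂convPow ν n := by
  have hK := continuous_fejerK A
  rw [integral_integral_swap]
  · simp_rw [integral_const_mul]
  · refine ((hf.norm.comp_snd (convPow ν n)).mul_const (A * ∫ t, tri t)).mono'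
      (hf.aestronglyMeasurable.comp_snd.mul
        (Continuous.aestronglyMeasurable (by fun_prop))) ?_
    filter_upwards with p
    simp only [Function.uncurry]
    rw [norm_mul, Real.norm_of_nonneg (fejerK_nonneg hA _)]
    exact mul_le_mul_of_nonneg_left (fejerK_le hA _) (norm_nonneg _)

lemma IsStep.tendsto_smoothed (h : IsStep ν σ) {A : ℝ} (hA : 0 < A)
    {f : ℝ → ℝ} (hf : Integrable f) :
    Tendsto (fun n : ℕ => √n * ∫ x, (∫ z, f z * fejerK A (x - z)) ∂convPow ν n) atTop
      (𝓝 ((∫ z, f z) * gaussMass σ)) := by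
  have := h.prob
  obtain ⟨C, hC⟩ := h.exists_fejerK_le hA
  have hK := continuous_fejerK A
  have e : ∀ n : ℕ, √n * ∫ x, (∫ z, f z * fejerK A (x - z)) ∂convPow ν n =
      ∫ z, √n * (f z * ∫ x, fejerK A (x - z) ∂convPow ν n) := fun n => by
    rw [integral_smoothed ν hA hf, integral_const_mul]
  simp_rw [e]
  rw [← integral_mul_const]
  refine tendsto_integral_of_dominated_convergence (fun z => ‖f z‖ * C) ?_ (hf.norm.mul_const C) ?_ ?_
  · intro n
    refine (hf.aestronglyMeasurable.mul ?_).const_mul _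
    exact (StronglyMeasurable.integral_prod_right
      (f := fun z x => fejerK A (x - z))
      (Continuous.stronglyMeasurable (by fun_prop))).aestronglyMeasurable
  · intro n
    filter_upwards with z
    rw [mul_left_comm, norm_mul]
    refine mul_le_mul_of_nonneg_left ?_ (norm_nonneg _)
    rw [Real.norm_of_nonneg]
    · exact hC n z
    · exact mul_nonneg (Real.sqrt_nonneg _) (integral_nonneg fun x => fejerK_nonneg hA _)
  · filter_upwards with z
    simp_rw [mul_left_comm]
    exact (h.tendsto_fejerK hA z).const_mul (f z)

/-- One-sided exponential. -/
def expPos (θ x : ℝ) : ℝ := (Ici 0).indicator (fun x => Real.exp (-θ * x)) x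

lemma expPos_nonneg (θ x : ℝ) : 0 ≤ expPos θ x :=
  indicator_nonneg (fun _ _ => (Real.exp_pos _).le) _

lemma expPos_le_one {θ : ℝ} (hθ : 0 < θ) (x : ℝ) : expPos θ x ≤ 1 := by
  unfold expPos
  by_cases hx : x ∈ Ici 0
  · rw [indicator_of_mem hx, Real.exp_le_one_iff]
    nlinarith [mem_Ici.1 hx]
  · rw [indicator_of_notMem hx]; exact zero_le_one

lemma measurable_expPos (θ : ℝ) : Measurable (expPos θ) :=
  Measurable.indicator (by fun_prop) measurableSet_Ici

lemma integrable_expPos {θ : ℝ} (hθ : 0 < θ) : Integrable (expPos θ) := by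
  unfold expPos
  rw [integrable_indicator_iff measurableSet_Ici, integrableOn_Ici_iff_integrableOn_Ioi]
  exact exp_neg_integrableOn_Ioi 0 hθ

lemma integral_expPos {θ : ℝ} (hθ : 0 < θ) : ∫ x, expPos θ x = 1 / θ := by
  unfold expPos
  rw [integral_indicator measurableSet_Ici, integral_Ici_eq_integral_Ioi,
    integral_exp_mul_Ioi (by linarith)]
  simp

lemma expPos_le_smoothed {θ A δ : ℝ} (hθ : 0 < θ) (hA : 0 < A) (w x : ℝ) :
    Real.exp (-2 * θ * δ) * fejerBall (A * δ) * expPos θ (x - w) ≤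
      ∫ z, expPos θ (z + δ - w) * fejerK A (x - z) := by
  have hK := continuous_fejerK A
  have h1 : Real.exp (-2 * θ * δ) * fejerBall (A * δ) * expPos θ (x - w) =
      ∫ z, (Real.exp (-2 * θ * δ) * expPos θ (x - w)) *
        (Icc (-δ) δ).indicator (fejerK A) (x - z) := by
    rw [integral_const_mul, integral_sub_left_eq_self (fun y => (Icc (-δ) δ).indicator (fejerK A) y),
      integral_indicator measurableSet_Icc, setIntegral_fejerK hA]
    ring
  rw [h1]
  refine integral_mono_of_nonneg ?_ ?_ ?_
  · filter_upwards with z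
    exact mul_nonneg (mul_nonneg (Real.exp_pos _).le (expPos_nonneg _ _))
      (indicator_nonneg (fun y _ => fejerK_nonneg hA y) _)
  · refine ((integrable_fejerK hA).comp_sub_left x).mono'
      (((measurable_expPos θ).comp (by fun_prop)).aestronglyMeasurable.mul
        (Continuous.aestronglyMeasurable (by fun_prop))) ?_
    filter_upwards with z
    rw [Real.norm_of_nonneg (mul_nonneg (expPos_nonneg _ _) (fejerK_nonneg hA _))]
    exact mul_le_of_le_one_left (fejerK_nonneg hA _) (expPos_le_one hθ _)
  · filter_upwards with z
    by_cases hz : x - z ∈ Icc (-δ) δ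
    · rw [indicator_of_mem hz]
      refine mul_le_mul_of_nonneg_right ?_ (fejerK_nonneg hA _)
      unfold expPos
      by_cases hx : x - w ∈ Ici 0
      · rw [indicator_of_mem hx, indicator_of_mem
          (show z + δ - w ∈ Ici (0 : ℝ) by have := mem_Ici.1 hx; rw [mem_Ici]; linarith [hz.2]),
          ← Real.exp_add, Real.exp_le_exp]
        nlinarith [hz.1]
      · rw [indicator_of_notMem hx, mul_zero]
        exact expPos_nonneg _ _
    · rw [indicator_of_notMem hz, mul_zero]
      exact mul_nonneg (expPos_nonneg _ _) (fejerK_nonneg hA _)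

lemma integrable_smoothed (ν : Measure ℝ) [IsProbabilityMeasure ν] {A : ℝ} (hA : 0 < A)
    {f : ℝ → ℝ} (hf : Integrable f) (n : ℕ) :
    Integrable (fun x => ∫ z, f z * fejerK A (x - z)) (convPow ν n) := by
  have hK := continuous_fejerK A
  have : Integrable (fun p : ℝ × ℝ => f p.2 * fejerK A (p.1 - p.2))
      ((convPow ν n).prod volume) := by
    refine ((hf.norm.comp_snd (convPow ν n)).mul_const (A * ∫ t, tri t)).mono'
      (hf.aestronglyMeasurable.comp_snd.mul
        (Continuous.aestronglyMeasurable (by fun_prop))) ?_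
    filter_upwards with p
    rw [norm_mul, Real.norm_of_nonneg (fejerK_nonneg hA _)]
    exact mul_le_mul_of_nonneg_left (fejerK_le hA _) (norm_nonneg _)
  exact this.integral_prod_left

end Smoothing

section LocalLimitProof

variable {ν : Measure ℝ} {σ : ℝ}

lemma integrable_expPos_sub (μ : Measure ℝ) [IsFiniteMeasure μ] {θ : ℝ} (hθ : 0 < θ) (w : ℝ) :
    Integrable (fun x => expPos θ (x - w)) μ :=
  Integrable.of_bound ((measurable_expPos θ).comp (measurable_id.sub_const w)).aestronglyMeasurable
    1 (ae_of_all _ fun x => by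
      rw [Real.norm_of_nonneg (expPos_nonneg _ _)]; exact expPos_le_one hθ _)

lemma IsStep.exists_expPos_le (h : IsStep ν σ) {θ : ℝ} (hθ : 0 < θ) :
    ∃ C, 0 ≤ C ∧ ∀ n : ℕ, ∀ w, √n * ∫ x, expPos θ (x - w) ∂convPow ν n ≤ C := by
  have := h.prob
  obtain ⟨k, hk⟩ := (tendsto_fejerBall.eventually (lt_mem_nhds fejerMass_pos)).exists
  have hA : (0 : ℝ) < k + 1 := by positivity
  obtain ⟨C, hC⟩ := h.exists_fejerK_le hA
  have hC0 : 0 ≤ C := by simpa using hC 0 0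
  set d := Real.exp (-2 * θ * 1) * fejerBall ((k + 1) * 1) with hd
  have hd0 : 0 < d := mul_pos (Real.exp_pos _) (by rw [mul_one]; exact hk)
  refine ⟨d⁻¹ * (1 / θ * C), by positivity, fun n w => ?_⟩
  have hf : Integrable fun z => expPos θ (z + 1 - w) := by
    simpa [add_sub_assoc] using (integrable_expPos hθ).comp_add_right (1 - w)
  have hfi : ∫ z, expPos θ (z + 1 - w) = 1 / θ := by
    simp_rw [add_sub_assoc]
    rw [integral_add_right_eq_self (expPos θ), integral_expPos hθ]
  have h1 : d * ∫ x, expPos θ (x - w) ∂convPow ν n ≤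
      ∫ z, expPos θ (z + 1 - w) * ∫ x, fejerK (k + 1) (x - z) ∂convPow ν n := by
    rw [← integral_smoothed ν hA hf, ← integral_const_mul]
    exact integral_mono ((integrable_expPos_sub _ hθ w).const_mul d)
      (integrable_smoothed ν hA hf n) fun x => expPos_le_smoothed hθ hA w x
  have h2 : √n * ∫ z, expPos θ (z + 1 - w) * ∫ x, fejerK (k + 1) (x - z) ∂convPow ν n ≤
      1 / θ * C := by
    rw [← integral_const_mul, ← hfi, ← integral_mul_const]
    refine integral_mono_of_nonneg (ae_of_all _ fun z => ?_) (hf.mul_const C)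
      (ae_of_all _ fun z => ?_)
    · exact mul_nonneg (Real.sqrt_nonneg _) (mul_nonneg (expPos_nonneg _ _)
        (integral_nonneg fun x => fejerK_nonneg hA _))
    · simp only
      rw [mul_left_comm]
      exact mul_le_mul_of_nonneg_left (hC n z) (expPos_nonneg _ _)
  rw [inv_mul_eq_div, le_div_iff₀ hd0]
  calc _ = √n * (d * ∫ x, expPos θ (x - w) ∂convPow ν n) := by ring
    _ ≤ _ := (mul_le_mul_of_nonneg_left h1 (Real.sqrt_nonneg _)).trans h2

lemma smoothed_le {θ A δ : ℝ} (hθ : 0 < θ) (hA : 0 < A) (x : ℝ) :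
    ∫ z, expPos θ (z - δ) * fejerK A (x - z) ≤
      fejerMass * Real.exp (2 * θ * δ) * (Ioi 0).indicator (fun x => Real.exp (-θ * x)) x +
        ∫ y, (Icc (-δ) δ)ᶜ.indicator (fejerK A) y * expPos θ (x - (y + δ)) := by
  have hK := continuous_fejerK A
  have hKi := integrable_fejerK hA
  have hint : ∀ s : Set ℝ, MeasurableSet s →
      Integrable fun y => s.indicator (fejerK A) y * expPos θ (x - (y + δ)) := fun s hs => by
    refine (hKi.indicator hs).mul_of_top_left ?_ |>.congr (ae_of_all _ fun y => rfl)
    refine memLp_top_of_bound ((measurable_expPos θ).comp (by fun_prop)).aestronglyMeasurable 1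
      (ae_of_all _ fun y => ?_)
    rw [Real.norm_of_nonneg (expPos_nonneg _ _)]; exact expPos_le_one hθ _
  have e : ∫ z, expPos θ (z - δ) * fejerK A (x - z) =
      ∫ y, ((Icc (-δ) δ).indicator (fejerK A) y * expPos θ (x - (y + δ)) +
        (Icc (-δ) δ)ᶜ.indicator (fejerK A) y * expPos θ (x - (y + δ))) := by
    rw [← integral_sub_left_eq_self _ _ x]
    refine integral_congr_ae (ae_of_all _ fun y => ?_)
    simp only
    rw [← add_mul, indicator_self_add_compl_apply]
    ring_nf
  rw [e, integral_add (hint _ measurableSet_Icc) (hint _ measurableSet_Icc.compl)]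
  gcongr
  have h2 : fejerMass * Real.exp (2 * θ * δ) *
      (Ioi 0).indicator (fun x => Real.exp (-θ * x)) x = ∫ y, fejerK A y *
        (Real.exp (2 * θ * δ) * (Ioi 0).indicator (fun x => Real.exp (-θ * x)) x) := by
    rw [integral_mul_const, integral_fejerK hA, mul_assoc]
  rw [h2]
  refine integral_mono_ae (hint _ measurableSet_Icc) (hKi.mul_const _) ?_
  have hne : ∀ᵐ y : ℝ, y ≠ -δ := by simp [ae_iff, measure_singleton]
  filter_upwards [hne] with y hy
  by_cases hz : y ∈ Icc (-δ) δ
  · rw [indicator_of_mem hz]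
    refine mul_le_mul_of_nonneg_left ?_ (fejerK_nonneg hA _)
    unfold expPos
    have hy' : -δ < y := lt_of_le_of_ne hz.1 (Ne.symm hy)
    by_cases hx : x - (y + δ) ∈ Ici 0
    · rw [indicator_of_mem hx, indicator_of_mem
          (show x ∈ Ioi (0 : ℝ) by have := mem_Ici.1 hx; rw [mem_Ioi]; linarith),
          ← Real.exp_add, Real.exp_le_exp]
      nlinarith [hz.2]
    · rw [indicator_of_notMem hx]
      exact mul_nonneg (Real.exp_pos _).le (indicator_nonneg (fun _ _ => (Real.exp_pos _).le) _)
  · rw [indicator_of_notMem hz, zero_mul]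
    exact mul_nonneg (fejerK_nonneg hA _)
      (mul_nonneg (Real.exp_pos _).le (indicator_nonneg (fun _ _ => (Real.exp_pos _).le) _))

lemma IsStep.le_smoothed (h : IsStep ν σ) {θ A δ C : ℝ} (hθ : 0 < θ) (hA : 0 < A)
    (hC : ∀ n : ℕ, ∀ w, √n * ∫ x, expPos θ (x - w) ∂convPow ν n ≤ C) (n : ℕ) :
    √n * ∫ x, (∫ z, expPos θ (z - δ) * fejerK A (x - z)) ∂convPow ν n ≤
      fejerMass * Real.exp (2 * θ * δ) * (√n * ∫ x in Ioi 0, Real.exp (-θ * x) ∂convPow ν n) +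
        (fejerMass - fejerBall (A * δ)) * C := by
  have := h.prob
  have hK := continuous_fejerK A
  have hKi := integrable_fejerK hA
  have hf : Integrable fun z => expPos θ (z - δ) := (integrable_expPos hθ).comp_sub_right δ
  have hi1 : Integrable (fun x => (Ioi 0).indicator (fun x => Real.exp (-θ * x)) x)
      (convPow ν n) := by
    refine Integrable.of_bound (Measurable.indicator (by fun_prop)
      measurableSet_Ioi).aestronglyMeasurable 1 (ae_of_all _ fun x => ?_)
    rw [Real.norm_of_nonneg (indicator_nonneg (fun _ _ => (Real.exp_pos _).le) _)]
    refine indicator_apply_le' (fun hx => ?_) fun _ => zero_le_one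
    rw [Real.exp_le_one_iff]
    nlinarith [mem_Ioi.1 hx]
  have hprod : Integrable (fun p : ℝ × ℝ => (Icc (-δ) δ)ᶜ.indicator (fejerK A) p.2 *
      expPos θ (p.1 - (p.2 + δ))) ((convPow ν n).prod volume) := by
    refine ((hKi.indicator (measurableSet_Icc (a := -δ) (b := δ)).compl).comp_snd
      (convPow ν n)).mono'
      (((hKi.indicator measurableSet_Icc.compl).aestronglyMeasurable.comp_snd).mul
        ((measurable_expPos θ).comp (by fun_prop)).aestronglyMeasurable) (ae_of_all _ fun p => ?_)
    rw [Real.norm_of_nonneg (mul_nonneg (indicator_nonneg (fun y _ => fejerK_nonneg hA y) _)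
      (expPos_nonneg _ _))]
    exact mul_le_of_le_one_right (indicator_nonneg (fun y _ => fejerK_nonneg hA y) _)
      (expPos_le_one hθ _)
  have h1 : ∫ x, (∫ z, expPos θ (z - δ) * fejerK A (x - z)) ∂convPow ν n ≤
      fejerMass * Real.exp (2 * θ * δ) * (∫ x in Ioi 0, Real.exp (-θ * x) ∂convPow ν n) +
        ∫ y, (Icc (-δ) δ)ᶜ.indicator (fejerK A) y *
          ∫ x, expPos θ (x - (y + δ)) ∂convPow ν n := by
    have e : ∫ y, (Icc (-δ) δ)ᶜ.indicator (fejerK A) y *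
          ∫ x, expPos θ (x - (y + δ)) ∂convPow ν n =
        ∫ x, (∫ y, (Icc (-δ) δ)ᶜ.indicator (fejerK A) y *
          expPos θ (x - (y + δ))) ∂convPow ν n := by
      simp_rw [← integral_const_mul]
      exact integral_integral_swap hprod.swap
    rw [e, ← integral_indicator measurableSet_Ioi, ← integral_const_mul,
      ← integral_add (hi1.const_mul _) hprod.integral_prod_left]
    exact integral_mono (integrable_smoothed ν hA hf n)
      ((hi1.const_mul _).add hprod.integral_prod_left) fun x => smoothed_le hθ hA x
  have h2 : √n * ∫ y, (Icc (-δ) δ)ᶜ.indicator (fejerK A) y *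
          ∫ x, expPos θ (x - (y + δ)) ∂convPow ν n ≤ (fejerMass - fejerBall (A * δ)) * C := by
    have e : fejerMass - fejerBall (A * δ) = ∫ y, (Icc (-δ) δ)ᶜ.indicator (fejerK A) y := by
      rw [integral_indicator measurableSet_Icc.compl, ← setIntegral_fejerK hA,
        ← integral_fejerK hA, ← integral_add_compl measurableSet_Icc hKi]
      ring
    rw [e, ← integral_mul_const, ← integral_const_mul]
    refine integral_mono_of_nonneg (ae_of_all _ fun y => ?_)
      ((hKi.indicator measurableSet_Icc.compl).mul_const C) (ae_of_all _ fun y => ?_)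
    · exact mul_nonneg (Real.sqrt_nonneg _) (mul_nonneg
        (indicator_nonneg (fun y _ => fejerK_nonneg hA y) _)
        (integral_nonneg fun x => expPos_nonneg _ _))
    · simp only
      rw [mul_left_comm]
      exact mul_le_mul_of_nonneg_left (hC n _) (indicator_nonneg (fun y _ => fejerK_nonneg hA y) _)
  calc _ ≤ √n * _ := mul_le_mul_of_nonneg_left h1 (Real.sqrt_nonneg _)
    _ ≤ _ := by rw [mul_add, mul_left_comm]; gcongr

/-- The constant of the local limit theorem. -/
def lltConst (σ : ℝ) : ℝ := gaussMass σ / fejerMass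

/-- Local limit theorem tested against one-sided exponentials. -/
lemma IsStep.tendsto_lap_convPow (h : IsStep ν σ) {θ : ℝ} (hθ : 0 < θ) {s : Set ℝ}
    (hs : MeasurableSet s) (hs1 : Ioi 0 ⊆ s) (hs2 : s ⊆ Ici 0) :
    Tendsto (fun n : ℕ => √n * ∫ x in s, Real.exp (-θ * x) ∂convPow ν n) atTop
      (𝓝 (lltConst σ / θ)) := by
  have := h.prob
  obtain ⟨C, hC0, hC⟩ := h.exists_expPos_le hθ
  have hκ := fejerMass_pos
  have hmono : ∀ n : ℕ, ∀ s t : Set ℝ, MeasurableSet t → s ⊆ t → t ⊆ Ici 0 →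
      ∫ x in s, Real.exp (-θ * x) ∂convPow ν n ≤ ∫ x in t, Real.exp (-θ * x) ∂convPow ν n := by
    intro n s t ht hst ht0
    refine setIntegral_mono_set (Integrable.of_bound (by fun_prop) 1 ?_)
      (ae_of_all _ fun x => (Real.exp_pos _).le) hst.eventuallyLE
    filter_upwards [ae_restrict_mem ht] with x hx
    rw [Real.norm_of_nonneg (Real.exp_pos _).le, Real.exp_le_one_iff]
    nlinarith [mem_Ici.1 (ht0 hx)]
  have hδ : Tendsto (fun k : ℕ => (1 : ℝ) / (k + 1)) atTop (𝓝 0) :=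
    tendsto_one_div_add_atTop_nhds_zero_nat
  have hAδ : ∀ k : ℕ, ((k : ℝ) + 1) ^ 2 * (1 / (k + 1)) = k + 1 := fun k => by field_simp
  obtain ⟨k0, hk0⟩ := eventually_atTop.1 (tendsto_fejerBall.eventually (lt_mem_nhds hκ))
  have hb : ∀ k, 0 < fejerBall (((k + k0 : ℕ) : ℝ) + 1) := fun k => hk0 _ (by omega)
  have hball := tendsto_fejerBall.comp (tendsto_add_atTop_nat k0)
  have hδ' := hδ.comp (tendsto_add_atTop_nat k0)
  simp only [Function.comp_def] at hball hδ'
  refine tendsto_of_forall_le_tendsto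
    (U := fun k n => (Real.exp (-2 * θ * (1 / (((k + k0 : ℕ) : ℝ) + 1))) *
      fejerBall (((k + k0 : ℕ) : ℝ) + 1))⁻¹ *
      (√n * ∫ x, (∫ z, expPos θ (z + 1 / (((k + k0 : ℕ) : ℝ) + 1)) *
        fejerK ((((k + k0 : ℕ) : ℝ) + 1) ^ 2) (x - z)) ∂convPow ν n))
    (L := fun k n => (fejerMass * Real.exp (2 * θ * (1 / ((k : ℝ) + 1))))⁻¹ *
      (√n * (∫ x, (∫ z, expPos θ (z - 1 / ((k : ℝ) + 1)) *
        fejerK (((k : ℝ) + 1) ^ 2) (x - z)) ∂convPow ν n) -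
          (fejerMass - fejerBall (k + 1)) * C))
    (B := fun k => (Real.exp (-2 * θ * (1 / (((k + k0 : ℕ) : ℝ) + 1))) *
      fejerBall (((k + k0 : ℕ) : ℝ) + 1))⁻¹ * (1 / θ * gaussMass σ))
    (B' := fun k => (fejerMass * Real.exp (2 * θ * (1 / ((k : ℝ) + 1))))⁻¹ *
      (1 / θ * gaussMass σ - (fejerMass - fejerBall (k + 1)) * C)) ?_ ?_ ?_ ?_ ?_ ?_
  · refine fun k => Eventually.of_forall fun n => ?_
    have hA : (0 : ℝ) < (((k + k0 : ℕ) : ℝ) + 1) ^ 2 := by positivity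
    have hf : Integrable fun z => expPos θ (z + 1 / (((k + k0 : ℕ) : ℝ) + 1)) :=
      (integrable_expPos hθ).comp_add_right _
    rw [inv_mul_eq_div, le_div_iff₀ (mul_pos (Real.exp_pos _) (hb k)), mul_assoc]
    refine mul_le_mul_of_nonneg_left ?_ (Real.sqrt_nonneg _)
    calc _ ≤ (∫ x in Ici 0, Real.exp (-θ * x) ∂convPow ν n) * _ :=
          mul_le_mul_of_nonneg_right (hmono n _ _ measurableSet_Ici hs2 subset_rfl)
            (mul_nonneg (Real.exp_pos _).le (hb k).le)
      _ = ∫ x, Real.exp (-2 * θ * (1 / (((k + k0 : ℕ) : ℝ) + 1))) *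
            fejerBall (((k + k0 : ℕ) : ℝ) + 1) * expPos θ (x - 0) ∂convPow ν n := by
          rw [integral_const_mul, ← integral_indicator measurableSet_Ici, mul_comm]
          simp only [sub_zero]
          rfl
      _ ≤ _ := by
          refine integral_mono ((integrable_expPos_sub _ hθ 0).const_mul _)
            (integrable_smoothed ν hA hf n) fun x => ?_
          have := expPos_le_smoothed (δ := 1 / (((k + k0 : ℕ) : ℝ) + 1)) hθ hA 0 x
          rw [hAδ] at this
          simpa only [sub_zero] using this
  · intro k
    have hA : (0 : ℝ) < (((k + k0 : ℕ) : ℝ) + 1) ^ 2 := by positivity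
    have := (h.tendsto_smoothed hA ((integrable_expPos hθ).comp_add_right
      (1 / (((k + k0 : ℕ) : ℝ) + 1))))
    rw [integral_add_right_eq_self (expPos θ), integral_expPos hθ] at this
    exact this.const_mul _
  · have e : lltConst σ / θ = (Real.exp (-2 * θ * 0) * fejerMass)⁻¹ * (1 / θ * gaussMass σ) := by
      simp [lltConst]; field_simp
    rw [e]
    refine Tendsto.mul_const _ (Tendsto.inv₀ (Tendsto.mul ?_ hball) (by positivity))
    exact (Real.continuous_exp.tendsto _).comp (hδ'.const_mul _)
  · refine fun k => Eventually.of_forall fun n => ?_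
    have hA : (0 : ℝ) < ((k : ℝ) + 1) ^ 2 := by positivity
    have h1 := h.le_smoothed (δ := 1 / ((k : ℝ) + 1)) hθ hA hC n
    rw [hAδ] at h1
    rw [inv_mul_eq_div, div_le_iff₀ (by positivity), mul_comm (√n * _) (_ * _)]
    have h2 : fejerMass * Real.exp (2 * θ * (1 / ((k : ℝ) + 1))) *
        (√n * ∫ x in Ioi 0, Real.exp (-θ * x) ∂convPow ν n) ≤
        fejerMass * Real.exp (2 * θ * (1 / ((k : ℝ) + 1))) *
        (√n * ∫ x in s, Real.exp (-θ * x) ∂convPow ν n) := by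
      exact mul_le_mul_of_nonneg_left
        (mul_le_mul_of_nonneg_left (hmono n _ _ hs hs1 hs2) (Real.sqrt_nonneg _)) (by positivity)
    linarith
  · intro k
    have hA : (0 : ℝ) < ((k : ℝ) + 1) ^ 2 := by positivity
    have := (h.tendsto_smoothed hA ((integrable_expPos hθ).comp_sub_right
      (1 / ((k : ℝ) + 1))))
    rw [integral_sub_right_eq_self (expPos θ), integral_expPos hθ] at this
    exact (this.sub_const _).const_mul _
  · have e : lltConst σ / θ = (fejerMass * Real.exp (2 * θ * 0))⁻¹ *
        (1 / θ * gaussMass σ - (fejerMass - fejerMass) * C) := by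
      simp [lltConst]; field_simp
    rw [e]
    refine Tendsto.mul (Tendsto.inv₀ (Tendsto.const_mul _ ?_) (by positivity))
      (Tendsto.const_sub _ (Tendsto.mul_const _ (tendsto_fejerBall.const_sub _)))
    exact (Real.continuous_exp.tendsto _).comp (hδ.const_mul _)

end LocalLimitProof

/-- The sequence `g` decays like `l n ^ (-α)`. -/
def DecayTo (α : ℝ) (g : ℕ → ℝ) (l : ℝ) : Prop :=
  Tendsto (fun n : ℕ => ((n : ℝ) + 1) ^ α * g n) atTop (𝓝 l)

/-- The weight `(n + 1) ^ (-3/2)`. -/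
def wt (n : ℕ) : ℝ := ((n : ℝ) + 1) ^ (-(3 / 2) : ℝ)

lemma wt_pos (n : ℕ) : 0 < wt n := by unfold wt; positivity

lemma wt_mul (n : ℕ) : ((n : ℝ) + 1) ^ (3 / 2 : ℝ) * wt n = 1 := by
  rw [wt, ← Real.rpow_add (by positivity)]; norm_num

lemma summable_wt : Summable wt := by
  have h := (summable_nat_add_iff 1).2 (Real.summable_nat_rpow.2 (show (-(3 / 2) : ℝ) < -1 by norm_num))
  refine h.congr fun n => ?_
  simp [wt]

lemma wt_mul_wt_le (i j : ℕ) : wt i * wt j ≤ 2 ^ (3 / 2 : ℝ) * wt (i + j) * (wt i + wt j) := by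
  have key : ∀ i j : ℕ, i ≤ j → wt j ≤ 2 ^ (3 / 2 : ℝ) * wt (i + j) := fun i j hij => by
    have h2 : (2 : ℝ) ^ (3 / 2 : ℝ) * wt (i + j) = ((((i + j : ℕ) : ℝ) + 1) / 2) ^ (-(3 / 2) : ℝ) := by
      rw [wt, Real.div_rpow (by positivity) (by norm_num), Real.rpow_neg (by norm_num : (0:ℝ) ≤ 2)]
      field_simp
    rw [h2, wt]
    refine Real.rpow_le_rpow_of_nonpos (by positivity) ?_ (by norm_num)
    have : (i : ℝ) ≤ j := by exact_mod_cast hij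
    push_cast; linarith
  have hi := wt_pos i
  have hj := wt_pos j
  have hij := wt_pos (i + j)
  have h2 : (0 : ℝ) < 2 ^ (3 / 2 : ℝ) := by positivity
  rcases le_total i j with h | h
  · have := key i j h
    have h3 := mul_le_mul_of_nonneg_left this hi.le
    have : 0 ≤ 2 ^ (3 / 2 : ℝ) * wt (i + j) * wt j := by positivity
    nlinarith
  · have := key j i h
    rw [add_comm] at this
    have h3 := mul_le_mul_of_nonneg_left this hj.le
    have : 0 ≤ 2 ^ (3 / 2 : ℝ) * wt (i + j) * wt i := by positivity
    nlinarith

/-- Constant in the convolution bound for `wt`. -/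
def wtConst : ℝ := 2 ^ (3 / 2 : ℝ) * (2 * ∑' n, wt n)

lemma wtConst_nonneg : 0 ≤ wtConst := by
  have : 0 ≤ ∑' n, wt n := tsum_nonneg fun n => (wt_pos n).le
  unfold wtConst; positivity

lemma sum_wt_le (n : ℕ) : ∑ p ∈ Finset.HasAntidiagonal.antidiagonal n, wt p.1 * wt p.2 ≤
    wtConst * wt n := by
  have h1 : ∑ p ∈ Finset.HasAntidiagonal.antidiagonal n, wt p.1 * wt p.2 ≤
      ∑ p ∈ Finset.HasAntidiagonal.antidiagonal n, 2 ^ (3 / 2 : ℝ) * wt n * (wt p.1 + wt p.2) := by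
    refine Finset.sum_le_sum fun p hp => ?_
    rw [← Finset.HasAntidiagonal.mem_antidiagonal.1 hp]
    exact wt_mul_wt_le _ _
  have h2 : ∑ p ∈ Finset.HasAntidiagonal.antidiagonal n, wt p.1 ≤ ∑' n, wt n := by
    rw [Finset.Nat.sum_antidiagonal_eq_sum_range_succ_mk]
    exact summable_wt.sum_le_tsum _ fun i _ => (wt_pos i).le
  have h3 : ∑ p ∈ Finset.HasAntidiagonal.antidiagonal n, wt p.2 ≤ ∑' n, wt n := by
    rw [← Finset.Nat.sum_antidiagonal_swap]
    exact h2
  refine h1.trans ?_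
  rw [← Finset.mul_sum, Finset.sum_add_distrib, wtConst]
  have := wt_pos n
  have h4 : (0 : ℝ) < 2 ^ (3 / 2 : ℝ) := by positivity
  calc _ ≤ 2 ^ (3 / 2 : ℝ) * wt n * (∑' n, wt n + ∑' n, wt n) := by gcongr
    _ = _ := by ring

lemma sum_conv_le {r b : ℕ → ℝ} {C D : ℝ} (hr0 : ∀ n, 0 ≤ r n) (hb0 : ∀ n, 0 ≤ b n)
    (hr : ∀ n, r n ≤ C * wt n) (hb : ∀ n, b n ≤ D * wt n) (n : ℕ) :
    ∑ p ∈ Finset.HasAntidiagonal.antidiagonal n, r p.1 * b p.2 ≤ wtConst * C * D * wt n := by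
  have hC : 0 ≤ C := nonneg_of_mul_nonneg_left ((hr0 0).trans (hr 0)) (wt_pos 0)
  have hD : 0 ≤ D := nonneg_of_mul_nonneg_left ((hb0 0).trans (hb 0)) (wt_pos 0)
  calc _ ≤ ∑ p ∈ Finset.HasAntidiagonal.antidiagonal n, C * D * (wt p.1 * wt p.2) := by
        refine Finset.sum_le_sum fun p _ => ?_
        calc _ ≤ (C * wt p.1) * (D * wt p.2) :=
              mul_le_mul (hr _) (hb _) (hb0 _) (mul_nonneg hC (wt_pos _).le)
          _ = _ := by ring
    _ ≤ C * D * (wtConst * wt n) := by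
        rw [← Finset.mul_sum]
        exact mul_le_mul_of_nonneg_left (sum_wt_le n) (by positivity)
    _ = _ := by ring

lemma DecayTo.exists_bound {α l : ℝ} {g : ℕ → ℝ} (h : DecayTo α g l) :
    ∃ G, 0 ≤ G ∧ ∀ n, |g n| ≤ G * ((n : ℝ) + 1) ^ (-α) := by
  obtain ⟨G, hG⟩ := h.abs.bddAbove_range
  refine ⟨G, (abs_nonneg _).trans (hG ⟨0, rfl⟩), fun n => ?_⟩
  have h1 : |((n : ℝ) + 1) ^ α * g n| ≤ G := hG ⟨n, rfl⟩
  have h0 : (0 : ℝ) < ((n : ℝ) + 1) ^ α := by positivity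
  rw [Real.rpow_neg (by positivity), ← div_eq_mul_inv, le_div_iff₀ h0]
  rwa [abs_mul, abs_of_pos h0, mul_comm] at h1

lemma tendsto_ratio_rpow (α : ℝ) (k : ℕ) :
    Tendsto (fun n : ℕ => (((n + k : ℕ) : ℝ) + 1) ^ α / ((n : ℝ) + 1) ^ α) atTop (𝓝 1) := by
  have h1 : Tendsto (fun n : ℕ => 1 + (k : ℝ) * (1 / ((n : ℝ) + 1))) atTop (𝓝 (1 + k * 0)) :=
    (tendsto_one_div_add_atTop_nhds_zero_nat.const_mul _).const_add _
  rw [mul_zero, add_zero] at h1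
  have h2 := h1.rpow_const (p := α) (Or.inl one_ne_zero)
  rw [Real.one_rpow] at h2
  refine h2.congr fun n => ?_
  rw [← Real.div_rpow (by positivity) (by positivity)]
  congr 1
  push_cast
  field_simp
  ring

lemma DecayTo.shift {α l : ℝ} {g : ℕ → ℝ} (k : ℕ) (h : DecayTo α g l) :
    DecayTo α (fun n => g (n + k)) l := by
  have h1 := (h.comp (tendsto_add_atTop_nat k)).div (tendsto_ratio_rpow α k) one_ne_zero
  rw [div_one] at h1
  refine h1.congr fun n => ?_
  have : (0 : ℝ) < ((n : ℝ) + 1) ^ α := by positivity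
  have : (0 : ℝ) < (((n + k : ℕ) : ℝ) + 1) ^ α := by positivity
  simp only [Function.comp_apply, Pi.div_apply]
  field_simp

lemma DecayTo.of_shift {α l : ℝ} {g : ℕ → ℝ} {k : ℕ} (h : DecayTo α (fun n => g (n + k)) l) :
    DecayTo α g l := by
  have h1 := h.mul (tendsto_ratio_rpow α k)
  rw [mul_one] at h1
  refine (tendsto_add_atTop_iff_nat k).1 (h1.congr fun n => ?_)
  have : (0 : ℝ) < ((n : ℝ) + 1) ^ α := by positivity
  field_simp

lemma DecayTo.half {α l : ℝ} {f g : ℕ → ℝ} (hα : 0 ≤ α) (hf : Summable fun n => |f n|)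
    (h : DecayTo α g l) :
    DecayTo α (fun n => ∑ i ∈ Finset.range (n + 1), if 2 * i ≤ n then f i * g (n - i) else 0)
      (l * ∑' i, f i) := by
  obtain ⟨G, hG0, hG⟩ := h.exists_bound
  have e : ∀ n : ℕ, ((n : ℝ) + 1) ^ α * ∑ i ∈ Finset.range (n + 1),
      (if 2 * i ≤ n then f i * g (n - i) else 0) =
      ∑' i, (if 2 * i ≤ n then ((n : ℝ) + 1) ^ α * (f i * g (n - i)) else 0) := fun n => by
    rw [tsum_eq_sum (s := Finset.range (n + 1)), Finset.mul_sum]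
    · exact Finset.sum_congr rfl fun i _ => by split_ifs <;> simp
    · intro i hi
      rw [if_neg]
      simp only [Finset.mem_range] at hi
      omega
  unfold DecayTo
  simp_rw [e]
  rw [← tsum_mul_left]
  refine tendsto_tsum_of_dominated_convergence (bound := fun i => |f i| * (G * 2 ^ α))
    (hf.mul_right _) (fun i => ?_) (Eventually.of_forall fun n i => ?_)
  · have h1 : Tendsto (fun n : ℕ => ((n : ℝ) + 1) ^ α * g (n - i)) atTop (𝓝 l) := by
      refine (tendsto_add_atTop_iff_nat i).1 ?_
      have h2 := h.mul (tendsto_ratio_rpow α i)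
      rw [mul_one] at h2
      refine h2.congr fun n => ?_
      have : (0 : ℝ) < ((n : ℝ) + 1) ^ α := by positivity
      rw [Nat.add_sub_cancel]
      field_simp
    refine (h1.mul_const (f i)).congr' ?_
    filter_upwards [eventually_ge_atTop (2 * i)] with n hn
    rw [if_pos hn]; ring
  · split_ifs with hi
    · have h1 := hG (n - i)
      have h2 : ((n : ℝ) + 1) ^ α * (((n - i : ℕ) : ℝ) + 1) ^ (-α) ≤ 2 ^ α := by
        rw [Real.rpow_neg (by positivity), ← div_eq_mul_inv,
          ← Real.div_rpow (by positivity) (by positivity)]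
        refine Real.rpow_le_rpow (by positivity) ?_ hα
        rw [div_le_iff₀ (by positivity)]
        have : (n : ℝ) ≤ 2 * ((n - i : ℕ) : ℝ) := by exact_mod_cast (by omega : n ≤ 2 * (n - i))
        linarith
      have h3 : (0 : ℝ) < ((n : ℝ) + 1) ^ α := by positivity
      rw [Real.norm_eq_abs, abs_mul, abs_mul, abs_of_pos h3, mul_left_comm]
      refine mul_le_mul_of_nonneg_left ?_ (abs_nonneg _)
      calc _ ≤ ((n : ℝ) + 1) ^ α * (G * (((n - i : ℕ) : ℝ) + 1) ^ (-α)) := by gcongr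
        _ = G * (((n : ℝ) + 1) ^ α * (((n - i : ℕ) : ℝ) + 1) ^ (-α)) := by ring
        _ ≤ _ := by gcongr
    · simp only [norm_zero]; positivity

lemma sum_antidiagonal_split (f g : ℕ → ℝ) (n : ℕ) :
    ∑ p ∈ Finset.HasAntidiagonal.antidiagonal n, f p.1 * g p.2 =
      (∑ i ∈ Finset.range (n + 1), if 2 * i ≤ n then f i * g (n - i) else 0) +
        ∑ i ∈ Finset.range (n + 1), if 2 * i < n then g i * f (n - i) else 0 := by
  have h2 : (∑ i ∈ Finset.range (n + 1), if 2 * i < n then g i * f (n - i) else 0) =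
      ∑ i ∈ Finset.range (n + 1), if n < 2 * i then f i * g (n - i) else 0 := by
    rw [← Finset.sum_range_reflect]
    refine Finset.sum_congr rfl fun i hi => ?_
    have hi' : i < n + 1 := Finset.mem_range.1 hi
    rw [show n + 1 - 1 - i = n - i by omega, show n - (n - i) = i by omega]
    by_cases h : n < 2 * i
    · rw [if_pos h, if_pos (by omega), mul_comm]
    · rw [if_neg h, if_neg (by omega)]
  rw [h2, ← Finset.sum_add_distrib,
    Finset.Nat.sum_antidiagonal_eq_sum_range_succ (fun i j => f i * g j)]
  refine Finset.sum_congr rfl fun i _ => ?_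
  by_cases h : 2 * i ≤ n
  · rw [if_pos h, if_neg (by omega), add_zero]
  · rw [if_neg h, if_pos (by omega), zero_add]

lemma DecayTo.summable {l : ℝ} {g : ℕ → ℝ} (h : DecayTo (3 / 2) g l) :
    Summable fun n => |g n| := by
  obtain ⟨G, -, hG⟩ := h.exists_bound
  exact (summable_wt.mul_left G).of_nonneg_of_le (fun n => abs_nonneg _) hG

lemma DecayTo.conv {R B : ℝ} {r b : ℕ → ℝ} (hr : DecayTo (3 / 2) r R) (hb : DecayTo (3 / 2) b B) :
    DecayTo (3 / 2) (fun n => ∑ p ∈ Finset.HasAntidiagonal.antidiagonal n, r p.1 * b p.2)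
      (B * ∑' i, r i + R * ∑' i, b i) := by
  have h1 := hb.half (by norm_num) hr.summable
  have h2 := hr.half (by norm_num) hb.summable
  have h3 : Tendsto (fun n : ℕ => ((n : ℝ) + 1) ^ (3 / 2 : ℝ) *
      ∑ i ∈ Finset.range (n + 1), if 2 * i = n then b i * r (n - i) else 0) atTop (𝓝 0) := by
    obtain ⟨C, hC0, hC⟩ := hr.exists_bound
    obtain ⟨D, hD0, hD⟩ := hb.exists_bound
    have hlim : Tendsto (fun n : ℕ => C * D * 2 ^ (3 / 2 : ℝ) *
        (2 * (((n : ℝ) / 2 + 1) ^ (-(3 / 2) : ℝ)))) atTop (𝓝 (C * D * 2 ^ (3 / 2 : ℝ) * (2 * 0))) := by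
      refine Tendsto.const_mul _ (Tendsto.const_mul _ ?_)
      refine (tendsto_rpow_neg_atTop (by norm_num)).comp ?_
      exact tendsto_atTop_add_const_right _ _
        (tendsto_natCast_atTop_atTop.atTop_div_const (by norm_num))
    rw [mul_zero, mul_zero] at hlim
    refine squeeze_zero_norm (fun n => ?_) hlim
    by_cases hn : ∃ m, 2 * m = n
    · obtain ⟨m, rfl⟩ := hn
      rw [Finset.sum_eq_single m]
      · rw [if_pos rfl, show 2 * m - m = m by omega, Real.norm_eq_abs, abs_mul, abs_mul,
          abs_of_pos (by positivity : (0 : ℝ) < (((2 * m : ℕ) : ℝ) + 1) ^ (3 / 2 : ℝ))]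
        have h4 := wt_mul_wt_le m m
        have h5 := wt_mul (2 * m)
        have h6 : (((2 * m : ℕ) : ℝ) / 2 + 1) ^ (-(3 / 2) : ℝ) = wt m := by
          rw [wt]; push_cast; congr 2; ring
        rw [h6]
        have h7 : |b m| * |r m| ≤ (D * wt m) * (C * wt m) :=
          mul_le_mul (hD m) (hC m) (abs_nonneg _) (mul_nonneg hD0 (wt_pos m).le)
        calc _ ≤ (((2 * m : ℕ) : ℝ) + 1) ^ (3 / 2 : ℝ) * ((D * wt m) * (C * wt m)) := by gcongr
          _ = (C * D) * (((2 * m : ℕ) : ℝ) + 1) ^ (3 / 2 : ℝ) * (wt m * wt m) := by ring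
          _ ≤ (C * D) * (((2 * m : ℕ) : ℝ) + 1) ^ (3 / 2 : ℝ) *
              (2 ^ (3 / 2 : ℝ) * wt (m + m) * (wt m + wt m)) := by gcongr
          _ = C * D * 2 ^ (3 / 2 : ℝ) * (2 * wt m) *
              ((((2 * m : ℕ) : ℝ) + 1) ^ (3 / 2 : ℝ) * wt (2 * m)) := by
                rw [← two_mul m]; ring
          _ = _ := by rw [h5]; ring
      · intro i _ hi
        rw [if_neg (by omega)]
      · intro h
        exact absurd (Finset.mem_range.2 (by omega)) h
    · rw [Finset.sum_eq_zero fun i _ => if_neg fun h => hn ⟨i, h⟩, mul_zero, norm_zero]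
      positivity
  have h4 := (h1.add h2).sub h3
  rw [sub_zero] at h4
  refine h4.congr fun n => ?_
  simp only
  rw [sum_antidiagonal_split, ← mul_add, ← mul_sub, add_sub_assoc, ← Finset.sum_sub_distrib]
  congr 3
  funext i
  rcases lt_trichotomy (2 * i) n with h | h | h
  · rw [if_pos h.le, if_neg h.ne, if_pos h, sub_zero]
  · rw [if_pos h.le, if_pos h, if_neg h.not_lt, sub_self]
  · rw [if_neg (by omega), if_neg h.ne', if_neg (by omega), sub_zero]

/-- The recursion satisfied by the coefficients of `exp (∑ d j s ^ (j + 1) / (j + 1))`. -/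
structure SpitzerRec (b d : ℕ → ℝ) : Prop where
  zero : b 0 = 1
  nonneg : ∀ n, 0 ≤ b n
  le_one : ∀ n, b n ≤ 1
  d_nonneg : ∀ n, 0 ≤ d n
  recur : ∀ n : ℕ, ((n : ℝ) + 1) * b (n + 1) =
    ∑ p ∈ Finset.HasAntidiagonal.antidiagonal n, b p.1 * d p.2

section Spitzer

variable {b d : ℕ → ℝ} {D : ℝ}

lemma sum_antidiagonal_le_prod (F : ℕ × ℕ → ℝ) (hF : ∀ p, 0 ≤ F p) (N : ℕ) :
    ∑ n ∈ Finset.range N, ∑ p ∈ Finset.HasAntidiagonal.antidiagonal n, F p ≤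
      ∑ i ∈ Finset.range N, ∑ j ∈ Finset.range N, F (i, j) := by
  rw [← Finset.sum_product', ← Finset.sum_biUnion]
  · refine Finset.sum_le_sum_of_subset_of_nonneg (fun p hp => ?_) fun p _ _ => hF p
    simp only [Finset.mem_biUnion, Finset.mem_range, Finset.HasAntidiagonal.mem_antidiagonal,
      Finset.mem_product] at hp ⊢
    obtain ⟨n, hn, h⟩ := hp
    omega
  · intro m _ n _ hmn
    refine Finset.disjoint_left.2 fun p hp hq => hmn ?_
    rw [Finset.HasAntidiagonal.mem_antidiagonal] at hp hq
    omega

lemma SpitzerRec.summable (h : SpitzerRec b d) (hd : ∀ j : ℕ, d j ≤ D * ((j : ℝ) + 1) ^ (-(1 / 2) : ℝ)) :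
    Summable b := by
  have hD : 0 ≤ D := by simpa using (h.d_nonneg 0).trans (hd 0)
  have hs : Summable fun j : ℕ => ((j : ℝ) + 1) ^ (-(5 / 4) : ℝ) := by
    have h := (summable_nat_add_iff 1).2
      (Real.summable_nat_rpow.2 (show (-(5 / 4) : ℝ) < -1 by norm_num))
    exact h.congr fun n => by simp
  set E := D * ∑' j : ℕ, ((j : ℝ) + 1) ^ (-(5 / 4) : ℝ) with hE
  have hE0 : 0 ≤ E := mul_nonneg hD (tsum_nonneg fun j => by positivity)
  have hlim : Tendsto (fun i : ℕ => ((i : ℝ) + 1) ^ (-(1 / 4) : ℝ) * E) atTop (𝓝 (0 * E)) :=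
    ((tendsto_rpow_neg_atTop (by norm_num)).comp
      (tendsto_atTop_add_const_right _ _ tendsto_natCast_atTop_atTop)).mul_const E
  rw [zero_mul] at hlim
  obtain ⟨i0, hi0⟩ := eventually_atTop.1 (hlim.eventually (gt_mem_nhds (show (0 : ℝ) < 1 / 2 by norm_num)))
  refine summable_of_sum_range_le (c := 2 * (1 + i0 * E)) h.nonneg fun N => ?_
  have h1 : ∀ n, b (n + 1) ≤ ∑ p ∈ Finset.HasAntidiagonal.antidiagonal n,
      (b p.1 * ((p.1 : ℝ) + 1) ^ (-(1 / 4) : ℝ)) * (D * ((p.2 : ℝ) + 1) ^ (-(5 / 4) : ℝ)) := fun n => by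
    have hn : (0 : ℝ) < n + 1 := by positivity
    refine le_of_mul_le_mul_left ?_ hn
    rw [h.recur, Finset.mul_sum]
    refine Finset.sum_le_sum fun p hp => ?_
    have hp' : ((p.1 : ℝ) + p.2) = n := by
      exact_mod_cast Finset.HasAntidiagonal.mem_antidiagonal.1 hp
    have h2 : 1 ≤ ((n : ℝ) + 1) * (((p.1 : ℝ) + 1) ^ (-(1 / 4) : ℝ) *
        ((p.2 : ℝ) + 1) ^ (-(3 / 4) : ℝ)) := by
      have e : ((n : ℝ) + 1) ^ (-(1 / 4) : ℝ) * ((n : ℝ) + 1) ^ (-(3 / 4) : ℝ) =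
          ((n : ℝ) + 1)⁻¹ := by
        rw [← Real.rpow_add hn, ← Real.rpow_neg_one]; norm_num
      calc (1 : ℝ) = ((n : ℝ) + 1) * (((n : ℝ) + 1) ^ (-(1 / 4) : ℝ) *
            ((n : ℝ) + 1) ^ (-(3 / 4) : ℝ)) := by rw [e]; field_simp
        _ ≤ _ := by
          gcongr ?_ * (?_ * ?_)
          · exact Real.rpow_le_rpow_of_nonpos (by positivity)
              (by linarith [(Nat.cast_nonneg p.2 : (0 : ℝ) ≤ p.2)]) (by norm_num)
          · exact Real.rpow_le_rpow_of_nonpos (by positivity)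
              (by linarith [(Nat.cast_nonneg p.1 : (0 : ℝ) ≤ p.1)]) (by norm_num)
    have h3 : ((p.2 : ℝ) + 1) ^ (-(5 / 4) : ℝ) =
        ((p.2 : ℝ) + 1) ^ (-(1 / 2) : ℝ) * ((p.2 : ℝ) + 1) ^ (-(3 / 4) : ℝ) := by
      rw [← Real.rpow_add (by positivity)]; norm_num
    have h4 := h.nonneg p.1
    have h5 : (0 : ℝ) < ((p.2 : ℝ) + 1) ^ (-(1 / 2) : ℝ) := by positivity
    calc b p.1 * d p.2 ≤ b p.1 * (D * ((p.2 : ℝ) + 1) ^ (-(1 / 2) : ℝ)) * 1 := by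
          rw [mul_one]; exact mul_le_mul_of_nonneg_left (hd _) h4
      _ ≤ b p.1 * (D * ((p.2 : ℝ) + 1) ^ (-(1 / 2) : ℝ)) * (((n : ℝ) + 1) *
          (((p.1 : ℝ) + 1) ^ (-(1 / 4) : ℝ) * ((p.2 : ℝ) + 1) ^ (-(3 / 4) : ℝ))) :=
        mul_le_mul_of_nonneg_left h2 (by positivity)
      _ = _ := by rw [h3]; ring
  have h2 : ∑ n ∈ Finset.range N, b (n + 1) ≤ ∑ i ∈ Finset.range N,
      b i * (((i : ℝ) + 1) ^ (-(1 / 4) : ℝ) * E) := by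
    refine (Finset.sum_le_sum fun n _ => h1 n).trans ((sum_antidiagonal_le_prod _ (fun p => ?_) N).trans ?_)
    · exact mul_nonneg (mul_nonneg (h.nonneg _) (by positivity)) (by positivity)
    · refine Finset.sum_le_sum fun i _ => ?_
      simp only
      rw [← Finset.mul_sum, mul_assoc, ← Finset.mul_sum]
      refine mul_le_mul_of_nonneg_left ?_ (h.nonneg _)
      refine mul_le_mul_of_nonneg_left ?_ (by positivity)
      exact mul_le_mul_of_nonneg_left (hs.sum_le_tsum _ fun j _ => by positivity) hD
  have h3 : ∑ i ∈ Finset.range N, b i * (((i : ℝ) + 1) ^ (-(1 / 4) : ℝ) * E) ≤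
      ∑ i ∈ Finset.range N, (1 / 2 * b i + if i < i0 then E else 0) := by
    refine Finset.sum_le_sum fun i _ => ?_
    split_ifs with hi
    · have h4 : ((i : ℝ) + 1) ^ (-(1 / 4) : ℝ) ≤ 1 :=
        Real.rpow_le_one_of_one_le_of_nonpos (by linarith [(Nat.cast_nonneg i : (0 : ℝ) ≤ i)])
          (by norm_num)
      have h5 : ((i : ℝ) + 1) ^ (-(1 / 4) : ℝ) * E ≤ E := mul_le_of_le_one_left hE0 h4
      have h6 : b i * (((i : ℝ) + 1) ^ (-(1 / 4) : ℝ) * E) ≤ 1 * E :=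
        mul_le_mul (h.le_one i) h5 (by positivity) zero_le_one
      linarith [h.nonneg i]
    · have := hi0 i (by omega)
      nlinarith [h.nonneg i]
  have h4 : ∑ i ∈ Finset.range N, (if i < i0 then E else 0) ≤ i0 * E := by
    rw [← Finset.sum_filter, Finset.sum_const, nsmul_eq_mul]
    refine mul_le_mul_of_nonneg_right ?_ hE0
    have : (Finset.range N).filter (· < i0) ⊆ Finset.range i0 := fun i hi =>
      Finset.mem_range.2 (Finset.mem_filter.1 hi).2
    exact_mod_cast (Finset.card_le_card this).trans (Finset.card_range i0).le
  have h5 : ∑ n ∈ Finset.range N, b n ≤ 1 + ∑ n ∈ Finset.range N, b (n + 1) := by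
    have := Finset.sum_range_succ' b N
    rw [Finset.sum_range_succ, h.zero] at this
    linarith [h.nonneg N]
  rw [Finset.sum_add_distrib, ← Finset.mul_sum] at h3
  linarith

lemma sum_rpow_neg_half_le (n : ℕ) :
    ∑ i ∈ Finset.range (n + 1), ((i : ℝ) + 1) ^ (-(1 / 2) : ℝ) ≤ 2 * ((n : ℝ) + 1) ^ (1 / 2 : ℝ) := by
  have e : ∀ i : ℕ, ((i : ℝ) + 1) ^ (-(1 / 2) : ℝ) = (√((i : ℝ) + 1))⁻¹ := fun i => by
    rw [Real.rpow_neg (by positivity), ← Real.sqrt_eq_rpow]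
  simp_rw [e, ← Real.sqrt_eq_rpow]
  induction n with
  | zero => simp
  | succ n ih =>
    rw [Finset.sum_range_succ]
    push_cast
    set x := √((n : ℝ) + 1)
    set y := √((n : ℝ) + 1 + 1)
    have hx : x ^ 2 = (n : ℝ) + 1 := Real.sq_sqrt (by positivity)
    have hy : y ^ 2 = (n : ℝ) + 1 + 1 := Real.sq_sqrt (by positivity)
    have hx0 : 0 < x := by positivity
    have hy0 : 0 < y := by positivity
    have : y⁻¹ ≤ 2 * y - 2 * x := by
      rw [inv_eq_one_div, div_le_iff₀ hy0]
      nlinarith [sq_nonneg (x - y)]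
    linarith

lemma rpow_half_mul_le (i j : ℕ) : ((i + j : ℕ) + 1 : ℝ) ^ (1 / 2 : ℝ) ≤
    ((i : ℝ) + 1) ^ (1 / 2 : ℝ) + ((j : ℝ) + 1) ^ (1 / 2 : ℝ) := by
  simp_rw [← Real.sqrt_eq_rpow]
  refine Real.sqrt_le_iff.2 ⟨by positivity, ?_⟩
  have h1 := Real.sq_sqrt (by positivity : (0 : ℝ) ≤ (i : ℝ) + 1)
  have h2 := Real.sq_sqrt (by positivity : (0 : ℝ) ≤ (j : ℝ) + 1)
  have : 0 ≤ √((i : ℝ) + 1) * √((j : ℝ) + 1) := by positivity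
  push_cast
  nlinarith

lemma SpitzerRec.le_wt (h : SpitzerRec b d) (hd : ∀ j : ℕ, d j ≤ D * ((j : ℝ) + 1) ^ (-(1 / 2) : ℝ)) :
    ∃ C, ∀ n, b n ≤ C * wt n := by
  have hsum := h.summable hd
  have hD : 0 ≤ D := by simpa using (h.d_nonneg 0).trans (hd 0)
  set T := ∑' n, b n
  have hT0 : 0 ≤ T := tsum_nonneg h.nonneg
  have hbT : ∀ n, ∑ p ∈ Finset.HasAntidiagonal.antidiagonal n, b p.1 ≤ T := fun n => by
    rw [Finset.Nat.sum_antidiagonal_eq_sum_range_succ_mk]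
    exact hsum.sum_le_tsum _ fun i _ => h.nonneg i
  have h1 : ∀ n : ℕ, b n ≤ (1 + D * T) * 2 * ((n : ℝ) + 1)⁻¹ := fun n => by
    rw [← div_eq_mul_inv, le_div_iff₀ (by positivity)]
    cases n with
    | zero => simp [h.zero]; nlinarith [mul_nonneg hD hT0]
    | succ n =>
      have h2 : ((n : ℝ) + 1) * b (n + 1) ≤ D * T := by
        rw [h.recur]
        calc _ ≤ ∑ p ∈ Finset.HasAntidiagonal.antidiagonal n, D * b p.1 := by
              refine Finset.sum_le_sum fun p _ => ?_
              rw [mul_comm]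
              refine mul_le_mul_of_nonneg_right ((hd _).trans (mul_le_of_le_one_right hD ?_))
                (h.nonneg _)
              exact Real.rpow_le_one_of_one_le_of_nonpos
                (by linarith [(Nat.cast_nonneg p.2 : (0 : ℝ) ≤ p.2)]) (by norm_num)
          _ ≤ D * T := by
              rw [← Finset.mul_sum]
              exact mul_le_mul_of_nonneg_left (hbT n) hD
      push_cast
      nlinarith [h.le_one (n + 1), h.nonneg (n + 1), mul_nonneg hD hT0]
  set C₁ := (1 + D * T) * 2 with hC₁
  have hC₁0 : 0 ≤ C₁ := by positivity
  have hw : ∀ n : ℕ, wt n = ((n : ℝ) + 1)⁻¹ * (((n : ℝ) + 1) ^ (1 / 2 : ℝ))⁻¹ := fun n => by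
    rw [wt, ← Real.rpow_neg (by positivity), ← Real.rpow_neg_one, ← Real.rpow_add (by positivity)]
    norm_num
  have hinv : ∀ i : ℕ, ((i : ℝ) + 1) ^ (-(1 / 2) : ℝ) * ((i : ℝ) + 1) ^ (1 / 2 : ℝ) = 1 := fun i => by
    rw [← Real.rpow_add (by positivity)]; norm_num
  have hsq : ∀ i : ℕ, ((i : ℝ) + 1) ^ (1 / 2 : ℝ) * ((i : ℝ) + 1)⁻¹ =
      ((i : ℝ) + 1) ^ (-(1 / 2) : ℝ) := fun i => by
    rw [← Real.rpow_neg_one, ← Real.rpow_add (by positivity)]; norm_num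
  have hS : ∀ n : ℕ, ((n : ℝ) + 1) ^ (1 / 2 : ℝ) * ∑ p ∈ Finset.HasAntidiagonal.antidiagonal n,
      ((p.1 : ℝ) + 1) ^ (-(1 / 2) : ℝ) * ((p.2 : ℝ) + 1) ^ (-(1 / 2) : ℝ) ≤
      4 * ((n : ℝ) + 1) ^ (1 / 2 : ℝ) := fun n => by
    have e1 : ∑ p ∈ Finset.HasAntidiagonal.antidiagonal n, ((p.1 : ℝ) + 1) ^ (-(1 / 2) : ℝ) ≤
        2 * ((n : ℝ) + 1) ^ (1 / 2 : ℝ) := by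
      rw [Finset.Nat.sum_antidiagonal_eq_sum_range_succ_mk]
      exact sum_rpow_neg_half_le n
    have e2 : ∑ p ∈ Finset.HasAntidiagonal.antidiagonal n, ((p.2 : ℝ) + 1) ^ (-(1 / 2) : ℝ) ≤
        2 * ((n : ℝ) + 1) ^ (1 / 2 : ℝ) := by
      rw [← Finset.Nat.sum_antidiagonal_swap]; exact e1
    calc _ ≤ ∑ p ∈ Finset.HasAntidiagonal.antidiagonal n,
          (((p.1 : ℝ) + 1) ^ (-(1 / 2) : ℝ) + ((p.2 : ℝ) + 1) ^ (-(1 / 2) : ℝ)) := by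
          rw [Finset.mul_sum]
          refine Finset.sum_le_sum fun p hp => ?_
          have := rpow_half_mul_le p.1 p.2
          rw [Finset.HasAntidiagonal.mem_antidiagonal.1 hp] at this
          calc _ ≤ (((p.1 : ℝ) + 1) ^ (1 / 2 : ℝ) + ((p.2 : ℝ) + 1) ^ (1 / 2 : ℝ)) *
                (((p.1 : ℝ) + 1) ^ (-(1 / 2) : ℝ) * ((p.2 : ℝ) + 1) ^ (-(1 / 2) : ℝ)) := by gcongr
            _ = (((p.1 : ℝ) + 1) ^ (-(1 / 2) : ℝ) * ((p.1 : ℝ) + 1) ^ (1 / 2 : ℝ)) *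
                ((p.2 : ℝ) + 1) ^ (-(1 / 2) : ℝ) + (((p.2 : ℝ) + 1) ^ (-(1 / 2) : ℝ) *
                ((p.2 : ℝ) + 1) ^ (1 / 2 : ℝ)) * ((p.1 : ℝ) + 1) ^ (-(1 / 2) : ℝ) := by ring
            _ = _ := by rw [hinv, hinv]; ring
      _ ≤ _ := by rw [Finset.sum_add_distrib]; linarith
  set C₂ := D * T + C₁ * D * 4 with hC₂
  have hC₂0 : 0 ≤ C₂ := by positivity
  have h2 : ∀ n : ℕ, ((n : ℝ) + 1) ^ (1 / 2 : ℝ) * (((n : ℝ) + 1) * b (n + 1)) ≤ C₂ := fun n => by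
    rw [h.recur]
    have hn0 : (0 : ℝ) < ((n : ℝ) + 1) ^ (1 / 2 : ℝ) := by positivity
    calc _ ≤ ∑ p ∈ Finset.HasAntidiagonal.antidiagonal n, (D * b p.1 + C₁ * D *
          (((p.1 : ℝ) + 1) ^ (-(1 / 2) : ℝ) * ((p.2 : ℝ) + 1) ^ (-(1 / 2) : ℝ))) := by
          rw [Finset.mul_sum]
          refine Finset.sum_le_sum fun p hp => ?_
          have := rpow_half_mul_le p.1 p.2
          rw [Finset.HasAntidiagonal.mem_antidiagonal.1 hp] at this
          have hb0 := h.nonneg p.1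
          have hi : (0 : ℝ) < ((p.1 : ℝ) + 1) ^ (1 / 2 : ℝ) := by positivity
          have hj : (0 : ℝ) < ((p.2 : ℝ) + 1) ^ (1 / 2 : ℝ) := by positivity
          calc _ ≤ (((p.1 : ℝ) + 1) ^ (1 / 2 : ℝ) + ((p.2 : ℝ) + 1) ^ (1 / 2 : ℝ)) *
                (b p.1 * (D * ((p.2 : ℝ) + 1) ^ (-(1 / 2) : ℝ))) := by
                refine mul_le_mul this (mul_le_mul_of_nonneg_left (hd _) hb0)
                  (mul_nonneg hb0 (h.d_nonneg _)) (by positivity)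
            _ = D * b p.1 * (((p.2 : ℝ) + 1) ^ (-(1 / 2) : ℝ) * ((p.2 : ℝ) + 1) ^ (1 / 2 : ℝ)) +
                ((p.1 : ℝ) + 1) ^ (1 / 2 : ℝ) * b p.1 *
                  (D * ((p.2 : ℝ) + 1) ^ (-(1 / 2) : ℝ)) := by ring
            _ ≤ D * b p.1 * 1 + ((p.1 : ℝ) + 1) ^ (1 / 2 : ℝ) * (C₁ * ((p.1 : ℝ) + 1)⁻¹) *
                  (D * ((p.2 : ℝ) + 1) ^ (-(1 / 2) : ℝ)) := by
                rw [hinv]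
                gcongr
                exact h1 _
            _ = D * b p.1 + C₁ * D * ((((p.1 : ℝ) + 1) ^ (1 / 2 : ℝ) * ((p.1 : ℝ) + 1)⁻¹) *
                  ((p.2 : ℝ) + 1) ^ (-(1 / 2) : ℝ)) := by ring
            _ = _ := by rw [hsq]
      _ ≤ D * T + C₁ * D * 4 := by
          rw [Finset.sum_add_distrib, ← Finset.mul_sum, ← Finset.mul_sum]
          have h4 : ∑ p ∈ Finset.HasAntidiagonal.antidiagonal n,
              ((p.1 : ℝ) + 1) ^ (-(1 / 2) : ℝ) * ((p.2 : ℝ) + 1) ^ (-(1 / 2) : ℝ) ≤ 4 := by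
            have := hS n
            rw [mul_comm 4] at this
            exact le_of_mul_le_mul_left this hn0
          have := hbT n
          gcongr
  refine ⟨1 + 2 ^ (3 / 2 : ℝ) * C₂, fun n => ?_⟩
  cases n with
  | zero => simp [h.zero, wt]; positivity
  | succ n =>
    have h3 : b (n + 1) ≤ C₂ * wt n := by
      rw [hw, ← mul_inv, ← div_eq_mul_inv, le_div_iff₀ (by positivity)]
      have := h2 n
      linarith
    have h4 : wt n ≤ 2 ^ (3 / 2 : ℝ) * wt (n + 1) := by
      have e : (2 : ℝ) ^ (3 / 2 : ℝ) * wt (n + 1) =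
          ((((n + 1 : ℕ) : ℝ) + 1) / 2) ^ (-(3 / 2) : ℝ) := by
        rw [wt, Real.div_rpow (by positivity) (by norm_num),
          Real.rpow_neg (by norm_num : (0:ℝ) ≤ 2)]
        field_simp
      rw [e, wt]
      refine Real.rpow_le_rpow_of_nonpos (by positivity) ?_ (by norm_num)
      push_cast
      linarith [(Nat.cast_nonneg n : (0 : ℝ) ≤ n)]
    calc b (n + 1) ≤ C₂ * (2 ^ (3 / 2 : ℝ) * wt (n + 1)) := h3.trans (by gcongr)
      _ ≤ _ := by nlinarith [wt_pos (n + 1)]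

lemma SpitzerRec.decayTo (h : SpitzerRec b d) {c : ℝ} (hd : DecayTo (1 / 2) d c) :
    DecayTo (3 / 2) b (c * ∑' n, b n) := by
  obtain ⟨D, hD0, hD⟩ := hd.exists_bound
  have hd' : ∀ j : ℕ, d j ≤ D * ((j : ℝ) + 1) ^ (-(1 / 2) : ℝ) := fun j => (le_abs_self _).trans (hD j)
  have hsum := h.summable hd'
  obtain ⟨C, hC⟩ := h.le_wt hd'
  have hC0 : 0 ≤ C := nonneg_of_mul_nonneg_left ((h.nonneg 0).trans (hC 0)) (wt_pos 0)
  have h1 := hd.half (by norm_num) hsum.abs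
  have h2 : Tendsto (fun n : ℕ => ((n : ℝ) + 1) ^ (1 / 2 : ℝ) *
      ∑ i ∈ Finset.range (n + 1), if 2 * i < n then d i * b (n - i) else 0) atTop (𝓝 0) := by
    have hlim : Tendsto (fun n : ℕ => C * D * 2 ^ (3 / 2 : ℝ) * 2 *
        (((n : ℝ) + 1) ^ (-(1 / 2) : ℝ))) atTop (𝓝 (C * D * 2 ^ (3 / 2 : ℝ) * 2 * 0)) := by
      refine Tendsto.const_mul _ ?_
      exact (tendsto_rpow_neg_atTop (by norm_num)).comp
        (tendsto_atTop_add_const_right _ _ tendsto_natCast_atTop_atTop)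
    rw [mul_zero] at hlim
    refine squeeze_zero (fun n => mul_nonneg (by positivity) (Finset.sum_nonneg fun i _ => ?_))
      (fun n => ?_) hlim
    · split_ifs
      · exact mul_nonneg (h.d_nonneg _) (h.nonneg _)
      · exact le_rfl
    · have h3 : ∑ i ∈ Finset.range (n + 1), (if 2 * i < n then d i * b (n - i) else 0) ≤
          ∑ i ∈ Finset.range (n + 1), ((i : ℝ) + 1) ^ (-(1 / 2) : ℝ) *
            (D * C * 2 ^ (3 / 2 : ℝ) * wt n) := by
        refine Finset.sum_le_sum fun i _ => ?_
        have := wt_pos n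
        split_ifs with hi
        · have h5 : wt (n - i) ≤ 2 ^ (3 / 2 : ℝ) * wt n := by
            have e : (2 : ℝ) ^ (3 / 2 : ℝ) * wt n = (((n : ℝ) + 1) / 2) ^ (-(3 / 2) : ℝ) := by
              rw [wt, Real.div_rpow (by positivity) (by norm_num),
                Real.rpow_neg (by norm_num : (0:ℝ) ≤ 2)]
              field_simp
            rw [e, wt]
            refine Real.rpow_le_rpow_of_nonpos (by positivity) ?_ (by norm_num)
            have : (n : ℝ) ≤ 2 * ((n - i : ℕ) : ℝ) := by exact_mod_cast (by omega : n ≤ 2 * (n - i))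
            linarith
          calc d i * b (n - i) ≤ (D * ((i : ℝ) + 1) ^ (-(1 / 2) : ℝ)) *
                (C * (2 ^ (3 / 2 : ℝ) * wt n)) :=
                mul_le_mul (hd' i) ((hC _).trans (by gcongr)) (h.nonneg _) (by positivity)
            _ = _ := by ring
        · positivity
      rw [← Finset.sum_mul] at h3
      have h6 := sum_rpow_neg_half_le n
      have h7 := wt_mul n
      have hn0 : (0 : ℝ) < ((n : ℝ) + 1) ^ (1 / 2 : ℝ) := by positivity
      have e1 : ((n : ℝ) + 1) ^ (1 / 2 : ℝ) * ((n : ℝ) + 1) ^ (1 / 2 : ℝ) * wt n =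
          ((n : ℝ) + 1) ^ (-(1 / 2) : ℝ) := by
        rw [wt, ← Real.rpow_add (by positivity), ← Real.rpow_add (by positivity)]; norm_num
      have := wt_pos n
      calc _ ≤ ((n : ℝ) + 1) ^ (1 / 2 : ℝ) * ((2 * ((n : ℝ) + 1) ^ (1 / 2 : ℝ)) *
            (D * C * 2 ^ (3 / 2 : ℝ) * wt n)) := by
            refine mul_le_mul_of_nonneg_left (h3.trans ?_) hn0.le
            gcongr
        _ = C * D * 2 ^ (3 / 2 : ℝ) * 2 * (((n : ℝ) + 1) ^ (1 / 2 : ℝ) *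
            ((n : ℝ) + 1) ^ (1 / 2 : ℝ) * wt n) := by ring
        _ = _ := by rw [e1]
  have h3 := h1.add h2
  rw [add_zero] at h3
  have h4 : Tendsto (fun n : ℕ => ((n : ℝ) + 1) ^ (3 / 2 : ℝ) * b (n + 1)) atTop
      (𝓝 (c * ∑' n, b n)) := by
    refine h3.congr fun n => ?_
    simp only
    rw [← mul_add, ← sum_antidiagonal_split, ← h.recur, ← mul_assoc]
    congr 1
    rw [← Real.rpow_add_one (by positivity)]
    norm_num
  exact DecayTo.of_shift (k := 1) h4

end Spitzer

/-! ### Laplace transforms of killed walks -/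

/-- The Laplace transform of a measure on the line. -/
def lap (P : Measure ℝ) (θ : ℝ) : ℝ := ∫ x, Real.exp (-θ * x) ∂P

lemma lap_nonneg (P : Measure ℝ) (θ : ℝ) : 0 ≤ lap P θ := integral_nonneg fun _ => (Real.exp_pos _).le

lemma lap_conv (P R : Measure ℝ) [IsFiniteMeasure P] [IsFiniteMeasure R] (θ : ℝ) :
    lap (Measure.conv P R) θ = lap P θ * lap R θ := by
  unfold lap Measure.conv
  rw [integral_map (by fun_prop) (by fun_prop), ← integral_prod_mul]
  congr 1 with p
  rw [← Real.exp_add]; ring_nf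

lemma lap_dirac (x θ : ℝ) : lap (Measure.dirac x) θ = Real.exp (-θ * x) := by
  simp [lap]

lemma integrable_exp_of_compl {P : Measure ℝ} [IsFiniteMeasure P] (hP : P (Ici 0)ᶜ = 0) {θ : ℝ}
    (hθ : 0 ≤ θ) : Integrable (fun x => Real.exp (-θ * x)) P := by
  refine (integrable_const (1 : ℝ)).mono' (by fun_prop) ?_
  have : ∀ᵐ x ∂P, x ∈ Ici (0 : ℝ) := hP
  filter_upwards [this] with x hx
  rw [Real.norm_of_nonneg (Real.exp_pos _).le, Real.exp_le_one_iff]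
  have := mul_nonneg hθ hx
  linarith

lemma lap_le_mass {P : Measure ℝ} [IsFiniteMeasure P] (hP : P (Ici 0)ᶜ = 0) {θ : ℝ}
    (hθ : 0 ≤ θ) : lap P θ ≤ P.real univ := by
  have h : lap P θ ≤ ∫ _, (1 : ℝ) ∂P := by
    refine integral_mono_ae (integrable_exp_of_compl hP hθ) (integrable_const _) ?_
    have : ∀ᵐ x ∂P, x ∈ Ici (0 : ℝ) := hP
    filter_upwards [this] with x hx
    rw [Real.exp_le_one_iff]
    have := mul_nonneg hθ hx
    linarith
  simpa using h

lemma killed_neg (ν : Measure ℝ) [IsFiniteMeasure ν] {H : Set ℝ} (hH : MeasurableSet H) (x : ℝ)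
    (n : ℕ) : killed (ν.map Neg.neg) H x n =
      (killed ν (Neg.neg ⁻¹' H) (-x) n).map Neg.neg := by
  induction n with
  | zero => simp [killed, Measure.map_dirac' measurable_neg]
  | succ n ih =>
    rw [killed, killed, ih]
    rw [← Measure.restrict_map measurable_neg hH]
    have := Measure.map_conv_addMonoidHom (μ := killed ν (Neg.neg ⁻¹' H) (-x) n) (ν := ν)
      (AddMonoidHom.mk' (fun x : ℝ => -x) (fun a b => by ring)) measurable_neg
    congr 1
    exact this.symm

lemma convPow_neg (ν : Measure ℝ) [IsFiniteMeasure ν] (n : ℕ) :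
    convPow (ν.map Neg.neg) n = (convPow ν n).map Neg.neg := by
  unfold convPow
  rw [killed_neg ν MeasurableSet.univ]
  simp

lemma killed_mass_le_one (ν : Measure ℝ) [IsProbabilityMeasure ν] (H : Set ℝ) (x : ℝ) (n : ℕ) :
    killed ν H x n univ ≤ 1 := by
  induction n with
  | zero => simp [killed]
  | succ n ih =>
    rw [killed]
    refine (Measure.restrict_apply_le _ _).trans ?_
    rw [Measure.conv, Measure.map_apply (by fun_prop) MeasurableSet.univ, preimage_univ,
      ← univ_prod_univ, Measure.prod_prod, measure_univ (μ := ν), mul_one]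
    exact ih

lemma IsStep.neg {ν : Measure ℝ} {σ : ℝ} (h : IsStep ν σ) : IsStep (ν.map Neg.neg) σ where
  prob := by
    have := h.prob
    exact Measure.isProbabilityMeasure_map measurable_neg.aemeasurable
  mean := by
    rw [integral_map measurable_neg.aemeasurable (by fun_prop), integral_neg, h.mean, neg_zero]
  sq := by
    rw [integral_map measurable_neg.aemeasurable (by fun_prop)]
    simpa using h.sq
  pos := h.pos
  nonLattice := by
    rintro ⟨a, k, hk⟩
    refine h.nonLattice ⟨-a, k, ?_⟩
    rw [Measure.map_apply measurable_neg] at hk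
    · rw [← hk]
      congr 1 with x
      simp only [mem_ofPred_eq, mem_preimage]
      constructor
      · rintro ⟨m, hm⟩; exact ⟨-m, by rw [hm]; push_cast; ring⟩
      · rintro ⟨m, hm⟩; exact ⟨-m, by push_cast; linarith⟩
    · have : {x : ℝ | ∃ m : ℤ, x = a + m * k} = range fun m : ℤ => a + m * k := by
        ext x; simp [eq_comm]
      rw [this]
      exact (countable_range _).measurableSet

/-- The properties of the laws of a centred walk killed when it leaves a half-line which are
used below. -/
structure LadderSeq (P : ℕ → Measure ℝ) (c : ℝ) : Prop where
  fin : ∀ n, IsFiniteMeasure (P n)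
  zero : P 0 = Measure.dirac 0
  supp : ∀ n, P n (Ici 0)ᶜ = 0
  mass : ∀ n, P n univ ≤ 1
  bound : ∀ θ : ℝ, 0 < θ → ∃ C, ∀ n, lap (P n) θ ≤ C * wt n
  lim : ∀ θ : ℝ, 0 < θ → DecayTo (3 / 2) (fun n => lap (P n) θ) (c / θ * ∑' n, lap (P n) θ)

lemma IsStep.ladderSeq {ν : Measure ℝ} {σ : ℝ} (h : IsStep ν σ) {H : Set ℝ}
    (hH : MeasurableSet H) (h1 : Ioi 0 ⊆ H) (h2 : H ⊆ Ici 0)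
    (hsp : ∀ n : ℕ, (n + 1) • killed ν H 0 (n + 1) =
      ∑ p ∈ Finset.HasAntidiagonal.antidiagonal n, Measure.conv (killed ν H 0 p.1)
        ((convPow ν (p.2 + 1)).restrict H)) :
    LadderSeq (killed ν H 0) (lltConst σ) := by
  have := h.prob
  have hsupp : ∀ n, killed ν H 0 n (Ici 0)ᶜ = 0 := fun n => by
    cases n with
    | zero => simp [killed]
    | succ n =>
      exact measure_mono_null (compl_subset_compl.2 h2) (by rw [killed, restrict_compl_self hH])
  have hrec : ∀ θ : ℝ, 0 < θ → SpitzerRec (fun n => lap (killed ν H 0 n) θ)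
      (fun n => ∫ x in H, Real.exp (-θ * x) ∂convPow ν (n + 1)) := fun θ hθ =>
    { zero := by simp [killed, lap_dirac]
      nonneg := fun n => lap_nonneg _ _
      le_one := fun n => (lap_le_mass (hsupp n) hθ.le).trans
        (ENNReal.toReal_mono ENNReal.one_ne_top (killed_mass_le_one ν H 0 n))
      d_nonneg := fun n => integral_nonneg fun _ => (Real.exp_pos _).le
      recur := fun n => by
        have e := congrArg (fun m => lap m θ) (hsp n)
        have e1 : lap ((n + 1) • killed ν H 0 (n + 1)) θ =
            ((n : ℝ) + 1) * lap (killed ν H 0 (n + 1)) θ := by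
          unfold lap
          rw [← Nat.cast_smul_eq_nsmul ENNReal, integral_smul_measure, ENNReal.toReal_natCast, smul_eq_mul]
          push_cast
          rfl
        have e2 : ∀ p : ℕ × ℕ, lap (Measure.conv (killed ν H 0 p.1)
            ((convPow ν (p.2 + 1)).restrict H)) θ = lap (killed ν H 0 p.1) θ *
              ∫ x in H, Real.exp (-θ * x) ∂convPow ν (p.2 + 1) := fun p => by
          rw [lap_conv]; rfl
        simp only [e1] at e
        rw [e, lap, integral_finsetSum_measure]
        · exact Finset.sum_congr rfl fun p _ => e2 p
        · intro p _
          refine integrable_exp_of_compl ?_ hθ.le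
          exact conv_compl_eq_zero measurableSet_Ici (fun x hx y hy => add_mem_Ici hx hy) _ _
            (hsupp _) (measure_mono_null (compl_subset_compl.2 h2) (restrict_compl_self hH _)) }
  have hd : ∀ θ : ℝ, 0 < θ → DecayTo (1 / 2)
      (fun n => ∫ x in H, Real.exp (-θ * x) ∂convPow ν (n + 1)) (lltConst σ / θ) := fun θ hθ => by
    have := (h.tendsto_lap_convPow hθ hH h1 h2).comp (tendsto_add_atTop_nat 1)
    refine this.congr fun n => ?_
    simp only [Function.comp_apply, Real.sqrt_eq_rpow, Nat.cast_add, Nat.cast_one]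
  exact
  { fin := fun n => inferInstance
    zero := rfl
    supp := hsupp
    mass := killed_mass_le_one ν H 0
    bound := fun θ hθ => by
      obtain ⟨D, hD0, hD⟩ := (hd θ hθ).exists_bound
      exact (hrec θ hθ).le_wt fun j => (le_abs_self _).trans (hD j)
    lim := fun θ hθ => (hrec θ hθ).decayTo (hd θ hθ) }

lemma IsStep.ladderSeq_pos {ν : Measure ℝ} {σ : ℝ} (h : IsStep ν σ) :
    LadderSeq (killed ν (Ici 0) 0) (lltConst σ) := by
  have := h.prob
  exact h.ladderSeq measurableSet_Ici Ioi_subset_Ici_self subset_rfl (spitzer_pos ν)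

lemma map_neg_neg (m : Measure ℝ) : (m.map Neg.neg).map Neg.neg = m := by
  rw [Measure.map_map measurable_neg measurable_neg]
  simp

lemma killed_Iio_neg (ν : Measure ℝ) [IsFiniteMeasure ν] (n : ℕ) :
    killed ν (Iio 0) 0 n = (killed (ν.map Neg.neg) (Ioi 0) 0 n).map Neg.neg := by
  rw [killed_neg ν measurableSet_Ioi, map_neg_neg]
  simp

lemma IsStep.ladderSeq_neg {ν : Measure ℝ} {σ : ℝ} (h : IsStep ν σ) :
    LadderSeq (killed (ν.map Neg.neg) (Ioi 0) 0) (lltConst σ) := by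
  have := h.prob
  refine h.neg.ladderSeq measurableSet_Ioi subset_rfl Ioi_subset_Ici_self fun n => ?_
  have hmap : ∀ m, killed (ν.map Neg.neg) (Ioi 0) 0 m = (killed ν (Iio 0) 0 m).map Neg.neg := fun m => by
    rw [killed_neg ν measurableSet_Ioi]; simp
  rw [hmap, ← Measure.mapₗ_apply_of_measurable measurable_neg, ← map_nsmul, spitzer_neg, map_sum]
  refine Finset.sum_congr rfl fun p _ => ?_
  rw [Measure.mapₗ_apply_of_measurable measurable_neg, hmap, convPow_neg,
    Measure.restrict_map measurable_neg measurableSet_Ioi]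
  have := Measure.map_conv_addMonoidHom (μ := killed ν (Iio 0) 0 p.1)
    (ν := (convPow ν (p.2 + 1)).restrict (Iio 0))
    (AddMonoidHom.mk' (fun x : ℝ => -x) (fun a b => by ring)) measurable_neg
  have e : (Neg.neg ⁻¹' Ioi (0 : ℝ)) = Iio 0 := by ext; simp
  rw [e]
  exact this

/-- The measures `a n • P n` on `[0, ∞)` converge to `ρ` in the sense that their Laplace
transforms converge at the positive integers. -/
structure LapConv (a : ℕ → ℝ) (P : ℕ → Measure ℝ) (ρ : Measure ℝ) : Prop where
  nonneg : ∀ n, 0 ≤ a n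
  supp : ∀ n, P n (Ici 0)ᶜ = 0
  int : ∀ n, Integrable (fun x => Real.exp (-x)) (P n)
  supp_lim : ρ (Ici 0)ᶜ = 0
  int_lim : Integrable (fun x => Real.exp (-x)) ρ
  lim : ∀ k : ℕ, Tendsto (fun n => a n * lap (P n) (k + 1)) atTop (𝓝 (lap ρ (k + 1)))

lemma lap_one (P : Measure ℝ) : lap P 1 = ∫ x, Real.exp (-x) ∂P := by simp [lap]

lemma exp_neg_mem_Icc {x : ℝ} (hx : 0 ≤ x) : Real.exp (-x) ∈ Icc (0 : ℝ) 1 :=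
  ⟨(Real.exp_pos _).le, Real.exp_le_one_iff.2 (by linarith)⟩

lemma exists_bound_on_Icc {g : ℝ → ℝ} (hg : Continuous g) : ∃ G, 0 ≤ G ∧ ∀ w ∈ Icc (0 : ℝ) 1, |g w| ≤ G := by
  obtain ⟨G, hG⟩ := isCompact_Icc.exists_bound_of_continuousOn (hg.continuousOn (s := Icc (0 : ℝ) 1))
  exact ⟨G, (norm_nonneg _).trans (hG 0 (by simp)), hG⟩

lemma integrable_exp_mul {m : Measure ℝ} (hs : m (Ici 0)ᶜ = 0)
    (hi : Integrable (fun x => Real.exp (-x)) m) {g : ℝ → ℝ} (hg : Continuous g) :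
    Integrable (fun x => Real.exp (-x) * g (Real.exp (-x))) m := by
  obtain ⟨G, hG0, hG⟩ := exists_bound_on_Icc hg
  refine (hi.mul_const G).mono' (by fun_prop) ?_
  have : ∀ᵐ x ∂m, x ∈ Ici (0 : ℝ) := hs
  filter_upwards [this] with x hx
  rw [norm_mul, Real.norm_of_nonneg (Real.exp_pos _).le]
  exact mul_le_mul_of_nonneg_left (hG _ (exp_neg_mem_Icc hx)) (Real.exp_pos _).le

lemma abs_integral_exp_sub_le {m : Measure ℝ} (hs : m (Ici 0)ᶜ = 0)
    (hi : Integrable (fun x => Real.exp (-x)) m) {g p : ℝ → ℝ} (hg : Continuous g)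
    (hp : Continuous p) {ε : ℝ} (h : ∀ w ∈ Icc (0 : ℝ) 1, |p w - g w| ≤ ε) :
    |∫ x, Real.exp (-x) * p (Real.exp (-x)) ∂m - ∫ x, Real.exp (-x) * g (Real.exp (-x)) ∂m| ≤
      ε * lap m 1 := by
  rw [← integral_sub (integrable_exp_mul hs hi hp) (integrable_exp_mul hs hi hg), lap_one,
    ← integral_const_mul]
  rw [← Real.norm_eq_abs]
  refine norm_integral_le_of_norm_le (hi.const_mul ε) ?_
  have : ∀ᵐ x ∂m, x ∈ Ici (0 : ℝ) := hs
  filter_upwards [this] with x hx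
  rw [← mul_sub, norm_mul, Real.norm_of_nonneg (Real.exp_pos _).le, mul_comm]
  exact mul_le_mul_of_nonneg_right (h _ (exp_neg_mem_Icc hx)) (Real.exp_pos _).le

lemma integral_exp_polynomial {m : Measure ℝ} (hs : m (Ici 0)ᶜ = 0)
    (hi : Integrable (fun x => Real.exp (-x)) m) (p : Polynomial ℝ) :
    ∫ x, Real.exp (-x) * p.eval (Real.exp (-x)) ∂m =
      ∑ k ∈ Finset.range (p.natDegree + 1), p.coeff k * lap m (k + 1) := by
  have e : ∀ x : ℝ, Real.exp (-x) * p.eval (Real.exp (-x)) =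
      ∑ k ∈ Finset.range (p.natDegree + 1), p.coeff k * (Real.exp (-x) * Real.exp (-x) ^ k) := fun x => by
    rw [Polynomial.eval_eq_sum_range, Finset.mul_sum]
    exact Finset.sum_congr rfl fun k _ => by ring
  simp_rw [e]
  rw [integral_finsetSum]
  · refine Finset.sum_congr rfl fun k _ => ?_
    rw [integral_const_mul, lap]
    congr 1
    refine integral_congr_ae (.of_forall fun x => ?_)
    simp only
    rw [← Real.exp_nat_mul, ← Real.exp_add]
    ring_nf
  · intro k _
    exact (integrable_exp_mul hs hi (g := fun w => w ^ k) (by fun_prop)).const_mul _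

lemma LapConv.tendsto {a : ℕ → ℝ} {P : ℕ → Measure ℝ} {ρ : Measure ℝ} (h : LapConv a P ρ)
    {g : ℝ → ℝ} (hg : Continuous g) :
    Tendsto (fun n => a n * ∫ x, Real.exp (-x) * g (Real.exp (-x)) ∂P n) atTop
      (𝓝 (∫ x, Real.exp (-x) * g (Real.exp (-x)) ∂ρ)) := by
  have hε : ∀ k : ℕ, (0 : ℝ) < 1 / ((k : ℝ) + 1) := fun k => by positivity
  choose p hp using fun k : ℕ => exists_polynomial_near_of_continuousOn 0 1 g hg.continuousOn _ (hε k)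
  have hp' : ∀ k, ∀ w ∈ Icc (0 : ℝ) 1, |(p k).eval w - g w| ≤ 1 / ((k : ℝ) + 1) :=
    fun k w hw => (hp k w hw).le
  have hpoly : ∀ k, Tendsto (fun n => a n * ∫ x, Real.exp (-x) * (p k).eval (Real.exp (-x)) ∂P n)
      atTop (𝓝 (∫ x, Real.exp (-x) * (p k).eval (Real.exp (-x)) ∂ρ)) := fun k => by
    rw [integral_exp_polynomial h.supp_lim h.int_lim]
    simp_rw [fun n => integral_exp_polynomial (h.supp n) (h.int n) (p k), Finset.mul_sum]
    refine tendsto_finsetSum _ fun i _ => ?_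
    refine ((h.lim i).const_mul ((p k).coeff i)).congr fun n => by ring
  have hl1 : Tendsto (fun n => a n * lap (P n) 1) atTop (𝓝 (lap ρ 1)) := by
    simpa using h.lim 0
  have hz : Tendsto (fun k : ℕ => 1 / ((k : ℝ) + 1) * lap ρ 1) atTop (𝓝 (0 * lap ρ 1)) :=
    tendsto_one_div_add_atTop_nhds_zero_nat.mul_const _
  rw [zero_mul] at hz
  have hconv : Tendsto (fun k => ∫ x, Real.exp (-x) * (p k).eval (Real.exp (-x)) ∂ρ) atTop
      (𝓝 (∫ x, Real.exp (-x) * g (Real.exp (-x)) ∂ρ)) := by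
    rw [tendsto_iff_norm_sub_tendsto_zero]
    refine squeeze_zero (fun _ => norm_nonneg _) (fun k => ?_) hz
    exact abs_integral_exp_sub_le h.supp_lim h.int_lim hg (p k).continuous (hp' k)
  have habs : ∀ k n, |a n * ∫ x, Real.exp (-x) * (p k).eval (Real.exp (-x)) ∂P n -
      a n * ∫ x, Real.exp (-x) * g (Real.exp (-x)) ∂P n| ≤
      1 / ((k : ℝ) + 1) * (a n * lap (P n) 1) := fun k n => by
    rw [← mul_sub, abs_mul, abs_of_nonneg (h.nonneg n), mul_left_comm]
    exact mul_le_mul_of_nonneg_left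
      (abs_integral_exp_sub_le (h.supp n) (h.int n) hg (p k).continuous (hp' k)) (h.nonneg n)
  refine tendsto_of_forall_le_tendsto
    (U := fun k n => a n * (∫ x, Real.exp (-x) * (p k).eval (Real.exp (-x)) ∂P n) +
      1 / ((k : ℝ) + 1) * (a n * lap (P n) 1))
    (L := fun k n => a n * (∫ x, Real.exp (-x) * (p k).eval (Real.exp (-x)) ∂P n) -
      1 / ((k : ℝ) + 1) * (a n * lap (P n) 1))
    (fun k => .of_forall fun n => ?_) (fun k => (hpoly k).add (hl1.const_mul _)) ?_
    (fun k => .of_forall fun n => ?_) (fun k => (hpoly k).sub (hl1.const_mul _)) ?_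
  · have := abs_le.1 (habs k n)
    linarith
  · simpa using hconv.add hz
  · have := abs_le.1 (habs k n)
    linarith
  · simpa using hconv.sub hz

/-- A continuous approximation of the indicator of a half-line. -/
def ramp (s : ℝ) : ℝ := min 1 (max 0 s)

lemma continuous_ramp : Continuous ramp := by unfold ramp; fun_prop

lemma ramp_nonneg (s : ℝ) : 0 ≤ ramp s := le_min zero_le_one (le_max_left _ _)

lemma ramp_le_one (s : ℝ) : ramp s ≤ 1 := min_le_left _ _

lemma ramp_eq_one {s : ℝ} (h : 1 ≤ s) : ramp s = 1 := by
  rw [ramp, max_eq_right (by linarith), min_eq_left h]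

lemma ramp_eq_zero {s : ℝ} (h : s ≤ 0) : ramp s = 0 := by
  rw [ramp, max_eq_left h, min_eq_right zero_le_one]

lemma tendsto_mul_natCast_sub {d : ℝ} (hd : d < 0) (c : ℝ) :
    ∀ᶠ k : ℕ in atTop, c + k * d ≤ 0 := by
  filter_upwards [tendsto_natCast_atTop_atTop.eventually_ge_atTop (c / -d)] with k hk
  rw [div_le_iff₀ (by linarith)] at hk
  linarith

lemma LapConv.tendsto_setIntegral {a : ℕ → ℝ} {P : ℕ → Measure ℝ} {ρ : Measure ℝ}
    (h : LapConv a P ρ) {g : ℝ → ℝ} (hg : Continuous g) (hg0 : ∀ w, 0 ≤ g w) {y₀ : ℝ}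
    (hρ : ρ {y₀} = 0) {A : Set ℝ} (hA : MeasurableSet A) (h1 : Ioi y₀ ⊆ A) (h2 : A ⊆ Ici y₀) :
    Tendsto (fun n => a n * ∫ x in A, Real.exp (-x) * g (Real.exp (-x)) ∂P n) atTop
      (𝓝 (∫ x in A, Real.exp (-x) * g (Real.exp (-x)) ∂ρ)) := by
  set w₀ := Real.exp (-y₀)
  have hind : ∀ m : Measure ℝ, ∫ x in A, Real.exp (-x) * g (Real.exp (-x)) ∂m =
      ∫ x, A.indicator (fun x => Real.exp (-x) * g (Real.exp (-x))) x ∂m := fun m =>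
    (integral_indicator hA).symm
  have hpos : ∀ x, 0 ≤ Real.exp (-x) * g (Real.exp (-x)) := fun x =>
    mul_nonneg (Real.exp_pos _).le (hg0 _)
  have hne : ∀ᵐ x ∂ρ, x ≠ y₀ := by
    rw [ae_iff]; simpa using hρ
  have hdct : ∀ φ : ℕ → ℝ → ℝ, (∀ k, Continuous (φ k)) → (∀ k w, 0 ≤ φ k w ∧ φ k w ≤ 1) →
      (∀ x, x ≠ y₀ → Tendsto (fun k => φ k (Real.exp (-x))) atTop (𝓝 (A.indicator 1 x))) →
      Tendsto (fun k => ∫ x, Real.exp (-x) * (g (Real.exp (-x)) * φ k (Real.exp (-x))) ∂ρ) atTop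
        (𝓝 (∫ x in A, Real.exp (-x) * g (Real.exp (-x)) ∂ρ)) := fun φ hφ hb hlim => by
    rw [hind]
    refine tendsto_integral_of_dominated_convergence
      (fun x => Real.exp (-x) * g (Real.exp (-x)))
      (fun k => ?_) (integrable_exp_mul h.supp_lim h.int_lim hg)
      (fun k => .of_forall fun x => ?_) ?_
    · have := hφ k
      fun_prop
    · rw [← mul_assoc, norm_mul, Real.norm_of_nonneg (hpos x), Real.norm_of_nonneg (hb k _).1]
      exact mul_le_of_le_one_right (hpos x) (hb k _).2
    · filter_upwards [hne] with x hx
      have := (hlim x hx).const_mul (Real.exp (-x) * g (Real.exp (-x)))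
      simp_rw [← mul_assoc]
      convert this using 2
      by_cases hxA : x ∈ A <;> simp [hxA]
  have hcU : ∀ k : ℕ, Continuous fun w => ramp (1 + k * (w₀ - w)) := fun k =>
    continuous_ramp.comp (by fun_prop)
  have hcL : ∀ k : ℕ, Continuous fun w => ramp (k * (w₀ - w)) := fun k =>
    continuous_ramp.comp (by fun_prop)
  have hcase : ∀ x, x ≠ y₀ → (x ∈ A ∧ Real.exp (-x) < w₀) ∨ (x ∉ A ∧ w₀ < Real.exp (-x)) := by
    intro x hx
    rcases lt_or_gt_of_ne hx with hlt | hlt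
    · exact .inr ⟨fun hxA => absurd (h2 hxA) (not_le.2 hlt), Real.exp_lt_exp.2 (by linarith)⟩
    · exact .inl ⟨h1 hlt, Real.exp_lt_exp.2 (by linarith)⟩
  refine tendsto_of_forall_le_tendsto
    (U := fun k n => a n * ∫ x, Real.exp (-x) *
      (g (Real.exp (-x)) * ramp (1 + k * (w₀ - Real.exp (-x)))) ∂P n)
    (L := fun k n => a n * ∫ x, Real.exp (-x) *
      (g (Real.exp (-x)) * ramp (k * (w₀ - Real.exp (-x)))) ∂P n)
    (fun k => .of_forall fun n => ?_)
    (fun k => h.tendsto (g := fun w => g w * ramp (1 + k * (w₀ - w))) (hg.mul (hcU k)))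
    (hdct (fun k w => ramp (1 + k * (w₀ - w))) hcU
      (fun k w => ⟨ramp_nonneg _, ramp_le_one _⟩) fun x hx => ?_)
    (fun k => .of_forall fun n => ?_)
    (fun k => h.tendsto (g := fun w => g w * ramp (k * (w₀ - w))) (hg.mul (hcL k)))
    (hdct (fun k w => ramp (k * (w₀ - w))) hcL
      (fun k w => ⟨ramp_nonneg _, ramp_le_one _⟩) fun x hx => ?_)
  · refine mul_le_mul_of_nonneg_left ?_ (h.nonneg n)
    rw [hind]
    refine integral_mono ((integrable_exp_mul (h.supp n) (h.int n) hg).indicator hA)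
      (integrable_exp_mul (h.supp n) (h.int n) (hg.mul (hcU k))) fun x => ?_
    by_cases hx : x ∈ A
    · have : (1 : ℝ) ≤ 1 + k * (w₀ - Real.exp (-x)) := by
        have : Real.exp (-x) ≤ w₀ := Real.exp_le_exp.2 (by linarith [mem_Ici.1 (h2 hx)])
        have := mul_nonneg (Nat.cast_nonneg k : (0 : ℝ) ≤ k) (sub_nonneg.2 this)
        linarith
      simp [hx, ramp_eq_one this]
    · simp only [hx, not_false_eq_true, indicator_of_notMem]
      rw [← mul_assoc]
      exact mul_nonneg (hpos x) (ramp_nonneg _)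
  · rcases hcase x hx with ⟨h3, h4⟩ | ⟨h3, h4⟩
    · have : ∀ k : ℕ, ramp (1 + k * (w₀ - Real.exp (-x))) = 1 := fun k => ramp_eq_one (by
        have := mul_nonneg (Nat.cast_nonneg k : (0 : ℝ) ≤ k) (sub_nonneg.2 h4.le)
        linarith)
      simp [h3, this]
    · simp only [h3, not_false_eq_true, indicator_of_notMem]
      refine tendsto_const_nhds.congr' ?_
      filter_upwards [tendsto_mul_natCast_sub (sub_neg.2 h4) 1] with k hk
      exact (ramp_eq_zero hk).symm
  · refine mul_le_mul_of_nonneg_left ?_ (h.nonneg n)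
    rw [hind]
    refine integral_mono (integrable_exp_mul (h.supp n) (h.int n) (hg.mul (hcL k)))
      ((integrable_exp_mul (h.supp n) (h.int n) hg).indicator hA) fun x => ?_
    by_cases hx : x ∈ A
    · simp only [hx, indicator_of_mem]
      rw [← mul_assoc]
      exact mul_le_of_le_one_right (hpos x) (ramp_le_one _)
    · have : (k : ℝ) * (w₀ - Real.exp (-x)) ≤ 0 := by
        have hxy : x ≤ y₀ := not_lt.1 fun hlt => hx (h1 hlt)
        have : w₀ ≤ Real.exp (-x) := Real.exp_le_exp.2 (by linarith)
        exact mul_nonpos_of_nonneg_of_nonpos (Nat.cast_nonneg k) (by linarith)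
      simp [hx, ramp_eq_zero this]
  · rcases hcase x hx with ⟨h3, h4⟩ | ⟨h3, h4⟩
    · simp only [h3, indicator_of_mem, Pi.one_apply]
      refine tendsto_const_nhds.congr' ?_
      filter_upwards [tendsto_mul_natCast_sub (sub_neg.2 h4 : Real.exp (-x) - w₀ < 0) 1] with k hk
      exact (ramp_eq_one (by linarith)).symm
    · have : ∀ k : ℕ, ramp (k * (w₀ - Real.exp (-x))) = 0 := fun k => ramp_eq_zero
        (mul_nonpos_of_nonneg_of_nonpos (Nat.cast_nonneg k) (by linarith))
      simp [h3, this]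

/-! ### Renewal measures -/

/-- A measurable choice, for each `x`, of one of the two half-lines ending at `x`. -/
structure HalfLines (I : ℝ → Set ℝ) : Prop where
  meas : MeasurableSet {p : ℝ × ℝ | p.2 ∈ I p.1}
  lo : ∀ x, Iio x ⊆ I x
  hi : ∀ x, I x ⊆ Iic x

lemma halfLines_Iic : HalfLines Iic :=
  ⟨measurableSet_le measurable_snd measurable_fst, fun _ => Iio_subset_Iic_self, fun _ => subset_rfl⟩

lemma halfLines_Iio : HalfLines Iio :=
  ⟨measurableSet_lt measurable_snd measurable_fst, fun _ => subset_rfl, fun _ => Iio_subset_Iic_self⟩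

/-- The renewal function, with values in `[0, ∞]`. -/
def renE (P : ℕ → Measure ℝ) (I : ℝ → Set ℝ) (x : ℝ) : ENNReal := ∑' k, P k (I x)

/-- The renewal function. -/
def ren (P : ℕ → Measure ℝ) (I : ℝ → Set ℝ) (x : ℝ) : ℝ := ∑' k, (P k).real (I x)

/-- The measure on `(0, ∞)` whose density is the renewal function. -/
def renMeas (P : ℕ → Measure ℝ) (I : ℝ → Set ℝ) : Measure ℝ :=
  (volume.restrict (Ioi 0)).withDensity (renE P I)

section Renewal

variable {P : ℕ → Measure ℝ} {I : ℝ → Set ℝ} {c : ℝ}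

lemma HalfLines.measurableSet (hI : HalfLines I) (x : ℝ) : MeasurableSet (I x) :=
  measurable_prodMk_left (x := x) hI.meas

lemma measurable_renE (hI : HalfLines I) (hf : ∀ n, IsFiniteMeasure (P n)) :
    Measurable (renE P I) := by
  unfold renE
  refine Measurable.tsum fun k => ?_
  have := hf k
  exact measurable_measure_prodMk_left hI.meas

lemma ren_eq_toReal (hf : ∀ n, IsFiniteMeasure (P n)) (x : ℝ) : ren P I x = (renE P I x).toReal := by
  rw [ren, renE, ENNReal.tsum_toReal_eq fun k => by have := hf k; exact measure_ne_top _ _]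
  rfl

lemma measurable_ren (hI : HalfLines I) (hf : ∀ n, IsFiniteMeasure (P n)) :
    Measurable (ren P I) := by
  rw [funext (ren_eq_toReal (I := I) hf)]
  exact (measurable_renE hI hf).ennreal_toReal

lemma ren_nonneg (x : ℝ) : 0 ≤ ren P I x := tsum_nonneg fun _ => measureReal_nonneg

lemma LadderSeq.summable_lap (h : LadderSeq P c) {θ : ℝ} (hθ : 0 < θ) :
    Summable fun n => lap (P n) θ :=
  summable_abs_iff.1 (h.lim θ hθ).summable

lemma LadderSeq.real_le (h : LadderSeq P c) (hI : HalfLines I) {θ : ℝ} (hθ : 0 < θ) (x : ℝ) (n : ℕ) :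
    (P n).real (I x) ≤ Real.exp (θ * x) * lap (P n) θ := by
  have := h.fin n
  rw [← integral_indicator_one (hI.measurableSet x), lap, ← integral_const_mul]
  refine integral_mono ((integrable_const (1 : ℝ)).indicator (hI.measurableSet x))
    ((integrable_exp_of_compl (h.supp n) hθ.le).const_mul _) fun y => ?_
  by_cases hy : y ∈ I x
  · simp only [hy, indicator_of_mem, Pi.one_apply]
    rw [← Real.exp_add, Real.one_le_exp_iff]
    have := mul_le_mul_of_nonneg_left (hI.hi x hy) hθ.le
    linarith
  · simp only [hy, not_false_eq_true, indicator_of_notMem]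
    positivity

lemma LadderSeq.summable_real (h : LadderSeq P c) (hI : HalfLines I) (x : ℝ) :
    Summable fun n => (P n).real (I x) :=
  Summable.of_nonneg_of_le (fun _ => measureReal_nonneg) (h.real_le hI one_pos x)
    ((h.summable_lap one_pos).mul_left _)

lemma LadderSeq.ren_le (h : LadderSeq P c) (hI : HalfLines I) {θ : ℝ} (hθ : 0 < θ) (x : ℝ) :
    ren P I x ≤ Real.exp (θ * x) * ∑' n, lap (P n) θ := by
  rw [ren, ← tsum_mul_left]
  exact (h.summable_real hI x).tsum_le_tsum (h.real_le hI hθ x) ((h.summable_lap hθ).mul_left _)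

lemma LadderSeq.renE_eq (h : LadderSeq P c) (hI : HalfLines I) (x : ℝ) :
    renE P I x = ENNReal.ofReal (ren P I x) := by
  rw [ren, ENNReal.ofReal_tsum_of_nonneg (fun _ => measureReal_nonneg) (h.summable_real hI x), renE]
  refine tsum_congr fun k => ?_
  have := h.fin k
  simp

lemma lintegral_renMeas (hI : HalfLines I) (hf : ∀ n, IsFiniteMeasure (P n))
    (hs : ∀ n, P n (Ici 0)ᶜ = 0) {φ : ℝ → ENNReal} (hφ : Measurable φ) :
    ∫⁻ y, φ y ∂renMeas P I = ∑' k, ∫⁻ z, (∫⁻ y in Ioi z, φ y) ∂P k := by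
  rw [renMeas, lintegral_withDensity_eq_lintegral_mul _ (measurable_renE hI hf) hφ]
  simp only [Pi.mul_apply, renE]
  simp_rw [← ENNReal.tsum_mul_right]
  rw [lintegral_tsum]
  · refine tsum_congr fun k => ?_
    have := hf k
    have e : ∀ y, P k (I y) * φ y =
        ∫⁻ z, {p : ℝ × ℝ | p.2 ∈ I p.1}.indicator (fun p => φ p.1) (y, z) ∂P k := fun y => by
      have : ∀ z, {p : ℝ × ℝ | p.2 ∈ I p.1}.indicator (fun p => φ p.1) (y, z) =
          (I y).indicator (fun _ => φ y) z := fun z => by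
        simp only [indicator]; rfl
      simp_rw [this]
      rw [lintegral_indicator (hI.measurableSet y), lintegral_const, Measure.restrict_apply_univ,
        mul_comm]
    simp_rw [e]
    rw [lintegral_lintegral_swap]
    · have hae : ∀ᵐ z ∂P k, z ∈ Ici (0 : ℝ) := hs k
      refine lintegral_congr_ae ?_
      filter_upwards [hae] with z hz
      have h2 : ∀ᵐ y : ℝ ∂volume, y ≠ z := by
        rw [ae_iff]; simp
      rw [← lintegral_indicator measurableSet_Ioi, ← lintegral_indicator measurableSet_Ioi]
      refine lintegral_congr_ae ?_
      filter_upwards [h2] with y hy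
      rcases lt_or_gt_of_ne hy with hlt | hlt
      · have : z ∉ I y := fun hz' => absurd (hI.hi y hz') (not_le.2 hlt)
        simp [indicator, this, hlt.le]
      · have h3 : z ∈ I y := hI.lo y hlt
        have h4 : 0 < y := lt_of_le_of_lt hz hlt
        simp only [indicator, mem_Ioi, h4, if_true, hlt]
        exact if_pos h3
    · exact ((hφ.comp measurable_fst).indicator hI.meas).aemeasurable
  · intro k
    have := hf k
    exact ((measurable_measure_prodMk_left hI.meas).mul hφ).aemeasurable

lemma lintegral_exp_Ioi {θ : ℝ} (hθ : 0 < θ) (z : ℝ) :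
    ∫⁻ y in Ioi z, ENNReal.ofReal (Real.exp (-θ * y)) = ENNReal.ofReal (Real.exp (-θ * z) / θ) := by
  rw [← ofReal_integral_eq_lintegral_ofReal]
  · rw [integral_exp_mul_Ioi (by linarith)]
    congr 1
    rw [neg_div, div_neg, neg_neg]
  · exact integrableOn_exp_mul_Ioi (by linarith) z
  · exact .of_forall fun _ => (Real.exp_pos _).le

lemma LadderSeq.lintegral_exp_renMeas (h : LadderSeq P c) (hI : HalfLines I) {θ : ℝ} (hθ : 0 < θ) :
    ∫⁻ y, ENNReal.ofReal (Real.exp (-θ * y)) ∂renMeas P I =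
      ENNReal.ofReal (1 / θ * ∑' n, lap (P n) θ) := by
  rw [lintegral_renMeas hI h.fin h.supp (by fun_prop), ← tsum_mul_left,
    ENNReal.ofReal_tsum_of_nonneg (fun n => mul_nonneg (by positivity) (lap_nonneg _ _))
      ((h.summable_lap hθ).mul_left _)]
  refine tsum_congr fun k => ?_
  have := h.fin k
  simp_rw [lintegral_exp_Ioi hθ]
  rw [← ofReal_integral_eq_lintegral_ofReal
    ((integrable_exp_of_compl (h.supp k) hθ.le).div_const θ) (.of_forall fun x => by positivity),
    integral_div, lap]
  congr 1
  ring

lemma LadderSeq.lap_renMeas (h : LadderSeq P c) (hI : HalfLines I) {θ : ℝ} (hθ : 0 < θ) :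
    lap (renMeas P I) θ = 1 / θ * ∑' n, lap (P n) θ := by
  rw [lap, integral_eq_lintegral_of_nonneg_ae (.of_forall fun _ => (Real.exp_pos _).le)
    (by fun_prop), h.lintegral_exp_renMeas hI hθ, ENNReal.toReal_ofReal]
  exact mul_nonneg (by positivity) (tsum_nonneg fun n => lap_nonneg _ _)

lemma LadderSeq.integrable_renMeas (h : LadderSeq P c) (hI : HalfLines I) {θ : ℝ} (hθ : 0 < θ) :
    Integrable (fun x => Real.exp (-θ * x)) (renMeas P I) := by
  refine ⟨by fun_prop, ?_⟩
  rw [hasFiniteIntegral_iff_ofReal (.of_forall fun _ => (Real.exp_pos _).le),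
    h.lintegral_exp_renMeas hI hθ]
  exact ENNReal.ofReal_lt_top

lemma renMeas_compl : renMeas P I (Ici 0)ᶜ = 0 := by
  refine withDensity_absolutelyContinuous _ _ ?_
  rw [Measure.restrict_apply measurableSet_Ici.compl]
  convert measure_empty (μ := (volume : Measure ℝ))
  ext x
  simp only [compl_Ici, mem_inter_iff, mem_Iio, mem_Ioi, mem_empty_iff_false, iff_false]
  exact fun h => lt_asymm h.1 h.2

lemma renMeas_singleton (y : ℝ) : renMeas P I {y} = 0 := by
  refine withDensity_absolutelyContinuous _ _ ?_
  exact le_antisymm ((Measure.restrict_apply_le _ _).trans (by simp)) bot_le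

lemma LadderSeq.one_le_tsum_lap (h : LadderSeq P c) {θ : ℝ} (hθ : 0 < θ) :
    1 ≤ ∑' n, lap (P n) θ := by
  have := (h.summable_lap hθ).le_tsum 0 fun n _ => lap_nonneg _ _
  simpa [h.zero, lap_dirac] using this

lemma LadderSeq.const_nonneg (h : LadderSeq P c) : 0 ≤ c := by
  have h1 := h.lim 1 one_pos
  have h2 : 0 ≤ c / 1 * ∑' n, lap (P n) 1 :=
    ge_of_tendsto' h1 fun n => mul_nonneg (by positivity) (lap_nonneg _ _)
  rw [div_one] at h2
  exact nonneg_of_mul_nonneg_left h2 (lt_of_lt_of_le one_pos (h.one_le_tsum_lap one_pos))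

lemma lap_smul (r : ℝ) (hr : 0 ≤ r) (m : Measure ℝ) (θ : ℝ) :
    lap (ENNReal.ofReal r • m) θ = r * lap m θ := by
  rw [lap, integral_smul_measure, ENNReal.toReal_ofReal hr, smul_eq_mul]; rfl

lemma LadderSeq.lapConv (h : LadderSeq P c) (hI : HalfLines I) :
    LapConv (fun n => ((n : ℝ) + 1) ^ (3 / 2 : ℝ)) P (ENNReal.ofReal c • renMeas P I) where
  nonneg n := by positivity
  supp := h.supp
  int n := by
    have := h.fin n
    simpa using integrable_exp_of_compl (h.supp n) zero_le_one
  supp_lim := by rw [Measure.smul_apply, renMeas_compl, smul_zero]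
  int_lim := by
    have := h.integrable_renMeas hI one_pos
    simp only [neg_mul, one_mul] at this
    exact this.smul_measure ENNReal.ofReal_ne_top
  lim k := by
    have hk : (0 : ℝ) < (k : ℝ) + 1 := by positivity
    have := h.lim _ hk
    rw [lap_smul _ h.const_nonneg, h.lap_renMeas hI hk]
    have e : c * (1 / ((k : ℝ) + 1) * ∑' n, lap (P n) (k + 1)) =
        c / ((k : ℝ) + 1) * ∑' n, lap (P n) (k + 1) := by ring
    rw [e]
    exact this

/-- The part of the renewal equation between levels `0` and `x`. -/
lemma LadderSeq.renewal_eq (h : LadderSeq P c) {θ : ℝ} (hθ : 0 < θ) (x : ℝ) :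
    (∑' n, ∫ y in Iic x, Real.exp (-θ * (x - y)) ∂P n) +
      θ * ∫ y in Iic x, Real.exp (-θ * (x - y)) ∂renMeas P Iic = ren P Iic x := by
  have hI := halfLines_Iic
  have hmeas : Measurable fun y => ENNReal.ofReal (Real.exp (-θ * (x - y))) := by fun_prop
  have hin : ∀ k, IntegrableOn (fun y => Real.exp (-θ * (x - y))) (Iic x) (P k) := fun k => by
    have := h.fin k
    refine (integrable_const (1 : ℝ)).mono' (by fun_prop) ?_
    filter_upwards [ae_restrict_mem measurableSet_Iic] with y hy
    rw [Real.norm_of_nonneg (Real.exp_pos _).le, Real.exp_le_one_iff]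
    have := mul_nonneg hθ.le (sub_nonneg.2 (mem_Iic.1 hy))
    linarith
  have hin' : ∀ k, 0 ≤ ∫ y in Iic x, Real.exp (-θ * (x - y)) ∂P k := fun k =>
    integral_nonneg fun _ => (Real.exp_pos _).le
  have hle : ∀ k, ∫ y in Iic x, Real.exp (-θ * (x - y)) ∂P k ≤ (P k).real (Iic x) := fun k => by
    have := h.fin k
    have h1 : ∫ y in Iic x, Real.exp (-θ * (x - y)) ∂P k ≤ ∫ _ in Iic x, (1 : ℝ) ∂P k := by
      refine setIntegral_mono_on (hin k) (integrable_const _) measurableSet_Iic fun y hy => ?_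
      rw [Real.exp_le_one_iff]
      have := mul_nonneg hθ.le (sub_nonneg.2 (mem_Iic.1 hy))
      linarith
    simpa [measureReal_restrict_apply] using h1
  have hsum : Summable fun k => ∫ y in Iic x, Real.exp (-θ * (x - y)) ∂P k :=
    Summable.of_nonneg_of_le hin' hle (h.summable_real hI x)
  have hval : ∀ k, ∫⁻ z, (∫⁻ y in Ioi z, (Iic x).indicator
      (fun y => ENNReal.ofReal (Real.exp (-θ * (x - y)))) y) ∂P k =
      ENNReal.ofReal (1 / θ * ((P k).real (Iic x) - ∫ y in Iic x, Real.exp (-θ * (x - y)) ∂P k)) := by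
    intro k
    have := h.fin k
    have e : ∀ z, (∫⁻ y in Ioi z, (Iic x).indicator
        (fun y => ENNReal.ofReal (Real.exp (-θ * (x - y)))) y) =
        (Iic x).indicator (fun z => ENNReal.ofReal (1 / θ * (1 - Real.exp (-θ * (x - z))))) z := by
      intro z
      rw [lintegral_indicator measurableSet_Iic, Measure.restrict_restrict measurableSet_Iic,
        inter_comm, Ioi_inter_Iic]
      by_cases hz : z ≤ x
      · rw [indicator_of_mem (mem_Iic.2 hz), ← ofReal_integral_eq_lintegral_ofReal
          (Continuous.integrableOn_Ioc (by fun_prop)) (.of_forall fun _ => (Real.exp_pos _).le),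
          ← intervalIntegral.integral_of_le hz]
        congr 1
        have hd : ∀ y ∈ uIcc z x, HasDerivAt (fun y => 1 / θ * Real.exp (-θ * (x - y)))
            (Real.exp (-θ * (x - y))) y := fun y _ => by
          have h1 : HasDerivAt (fun y => -θ * (x - y)) (-θ * (0 - 1)) y :=
            ((hasDerivAt_const y x).sub (hasDerivAt_id y)).const_mul _
          have e : Real.exp (-θ * (x - y)) =
              1 / θ * (Real.exp (-θ * (x - y)) * (-θ * (0 - 1))) := by
            rw [show -θ * (0 - 1) = θ by ring, mul_comm (Real.exp _) θ, ← mul_assoc, one_div,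
              inv_mul_cancel₀ hθ.ne', one_mul]
          have h2 := h1.exp.const_mul (1 / θ)
          rwa [← e] at h2
        rw [intervalIntegral.integral_eq_sub_of_hasDerivAt hd
          (Continuous.intervalIntegrable (by fun_prop) _ _)]
        simp
        ring
      · rw [indicator_of_notMem (by simpa using hz), Ioc_eq_empty (by
          intro h; exact hz h.le)]
        simp
    simp_rw [e]
    rw [lintegral_indicator measurableSet_Iic, ← ofReal_integral_eq_lintegral_ofReal]
    · congr 1
      rw [integral_const_mul, integral_sub (integrable_const _) (hin k)]
      simp [measureReal_restrict_apply]
    · exact ((integrable_const _).sub (hin k)).const_mul _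
    · filter_upwards [ae_restrict_mem measurableSet_Iic] with y hy
      refine mul_nonneg (by positivity) (sub_nonneg.2 ?_)
      rw [Real.exp_le_one_iff]
      have := mul_nonneg hθ.le (sub_nonneg.2 (mem_Iic.1 hy))
      linarith
  have key : ∫ y in Iic x, Real.exp (-θ * (x - y)) ∂renMeas P Iic =
      1 / θ * (ren P Iic x - ∑' k, ∫ y in Iic x, Real.exp (-θ * (x - y)) ∂P k) := by
    rw [integral_eq_lintegral_of_nonneg_ae (.of_forall fun _ => (Real.exp_pos _).le) (by fun_prop),
      ← lintegral_indicator measurableSet_Iic,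
      lintegral_renMeas hI h.fin h.supp (hmeas.indicator measurableSet_Iic)]
    simp_rw [hval]
    rw [← ENNReal.ofReal_tsum_of_nonneg, ENNReal.toReal_ofReal, tsum_mul_left,
      (h.summable_real hI x).tsum_sub hsum, ren]
    · exact tsum_nonneg fun k => mul_nonneg (by positivity) (sub_nonneg.2 (hle k))
    · exact fun k => mul_nonneg (by positivity) (sub_nonneg.2 (hle k))
    · exact ((h.summable_real hI x).sub hsum).mul_left _
  rw [key]
  field_simp
  ring

end Renewal

/-! ### The conditioned local limit theorem -/

/-- The laws of the walk killed when it leaves `[0, ∞)`. -/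
def upSeq (ν : Measure ℝ) : ℕ → Measure ℝ := killed ν (Ici 0) 0

/-- The laws of the reflected walk killed when it leaves `(0, ∞)`. -/
def downSeq (ν : Measure ℝ) : ℕ → Measure ℝ := killed (ν.map Neg.neg) (Ioi 0) 0

/-- The Laplace transform at `θ` of the law of the walk started at `x` at the time of the `n`-th
strict descent, restricted to nonnegative positions. -/
def descentLap (ν : Measure ℝ) (θ x : ℝ) (n : ℕ) : ℝ :=
  ∫ y in Iic x, Real.exp (-θ * (x - y)) ∂downSeq ν n

lemma descentLap_nonneg (ν : Measure ℝ) (θ x : ℝ) (n : ℕ) : 0 ≤ descentLap ν θ x n :=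
  integral_nonneg fun _ => (Real.exp_pos _).le

lemma lap_descent (ν : Measure ℝ) [IsFiniteMeasure ν] (θ x : ℝ) (n : ℕ) :
    lap ((Measure.conv (Measure.dirac x) (killed ν (Iio 0) 0 n)).restrict (Ici 0)) θ =
      descentLap ν θ x n := by
  rw [lap, Measure.dirac_conv, killed_Iio_neg, Measure.map_map (by fun_prop) measurable_neg,
    Measure.restrict_map (by fun_prop) measurableSet_Ici,
    integral_map (by fun_prop) (by fun_prop), descentLap]
  have e : ((fun y => x + y) ∘ Neg.neg) ⁻¹' Ici 0 = Iic x := by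
    ext y
    simp
  rw [e]
  rfl

lemma lap_killed (ν : Measure ℝ) [IsFiniteMeasure ν] {θ x : ℝ} (hθ : 0 < θ) (hx : 0 ≤ x) (n : ℕ) :
    lap (killed ν (Ici 0) x n) θ = ∑ p ∈ Finset.HasAntidiagonal.antidiagonal n,
      descentLap ν θ x p.1 * lap (upSeq ν p.2) θ := by
  rw [killed_pos_eq_sum ν hx, lap, integral_finsetSum_measure]
  · refine Finset.sum_congr rfl fun p _ => ?_
    rw [← lap_descent, upSeq, ← lap_conv]
    rfl
  · intro p _
    refine integrable_exp_of_compl ?_ hθ.le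
    exact conv_compl_eq_zero measurableSet_Ici (fun x hx y hy => add_mem_Ici hx hy) _ _
      (restrict_compl_self measurableSet_Ici _) (killed_compl ν measurableSet_Ici (by simp) _)

section ConditionedLimit

variable {ν : Measure ℝ} {σ : ℝ}

lemma LadderSeq.descent_le {c θ δ : ℝ} (h : LadderSeq (downSeq ν) c) (hθ : 0 < θ) (hδ : 0 < δ)
    (x : ℝ) (n : ℕ) : descentLap ν θ x n ≤ Real.exp (δ * x) * lap (downSeq ν n) δ := by
  have := h.fin n
  have hi := (integrable_exp_of_compl (h.supp n) hδ.le).const_mul (Real.exp (δ * x))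
  have hle : ∀ y ∈ Iic x, Real.exp (-θ * (x - y)) ≤ Real.exp (δ * x) * Real.exp (-δ * y) := by
    intro y hy
    rw [← Real.exp_add, Real.exp_le_exp]
    have h1 := mul_nonneg hθ.le (sub_nonneg.2 (mem_Iic.1 hy))
    have h2 := mul_nonneg hδ.le (sub_nonneg.2 (mem_Iic.1 hy))
    linarith
  calc descentLap ν θ x n ≤ ∫ y in Iic x, Real.exp (δ * x) * Real.exp (-δ * y) ∂downSeq ν n := by
        refine setIntegral_mono_on (hi.integrableOn.mono' (by fun_prop) ?_) hi.integrableOn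
          measurableSet_Iic hle
        filter_upwards [ae_restrict_mem measurableSet_Iic] with y hy
        rw [Real.norm_of_nonneg (Real.exp_pos _).le]
        exact hle y hy
    _ ≤ ∫ y, Real.exp (δ * x) * Real.exp (-δ * y) ∂downSeq ν n :=
        setIntegral_le_integral hi (.of_forall fun y => by positivity)
    _ = _ := by rw [integral_const_mul, lap]

lemma IsStep.lap_killed_le (h : IsStep ν σ) {θ δ : ℝ} (hθ : 0 < θ) (hδ : 0 < δ) :
    ∃ C, 0 ≤ C ∧ ∀ x, 0 ≤ x → ∀ n,
      lap (killed ν (Ici 0) x n) θ ≤ C * Real.exp (δ * x) * wt n := by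
  have := h.prob
  have hQ : LadderSeq (downSeq ν) (lltConst σ) := h.ladderSeq_neg
  have hp : LadderSeq (upSeq ν) (lltConst σ) := h.ladderSeq_pos
  obtain ⟨C, hC⟩ := hQ.bound δ hδ
  obtain ⟨D, hD⟩ := hp.bound θ hθ
  have hC0 : 0 ≤ C := nonneg_of_mul_nonneg_left ((lap_nonneg _ _).trans (hC 0)) (wt_pos 0)
  have hD0 : 0 ≤ D := nonneg_of_mul_nonneg_left ((lap_nonneg _ _).trans (hD 0)) (wt_pos 0)
  refine ⟨wtConst * C * D, mul_nonneg (mul_nonneg wtConst_nonneg hC0) hD0, fun x hx n => ?_⟩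
  rw [lap_killed ν hθ hx]
  refine (sum_conv_le (C := Real.exp (δ * x) * C) (D := D) (fun n => descentLap_nonneg ν θ x n)
    (fun n => lap_nonneg _ _) (fun n => ?_) hD n).trans (le_of_eq (by ring))
  refine (hQ.descent_le hθ hδ x n).trans ?_
  rw [mul_assoc]
  exact mul_le_mul_of_nonneg_left (hC n) (Real.exp_pos _).le

lemma IsStep.decayTo_descent (h : IsStep ν σ) (θ x : ℝ) :
    DecayTo (3 / 2) (descentLap ν θ x)
      (lltConst σ * ∫ y in Iic x, Real.exp (-θ * (x - y)) ∂renMeas (downSeq ν) Iic) := by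
  have hQ : LadderSeq (downSeq ν) (lltConst σ) := h.ladderSeq_neg
  have hL := hQ.lapConv halfLines_Iic
  set g : ℝ → ℝ := fun w => Real.exp (-θ * x) * max w (Real.exp (-x)) ^ (-θ - 1)
  have hg : Continuous g := by
    refine continuous_const.mul (Continuous.rpow_const (by fun_prop) fun w => .inl ?_)
    exact (lt_max_of_lt_right (Real.exp_pos _)).ne'
  have hg0 : ∀ w, 0 ≤ g w := fun w => mul_nonneg (Real.exp_pos _).le
    (Real.rpow_nonneg (le_max_of_le_right (Real.exp_pos _).le) _)
  have hge : ∀ y ∈ Iic x, Real.exp (-y) * g (Real.exp (-y)) = Real.exp (-θ * (x - y)) := by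
    intro y hy
    simp only [g]
    rw [max_eq_left (Real.exp_le_exp.2 (neg_le_neg hy)), ← Real.exp_mul, ← Real.exp_add,
      ← Real.exp_add]
    ring_nf
  have hsplit : ∀ m : Measure ℝ, m (Ici 0)ᶜ = 0 → Integrable (fun x => Real.exp (-x)) m →
      ∫ y in Iic x, Real.exp (-θ * (x - y)) ∂m = ∫ y, Real.exp (-y) * g (Real.exp (-y)) ∂m -
        ∫ y in Ioi x, Real.exp (-y) * g (Real.exp (-y)) ∂m := fun m hm hi => by
    rw [← setIntegral_congr_fun measurableSet_Iic hge,
      ← integral_add_compl measurableSet_Iic (integrable_exp_mul hm hi hg), compl_Iic]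
    ring
  have h1 := hL.tendsto hg
  have h2 := hL.tendsto_setIntegral hg hg0 (y₀ := x)
    (by rw [Measure.smul_apply, renMeas_singleton, smul_zero]) measurableSet_Ioi subset_rfl
    Ioi_subset_Ici_self
  have h3 := h1.sub h2
  have e : lltConst σ * ∫ y in Iic x, Real.exp (-θ * (x - y)) ∂renMeas (downSeq ν) Iic =
      ∫ y in Iic x, Real.exp (-θ * (x - y)) ∂(ENNReal.ofReal (lltConst σ) • renMeas (downSeq ν) Iic) := by
    rw [Measure.restrict_smul, integral_smul_measure, ENNReal.toReal_ofReal hQ.const_nonneg,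
      smul_eq_mul]
  rw [DecayTo, e, hsplit _ hL.supp_lim hL.int_lim]
  refine h3.congr fun n => ?_
  rw [descentLap, hsplit _ (hL.supp n) (hL.int n)]
  ring

/-- The conditioned local limit theorem: weak limits of the killed walk started at `x`. -/
lemma IsStep.lapConv_killed (h : IsStep ν σ) {x : ℝ} (hx : 0 ≤ x) :
    LapConv (fun n => ((n : ℝ) + 1) ^ (3 / 2 : ℝ)) (killed ν (Ici 0) x)
      (ENNReal.ofReal (lltConst σ * ren (downSeq ν) Iic x) • renMeas (upSeq ν) Iio) := by
  have := h.prob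
  have hQ : LadderSeq (downSeq ν) (lltConst σ) := h.ladderSeq_neg
  have hp : LadderSeq (upSeq ν) (lltConst σ) := h.ladderSeq_pos
  have hsupp : ∀ n, killed ν (Ici 0) x n (Ici 0)ᶜ = 0 := fun n =>
    killed_compl ν measurableSet_Ici (mem_Ici.2 hx) n
  exact
  { nonneg := fun n => by positivity
    supp := hsupp
    int := fun n => by simpa using integrable_exp_of_compl (hsupp n) zero_le_one
    supp_lim := by rw [Measure.smul_apply, renMeas_compl, smul_zero]
    int_lim := by
      have := hp.integrable_renMeas halfLines_Iio one_pos
      simp only [neg_mul, one_mul] at this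
      exact this.smul_measure ENNReal.ofReal_ne_top
    lim := fun k => by
      have hk : (0 : ℝ) < (k : ℝ) + 1 := by positivity
      have h1 := (h.decayTo_descent ((k : ℝ) + 1) x).conv (hp.lim _ hk)
      rw [lap_smul _ (mul_nonneg hp.const_nonneg (ren_nonneg _)), hp.lap_renMeas halfLines_Iio hk]
      have h2 := hQ.renewal_eq hk x
      have e : lltConst σ * ren (downSeq ν) Iic x * (1 / ((k : ℝ) + 1) * ∑' n, lap (upSeq ν n) (k + 1)) =
          lltConst σ / ((k : ℝ) + 1) * (∑' n, lap (upSeq ν n) (k + 1)) *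
            (∑' n, descentLap ν (k + 1) x n) +
          (lltConst σ * ∫ y in Iic x, Real.exp (-((k : ℝ) + 1) * (x - y)) ∂renMeas (downSeq ν) Iic) *
            ∑' n, lap (upSeq ν n) (k + 1) := by
        rw [← h2]
        unfold descentLap
        field_simp
      rw [e]
      refine h1.congr fun n => ?_
      rw [lap_killed ν hk hx] }

end ConditionedLimit

/-! ### Splicing i.i.d. sequences -/

section Splice

variable {E : Type*} [MeasurableSpace E]

/-- The law of an i.i.d. sequence with common law `L`. -/
abbrev seqLaw (L : Measure E) [IsProbabilityMeasure L] : Measure (ℕ → E) :=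
  Measure.infinitePi fun _ : ℕ => L

/-- The sequence taking the term `e i` from one of two sequences. -/
def splice (e : ℕ → ℕ ⊕ ℕ) (p : (ℕ → E) × (ℕ → E)) (i : ℕ) : E := Sum.elim p.1 p.2 (e i)

lemma measurable_sumElim (c : ℕ ⊕ ℕ) :
    Measurable fun p : (ℕ → E) × (ℕ → E) => (Sum.elim p.1 p.2 c : E) := by
  rcases c with i | i
  · exact (measurable_pi_apply i).comp measurable_fst
  · exact (measurable_pi_apply i).comp measurable_snd

lemma measurable_splice (e : ℕ → ℕ ⊕ ℕ) : Measurable (splice (E := E) e) :=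
  measurable_pi_iff.2 fun i => measurable_sumElim (e i)

lemma map_splice (L : Measure E) [IsProbabilityMeasure L] {e : ℕ → ℕ ⊕ ℕ}
    (he : Function.Injective e) :
    ((seqLaw L).prod (seqLaw L)).map (splice e) = seqLaw L := by
  have h1 : ((seqLaw L).prod (seqLaw L)).map (fun p (c : ℕ ⊕ ℕ) => (Sum.elim p.1 p.2 c : E))
      = Measure.infinitePi fun _ : ℕ ⊕ ℕ => L := by
    refine Measure.eq_infinitePi _ fun s A hA => ?_
    rw [Measure.map_apply (measurable_pi_iff.2 measurable_sumElim)
      (MeasurableSet.pi s.countable_toSet fun i _ => hA i)]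
    have h2 : (fun p (c : ℕ ⊕ ℕ) => (Sum.elim p.1 p.2 c : E)) ⁻¹' (Set.pi s A)
        = (Set.pi (s.toLeft : Set ℕ) fun i => A (.inl i)) ×ˢ
          (Set.pi (s.toRight : Set ℕ) fun i => A (.inr i)) := by
      ext p
      simp [Set.mem_pi]
    rw [h2, Measure.prod_prod, Measure.infinitePi_pi _ (fun i _ => hA _),
      Measure.infinitePi_pi _ (fun i _ => hA _), ← Finset.prod_disjSum s.toLeft s.toRight (fun i => L (A i)),
      Finset.toLeft_disjSum_toRight]
  have h3 : splice (E := E) e = (fun ω i => ω (e i)) ∘ fun p (c : ℕ ⊕ ℕ) => Sum.elim p.1 p.2 c := rfl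
  rw [h3, ← Measure.map_map (by fun_prop) (measurable_pi_iff.2 measurable_sumElim), h1,
    Measure.map_infinitePi_infinitePi_of_inj he]

/-- Follow the first sequence up to the index `n`, then the second one. -/
def concatAt (n i : ℕ) : ℕ ⊕ ℕ := if i ≤ n then .inl i else .inr (i - n)

lemma concatAt_injective (n : ℕ) : Function.Injective (concatAt n) := by
  intro i j h
  unfold concatAt at h
  split_ifs at h <;> simp at h <;> omega

/-- Follow the first sequence up to the index `N - k`, then the second one backwards. -/
def reverseAt (N k i : ℕ) : ℕ ⊕ ℕ :=
  if N - k < i ∧ i ≤ N then .inr (N + 1 - i) else .inl i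

lemma reverseAt_injective (N k : ℕ) : Function.Injective (reverseAt N k) := by
  intro i j h
  unfold reverseAt at h
  split_ifs at h <;> simp at h <;> omega

end Splice

/-! ### The walk driven by an i.i.d. sequence -/

/-- The increments of the walk driven by a sequence of pairs `(X, η)`. -/
def stp (i : ℕ) (w : ℕ → ℝ × ℝ) : ℝ := (w i).1

lemma measurable_stp (i : ℕ) : Measurable (stp i) := by unfold stp; fun_prop

lemma measurable_walk {Ω : Type*} [MeasurableSpace Ω] {X : ℕ → Ω → ℝ} (hX : ∀ i, 1 ≤ i → Measurable (X i))
    (n : ℕ) : Measurable (walk X n) := by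
  unfold walk
  exact Finset.measurable_fun_sum _ fun i hi => hX i (Finset.mem_Icc.1 hi).1

lemma walk_zero {Ω : Type*} [MeasurableSpace Ω] (X : ℕ → Ω → ℝ) (ω : Ω) : walk X 0 ω = 0 := by simp [walk]

lemma walk_succ {Ω : Type*} [MeasurableSpace Ω] (X : ℕ → Ω → ℝ) (n : ℕ) (ω : Ω) :
    walk X (n + 1) ω = walk X n ω + X (n + 1) ω := by
  simp [walk, Finset.sum_Icc_succ_top]

lemma walk_concat_of_le {n i : ℕ} (h : i ≤ n) (p : (ℕ → ℝ × ℝ) × (ℕ → ℝ × ℝ)) :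
    walk stp i (splice (concatAt n) p) = walk stp i p.1 := by
  refine Finset.sum_congr rfl fun l hl => ?_
  have : l ≤ n := (Finset.mem_Icc.1 hl).2.trans h
  simp [stp, splice, concatAt, this]

lemma walk_concat_add (n i : ℕ) (p : (ℕ → ℝ × ℝ) × (ℕ → ℝ × ℝ)) :
    walk stp (n + i) (splice (concatAt n) p) = walk stp n p.1 + walk stp i p.2 := by
  induction i with
  | zero => simp [walk_concat_of_le le_rfl, walk_zero]
  | succ i ih =>
    rw [← add_assoc, walk_succ, ih, walk_succ, add_assoc]
    simp [stp, splice, concatAt, show n + i + 1 - n = i + 1 by omega]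

/-- The event that the walk started at `x` stays in `H` up to time `n`. -/
def stayIn {Ω : Type*} [MeasurableSpace Ω] (X : ℕ → Ω → ℝ) (H : Set ℝ) (x : ℝ) (n : ℕ) : Set Ω :=
  {ω | ∀ i ∈ Finset.Icc 1 n, x + walk X i ω ∈ H}

lemma measurableSet_stayIn {Ω : Type*} [MeasurableSpace Ω] {X : ℕ → Ω → ℝ} (hX : ∀ i, 1 ≤ i → Measurable (X i))
    {H : Set ℝ} (hH : MeasurableSet H) (x : ℝ) (n : ℕ) : MeasurableSet (stayIn X H x n) := by
  unfold stayIn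
  have : {ω | ∀ i ∈ Finset.Icc 1 n, x + walk X i ω ∈ H}
      = ⋂ i ∈ Finset.Icc 1 n, {ω | x + walk X i ω ∈ H} := by ext; simp
  rw [this]
  exact Finset.measurableSet_biInter _ fun i _ => ((measurable_walk hX i).const_add x) hH

lemma mem_stayIn_succ {Ω : Type*} [MeasurableSpace Ω] {X : ℕ → Ω → ℝ} {H : Set ℝ} {x : ℝ} {n : ℕ} {ω : Ω} :
    ω ∈ stayIn X H x (n + 1) ↔ ω ∈ stayIn X H x n ∧ x + walk X (n + 1) ω ∈ H := by
  simp only [stayIn, mem_ofPred_eq, Finset.mem_Icc]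
  constructor
  · exact fun h => ⟨fun i hi => h i (by omega), h (n + 1) (by omega)⟩
  · rintro ⟨h1, h2⟩ i hi
    rcases Nat.lt_or_ge i (n + 1) with h | h
    · exact h1 i (by omega)
    · obtain rfl : i = n + 1 := by omega
      exact h2

lemma concat_mem_stayIn {H : Set ℝ} {x : ℝ} {n N : ℕ} {p : (ℕ → ℝ × ℝ) × (ℕ → ℝ × ℝ)} :
    splice (concatAt n) p ∈ stayIn stp H x (n + N) ↔
      p.1 ∈ stayIn stp H x n ∧ p.2 ∈ stayIn stp H (x + walk stp n p.1) N := by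
  induction N with
  | zero =>
    simp only [stayIn, mem_ofPred_eq, Finset.mem_Icc]
    constructor
    · exact fun h => ⟨fun i hi => by simpa [walk_concat_of_le hi.2] using h i hi, fun i hi => by omega⟩
    · exact fun h i hi => by simpa [walk_concat_of_le (show i ≤ n by omega)] using h.1 i hi
  | succ N ih =>
    rw [← add_assoc, mem_stayIn_succ, ih, mem_stayIn_succ, add_assoc n N 1, walk_concat_add,
      and_assoc, add_assoc]

section Law

variable (L : Measure (ℝ × ℝ)) [IsProbabilityMeasure L]

lemma map_stayIn {H : Set ℝ} (hH : MeasurableSet H) (x : ℝ) (n : ℕ) :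
    ((seqLaw L).restrict (stayIn stp H x n)).map (fun w => x + walk stp n w)
      = killed (L.map Prod.fst) H x n := by
  have hS := fun i (_ : 1 ≤ i) => measurable_stp i
  have hpr : IsProbabilityMeasure (L.map Prod.fst) := Measure.isProbabilityMeasure_map (by fun_prop)
  induction n with
  | zero =>
    have : stayIn stp H x 0 = univ := by ext w; simp [stayIn]
    simp [this, walk_zero, killed]
  | succ n ih =>
    have hm : ∀ n, Measurable fun w : ℕ → ℝ × ℝ => x + walk stp n w := fun n =>
      (measurable_walk hS n).const_add x
    have hmap : (seqLaw L).map (stp 1) = L.map Prod.fst := by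
      have h1 : stp 1 = Prod.fst ∘ fun w : ℕ → ℝ × ℝ => w 1 := rfl
      rw [h1, ← Measure.map_map (by fun_prop) (by fun_prop)]
      congr 1
      exact Measure.infinitePi_map_eval _ 1
    have h2 : Measure.conv (killed (L.map Prod.fst) H x n) (L.map Prod.fst)
        = (((seqLaw L).restrict (stayIn stp H x n)).prod (seqLaw L)).map
          (fun p => x + walk stp n p.1 + stp 1 p.2) := by
      rw [← ih, ← hmap, Measure.conv, Measure.map_prod_map _ _ (hm n) (measurable_stp 1),
        Measure.map_map (by fun_prop) ((hm n).prodMap (measurable_stp 1))]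
      rfl
    have hm2 : Measurable fun p : (ℕ → ℝ × ℝ) × (ℕ → ℝ × ℝ) => x + walk stp n p.1 + stp 1 p.2 :=
      ((hm n).comp measurable_fst).add ((measurable_stp 1).comp measurable_snd)
    have h5 : ((seqLaw L).restrict (stayIn stp H x n)).prod (seqLaw L)
        = ((seqLaw L).prod (seqLaw L)).restrict (stayIn stp H x n ×ˢ univ) := by
      rw [← Measure.prod_restrict, Measure.restrict_univ]
    ext A hA
    rw [killed, h2, Measure.map_apply (hm _) hA,
      Measure.restrict_apply (hm _ hA), Measure.restrict_apply hA,
      Measure.map_apply hm2 (hA.inter hH)]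
    conv_lhs => rw [← map_splice L (concatAt_injective n)]
    rw [Measure.map_apply (measurable_splice _) ((hm _ hA).inter (measurableSet_stayIn hS hH _ _)),
      h5, Measure.restrict_apply (hm2 (hA.inter hH))]
    congr 1
    ext p
    simp only [mem_preimage, mem_inter_iff, concat_mem_stayIn, walk_concat_add, mem_prod, mem_univ,
      and_true]
    have h3 : walk stp 1 p.2 = stp 1 p.2 := by simp [walk]
    have h4 : p.2 ∈ stayIn stp H (x + walk stp n p.1) 1 ↔ x + walk stp n p.1 + stp 1 p.2 ∈ H := by
      simp [stayIn, h3]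
    rw [h4, h3, ← add_assoc]
    tauto

lemma setIntegral_stayIn {H : Set ℝ} (hH : MeasurableSet H) (x : ℝ) (n : ℕ) {f : ℝ → ℝ}
    (hf : Measurable f) :
    ∫ w in stayIn stp H x n, f (x + walk stp n w) ∂seqLaw L
      = ∫ y, f y ∂killed (L.map Prod.fst) H x n := by
  rw [← map_stayIn L hH, integral_map]
  · exact ((measurable_walk (fun i _ => measurable_stp i) n).const_add x).aemeasurable
  · exact hf.aestronglyMeasurable

lemma measureReal_stayIn {H : Set ℝ} (hH : MeasurableSet H) (x : ℝ) (n : ℕ) {A : Set ℝ}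
    (hA : MeasurableSet A) :
    (seqLaw L) {w | x + walk stp n w ∈ A ∧ w ∈ stayIn stp H x n} = killed (L.map Prod.fst) H x n A := by
  have hm : Measurable fun w : ℕ → ℝ × ℝ => x + walk stp n w :=
      (measurable_walk (fun i _ => measurable_stp i) n).const_add x
  rw [← map_stayIn L hH, Measure.map_apply hm hA, Measure.restrict_apply (hm hA)]
  rfl

end Law

/-! ### The renewal functions of the walk -/

lemma Mwalk_lt_zero_iff {Ω : Type*} [MeasurableSpace Ω] {X : ℕ → Ω → ℝ} {k : ℕ} {ω : Ω} :
    Mwalk X (k + 1) ω < 0 ↔ ω ∈ stayIn X (Iio 0) 0 (k + 1) := by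
  simp [Mwalk, stayIn, Finset.sup'_lt_iff]

lemma Lwalk_nonneg_iff {Ω : Type*} [MeasurableSpace Ω] {X : ℕ → Ω → ℝ} {k : ℕ} {ω : Ω} :
    0 ≤ Lwalk X (k + 1) ω ↔ ω ∈ stayIn X (Ici 0) 0 (k + 1) := by
  simp [Lwalk, stayIn, Finset.le_inf'_iff]

section Law

variable {Ω : Type*} [MeasurableSpace Ω] {μ : Measure Ω} {ξ : Ω → ℕ → ℝ × ℝ}
  {L : Measure (ℝ × ℝ)} [IsProbabilityMeasure L] {σ : ℝ}

lemma measure_stayIn_comp (hξ : Measurable ξ) (hm : μ.map ξ = seqLaw L) {H A : Set ℝ}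
    (hH : MeasurableSet H) (hA : MeasurableSet A) (x : ℝ) (n : ℕ) :
    μ {ω | x + walk (fun i ω => stp i (ξ ω)) n ω ∈ A ∧ ω ∈ stayIn (fun i ω => stp i (ξ ω)) H x n}
      = killed (L.map Prod.fst) H x n A := by
  have hS := fun i (_ : 1 ≤ i) => measurable_stp i
  rw [← measureReal_stayIn L hH x n hA, ← hm, Measure.map_apply hξ]
  · rfl
  · exact (((measurable_walk hS n).const_add x) hA).inter (measurableSet_stayIn hS hH x n)

lemma uFun_eq_ren (hξ : Measurable ξ) (hm : μ.map ξ = seqLaw L) (h : IsStep (L.map Prod.fst) σ) {x : ℝ}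
    (hx : 0 ≤ x) :
    uFun μ (fun i ω => stp i (ξ ω)) x = ren (downSeq (L.map Prod.fst)) Iic x := by
  have hpr := h.prob
  have hs := h.ladderSeq_neg.summable_real halfLines_Iic x
  rw [uFun, if_pos hx, ren, downSeq, hs.tsum_eq_zero_add]
  congr 1
  · simp [killed, measureReal_def, hx]
  · congr 1
    ext k
    rw [measureReal_def, ← map_neg_neg (killed _ _ _ _), ← killed_Iio_neg,
      Measure.map_apply measurable_neg measurableSet_Iic,
      ← measure_stayIn_comp hξ hm measurableSet_Iio (measurable_neg measurableSet_Iic)]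
    simp only [Mwalk_lt_zero_iff, zero_add, mem_preimage, mem_Iic]

lemma vFun_eq_ren (hξ : Measurable ξ) (hm : μ.map ξ = seqLaw L) (h : IsStep (L.map Prod.fst) σ) {x : ℝ}
    (hx : x < 0) :
    vFun μ (fun i ω => stp i (ξ ω)) x = ren (upSeq (L.map Prod.fst)) Iio (-x) := by
  have hpr := h.prob
  have hs := h.ladderSeq_pos.summable_real halfLines_Iio (-x)
  rw [vFun, if_pos hx.le, ren, upSeq, hs.tsum_eq_zero_add]
  congr 1
  · simp [killed, measureReal_def, hx]
  · congr 1
    ext k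
    rw [measureReal_def, ← measure_stayIn_comp hξ hm measurableSet_Ici measurableSet_Iio]
    simp only [Lwalk_nonneg_iff, zero_add, mem_Iio, lt_neg]

end Law

section StepLaw

variable {ν : Measure ℝ} {σ : ℝ}

lemma IsStep.ren_down_zero (h : IsStep ν σ) : ren (downSeq ν) Iic 0 = 1 := by
  have hpr := h.prob
  have hs := h.ladderSeq_neg.summable_real halfLines_Iic 0
  rw [ren, downSeq, hs.tsum_eq_zero_add]
  have : ∀ k, (killed (ν.map Neg.neg) (Ioi 0) 0 (k + 1)).real (Iic 0) = 0 := fun k => by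
    rw [measureReal_def, killed, Measure.restrict_apply measurableSet_Iic,
      show Iic (0 : ℝ) ∩ Ioi 0 = ∅ by ext y; simp]
    simp
  rw [tsum_congr this]
  simp [killed, measureReal_def]

lemma IsStep.one_le_ren_up (h : IsStep ν σ) {x : ℝ} (hx : 0 < x) : 1 ≤ ren (upSeq ν) Iio x := by
  have hpr := h.prob
  have hs := h.ladderSeq_pos.summable_real halfLines_Iio x
  rw [ren, upSeq, hs.tsum_eq_zero_add]
  have h0 : (killed ν (Ici 0) 0 0).real (Iio x) = 1 := by simp [killed, measureReal_def, hx]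
  rw [h0, le_add_iff_nonneg_right]
  exact tsum_nonneg fun _ => measureReal_nonneg

end StepLaw

/-! ### Expectations over the walk conditioned to stay nonnegative -/

/-- The standing assumptions on the law of the pair `(X, η)`. -/
structure EnvLaw (L : Measure (ℝ × ℝ)) (χ σ : ℝ) : Prop where
  step : IsStep (L.map Prod.fst) σ
  pos : 0 < χ
  lt_one : χ < 1
  le_eta : ∀ᵐ p ∂L, χ ≤ p.2
  eta_le : ∀ᵐ p ∂L, p.2 ≤ χ⁻¹
  exp_le : ∀ᵐ p ∂L, Real.exp (-p.1) ≤ χ⁻¹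

section Law

variable {L : Measure (ℝ × ℝ)} [IsProbabilityMeasure L] {χ σ : ℝ}

lemma ae_seqLaw {q : ℝ × ℝ → Prop} (h : ∀ᵐ p ∂L, q p) : ∀ᵐ w ∂seqLaw L, ∀ i, q (w i) := by
  rw [ae_all_iff]
  intro i
  have := Measure.infinitePi_map_eval (fun _ : ℕ => L) i
  rw [← this] at h
  exact ae_of_ae_map (measurable_pi_apply i).aemeasurable h

lemma measurable_walk_stp (n : ℕ) : Measurable (walk stp n) :=
  measurable_walk (fun i _ => measurable_stp i) n

lemma measurableSet_stayIn_stp {H : Set ℝ} (hH : MeasurableSet H) (x : ℝ) (n : ℕ) :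
    MeasurableSet (stayIn stp H x n) :=
  measurableSet_stayIn (fun i _ => measurable_stp i) hH x n

lemma integrable_splice {e : ℕ → ℕ ⊕ ℕ} (he : Function.Injective e) {f : (ℕ → ℝ × ℝ) → ℝ}
    (hf : Integrable f (seqLaw L)) :
    Integrable (fun p => f (splice e p)) ((seqLaw L).prod (seqLaw L)) := by
  rw [← map_splice L he] at hf
  exact hf.comp_measurable (measurable_splice e)

lemma integral_splice {e : ℕ → ℕ ⊕ ℕ} (he : Function.Injective e) {f : (ℕ → ℝ × ℝ) → ℝ}
    (hf : Integrable f (seqLaw L)) :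
    ∫ w, f w ∂seqLaw L = ∫ p, f (splice e p) ∂(seqLaw L).prod (seqLaw L) := by
  have h := hf.aestronglyMeasurable
  rw [← map_splice L he] at h
  conv_lhs => rw [← map_splice L he]
  exact integral_map (measurable_splice e).aemeasurable h

lemma setIntegral_concat {H : Set ℝ} (hH : MeasurableSet H) (x : ℝ) (n N : ℕ)
    {f : (ℕ → ℝ × ℝ) → ℝ} (hf : IntegrableOn f (stayIn stp H x (n + N)) (seqLaw L)) :
    IntegrableOn (fun w => ∫ w' in stayIn stp H (x + walk stp n w) N,
        f (splice (concatAt n) (w, w')) ∂seqLaw L) (stayIn stp H x n) (seqLaw L) ∧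
      ∫ w in stayIn stp H x (n + N), f w ∂seqLaw L =
        ∫ w in stayIn stp H x n, ∫ w' in stayIn stp H (x + walk stp n w) N,
          f (splice (concatAt n) (w, w')) ∂seqLaw L ∂seqLaw L := by
  have hm := measurableSet_stayIn_stp hH
  have hi := (integrable_indicator_iff (hm x (n + N))).2 hf
  have hi' := integrable_splice (concatAt_injective n) hi
  have hval : ∀ w w', (stayIn stp H x (n + N)).indicator f (splice (concatAt n) (w, w'))
      = (stayIn stp H x n).indicator (fun w => (stayIn stp H (x + walk stp n w) N).indicator
        (fun w' => f (splice (concatAt n) (w, w'))) w') w := fun w w' => by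
    have := concat_mem_stayIn (H := H) (x := x) (n := n) (N := N) (p := (w, w'))
    by_cases h1 : w ∈ stayIn stp H x n <;>
      by_cases h2 : w' ∈ stayIn stp H (x + walk stp n w) N <;> simp [Set.indicator, this, h1, h2]
  have hin : ∀ w, ∫ w', (stayIn stp H x (n + N)).indicator f (splice (concatAt n) (w, w')) ∂seqLaw L
      = (stayIn stp H x n).indicator (fun w => ∫ w' in stayIn stp H (x + walk stp n w) N,
          f (splice (concatAt n) (w, w')) ∂seqLaw L) w := fun w => by
    simp_rw [hval]
    by_cases hw : w ∈ stayIn stp H x n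
    · simp only [indicator_of_mem hw]
      rw [integral_indicator (hm _ N)]
    · simp [indicator_of_notMem hw]
  constructor
  · rw [← integrable_indicator_iff (hm x n)]
    exact hi'.integral_prod_left.congr (.of_forall hin)
  · rw [← integral_indicator (hm x (n + N)), ← integral_indicator (hm x n),
      integral_splice (concatAt_injective n) hi, integral_prod _ hi']
    exact integral_congr_ae (.of_forall hin)

lemma setIntegral_exp_stayIn (x : ℝ) (n : ℕ) (θ : ℝ) :
    ∫ w in stayIn stp (Ici 0) x n, Real.exp (-θ * (x + walk stp n w)) ∂seqLaw L
      = lap (killed (L.map Prod.fst) (Ici 0) x n) θ :=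
  setIntegral_stayIn L measurableSet_Ici x n (f := fun y => Real.exp (-θ * y)) (by fun_prop)

lemma nonneg_of_mem_stayIn {x : ℝ} (hx : 0 ≤ x) {n : ℕ} {w : ℕ → ℝ × ℝ}
    (hw : w ∈ stayIn stp (Ici 0) x n) : 0 ≤ x + walk stp n w := by
  rcases Nat.eq_zero_or_pos n with rfl | hn
  · simpa [walk_zero]
  · exact hw n (Finset.mem_Icc.2 ⟨hn, le_rfl⟩)

lemma nonneg_of_mem_stayIn_of_le {x : ℝ} (hx : 0 ≤ x) {n i : ℕ} (hi : i ≤ n) {w : ℕ → ℝ × ℝ}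
    (hw : w ∈ stayIn stp (Ici 0) x n) : 0 ≤ x + walk stp i w := by
  rcases Nat.eq_zero_or_pos i with rfl | hn
  · simpa [walk_zero]
  · exact hw i (Finset.mem_Icc.2 ⟨hn, hi⟩)

lemma integrableOn_stayIn_of_bound {x : ℝ} {n : ℕ} {f : (ℕ → ℝ × ℝ) → ℝ} (hf : Measurable f) {C : ℝ}
    (hC : ∀ᵐ w ∂seqLaw L, w ∈ stayIn stp (Ici 0) x n → |f w| ≤ C) :
    IntegrableOn f (stayIn stp (Ici 0) x n) (seqLaw L) := by
  refine (integrable_const C).mono' hf.aestronglyMeasurable ?_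
  rw [ae_restrict_iff' (measurableSet_stayIn_stp measurableSet_Ici x n)]
  exact hC

lemma exists_exp_exp_le (h : IsStep (L.map Prod.fst) σ) : ∃ C, 0 ≤ C ∧ ∀ i M : ℕ,
    ∫ w in stayIn stp (Ici 0) 0 (i + M),
      Real.exp (-walk stp (i + M) w) * Real.exp (-walk stp i w) ∂seqLaw L ≤ C * (wt i * wt M) := by
  have hpr := h.prob
  obtain ⟨C, hC, hle⟩ := h.lap_killed_le (θ := 1) (δ := 1 / 2) one_pos (by norm_num)
  obtain ⟨C', hC', hle'⟩ := h.lap_killed_le (θ := 1 / 2) (δ := 1) (by norm_num) one_pos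
  refine ⟨C * C', by positivity, fun i M => ?_⟩
  have hm := measurable_walk_stp
  have hint : IntegrableOn (fun w => Real.exp (-walk stp (i + M) w) * Real.exp (-walk stp i w))
      (stayIn stp (Ici 0) 0 (i + M)) (seqLaw L) := by
    refine integrableOn_stayIn_of_bound (C := 1) (by fun_prop) (.of_forall fun w hw => ?_)
    have h1 := nonneg_of_mem_stayIn le_rfl hw
    have h2 := nonneg_of_mem_stayIn_of_le le_rfl (Nat.le_add_right i M) hw
    rw [← Real.exp_add, abs_of_pos (Real.exp_pos _), Real.exp_le_one_iff]
    linarith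
  rw [(setIntegral_concat measurableSet_Ici 0 i M hint).2]
  have hinner : ∀ w, ∫ w' in stayIn stp (Ici 0) (0 + walk stp i w) M,
      Real.exp (-walk stp (i + M) (splice (concatAt i) (w, w'))) *
        Real.exp (-walk stp i (splice (concatAt i) (w, w'))) ∂seqLaw L
      = lap (killed (L.map Prod.fst) (Ici 0) (0 + walk stp i w) M) 1 * Real.exp (-walk stp i w) := by
    intro w
    rw [← setIntegral_exp_stayIn, ← integral_mul_const]
    simp_rw [walk_concat_add, walk_concat_of_le le_rfl]
    congr 1
    ext w'
    ring_nf
  simp_rw [hinner]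
  calc _ ≤ ∫ w in stayIn stp (Ici 0) 0 i,
        C * wt M * Real.exp (-(1 / 2) * (0 + walk stp i w)) ∂seqLaw L := by
        refine integral_mono_of_nonneg (.of_forall fun w => mul_nonneg (lap_nonneg _ _) (Real.exp_pos _).le)
          (integrableOn_stayIn_of_bound (C := C * wt M) (by fun_prop) (.of_forall fun w hw => ?_)) ?_
        · have h1 := nonneg_of_mem_stayIn le_rfl hw
          rw [abs_of_nonneg (by have := wt_pos M; positivity)]
          refine mul_le_of_le_one_right (by have := wt_pos M; positivity) (Real.exp_le_one_iff.2 ?_)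
          linarith
        · filter_upwards [ae_restrict_mem (measurableSet_stayIn_stp measurableSet_Ici 0 i)] with w hw
          have h1 := nonneg_of_mem_stayIn le_rfl hw
          calc _ ≤ C * Real.exp (1 / 2 * (0 + walk stp i w)) * wt M * Real.exp (-walk stp i w) :=
                mul_le_mul_of_nonneg_right (hle _ h1 M) (Real.exp_pos _).le
            _ = C * wt M * (Real.exp (1 / 2 * (0 + walk stp i w)) * Real.exp (-walk stp i w)) := by ring
            _ = _ := by rw [← Real.exp_add]; ring_nf
    _ = C * wt M * lap (killed (L.map Prod.fst) (Ici 0) 0 i) (1 / 2) := by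
        rw [integral_const_mul, setIntegral_exp_stayIn]
    _ ≤ C * wt M * (C' * Real.exp (1 * 0) * wt i) :=
        mul_le_mul_of_nonneg_left (hle' 0 le_rfl i) (by have := wt_pos M; positivity)
    _ = _ := by simp; ring

end Law

/-! ### The last steps of the walk, read backwards -/

/-- Partial sums of `B⁺`. -/
def Bfwd (k : ℕ) (w : ℕ → ℝ × ℝ) : ℝ :=
  ∑ i ∈ Finset.range k, (w (i + 1)).2 * Real.exp (-walk stp i w)

/-- Partial sums of `B⁻`. -/
def Bbwd (k : ℕ) (w : ℕ → ℝ × ℝ) : ℝ :=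
  ∑ i ∈ Finset.range k, (w (i + 1)).2 * Real.exp (walk stp (i + 1) w)

/-- The sequence `w 1, ..., w N` read backwards. -/
def revSeq (N : ℕ) (w : ℕ → ℝ × ℝ) (i : ℕ) : ℝ × ℝ := w (N + 1 - i)

lemma walk_congr {w w' : ℕ → ℝ × ℝ} {k : ℕ} (h : ∀ i, 1 ≤ i → i ≤ k → w i = w' i) :
    walk stp k w = walk stp k w' :=
  Finset.sum_congr rfl fun i hi => by
    rw [stp, stp, h i (Finset.mem_Icc.1 hi).1 (Finset.mem_Icc.1 hi).2]

lemma Bbwd_congr {w w' : ℕ → ℝ × ℝ} {k : ℕ} (h : ∀ i, 1 ≤ i → i ≤ k → w i = w' i) :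
    Bbwd k w = Bbwd k w' :=
  Finset.sum_congr rfl fun i hi => by
    have hi := Finset.mem_range.1 hi
    rw [h (i + 1) (by omega) (by omega), walk_congr fun l h1 h2 => h l h1 (by omega)]

lemma Bfwd_congr {w w' : ℕ → ℝ × ℝ} {k : ℕ} (h : ∀ i, 1 ≤ i → i ≤ k → w i = w' i) :
    Bfwd k w = Bfwd k w' :=
  Finset.sum_congr rfl fun i hi => by
    have hi := Finset.mem_range.1 hi
    rw [h (i + 1) (by omega) (by omega), walk_congr fun l h1 h2 => h l h1 (by omega)]

lemma measurable_Bfwd (k : ℕ) : Measurable (Bfwd k) := by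
  unfold Bfwd
  have := measurable_walk_stp
  exact Finset.measurable_fun_sum _ fun i _ => by fun_prop

lemma measurable_Bbwd (k : ℕ) : Measurable (Bbwd k) := by
  unfold Bbwd
  have := measurable_walk_stp
  exact Finset.measurable_fun_sum _ fun i _ => by fun_prop

lemma measurable_revSeq (N : ℕ) : Measurable (revSeq N) :=
  measurable_pi_iff.2 fun _ => measurable_pi_apply _

section Reverse

variable {n k : ℕ} (p : (ℕ → ℝ × ℝ) × (ℕ → ℝ × ℝ))

lemma splice_reverseAt_of_le {i : ℕ} (hi : i ≤ n) : splice (reverseAt (n + k) k) p i = p.1 i := by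
  simp [splice, reverseAt, not_lt.2 hi]

lemma splice_reverseAt_of_lt {i : ℕ} (hi : n < i) (hi' : i ≤ n + k) :
    splice (reverseAt (n + k) k) p i = p.2 (n + k + 1 - i) := by
  simp [splice, reverseAt, hi, hi']

lemma walk_reverse_of_le {i : ℕ} (hi : i ≤ n) :
    walk stp i (splice (reverseAt (n + k) k) p) = walk stp i p.1 :=
  walk_congr fun _ _ h => splice_reverseAt_of_le p (h.trans hi)

lemma walk_reverse_add {i : ℕ} (hi : i ≤ k) :
    walk stp (n + i) (splice (reverseAt (n + k) k) p)
      = walk stp n p.1 + (walk stp k p.2 - walk stp (k - i) p.2) := by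
  induction i with
  | zero => simp [walk_reverse_of_le]
  | succ i ih =>
    have h1 : walk stp (k - i) p.2 = walk stp (k - (i + 1)) p.2 + stp (k - i) p.2 := by
      rw [show k - i = k - (i + 1) + 1 by omega, walk_succ]
    have h2 : stp (n + i + 1) (splice (reverseAt (n + k) k) p) = stp (k - i) p.2 := by
      rw [stp, splice_reverseAt_of_lt p (by omega) (by omega), stp,
        show n + k + 1 - (n + i + 1) = k - i by omega]
    rw [← add_assoc, walk_succ, ih (by omega), h2, h1]
    ring

lemma Bbwd_revSeq_splice :
    Bbwd k (revSeq (n + k) (splice (reverseAt (n + k) k) p)) = Bbwd k p.2 :=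
  Bbwd_congr fun i h1 h2 => by
    rw [revSeq, splice_reverseAt_of_lt p (by omega) (by omega),
      show n + k + 1 - (n + k + 1 - i) = i by omega]

/-- The lowest admissible height before the last `k` steps. -/
def lowest (k : ℕ) (w : ℕ → ℝ × ℝ) : ℝ :=
  (Finset.range (k + 1)).sup' (by simp) fun i => walk stp i w - walk stp k w

lemma lowest_le_iff {w : ℕ → ℝ × ℝ} {y : ℝ} :
    lowest k w ≤ y ↔ ∀ i ≤ k, walk stp i w - walk stp k w ≤ y := by
  simp [lowest, Finset.sup'_le_iff]

lemma reverse_mem_stayIn {x : ℝ} (hx : 0 ≤ x) :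
    splice (reverseAt (n + k) k) p ∈ stayIn stp (Ici 0) x (n + k) ↔
      p.1 ∈ stayIn stp (Ici 0) x n ∧ lowest k p.2 ≤ x + walk stp n p.1 := by
  rw [lowest_le_iff]
  constructor
  · intro h
    have h1 : p.1 ∈ stayIn stp (Ici 0) x n := fun i hi => by
      have hi' := Finset.mem_Icc.1 hi
      have := h i (Finset.mem_Icc.2 ⟨hi'.1, by omega⟩)
      rwa [walk_reverse_of_le p hi'.2] at this
    refine ⟨h1, fun i hi => ?_⟩
    rcases hi.eq_or_lt with rfl | hi
    · simpa using nonneg_of_mem_stayIn hx h1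
    · have := h (n + (k - i)) (Finset.mem_Icc.2 (by omega))
      rw [walk_reverse_add p (by omega), show k - (k - i) = i by omega, mem_Ici] at this
      linarith
  · rintro ⟨h1, h2⟩ i hi
    have hi' := Finset.mem_Icc.1 hi
    rcases le_or_gt i n with h | h
    · rw [walk_reverse_of_le p h]
      exact h1 i (Finset.mem_Icc.2 ⟨hi'.1, h⟩)
    · obtain ⟨l, rfl⟩ := Nat.exists_eq_add_of_lt h
      rw [show n + l + 1 = n + (l + 1) by ring, walk_reverse_add p (by omega), mem_Ici]
      have := h2 (k - (l + 1)) (by omega)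
      linarith

end Reverse

section Law

variable {L : Measure (ℝ × ℝ)} [IsProbabilityMeasure L] {χ σ : ℝ}

lemma setIntegral_reverse {x : ℝ} (hx : 0 ≤ x) (n k : ℕ) {g : ℝ → ℝ → ℝ}
    (hg : Continuous (Function.uncurry g)) {G : ℝ} (hG : ∀ a b, |g a b| ≤ G) :
    Integrable (fun w => ∫ y in Ici (lowest k w), Real.exp (-(y + walk stp k w)) *
        g (Bbwd k w) (Real.exp (-(y + walk stp k w))) ∂killed (L.map Prod.fst) (Ici 0) x n) (seqLaw L) ∧
    ∫ w in stayIn stp (Ici 0) x (n + k), Real.exp (-(x + walk stp (n + k) w)) *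
        g (Bbwd k (revSeq (n + k) w)) (Real.exp (-(x + walk stp (n + k) w))) ∂seqLaw L =
      ∫ w, ∫ y in Ici (lowest k w), Real.exp (-(y + walk stp k w)) *
        g (Bbwd k w) (Real.exp (-(y + walk stp k w))) ∂killed (L.map Prod.fst) (Ici 0) x n ∂seqLaw L := by
  set f : (ℕ → ℝ × ℝ) → ℝ := fun w => Real.exp (-(x + walk stp (n + k) w)) *
        g (Bbwd k (revSeq (n + k) w)) (Real.exp (-(x + walk stp (n + k) w)))
  have hms := measurableSet_stayIn_stp (measurableSet_Ici (a := (0 : ℝ))) x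
  have hmw := measurable_walk_stp
  have hf : Measurable f := by
    have h1 := (measurable_Bbwd k).comp (measurable_revSeq (n + k))
    have h2 : Measurable fun w => Real.exp (-(x + walk stp (n + k) w)) := by fun_prop
    exact h2.mul (hg.measurable.comp (h1.prodMk h2))
  have hi : IntegrableOn f (stayIn stp (Ici 0) x (n + k)) (seqLaw L) := by
    refine integrableOn_stayIn_of_bound (C := G) hf (.of_forall fun w hw => ?_)
    rw [abs_mul, abs_of_pos (Real.exp_pos _)]
    refine (mul_le_of_le_one_left (abs_nonneg _) (Real.exp_le_one_iff.2 ?_)).trans (hG _ _)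
    linarith [nonneg_of_mem_stayIn hx hw]
  have hi' := integrable_splice (reverseAt_injective (n + k) k) ((integrable_indicator_iff (hms _)).2 hi)
  have hin : ∀ w, ∫ w', (stayIn stp (Ici 0) x (n + k)).indicator f
        (splice (reverseAt (n + k) k) (w', w)) ∂seqLaw L
      = ∫ y in Ici (lowest k w), Real.exp (-(y + walk stp k w)) *
        g (Bbwd k w) (Real.exp (-(y + walk stp k w))) ∂killed (L.map Prod.fst) (Ici 0) x n := fun w => by
    have hgm : Measurable fun y => Real.exp (-(y + walk stp k w)) *
        g (Bbwd k w) (Real.exp (-(y + walk stp k w))) := by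
      have h2 : Measurable fun y => Real.exp (-(y + walk stp k w)) := by fun_prop
      exact h2.mul (hg.measurable.comp (measurable_const.prodMk h2))
    rw [← integral_indicator measurableSet_Ici,
      ← setIntegral_stayIn L measurableSet_Ici x n (hgm.indicator measurableSet_Ici),
      ← integral_indicator (hms n)]
    congr 1
    ext w'
    have := reverse_mem_stayIn (n := n) (k := k) (w', w) hx
    by_cases h1 : w' ∈ stayIn stp (Ici 0) x n <;>
      by_cases h2 : lowest k w ≤ x + walk stp n w' <;>
        simp [Set.indicator, this, h1, h2, f, walk_reverse_add, Bbwd_revSeq_splice, walk_zero, add_assoc]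
  constructor
  · exact hi'.integral_prod_right.congr (.of_forall hin)
  · rw [← integral_indicator (hms (n + k)),
      integral_splice (reverseAt_injective (n + k) k) ((integrable_indicator_iff (hms _)).2 hi),
      integral_prod_symm _ hi']
    exact integral_congr_ae (.of_forall hin)

lemma EnvLaw.exp_neg_walk_le (h : EnvLaw L χ σ) :
    ∀ᵐ w ∂seqLaw L, ∀ k, Real.exp (-walk stp k w) ≤ (χ⁻¹) ^ k := by
  filter_upwards [ae_seqLaw h.exp_le] with w hw k
  induction k with
  | zero => simp [walk_zero]
  | succ k ih =>
    rw [walk_succ, neg_add, Real.exp_add, pow_succ]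
    exact mul_le_mul ih (hw _) (Real.exp_pos _).le (by have := h.pos; positivity)

lemma EnvLaw.tendsto_reverse (h : EnvLaw L χ σ) {x : ℝ} (hx : 0 ≤ x) (k : ℕ) {g : ℝ → ℝ → ℝ}
    (hg : Continuous (Function.uncurry g)) (hg0 : ∀ a b, 0 ≤ g a b) {G : ℝ} (hG : ∀ a b, g a b ≤ G) :
    Tendsto (fun n : ℕ => ((n : ℝ) + 1) ^ (3 / 2 : ℝ) *
        ∫ w in stayIn stp (Ici 0) x (n + k), Real.exp (-(x + walk stp (n + k) w)) *
          g (Bbwd k (revSeq (n + k) w)) (Real.exp (-(x + walk stp (n + k) w))) ∂seqLaw L) atTop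
      (𝓝 (lltConst σ * ren (downSeq (L.map Prod.fst)) Iic x *
        ∫ w, ∫ y in Ici (lowest k w), Real.exp (-(y + walk stp k w)) *
          g (Bbwd k w) (Real.exp (-(y + walk stp k w)))
            ∂renMeas (upSeq (L.map Prod.fst)) Iio ∂seqLaw L)) := by
  have hpr := h.step.prob
  have hG' : ∀ a b, |g a b| ≤ G := fun a b => by rw [abs_of_nonneg (hg0 a b)]; exact hG a b
  have hG0 : 0 ≤ G := (hg0 0 0).trans (hG 0 0)
  obtain ⟨C, hC, hle⟩ := h.step.lap_killed_le (θ := 1) (δ := 1) one_pos one_pos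
  have hconv := h.step.lapConv_killed hx
  set c := lltConst σ * ren (downSeq (L.map Prod.fst)) Iic x with hc
  have hc0 : 0 ≤ c := mul_nonneg h.step.ladderSeq_pos.const_nonneg (ren_nonneg x)
  have hform : ∀ (w : ℕ → ℝ × ℝ) (y : ℝ), Real.exp (-(y + walk stp k w)) *
      g (Bbwd k w) (Real.exp (-(y + walk stp k w)))
        = Real.exp (-y) * (Real.exp (-walk stp k w) *
          g (Bbwd k w) (Real.exp (-walk stp k w) * Real.exp (-y))) := fun w y => by
    rw [neg_add, Real.exp_add, mul_assoc, mul_comm (Real.exp (-y)) (Real.exp (-walk stp k w))]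
  have hgc : ∀ w : ℕ → ℝ × ℝ, Continuous fun v => Real.exp (-walk stp k w) *
      g (Bbwd k w) (Real.exp (-walk stp k w) * v) := fun w => by
    have : Continuous fun v => Function.uncurry g (Bbwd k w, Real.exp (-walk stp k w) * v) :=
      hg.comp (by fun_prop)
    exact continuous_const.mul this
  simp_rw [fun n => (setIntegral_reverse (L := L) hx n k hg hG').2]
  suffices hmain : Tendsto (fun n : ℕ => ∫ w, ((n : ℝ) + 1) ^ (3 / 2 : ℝ) *
      ∫ y in Ici (lowest k w), Real.exp (-(y + walk stp k w)) *
        g (Bbwd k w) (Real.exp (-(y + walk stp k w))) ∂killed (L.map Prod.fst) (Ici 0) x n ∂seqLaw L) atTop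
      (𝓝 (∫ w, c * ∫ y in Ici (lowest k w), Real.exp (-(y + walk stp k w)) *
        g (Bbwd k w) (Real.exp (-(y + walk stp k w)))
          ∂renMeas (upSeq (L.map Prod.fst)) Iio ∂seqLaw L)) by
    simpa only [integral_const_mul] using hmain
  refine tendsto_integral_of_dominated_convergence (fun _ => C * Real.exp (1 * x) * (G * (χ⁻¹) ^ k))
    (fun n => ((setIntegral_reverse (L := L) hx n k hg hG').1.const_mul _).aestronglyMeasurable)
    (integrable_const _) (fun n => ?_) (.of_forall fun w => ?_)
  · filter_upwards [h.exp_neg_walk_le] with w hw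
    have hi := hconv.int n
    have h1 : |∫ y in Ici (lowest k w), Real.exp (-(y + walk stp k w)) *
        g (Bbwd k w) (Real.exp (-(y + walk stp k w))) ∂killed (L.map Prod.fst) (Ici 0) x n|
        ≤ ∫ y in Ici (lowest k w), Real.exp (-y) * (G * (χ⁻¹) ^ k) ∂killed (L.map Prod.fst) (Ici 0) x n := by
      rw [← Real.norm_eq_abs]
      refine norm_integral_le_of_norm_le (hi.mul_const _).integrableOn (.of_forall fun y => ?_)
      rw [hform, Real.norm_eq_abs, abs_mul, abs_mul, abs_of_pos (Real.exp_pos _),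
        abs_of_pos (Real.exp_pos _)]
      refine mul_le_mul_of_nonneg_left ?_ (Real.exp_pos _).le
      rw [mul_comm G]
      exact mul_le_mul (hw k) (hG' _ _) (abs_nonneg _) (by have := h.pos; positivity)
    have h2 : ∫ y in Ici (lowest k w), Real.exp (-y) * (G * (χ⁻¹) ^ k) ∂killed (L.map Prod.fst) (Ici 0) x n
        ≤ lap (killed (L.map Prod.fst) (Ici 0) x n) 1 * (G * (χ⁻¹) ^ k) := by
      rw [lap_one, ← integral_mul_const]
      exact setIntegral_le_integral (hi.mul_const _) (.of_forall fun y => by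
        have := h.pos; positivity)
    have h3 := hle x hx n
    have hGk : 0 ≤ G * (χ⁻¹) ^ k := by have := h.pos; positivity
    have ha : (0 : ℝ) ≤ ((n : ℝ) + 1) ^ (3 / 2 : ℝ) := by positivity
    rw [Real.norm_eq_abs, abs_mul, abs_of_nonneg ha]
    calc _ ≤ ((n : ℝ) + 1) ^ (3 / 2 : ℝ) * (C * Real.exp (1 * x) * wt n * (G * (χ⁻¹) ^ k)) :=
          mul_le_mul_of_nonneg_left (h1.trans (h2.trans (mul_le_mul_of_nonneg_right h3 hGk))) ha
      _ = ((n : ℝ) + 1) ^ (3 / 2 : ℝ) * wt n * (C * Real.exp (1 * x) * (G * (χ⁻¹) ^ k)) := by ring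
      _ = _ := by rw [wt_mul, one_mul]
  · have hlim := hconv.tendsto_setIntegral (hgc w) (fun v => mul_nonneg (Real.exp_pos _).le (hg0 _ _))
      (y₀ := lowest k w) (by simp [renMeas_singleton]) measurableSet_Ici Ioi_subset_Ici_self subset_rfl
    simp_rw [hform]
    convert hlim using 2
    rw [Measure.restrict_smul, integral_smul_measure, ENNReal.toReal_ofReal hc0, smul_eq_mul]

end Law

/-! ### The limiting law of the last steps -/

/-- The density `v(-y) e^{-y}` on the positive half-line. -/
def upDensity (ν : Measure ℝ) (y : ℝ) : ℝ :=
  (Ioi 0).indicator (fun y => ren (upSeq ν) Iio y * Real.exp (-y)) y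

lemma upDensity_nonneg (ν : Measure ℝ) (y : ℝ) : 0 ≤ upDensity ν y :=
  indicator_nonneg (fun y _ => mul_nonneg (ren_nonneg y) (Real.exp_pos _).le) y

lemma IsStep.measurable_ren_up {ν : Measure ℝ} {σ : ℝ} (h : IsStep ν σ) :
    Measurable (ren (upSeq ν) Iio) :=
  measurable_ren halfLines_Iio h.ladderSeq_pos.fin

lemma IsStep.measurable_ren_down {ν : Measure ℝ} {σ : ℝ} (h : IsStep ν σ) :
    Measurable (ren (downSeq ν) Iic) :=
  measurable_ren halfLines_Iic h.ladderSeq_neg.fin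

lemma LadderSeq.integral_renMeas {P : ℕ → Measure ℝ} {I : ℝ → Set ℝ} {c : ℝ} (h : LadderSeq P c)
    (hI : HalfLines I) (f : ℝ → ℝ) :
    ∫ y, f y ∂renMeas P I = ∫ y in Ioi 0, ren P I y * f y := by
  rw [renMeas, integral_withDensity_eq_integral_toReal_smul (measurable_renE hI h.fin)
    (.of_forall fun y => by rw [h.renE_eq hI]; exact ENNReal.ofReal_lt_top)]
  simp_rw [ren_eq_toReal h.fin, smul_eq_mul]

lemma IsStep.integrable_upDensity {ν : Measure ℝ} {σ : ℝ} (h : IsStep ν σ) :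
    Integrable (upDensity ν) := by
  have hp : LadderSeq (upSeq ν) (lltConst σ) := h.ladderSeq_pos
  have h1 := hp.integrable_renMeas halfLines_Iio one_pos
  rw [renMeas, integrable_withDensity_iff_integrable_smul' (measurable_renE halfLines_Iio hp.fin)
    (.of_forall fun y => by rw [hp.renE_eq halfLines_Iio]; exact ENNReal.ofReal_lt_top)] at h1
  unfold upDensity
  rw [integrable_indicator_iff measurableSet_Ioi]
  refine h1.congr (.of_forall fun y => ?_)
  simp [ren_eq_toReal hp.fin]

lemma IsStep.integral_upDensity {ν : Measure ℝ} {σ : ℝ} (h : IsStep ν σ) :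
    ∫ y, upDensity ν y = lap (renMeas (upSeq ν) Iio) 1 := by
  have hp : LadderSeq (upSeq ν) (lltConst σ) := h.ladderSeq_pos
  rw [lap_one, hp.integral_renMeas halfLines_Iio]
  exact integral_indicator measurableSet_Ioi

/-- The density of the final height `s` together with the last `k` steps. -/
def backDensity (ν : Measure ℝ) (k : ℕ) (w : ℕ → ℝ × ℝ) (s : ℝ) : ℝ :=
  {q : (ℕ → ℝ × ℝ) × ℝ | 0 < q.2 ∧ q.1 ∈ stayIn stp (Iio 0) (-q.2) k}.indicator
    (fun q => ren (upSeq ν) Iio (q.2 - walk stp k q.1) * Real.exp (-q.2)) (w, s)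

lemma backDensity_nonneg (ν : Measure ℝ) (k : ℕ) (w : ℕ → ℝ × ℝ) (s : ℝ) : 0 ≤ backDensity ν k w s :=
  indicator_nonneg (fun _ _ => mul_nonneg (ren_nonneg _) (Real.exp_pos _).le) _

lemma walk_lt_of_mem_stayIn {k : ℕ} {w : ℕ → ℝ × ℝ} {s : ℝ} (hs : 0 < s)
    (hw : w ∈ stayIn stp (Iio 0) (-s) k) {i : ℕ} (hi : i ≤ k) : walk stp i w < s := by
  rcases Nat.eq_zero_or_pos i with rfl | h
  · simpa [walk_zero]
  · have := hw i (Finset.mem_Icc.2 ⟨h, hi⟩)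
    rw [mem_Iio] at this
    linarith

lemma backDensity_le (ν : Measure ℝ) (k : ℕ) (w : ℕ → ℝ × ℝ) (s : ℝ) :
    backDensity ν k w s ≤ Real.exp (-walk stp k w) * upDensity ν (s - walk stp k w) := by
  unfold backDensity
  refine indicator_le' (s := {q : (ℕ → ℝ × ℝ) × ℝ | 0 < q.2 ∧ q.1 ∈ stayIn stp (Iio 0) (-q.2) k})
    (g := fun q => Real.exp (-walk stp k q.1) * upDensity ν (q.2 - walk stp k q.1)) ?_ ?_ (w, s)
  · rintro ⟨w, s⟩ ⟨h1, h2⟩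
    have := walk_lt_of_mem_stayIn h1 h2 le_rfl
    rw [upDensity, indicator_of_mem (mem_Ioi.2 (by simpa using this)), mul_left_comm, ← Real.exp_add]
    exact le_of_eq (by ring_nf)
  · exact fun q _ => mul_nonneg (Real.exp_pos _).le (upDensity_nonneg _ _)

lemma measurableSet_back (k : ℕ) :
    MeasurableSet {q : (ℕ → ℝ × ℝ) × ℝ | 0 < q.2 ∧ q.1 ∈ stayIn stp (Iio 0) (-q.2) k} := by
  have : {q : (ℕ → ℝ × ℝ) × ℝ | 0 < q.2 ∧ q.1 ∈ stayIn stp (Iio 0) (-q.2) k}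
      = {q | 0 < q.2} ∩ ⋂ i ∈ Finset.Icc 1 k, {q | -q.2 + walk stp i q.1 < 0} := by
    ext q; simp [stayIn]
  rw [this]
  have := measurable_walk_stp
  refine (measurableSet_lt measurable_const measurable_snd).inter
    (Finset.measurableSet_biInter _ fun i _ => measurableSet_lt (by fun_prop) measurable_const)

section Law

variable {L : Measure (ℝ × ℝ)} [IsProbabilityMeasure L] {χ σ : ℝ}

lemma IsStep.measurable_backDensity {ν : Measure ℝ} (h : IsStep ν σ) (k : ℕ) :
    Measurable fun q : (ℕ → ℝ × ℝ) × ℝ => backDensity ν k q.1 q.2 := by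
  have := measurable_walk_stp k
  have hm : Measurable fun q : (ℕ → ℝ × ℝ) × ℝ =>
      ren (upSeq ν) Iio (q.2 - walk stp k q.1) * Real.exp (-q.2) :=
    (h.measurable_ren_up.comp (by fun_prop)).mul (by fun_prop)
  exact hm.indicator (measurableSet_back k)

lemma EnvLaw.integrable_backDensity (h : EnvLaw L χ σ) (k : ℕ) :
    Integrable (fun q : (ℕ → ℝ × ℝ) × ℝ => backDensity (L.map Prod.fst) k q.1 q.2)
      ((seqLaw L).prod volume) := by
  have hm := h.step.measurable_backDensity k
  have hu := h.step.integrable_upDensity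
  have hs : ∀ w, Integrable (fun s => backDensity (L.map Prod.fst) k w s) := fun w => by
    refine ((hu.comp_sub_right (walk stp k w)).const_mul (Real.exp (-walk stp k w))).mono'
      (hm.comp measurable_prodMk_left).aestronglyMeasurable (.of_forall fun s => ?_)
    rw [Real.norm_of_nonneg (backDensity_nonneg _ _ _ _)]
    exact backDensity_le _ _ _ _
  rw [integrable_prod_iff hm.aestronglyMeasurable]
  refine ⟨.of_forall hs, (integrable_const ((χ⁻¹) ^ k * ∫ y, upDensity (L.map Prod.fst) y)).mono'
    hm.aestronglyMeasurable.norm.integral_prod_right' ?_⟩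
  filter_upwards [h.exp_neg_walk_le] with w hw
  simp_rw [Real.norm_of_nonneg (backDensity_nonneg _ _ _ _)]
  rw [Real.norm_of_nonneg (integral_nonneg fun _ => backDensity_nonneg _ _ _ _)]
  calc _ ≤ ∫ s, Real.exp (-walk stp k w) * upDensity (L.map Prod.fst) (s - walk stp k w) :=
        integral_mono (hs w) ((hu.comp_sub_right _).const_mul _) fun s => backDensity_le _ _ _ _
    _ = Real.exp (-walk stp k w) * ∫ y, upDensity (L.map Prod.fst) y := by
        rw [integral_const_mul, integral_sub_right_eq_self]
    _ ≤ _ := mul_le_mul_of_nonneg_right (hw k) (integral_nonneg (upDensity_nonneg _))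

lemma IsStep.integral_renMeas_lowest {ν : Measure ℝ} (h : IsStep ν σ) (k : ℕ) (w : ℕ → ℝ × ℝ)
    (φ : ℝ → ℝ) :
    ∫ y in Ici (lowest k w), Real.exp (-(y + walk stp k w)) * φ (Real.exp (-(y + walk stp k w)))
        ∂renMeas (upSeq ν) Iio = ∫ s, backDensity ν k w s * φ (Real.exp (-s)) := by
  have hp : LadderSeq (upSeq ν) (lltConst σ) := h.ladderSeq_pos
  set R := walk stp k w with hR
  set H : ℝ → ℝ := (Ioi 0 ∩ Ici (lowest k w)).indicator (fun y => ren (upSeq ν) Iio y *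
    (Real.exp (-(y + R)) * φ (Real.exp (-(y + R))))) with hH
  have h1 : ∫ y in Ici (lowest k w), Real.exp (-(y + R)) * φ (Real.exp (-(y + R)))
        ∂renMeas (upSeq ν) Iio = ∫ y, H y := by
    rw [← integral_indicator measurableSet_Ici, hp.integral_renMeas halfLines_Iio,
      ← integral_indicator measurableSet_Ioi]
    congr 1
    ext y
    by_cases h1 : 0 < y <;> by_cases h2 : lowest k w ≤ y <;>
      simp [H, Set.indicator, h1, h2]
  rw [h1, ← integral_sub_right_eq_self H R]
  refine integral_congr_ae ?_
  have hfin : ((fun i => walk stp i w) '' (Finset.range (k + 1) : Set ℕ)).Finite :=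
    (Finset.finite_toSet _).image _
  filter_upwards [(hfin.measure_zero volume : volume _ = 0) |> measure_eq_zero_iff_ae_notMem.1] with s hs
  have hne : ∀ i ≤ k, walk stp i w ≠ s := fun i hi he =>
    hs ⟨i, by simpa using Nat.lt_succ_iff.2 hi, he⟩
  have hiff : s - R ∈ Ioi 0 ∩ Ici (lowest k w) ↔ (0 < s ∧ w ∈ stayIn stp (Iio 0) (-s) k) := by
    rw [mem_inter_iff, mem_Ici, lowest_le_iff, mem_Ioi]
    constructor
    · rintro ⟨-, h2⟩
      have h3 : ∀ i ≤ k, walk stp i w < s := fun i hi =>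
        lt_of_le_of_ne (by linarith [h2 i hi]) (hne i hi)
      refine ⟨by simpa [walk_zero] using h3 0 (Nat.zero_le k), fun i hi => ?_⟩
      rw [mem_Iio]
      linarith [h3 i (Finset.mem_Icc.1 hi).2]
    · rintro ⟨h2, h3⟩
      have := fun i hi => walk_lt_of_mem_stayIn h2 h3 (i := i) hi
      exact ⟨by linarith [this k le_rfl], fun i hi => by linarith [this i hi]⟩
  by_cases hc : 0 < s ∧ w ∈ stayIn stp (Iio 0) (-s) k
  · rw [hH, indicator_of_mem (hiff.2 hc), backDensity, indicator_of_mem (by exact hc), sub_add_cancel,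
      mul_assoc]
  · rw [hH, indicator_of_notMem (fun h => hc (hiff.1 h)), backDensity,
      indicator_of_notMem (by exact hc), zero_mul]

end Law

/-- Dominated convergence with a converging sequence of dominating functions. -/
lemma tendsto_integral_of_le_of_tendsto {α : Type*} [MeasurableSpace α] {μ : Measure α}
    {f g : ℕ → α → ℝ} {f' g' : α → ℝ} (hf : ∀ n, AEStronglyMeasurable (f n) μ)
    (hf0 : ∀ n, ∀ᵐ a ∂μ, 0 ≤ f n a) (hfg : ∀ n, ∀ᵐ a ∂μ, f n a ≤ g n a)
    (hg : ∀ n, Integrable (g n) μ) (hg' : Integrable g' μ)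
    (hfl : ∀ᵐ a ∂μ, Tendsto (fun n => f n a) atTop (𝓝 (f' a)))
    (hgl : ∀ᵐ a ∂μ, Tendsto (fun n => g n a) atTop (𝓝 (g' a)))
    (hgi : Tendsto (fun n => ∫ a, g n a ∂μ) atTop (𝓝 (∫ a, g' a ∂μ))) :
    Tendsto (fun n => ∫ a, f n a ∂μ) atTop (𝓝 (∫ a, f' a ∂μ)) := by
  have hall : ∀ᵐ a ∂μ, ∀ n, 0 ≤ f n a ∧ f n a ≤ g n a :=
    ae_all_iff.2 fun n => by filter_upwards [hf0 n, hfg n] with a h1 h2 using ⟨h1, h2⟩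
  have hg0 : ∀ᵐ a ∂μ, 0 ≤ g' a := by
    filter_upwards [hall, hgl] with a h1 h2
    exact ge_of_tendsto' h2 fun n => (h1 n).1.trans (h1 n).2
  have hle : ∀ᵐ a ∂μ, f' a ≤ g' a := by
    filter_upwards [hall, hfl, hgl] with a h1 h2 h3
    exact le_of_tendsto_of_tendsto' h2 h3 fun n => (h1 n).2
  have h1 : Tendsto (fun n => ∫ a, min (f n a) (g' a) ∂μ) atTop (𝓝 (∫ a, f' a ∂μ)) := by
    refine tendsto_integral_of_dominated_convergence g' (fun n => (hf n).inf hg'.aestronglyMeasurable)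
      hg' (fun n => ?_) ?_
    · filter_upwards [hall, hg0] with a h1 h2
      rw [Real.norm_of_nonneg (le_min (h1 n).1 h2)]
      exact min_le_right _ _
    · filter_upwards [hfl, hle] with a h1 h2
      simpa [min_eq_left h2] using h1.min (tendsto_const_nhds (x := g' a))
  have h2 : Tendsto (fun n => ∫ a, min (g n a) (g' a) ∂μ) atTop (𝓝 (∫ a, g' a ∂μ)) := by
    refine tendsto_integral_of_dominated_convergence g' (fun n => ((hg n).inf hg').aestronglyMeasurable)
      hg' (fun n => ?_) ?_
    · filter_upwards [hall, hg0] with a h1 h2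
      rw [Real.norm_of_nonneg (le_min ((h1 n).1.trans (h1 n).2) h2)]
      exact min_le_right _ _
    · filter_upwards [hgl] with a h1
      simpa using h1.min (tendsto_const_nhds (x := g' a))
  have hfi : ∀ n, Integrable (f n) μ := fun n => (hg n).mono' (hf n) (by
    filter_upwards [hall] with a h
    rw [Real.norm_of_nonneg (h n).1]
    exact (h n).2)
  have h3 : Tendsto (fun n => ∫ a, f n a ∂μ - ∫ a, min (f n a) (g' a) ∂μ) atTop (𝓝 0) := by
    have h4 := hgi.sub h2
    rw [sub_self] at h4
    refine squeeze_zero (fun n => ?_) (fun n => ?_) h4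
    · exact sub_nonneg.2 (integral_mono ((hfi n).inf hg') (hfi n) fun a => min_le_left _ _)
    · have h5 : Integrable (fun a => min (f n a) (g' a)) μ := (hfi n).inf hg'
      have h6 : Integrable (fun a => min (g n a) (g' a)) μ := (hg n).inf hg'
      rw [← integral_sub (hfi n) h5, ← integral_sub (hg n) h6]
      refine integral_mono_ae ((hfi n).sub h5) ((hg n).sub h6) ?_
      filter_upwards [hall] with a h
      have := (h n).2
      rcases le_total (f n a) (g' a) with h5 | h5 <;> rcases le_total (g n a) (g' a) with h6 | h6 <;>
        (simp [h5, h6, this]; try linarith)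
  simpa using h3.add h1

section Law

variable {L : Measure (ℝ × ℝ)} [IsProbabilityMeasure L] {χ σ : ℝ}

/-- Both truncated exponential functionals of the spliced sequence decouple. -/
lemma Bbwd_revSeq_concat (k n : ℕ) (p : (ℕ → ℝ × ℝ) × (ℕ → ℝ × ℝ)) :
    Bbwd k (revSeq (k + (n + k)) (splice (concatAt k) p)) = Bbwd k (revSeq (n + k) p.2) := by
  refine Bbwd_congr fun i h1 h2 => ?_
  simp only [revSeq, splice, concatAt, show ¬ k + (n + k) + 1 - i ≤ k by omega, if_false, Sum.elim_inr]
  exact congrArg p.2 (by omega)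

lemma Bfwd_concat (k : ℕ) (p : (ℕ → ℝ × ℝ) × (ℕ → ℝ × ℝ)) :
    Bfwd k (splice (concatAt k) p) = Bfwd k p.1 :=
  Bfwd_congr fun i _ h2 => by simp [splice, concatAt, h2]

/-- The integrand of the truncated functional. -/
def truncated (g : ℝ → ℝ → ℝ → ℝ) (k N : ℕ) (w : ℕ → ℝ × ℝ) : ℝ :=
  Real.exp (-walk stp N w) * g (Bfwd k w) (Bbwd k (revSeq N w)) (Real.exp (-walk stp N w))

lemma measurable_truncated {g : ℝ → ℝ → ℝ → ℝ} (hg : Continuous fun q : ℝ × ℝ × ℝ => g q.1 q.2.1 q.2.2)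
    (k N : ℕ) : Measurable (truncated g k N) := by
  have h1 := measurable_walk_stp N
  have h2 := (measurable_Bbwd k).comp (measurable_revSeq N)
  have h3 := measurable_Bfwd k
  exact (h1.neg.exp).mul (hg.measurable.comp (h3.prodMk (h2.prodMk h1.neg.exp)))

lemma integrableOn_truncated {g : ℝ → ℝ → ℝ → ℝ}
    (hg : Continuous fun q : ℝ × ℝ × ℝ => g q.1 q.2.1 q.2.2) (hg0 : ∀ a b c, 0 ≤ g a b c) {G : ℝ}
    (hG : ∀ a b c, g a b c ≤ G) (k N : ℕ) :
    IntegrableOn (truncated g k N) (stayIn stp (Ici 0) 0 N) (seqLaw L) := by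
  refine integrableOn_stayIn_of_bound (measurable_truncated hg k N) (C := 1 * G) (.of_forall fun w hw => ?_)
  have h0 := nonneg_of_mem_stayIn le_rfl hw
  rw [zero_add] at h0
  rw [truncated, abs_mul, abs_of_pos (Real.exp_pos _), abs_of_nonneg (hg0 _ _ _)]
  exact mul_le_mul (Real.exp_le_one_iff.2 (by linarith)) (hG _ _ _) (hg0 _ _ _) zero_le_one

/-- The limit of the truncated functional. -/
def blockLimit (L : Measure (ℝ × ℝ)) [IsProbabilityMeasure L] (g : ℝ → ℝ → ℝ → ℝ) (k : ℕ) : ℝ :=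
  ∫ w₁ in stayIn stp (Ici 0) 0 k, ren (downSeq (L.map Prod.fst)) Iic (walk stp k w₁) *
    ∫ w, (∫ s, backDensity (L.map Prod.fst) k w s * g (Bfwd k w₁) (Bbwd k w) (Real.exp (-s))) ∂seqLaw L
      ∂seqLaw L

lemma EnvLaw.tendsto_truncated (h : EnvLaw L χ σ)
    (hu : ∀ k, ∫ w in stayIn stp (Ici 0) 0 k,
      ren (downSeq (L.map Prod.fst)) Iic (walk stp k w) ∂seqLaw L = 1)
    {g : ℝ → ℝ → ℝ → ℝ} (hg : Continuous fun q : ℝ × ℝ × ℝ => g q.1 q.2.1 q.2.2)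
    (hg0 : ∀ a b c, 0 ≤ g a b c) {G : ℝ} (hG : ∀ a b c, g a b c ≤ G) (k : ℕ) :
    DecayTo (3 / 2) (fun N => ∫ w in stayIn stp (Ici 0) 0 N, truncated g k N w ∂seqLaw L)
      (lltConst σ * blockLimit L g k) := by
  have hpr := h.step.prob
  have hG0 : 0 ≤ G := (hg0 0 0 0).trans (hG 0 0 0)
  have hms := measurableSet_stayIn_stp (measurableSet_Ici (a := (0 : ℝ))) 0 k
  have hui : IntegrableOn (fun w => ren (downSeq (L.map Prod.fst)) Iic (walk stp k w))
      (stayIn stp (Ici 0) 0 k) (seqLaw L) := by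
    by_contra hc
    have := hu k
    rw [integral_undef hc] at this
    exact zero_ne_one this
  refine DecayTo.of_shift (k := 2 * k) ?_
  have heq : ∀ n : ℕ, n + 2 * k = k + (n + k) := fun n => by ring
  have hcon := fun n : ℕ => setIntegral_concat (L := L) measurableSet_Ici 0 k (n + k)
    (integrableOn_truncated (L := L) hg hg0 hG k (k + (n + k)))
  have htr : ∀ (n : ℕ) (w w' : ℕ → ℝ × ℝ), truncated g k (k + (n + k)) (splice (concatAt k) (w, w')) =
      Real.exp (-(walk stp k w + walk stp (n + k) w')) * g (Bfwd k w) (Bbwd k (revSeq (n + k) w'))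
        (Real.exp (-(walk stp k w + walk stp (n + k) w'))) := fun n w w' => by
    rw [truncated, walk_concat_add, Bbwd_revSeq_concat, Bfwd_concat]
  simp only [zero_add, htr] at hcon
  unfold DecayTo
  simp_rw [heq, fun n => (hcon n).2]
  rw [blockLimit, ← integral_const_mul]
  refine Tendsto.congr (fun n => integral_const_mul _ _) ?_
  have hconv := fun x (hx : (0 : ℝ) ≤ x) => h.step.lapConv_killed hx
  have hlap : ∀ x, 0 ≤ x → DecayTo (3 / 2) (fun n => lap (killed (L.map Prod.fst) (Ici 0) x n) 1)
      (lltConst σ * ren (downSeq (L.map Prod.fst)) Iic x * lap (renMeas (upSeq (L.map Prod.fst)) Iio) 1) :=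
    fun x hx => by
      have := (hconv x hx).lim 0
      simp only [Nat.cast_zero, zero_add] at this
      refine this.trans_eq ?_
      rw [lap, lap, integral_smul_measure, ENNReal.toReal_ofReal
        (mul_nonneg h.step.ladderSeq_pos.const_nonneg (ren_nonneg x)), smul_eq_mul]
  have hexp : ∀ x n, ∫ w in stayIn stp (Ici 0) x n, Real.exp (-(x + walk stp n w)) ∂seqLaw L
      = lap (killed (L.map Prod.fst) (Ici 0) x n) 1 := fun x n => by
    rw [← setIntegral_exp_stayIn]; simp
  have hexpi : ∀ x, 0 ≤ x → ∀ n, IntegrableOn (fun w => Real.exp (-(x + walk stp n w)))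
      (stayIn stp (Ici 0) x n) (seqLaw L) := fun x hx n => by
    have := measurable_walk_stp n
    refine integrableOn_stayIn_of_bound (C := 1) (by fun_prop) (.of_forall fun w hw => ?_)
    rw [abs_of_pos (Real.exp_pos _)]
    exact Real.exp_le_one_iff.2 (by linarith [nonneg_of_mem_stayIn hx hw])
  have hcon1 := fun n : ℕ => setIntegral_concat (L := L) measurableSet_Ici 0 k (n + k)
    (hexpi 0 le_rfl (k + (n + k)))
  simp only [zero_add, walk_concat_add, hexp] at hcon1
  refine tendsto_integral_of_le_of_tendsto
    (g := fun n w => ((n : ℝ) + 1) ^ (3 / 2 : ℝ) *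
      (G * lap (killed (L.map Prod.fst) (Ici 0) (walk stp k w) (n + k)) 1))
    (g' := fun w => G * (lltConst σ * ren (downSeq (L.map Prod.fst)) Iic (walk stp k w) *
      lap (renMeas (upSeq (L.map Prod.fst)) Iio) 1)) (fun n => ((hcon n).1.const_mul _).aestronglyMeasurable)
    (fun n => .of_forall fun w => ?_) (fun n => (ae_restrict_iff' hms).2 (.of_forall fun w hw => ?_))
    (fun n => ((hcon1 n).1.const_mul _).const_mul _)
    (((hui.const_mul _).mul_const _).const_mul _) ((ae_restrict_iff' hms).2 (.of_forall fun w hw => ?_))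
    ((ae_restrict_iff' hms).2 (.of_forall fun w hw => ?_)) ?_
  · refine mul_nonneg (by positivity) (integral_nonneg fun w' => mul_nonneg (Real.exp_pos _).le (hg0 _ _ _))
  · have h0 := nonneg_of_mem_stayIn le_rfl hw
    rw [zero_add] at h0
    refine mul_le_mul_of_nonneg_left ?_ (by positivity)
    rw [← hexp, ← integral_const_mul]
    refine integral_mono_of_nonneg (.of_forall fun w' => mul_nonneg (Real.exp_pos _).le (hg0 _ _ _))
      ((hexpi _ h0 _).const_mul G) (.of_forall fun w' => ?_)
    simp only
    rw [mul_comm G]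
    exact mul_le_mul_of_nonneg_left (hG _ _ _) (Real.exp_pos _).le
  · have h0 := nonneg_of_mem_stayIn le_rfl hw
    rw [zero_add] at h0
    have := h.tendsto_reverse h0 k (g := fun a b => g (Bfwd k w) a b)
      (hg.comp (by fun_prop : Continuous fun q : ℝ × ℝ => (Bfwd k w, q.1, q.2)))
      (fun a b => hg0 _ a b) (fun a b => hG _ a b)
    simp_rw [fun w' => h.step.integral_renMeas_lowest k w' (g (Bfwd k w) (Bbwd k w'))] at this
    rwa [mul_assoc] at this
  · have h0 := nonneg_of_mem_stayIn le_rfl hw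
    rw [zero_add] at h0
    have := ((hlap _ h0).shift k).const_mul G
    refine this.congr fun n => by ring
  · have h1 := (((hlap 0 le_rfl).shift (2 * k)).const_mul G)
    refine Tendsto.congr (fun n => ?_) (h1.trans_eq ?_)
    · rw [integral_const_mul, integral_const_mul, ← (hcon1 n).2]
      beta_reduce
      rw [heq, ← hexp]
      simp only [zero_add]
      ring
    · congr 1
      rw [integral_const_mul, integral_mul_const, integral_const_mul, hu k, h.step.ren_down_zero]

end Law

/-! ### Exponential functionals under the conditioned laws -/

lemma killed_mono (ν : Measure ℝ) [IsFiniteMeasure ν] {H H' : Set ℝ} (hH : H ⊆ H') (x : ℝ) (n : ℕ) :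
    killed ν H x n ≤ killed ν H' x n := by
  induction n with
  | zero => exact le_rfl
  | succ n ih => exact Measure.restrict_mono hH (Measure.map_mono (Measure.prod_mono ih le_rfl) (by fun_prop))

lemma ae_summable_of_integral_le {α : Type*} [MeasurableSpace α] {P : Measure α} {f : ℕ → α → ℝ}
    (hf : ∀ i, Integrable (f i) P) (hf0 : ∀ i a, 0 ≤ f i a) {c : ℕ → ℝ} (hc : Summable c)
    (h : ∀ i, ∫ a, f i a ∂P ≤ c i) : ∀ᵐ a ∂P, Summable fun i => f i a := by
  have hc0 : ∀ i, 0 ≤ c i := fun i => (integral_nonneg (hf0 i)).trans (h i)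
  have h1 : ∫⁻ a, ∑' i, ENNReal.ofReal (f i a) ∂P ≠ ⊤ := by
    rw [lintegral_tsum fun i => (hf i).aemeasurable.ennreal_ofReal]
    refine ne_top_of_le_ne_top (ENNReal.ofReal_ne_top (r := ∑' i, c i)) ?_
    rw [ENNReal.ofReal_tsum_of_nonneg hc0 hc]
    refine ENNReal.tsum_le_tsum fun i => ?_
    rw [← ofReal_integral_eq_lintegral_ofReal (hf i) (.of_forall (hf0 i))]
    exact ENNReal.ofReal_le_ofReal (h i)
  filter_upwards [ae_lt_top' (AEMeasurable.tsum fun i => (hf i).aemeasurable.ennreal_ofReal) h1]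
    with a ha
  have := ENNReal.summable_toReal ha.ne
  simpa [ENNReal.toReal_ofReal (hf0 _ a)] using this

/-- The measurable functions of a sequence depending on the coordinates `1, …, k` only. -/
def UpTo {β : Type*} [MeasurableSpace β] (k : ℕ) (φ : (ℕ → ℝ × ℝ) → β) : Prop :=
  Measurable φ ∧ ∀ w w' : ℕ → ℝ × ℝ, (∀ i, 1 ≤ i → i ≤ k → w i = w' i) → φ w = φ w'

lemma upTo_Bfwd (k : ℕ) : UpTo k (Bfwd k) := ⟨measurable_Bfwd k, fun _ _ => Bfwd_congr⟩

lemma upTo_Bbwd (k : ℕ) : UpTo k (Bbwd k) := ⟨measurable_Bbwd k, fun _ _ => Bbwd_congr⟩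

lemma upTo_walk (k : ℕ) : UpTo k (walk stp k) := ⟨measurable_walk_stp k, fun _ _ => walk_congr⟩

lemma upTo_eta (k : ℕ) : UpTo (k + 1) fun w => (w (k + 1)).2 :=
  ⟨measurable_snd.comp (measurable_pi_apply _), fun _ _ h => congrArg Prod.snd (h (k + 1) (by omega) le_rfl)⟩

lemma UpTo.comp {β γ : Type*} [MeasurableSpace β] [MeasurableSpace γ] {k : ℕ}
    {φ : (ℕ → ℝ × ℝ) → β} (hφ : UpTo k φ) {g : β → γ} (hg : Measurable g) : UpTo k fun w => g (φ w) :=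
  ⟨hg.comp hφ.1, fun w w' h => congrArg g (hφ.2 w w' h)⟩

lemma UpTo.measurable_comp {Ω : Type*} {ξ : Ω → ℕ → ℝ × ℝ} {F : ℕ → MeasurableSpace Ω} {k : ℕ}
    {φ : (ℕ → ℝ × ℝ) → ℝ} (hφ : UpTo k φ)
    (hF : ∀ i, 1 ≤ i → i ≤ k → Measurable[F k] fun ω => ξ ω i) :
    Measurable[F k] fun ω => φ (ξ ω) := by
  have h1 : Measurable[F k] fun ω (i : ℕ) => if 1 ≤ i ∧ i ≤ k then ξ ω i else 0 := by
    refine @measurable_pi_lambda _ _ _ (F k) _ _ fun i => ?_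
    by_cases hi : 1 ≤ i ∧ i ≤ k
    · simpa [hi] using hF i hi.1 hi.2
    · simp only [hi, if_false]
      exact measurable_const
  have h2 := hφ.1.comp h1
  refine (congrArg (fun f => Measurable[F k] f) (funext fun ω => ?_)).mp h2
  exact hφ.2 _ _ fun i h1 h2 => by simp [h1, h2]

section Transform

variable {Ω : Type*} [MeasurableSpace Ω] {μ : Measure Ω} {ξ : Ω → ℕ → ℝ × ℝ}
  {F : ℕ → MeasurableSpace Ω} {L : Measure (ℝ × ℝ)} [IsProbabilityMeasure L] {χ σ : ℝ}
  {P : Measure Ω} {z : ℝ}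

/-- The data relating the environment on `Ω` to its canonical version. -/
structure Coding (μ : Measure Ω) (ξ : Ω → ℕ → ℝ × ℝ) (F : ℕ → MeasurableSpace Ω) (L : Measure (ℝ × ℝ))
    [IsProbabilityMeasure L] : Prop where
  meas : Measurable ξ
  map : μ.map ξ = seqLaw L
  adapted : ∀ k i, 1 ≤ i → i ≤ k → Measurable[F k] fun ω => ξ ω i

lemma Coding.integral_plus (hc : Coding μ ξ F L) (h : EnvLaw L χ σ)
    (hP : IsPplus μ (fun i ω => stp i (ξ ω)) F 0 P) {k : ℕ} {φ : (ℕ → ℝ × ℝ) → ℝ} (hφ : UpTo k φ) {C : ℝ}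
    (hC : ∀ w, |φ w| ≤ C) :
    ∫ ω, φ (ξ ω) ∂P = ∫ w in stayIn stp (Ici 0) 0 k,
      φ w * ren (downSeq (L.map Prod.fst)) Iic (walk stp k w) ∂seqLaw L := by
  have hm := measurableSet_stayIn_stp (measurableSet_Ici (a := (0 : ℝ))) 0 k
  have hs := setIntegral_map (μ := μ) (g := ξ)
    (f := fun w => φ w * ren (downSeq (L.map Prod.fst)) Iic (walk stp k w)) hm
    (hφ.1.mul (h.step.measurable_ren_down.comp (measurable_walk_stp k))).aestronglyMeasurable
    hc.meas.aemeasurable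
  rw [hP.2 k _ (hφ.measurable_comp (hc.adapted k)) ⟨C, fun ω => hC _⟩,
    uFun_eq_ren hc.meas hc.map h.step le_rfl, h.step.ren_down_zero, inv_one, one_mul, ← hc.map, hs]
  refine setIntegral_congr_fun (hc.meas hm) fun ω hω => ?_
  have h0 := nonneg_of_mem_stayIn le_rfl (show ξ ω ∈ stayIn stp (Ici 0) 0 k from hω)
  have h1 := uFun_eq_ren hc.meas hc.map h.step h0
  rw [zero_add] at h1
  simp only [zero_add]
  exact congrArg _ h1

lemma Coding.integral_minus (hc : Coding μ ξ F L) (h : EnvLaw L χ σ) (hz : z < 0)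
    (hP : IsPminus μ (fun i ω => stp i (ξ ω)) F z P) {k : ℕ} {φ : (ℕ → ℝ × ℝ) → ℝ} (hφ : UpTo k φ) {C : ℝ}
    (hC : ∀ w, |φ w| ≤ C) :
    ∫ ω, φ (ξ ω) ∂P = (ren (upSeq (L.map Prod.fst)) Iio (-z))⁻¹ * ∫ w in stayIn stp (Iio 0) z k,
      φ w * ren (upSeq (L.map Prod.fst)) Iio (-(z + walk stp k w)) ∂seqLaw L := by
  have hm := measurableSet_stayIn_stp (measurableSet_Iio (a := (0 : ℝ))) z k
  have hw := measurable_walk_stp k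
  have hs := setIntegral_map (μ := μ) (g := ξ)
    (f := fun w => φ w * ren (upSeq (L.map Prod.fst)) Iio (-(z + walk stp k w))) hm
    (hφ.1.mul (h.step.measurable_ren_up.comp (by fun_prop))).aestronglyMeasurable hc.meas.aemeasurable
  rw [hP.2 k _ (hφ.measurable_comp (hc.adapted k)) ⟨C, fun ω => hC _⟩,
    vFun_eq_ren hc.meas hc.map h.step hz, ← hc.map, hs]
  congr 1
  refine setIntegral_congr_fun (hc.meas hm) fun ω hω => ?_
  have h0 := walk_lt_of_mem_stayIn (s := -z) (by linarith)
    (show ξ ω ∈ stayIn stp (Iio 0) (- -z) k by rw [neg_neg]; exact hω) le_rfl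
  exact congrArg _ (vFun_eq_ren hc.meas hc.map h.step (show z + walk stp k (ξ ω) < 0 by linarith))

lemma Coding.ae_plus (hc : Coding μ ξ F L) (h : EnvLaw L χ σ)
    (hP : IsPplus μ (fun i ω => stp i (ξ ω)) F 0 P) {k : ℕ} {q : (ℕ → ℝ × ℝ) → Prop} (hq : UpTo k q)
    (hq' : ∀ᵐ w ∂seqLaw L, w ∈ stayIn stp (Ici 0) 0 k → q w) : ∀ᵐ ω ∂P, q (ξ ω) := by
  have := hP.1
  have hs : MeasurableSet {w | ¬ q w} := measurableSet_setOfPred.2 hq.1.not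
  have hφ : UpTo k ({w | ¬ q w}.indicator (1 : (ℕ → ℝ × ℝ) → ℝ)) :=
    ⟨measurable_one.indicator hs, fun w w' hw => by
      have hi : q w ↔ q w' := iff_of_eq (hq.2 w w' hw)
      by_cases h2 : q w'
      · simp [Set.indicator, h2, hi.2 h2]
      · simp [Set.indicator, h2, mt hi.1 h2]⟩
  have h1 := hc.integral_plus h hP hφ (C := 1) fun w => by
    by_cases hw : q w <;> simp [Set.indicator, hw]
  have h2 : ∫ w in stayIn stp (Ici 0) 0 k, {w | ¬ q w}.indicator (1 : (ℕ → ℝ × ℝ) → ℝ) w *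
      ren (downSeq (L.map Prod.fst)) Iic (walk stp k w) ∂seqLaw L = 0 := by
    refine integral_eq_zero_of_ae ((ae_restrict_iff' (measurableSet_stayIn_stp measurableSet_Ici 0 k)).2 ?_)
    filter_upwards [hq'] with w hw hw'
    simp [Set.indicator, hw hw']
  rw [h2] at h1
  have h3 : ∫ ω, {w | ¬ q w}.indicator (1 : (ℕ → ℝ × ℝ) → ℝ) (ξ ω) ∂P = P.real (ξ ⁻¹' {w | ¬ q w}) := by
    rw [← integral_indicator_one (hc.meas hs)]
    rfl
  rw [h3, measureReal_eq_zero_iff] at h1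
  exact h1

lemma Coding.ae_minus (hc : Coding μ ξ F L) (h : EnvLaw L χ σ) (hz : z < 0)
    (hP : IsPminus μ (fun i ω => stp i (ξ ω)) F z P) {k : ℕ} {q : (ℕ → ℝ × ℝ) → Prop} (hq : UpTo k q)
    (hq' : ∀ᵐ w ∂seqLaw L, w ∈ stayIn stp (Iio 0) z k → q w) : ∀ᵐ ω ∂P, q (ξ ω) := by
  have := hP.1
  have hs : MeasurableSet {w | ¬ q w} := measurableSet_setOfPred.2 hq.1.not
  have hφ : UpTo k ({w | ¬ q w}.indicator (1 : (ℕ → ℝ × ℝ) → ℝ)) :=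
    ⟨measurable_one.indicator hs, fun w w' hw => by
      have hi : q w ↔ q w' := iff_of_eq (hq.2 w w' hw)
      by_cases h2 : q w'
      · simp [Set.indicator, h2, hi.2 h2]
      · simp [Set.indicator, h2, mt hi.1 h2]⟩
  have h1 := hc.integral_minus h hz hP hφ (C := 1) fun w => by
    by_cases hw : q w <;> simp [Set.indicator, hw]
  have h2 : ∫ w in stayIn stp (Iio 0) z k, {w | ¬ q w}.indicator (1 : (ℕ → ℝ × ℝ) → ℝ) w *
      ren (upSeq (L.map Prod.fst)) Iio (-(z + walk stp k w)) ∂seqLaw L = 0 := by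
    refine integral_eq_zero_of_ae ((ae_restrict_iff' (measurableSet_stayIn_stp measurableSet_Iio z k)).2 ?_)
    filter_upwards [hq'] with w hw hw'
    simp [Set.indicator, hw hw']
  rw [h2, mul_zero] at h1
  have h3 : ∫ ω, {w | ¬ q w}.indicator (1 : (ℕ → ℝ × ℝ) → ℝ) (ξ ω) ∂P = P.real (ξ ⁻¹' {w | ¬ q w}) := by
    rw [← integral_indicator_one (hc.meas hs)]
    rfl
  rw [h3, measureReal_eq_zero_iff] at h1
  exact h1

/-- A bounded version of the exponential. -/
lemma abs_exp_min_le (y : ℝ) : |Real.exp (min y 0)| ≤ 1 := by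
  rw [abs_of_pos (Real.exp_pos _)]
  exact Real.exp_le_one_iff.2 (min_le_right _ _)

/-- The forward exponential functional of the whole sequence. -/
def BfwdInf (w : ℕ → ℝ × ℝ) : ℝ := ∑' i, (w (i + 1)).2 * Real.exp (-walk stp i w)

/-- The backward exponential functional of the whole sequence. -/
def BbwdInf (w : ℕ → ℝ × ℝ) : ℝ := ∑' i, (w (i + 1)).2 * Real.exp (walk stp (i + 1) w)

lemma EnvLaw.ae_eta (h : EnvLaw L χ σ) :
    ∀ᵐ w ∂seqLaw L, ∀ i, 0 ≤ (w i).2 ∧ (w i).2 ≤ χ⁻¹ :=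
  ae_seqLaw (q := fun p => 0 ≤ p.2 ∧ p.2 ≤ χ⁻¹) (by
    filter_upwards [h.le_eta, h.eta_le] with p h1 h2 using ⟨h.pos.le.trans h1, h2⟩)

lemma upTo_eta_bound (χ : ℝ) (i : ℕ) :
    UpTo (i + 1) fun w => 0 ≤ (w (i + 1)).2 ∧ (w (i + 1)).2 ≤ χ⁻¹ :=
  (upTo_eta i).comp (g := fun y : ℝ => 0 ≤ y ∧ y ≤ χ⁻¹)
    (measurableSet_setOfPred.1 (measurableSet_Icc (a := (0 : ℝ)) (b := χ⁻¹)))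

lemma summable_eta_mul {a b : ℕ → ℝ} {C : ℝ} (ha : ∀ i, 0 ≤ a i ∧ a i ≤ C) (hb : Summable b)
    (hb0 : ∀ i, 0 ≤ b i) : Summable fun i => a i * b i :=
  (hb.mul_left C).of_nonneg_of_le (fun i => mul_nonneg (ha i).1 (hb0 i))
    fun i => mul_le_mul_of_nonneg_right (ha i).2 (hb0 i)

lemma Coding.tendsto_Bfwd (hc : Coding μ ξ F L) (h : EnvLaw L χ σ)
    (hP : IsPplus μ (fun i ω => stp i (ξ ω)) F 0 P) :
    ∀ᵐ ω ∂P, Tendsto (fun k => Bfwd k (ξ ω)) atTop (𝓝 (BfwdInf (ξ ω))) := by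
  have hpr := hP.1
  have hst := h.step.prob
  obtain ⟨C, hC, hle⟩ := h.step.lap_killed_le (θ := 1 / 2) (δ := 1) (by norm_num) one_pos
  have hdown : LadderSeq (downSeq (L.map Prod.fst)) (lltConst σ) := h.step.ladderSeq_neg
  set D := ∑' n, lap (downSeq (L.map Prod.fst) n) (1 / 2)
  have hD : 0 ≤ D := tsum_nonneg fun n => lap_nonneg _ _
  have hup : ∀ i, UpTo i fun w => Real.exp (min (-walk stp i w) 0) := fun i =>
    (upTo_walk i).comp (g := fun y => Real.exp (min (-y) 0)) (by fun_prop)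
  have hb : ∀ i, ∫ ω, Real.exp (min (-walk stp i (ξ ω)) 0) ∂P ≤ D * (C * Real.exp (1 * 0)) * wt i := by
    intro i
    have hw := measurable_walk_stp i
    rw [hc.integral_plus h hP (hup i) fun w => abs_exp_min_le _, mul_assoc]
    have h1 : ∫ w in stayIn stp (Ici 0) 0 i, D * Real.exp (-(1 / 2) * (0 + walk stp i w)) ∂seqLaw L
        ≤ D * (C * Real.exp (1 * 0) * wt i) := by
      rw [integral_const_mul, setIntegral_exp_stayIn]
      exact mul_le_mul_of_nonneg_left (hle 0 le_rfl i) hD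
    refine le_trans (integral_mono_of_nonneg (.of_forall fun w => mul_nonneg (Real.exp_pos _).le (ren_nonneg _))
      ?_ ((ae_restrict_iff' (measurableSet_stayIn_stp measurableSet_Ici 0 i)).2 (.of_forall fun w hw => ?_))) h1
    · refine (integrableOn_stayIn_of_bound (C := 1) (by fun_prop) (.of_forall fun w hw => ?_)).const_mul D
      rw [abs_of_pos (Real.exp_pos _)]
      exact Real.exp_le_one_iff.2 (by linarith [nonneg_of_mem_stayIn le_rfl hw])
    · have h0 := nonneg_of_mem_stayIn le_rfl hw
      rw [zero_add] at h0
      have h2 := hdown.ren_le halfLines_Iic (θ := 1 / 2) (by norm_num) (walk stp i w)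
      refine (mul_le_mul_of_nonneg_left h2 (Real.exp_pos _).le).trans_eq ?_
      rw [min_eq_left (by linarith), ← mul_assoc, ← Real.exp_add, mul_comm]
      congr 2
      ring
  have hsum := ae_summable_of_integral_le (P := P) (f := fun i ω => Real.exp (min (-walk stp i (ξ ω)) 0))
    (fun i => (integrable_const 1).mono' ((hup i).1.comp hc.meas).aestronglyMeasurable
      (.of_forall fun ω => abs_exp_min_le _)) (fun i ω => (Real.exp_pos _).le)
    (summable_wt.mul_left _) hb
  have hpos : ∀ᵐ ω ∂P, ∀ i, 0 ≤ walk stp i (ξ ω) := ae_all_iff.2 fun i =>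
    hc.ae_plus h hP ((upTo_walk i).comp (g := fun y : ℝ => 0 ≤ y)
      (measurableSet_setOfPred.1 (measurableSet_Ici (a := (0 : ℝ))))) (.of_forall fun w hw => by
        simpa using nonneg_of_mem_stayIn le_rfl hw)
  have heta : ∀ᵐ ω ∂P, ∀ i, 0 ≤ (ξ ω (i + 1)).2 ∧ (ξ ω (i + 1)).2 ≤ χ⁻¹ := ae_all_iff.2 fun i =>
    hc.ae_plus h hP (upTo_eta_bound χ i) (by filter_upwards [h.ae_eta] with w hw _ using hw _)
  filter_upwards [hsum, hpos, heta] with ω h1 h2 h3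
  have h4 : Summable fun i => Real.exp (-walk stp i (ξ ω)) :=
    h1.congr fun i => by rw [min_eq_left (by linarith [h2 i])]
  exact (summable_eta_mul h3 h4 fun i => (Real.exp_pos _).le).hasSum.tendsto_sum_nat

lemma Coding.tendsto_Bbwd (hc : Coding μ ξ F L) (h : EnvLaw L χ σ) (hz : z < 0)
    (hP : IsPminus μ (fun i ω => stp i (ξ ω)) F z P) :
    ∀ᵐ ω ∂P, Tendsto (fun k => Bbwd k (ξ ω)) atTop (𝓝 (BbwdInf (ξ ω))) := by
  have hpr := hP.1
  have hst := h.step.prob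
  obtain ⟨C, hC, hle⟩ := h.step.neg.lap_killed_le (θ := 1 / 2) (δ := 1) (by norm_num) one_pos
  have hup' : LadderSeq (upSeq (L.map Prod.fst)) (lltConst σ) := h.step.ladderSeq_pos
  set D := ∑' n, lap (upSeq (L.map Prod.fst) n) (1 / 2)
  have hD : 0 ≤ D := tsum_nonneg fun n => lap_nonneg _ _
  have hup : ∀ i, UpTo i fun w => Real.exp (min (z + walk stp i w) 0) := fun i =>
    (upTo_walk i).comp (g := fun y => Real.exp (min (z + y) 0)) (by fun_prop)
  have hneg : ∀ {i w}, w ∈ stayIn stp (Iio 0) z i → z + walk stp i w < 0 := fun {i w} hw => by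
    have := walk_lt_of_mem_stayIn (s := -z) (by linarith) (by rw [neg_neg]; exact hw) (le_refl i)
    linarith
  set A := (ren (upSeq (L.map Prod.fst)) Iio (-z))⁻¹
  have hA : 0 ≤ A := inv_nonneg.2 (ren_nonneg _)
  have hb : ∀ i, ∫ ω, Real.exp (min (z + walk stp i (ξ ω)) 0) ∂P
      ≤ A * (D * (C * Real.exp (1 * -z))) * wt i := by
    intro i
    have hw := measurable_walk_stp i
    have hms := measurableSet_stayIn_stp (measurableSet_Iio (a := (0 : ℝ))) z i
    rw [hc.integral_minus h hz hP (hup i) fun w => abs_exp_min_le _, mul_assoc]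
    refine mul_le_mul_of_nonneg_left ?_ hA
    have h1 : ∫ w in stayIn stp (Iio 0) z i, D * Real.exp (1 / 2 * (z + walk stp i w)) ∂seqLaw L
        ≤ D * (C * Real.exp (1 * -z)) * wt i := by
      rw [integral_const_mul, setIntegral_stayIn L measurableSet_Iio z i
        (f := fun y => Real.exp (1 / 2 * y)) (by fun_prop), mul_assoc]
      refine mul_le_mul_of_nonneg_left ?_ hD
      refine le_trans ?_ (hle (-z) (by linarith) i)
      rw [lap, killed_neg _ measurableSet_Ici, neg_neg, integral_map measurable_neg.aemeasurable
        (by fun_prop)]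
      have e : (Neg.neg ⁻¹' Ici (0 : ℝ)) = Iic 0 := by ext; simp
      simp only [e, neg_mul_neg]
      refine integral_mono_measure (killed_mono _ Iio_subset_Iic_self _ _)
        (.of_forall fun _ => (Real.exp_pos _).le) ?_
      have hk := killed_compl (L.map Prod.fst) measurableSet_Iic (mem_Iic.2 hz.le) i
      have hf := killed_mass_le_one (L.map Prod.fst) (Iic 0) z i
      have : IsFiniteMeasure (killed (L.map Prod.fst) (Iic 0) z i) := ⟨hf.trans_lt ENNReal.one_lt_top⟩
      refine (integrable_const (1 : ℝ)).mono' (by fun_prop) ?_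
      have hae : ∀ᵐ y ∂killed (L.map Prod.fst) (Iic 0) z i, y ∈ Iic (0 : ℝ) := hk
      filter_upwards [hae] with y hy
      rw [Real.norm_of_nonneg (Real.exp_pos _).le]
      exact Real.exp_le_one_iff.2 (by have := mem_Iic.1 hy; linarith)
    refine le_trans (integral_mono_of_nonneg (.of_forall fun w => mul_nonneg (Real.exp_pos _).le (ren_nonneg _))
      ?_ ((ae_restrict_iff' hms).2 (.of_forall fun w hw => ?_))) h1
    · refine (Integrable.mono' (integrable_const 1) (by fun_prop) ((ae_restrict_iff' hms).2
        (.of_forall fun w hw => ?_))).const_mul D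
      rw [Real.norm_of_nonneg (Real.exp_pos _).le]
      exact Real.exp_le_one_iff.2 (by linarith [hneg hw])
    · have h0 := hneg hw
      have h2 := hup'.ren_le halfLines_Iio (θ := 1 / 2) (by norm_num) (-(z + walk stp i w))
      refine (mul_le_mul_of_nonneg_left h2 (Real.exp_pos _).le).trans_eq ?_
      rw [min_eq_left h0.le, ← mul_assoc, ← Real.exp_add, mul_comm]
      congr 2
      ring
  have hsum := ae_summable_of_integral_le (P := P) (f := fun i ω => Real.exp (min (z + walk stp i (ξ ω)) 0))
    (fun i => (integrable_const 1).mono' ((hup i).1.comp hc.meas).aestronglyMeasurable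
      (.of_forall fun ω => abs_exp_min_le _)) (fun i ω => (Real.exp_pos _).le)
    (summable_wt.mul_left _) hb
  have hlt : ∀ᵐ ω ∂P, ∀ i, z + walk stp i (ξ ω) ≤ 0 := ae_all_iff.2 fun i =>
    hc.ae_minus h hz hP ((upTo_walk i).comp (g := fun y : ℝ => z + y ≤ 0)
      (measurableSet_setOfPred.1 (measurableSet_le (by fun_prop) measurable_const)))
      (.of_forall fun w hw => (hneg hw).le)
  have heta : ∀ᵐ ω ∂P, ∀ i, 0 ≤ (ξ ω (i + 1)).2 ∧ (ξ ω (i + 1)).2 ≤ χ⁻¹ := ae_all_iff.2 fun i =>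
    hc.ae_minus h hz hP (upTo_eta_bound χ i) (by filter_upwards [h.ae_eta] with w hw _ using hw _)
  filter_upwards [hsum, hlt, heta] with ω h1 h2 h3
  have h4 : Summable fun i => Real.exp (walk stp (i + 1) (ξ ω)) := by
    have h5 := ((summable_nat_add_iff 1).2 h1).mul_left (Real.exp (-z))
    refine h5.congr fun i => ?_
    rw [min_eq_left (h2 _), ← Real.exp_add]
    congr 1
    ring
  exact (summable_eta_mul h3 h4 fun i => (Real.exp_pos _).le).hasSum.tendsto_sum_nat

end Transform

/-! ### The limit of the truncated functionals -/

lemma integral_prod_right_comm {α β γ : Type*} [MeasurableSpace α] [MeasurableSpace β] [MeasurableSpace γ]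
    {μ : Measure α} {ν : Measure β} {τ : Measure γ} [SFinite μ] [SFinite ν] [SFinite τ]
    {f : α → β → γ → ℝ}
    (hf : Integrable (fun q : α × β × γ => f q.1 q.2.1 q.2.2) (μ.prod (ν.prod τ))) :
    AEStronglyMeasurable (fun b => ∫ a, (∫ c, f a b c ∂τ) ∂μ) ν ∧
      ∫ a, (∫ b, (∫ c, f a b c ∂τ) ∂ν) ∂μ = ∫ b, (∫ a, (∫ c, f a b c ∂τ) ∂μ) ∂ν := by
  have h1 := (measurePreserving_prodAssoc μ ν τ).integrable_comp_of_integrable hf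
  have h2 : Integrable (fun p : α × β => ∫ c, f p.1 p.2 c ∂τ) (μ.prod ν) := h1.integral_prod_left
  exact ⟨h2.integral_prod_right.aestronglyMeasurable, integral_integral_swap h2⟩

section Limit

variable {Ω : Type*} [MeasurableSpace Ω] {μ : Measure Ω} {ξ : Ω → ℕ → ℝ × ℝ}
  {F : ℕ → MeasurableSpace Ω} {L : Measure (ℝ × ℝ)} [IsProbabilityMeasure L] {χ σ : ℝ}
  {P : Measure Ω} {Pm : ℝ → Measure Ω} {g : ℝ → ℝ → ℝ → ℝ} {G : ℝ}

lemma Coding.integral_ren_down (hc : Coding μ ξ F L) (h : EnvLaw L χ σ)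
    (hP : IsPplus μ (fun i ω => stp i (ξ ω)) F 0 P) (k : ℕ) :
    ∫ w in stayIn stp (Ici 0) 0 k, ren (downSeq (L.map Prod.fst)) Iic (walk stp k w) ∂seqLaw L = 1 := by
  have := hP.1
  have h1 := hc.integral_plus h hP (k := k) (φ := fun _ => 1) ⟨measurable_const, fun _ _ _ => rfl⟩
    (C := 1) fun w => by simp
  simpa using h1.symm

lemma Coding.integral_backDensity (hc : Coding μ ξ F L) (h : EnvLaw L χ σ) {s : ℝ} (hs : 0 < s)
    (hP : IsPminus μ (fun i ω => stp i (ξ ω)) F (-s) P) {k : ℕ} {φ : (ℕ → ℝ × ℝ) → ℝ} (hφ : UpTo k φ)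
    {C : ℝ} (hC : ∀ w, |φ w| ≤ C) :
    ∫ w, backDensity (L.map Prod.fst) k w s * φ w ∂seqLaw L
      = upDensity (L.map Prod.fst) s * ∫ ω, φ (ξ ω) ∂P := by
  have hm := measurableSet_stayIn_stp (measurableSet_Iio (a := (0 : ℝ))) (-s) k
  have hone := h.step.one_le_ren_up hs
  have hr : ∀ r e i : ℝ, 1 ≤ r → r * e * (r⁻¹ * i) = e * i := fun r e i hr => by field_simp
  rw [hc.integral_minus h (by linarith) hP hφ hC, ← integral_indicator hm, neg_neg, upDensity,
    indicator_of_mem (mem_Ioi.2 hs), hr _ _ _ hone, ← integral_const_mul]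
  refine integral_congr_ae (.of_forall fun w => ?_)
  by_cases hw : w ∈ stayIn stp (Iio 0) (-s) k
  · simp only [backDensity, Set.indicator, mem_ofPred_eq, hs, hw, and_self, if_true]
    rw [show -(-s + walk stp k w) = s - walk stp k w by ring]
    ring
  · simp [backDensity, Set.indicator, hw]

lemma blockLimit_eq (hc : Coding μ ξ F L) (h : EnvLaw L χ σ)
    (hP : IsPplus μ (fun i ω => stp i (ξ ω)) F 0 P)
    (hPm : ∀ x ≤ 0, IsPminus μ (fun i ω => stp i (ξ ω)) F x (Pm x))
    (hg : Continuous fun q : ℝ × ℝ × ℝ => g q.1 q.2.1 q.2.2)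
    (hG : ∀ a b c, |g a b c| ≤ G) (k : ℕ) :
    AEStronglyMeasurable (fun s => upDensity (L.map Prod.fst) s *
        ∫ ω₁, (∫ ω₂, g (Bfwd k (ξ ω₁)) (Bbwd k (ξ ω₂)) (Real.exp (-s)) ∂Pm (-s)) ∂P) ∧
      blockLimit L g k = ∫ s, upDensity (L.map Prod.fst) s *
        ∫ ω₁, (∫ ω₂, g (Bfwd k (ξ ω₁)) (Bbwd k (ξ ω₂)) (Real.exp (-s)) ∂Pm (-s)) ∂P := by
  have hu := integrable_of_integral_eq_one (hc.integral_ren_down h hP k)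
  have hb := h.integrable_backDensity k
  have hgm := hg.measurable
  have hbm := h.step.measurable_backDensity k
  have hum := h.step.measurable_ren_down.comp (measurable_walk_stp k)
  have hm1 := measurable_Bfwd k
  have hm2 := measurable_Bbwd k
  have hG0 : 0 ≤ G := (abs_nonneg _).trans (hG 0 0 0)
  set ν := L.map Prod.fst
  set m := (seqLaw L).restrict (stayIn stp (Ici 0) 0 k)
  have hgc : Measurable fun q : (ℕ → ℝ × ℝ) × ℝ × (ℕ → ℝ × ℝ) =>
      g (Bfwd k q.1) (Bbwd k q.2.2) (Real.exp (-q.2.1)) :=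
    hgm.comp (f := fun q : (ℕ → ℝ × ℝ) × ℝ × (ℕ → ℝ × ℝ) => (Bfwd k q.1, Bbwd k q.2.2, Real.exp (-q.2.1)))
      (by fun_prop)
  have hint : Integrable (fun q : (ℕ → ℝ × ℝ) × ℝ × (ℕ → ℝ × ℝ) =>
      ren (downSeq ν) Iic (walk stp k q.1) *
        (backDensity ν k q.2.2 q.2.1 * g (Bfwd k q.1) (Bbwd k q.2.2) (Real.exp (-q.2.1))))
      (m.prod (volume.prod (seqLaw L))) := by
    refine ((hu.mul_prod hb.swap).mul_const G).mono' ?_ (.of_forall fun q => ?_)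
    · refine ((hum.comp measurable_fst).mul (Measurable.mul ?_ hgc)).aestronglyMeasurable
      exact hbm.comp (f := fun q : (ℕ → ℝ × ℝ) × ℝ × (ℕ → ℝ × ℝ) => (q.2.2, q.2.1)) (by fun_prop)
    · rw [Real.norm_eq_abs, abs_mul, abs_mul, abs_of_nonneg (ren_nonneg _),
        abs_of_nonneg (backDensity_nonneg _ _ _ _), ← mul_assoc]
      exact mul_le_mul_of_nonneg_left (hG _ _ _) (mul_nonneg (ren_nonneg _) (backDensity_nonneg _ _ _ _))
  obtain ⟨hA, hB⟩ := integral_prod_right_comm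
    (f := fun w₁ s w => ren (downSeq ν) Iic (walk stp k w₁) *
      (backDensity ν k w s * g (Bfwd k w₁) (Bbwd k w) (Real.exp (-s)))) hint
  have hL : blockLimit L g k = ∫ w₁, (∫ s, (∫ w, ren (downSeq ν) Iic (walk stp k w₁) *
      (backDensity ν k w s * g (Bfwd k w₁) (Bbwd k w) (Real.exp (-s))) ∂seqLaw L)) ∂m := by
    refine integral_congr_ae (.of_forall fun w₁ => ?_)
    have hi : Integrable (fun q : (ℕ → ℝ × ℝ) × ℝ => backDensity ν k q.1 q.2 *
        g (Bfwd k w₁) (Bbwd k q.1) (Real.exp (-q.2))) ((seqLaw L).prod volume) := by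
      refine (hb.mul_const G).mono' (hbm.mul (hgc.comp
        (f := fun q : (ℕ → ℝ × ℝ) × ℝ => (w₁, q.2, q.1)) (by fun_prop))).aestronglyMeasurable
        (.of_forall fun q => ?_)
      rw [Real.norm_eq_abs, abs_mul, abs_of_nonneg (backDensity_nonneg _ _ _ _)]
      exact mul_le_mul_of_nonneg_left (hG _ _ _) (backDensity_nonneg _ _ _ _)
    have hsw := integral_integral_swap (f := fun w s => backDensity ν k w s *
      g (Bfwd k w₁) (Bbwd k w) (Real.exp (-s))) hi
    simp only [integral_const_mul]
    rw [hsw]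
  have hR : ∀ s, ∫ w₁, (∫ w, ren (downSeq ν) Iic (walk stp k w₁) *
      (backDensity ν k w s * g (Bfwd k w₁) (Bbwd k w) (Real.exp (-s))) ∂seqLaw L) ∂m
      = upDensity ν s * ∫ ω₁, (∫ ω₂, g (Bfwd k (ξ ω₁)) (Bbwd k (ξ ω₂)) (Real.exp (-s)) ∂Pm (-s)) ∂P := by
    intro s
    rcases le_or_gt s 0 with hs | hs
    · have h1 : ∀ w, backDensity ν k w s = 0 := fun w => by simp [backDensity, Set.indicator, hs.not_gt]
      simp [h1, upDensity, Set.indicator, hs.not_gt]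
    have hmin := hPm (-s) (by linarith)
    have hpr := hmin.1
    have hback : ∀ b, ∫ w, backDensity ν k w s * g b (Bbwd k w) (Real.exp (-s)) ∂seqLaw L
        = upDensity ν s * ∫ ω, g b (Bbwd k (ξ ω)) (Real.exp (-s)) ∂Pm (-s) := fun b =>
      hc.integral_backDensity h hs hmin
        ((upTo_Bbwd k).comp (g := fun y => g b y (Real.exp (-s))) (by fun_prop)) fun w => hG _ _ _
    have hψ : Measurable fun b => ∫ ω, g b (Bbwd k (ξ ω)) (Real.exp (-s)) ∂Pm (-s) := by
      have hξ := hc.meas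
      refine (StronglyMeasurable.integral_prod_right (f := fun b ω => g b (Bbwd k (ξ ω)) (Real.exp (-s)))
        (Measurable.stronglyMeasurable ?_)).measurable
      exact hgm.comp (f := fun q : ℝ × Ω => (q.1, Bbwd k (ξ q.2), Real.exp (-s))) (by fun_prop)
    have hfor := hc.integral_plus h hP ((upTo_Bfwd k).comp hψ) (C := G) fun w => by
      rw [← Real.norm_eq_abs]
      refine (norm_integral_le_of_norm_le_const (C := G) (.of_forall fun ω => hG _ _ _)).trans_eq ?_
      simp
    rw [hfor, ← integral_const_mul]
    refine integral_congr_ae (.of_forall fun w₁ => ?_)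
    simp only [integral_const_mul, hback]
    ring
  rw [hL, hB]
  simp only [hR] at hA ⊢
  exact ⟨hA, trivial⟩

lemma tendsto_blockLimit (hc : Coding μ ξ F L) (h : EnvLaw L χ σ)
    (hP : IsPplus μ (fun i ω => stp i (ξ ω)) F 0 P)
    (hPm : ∀ x ≤ 0, IsPminus μ (fun i ω => stp i (ξ ω)) F x (Pm x))
    (hg : Continuous fun q : ℝ × ℝ × ℝ => g q.1 q.2.1 q.2.2)
    (hG : ∀ a b c, |g a b c| ≤ G) :
    Tendsto (blockLimit L g) atTop (𝓝 (∫ s, upDensity (L.map Prod.fst) s *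
        ∫ ω₁, (∫ ω₂, g (BfwdInf (ξ ω₁)) (BbwdInf (ξ ω₂)) (Real.exp (-s)) ∂Pm (-s)) ∂P)) := by
  have hG0 : 0 ≤ G := (abs_nonneg _).trans (hG 0 0 0)
  have hP1 := hP.1
  have hξ := hc.meas
  have hgm := hg.measurable
  rw [funext fun k => (blockLimit_eq hc h hP hPm hg hG k).2]
  have hin : ∀ {s b : ℝ} (φ : Ω → ℝ), -s ≤ 0 →
      ‖∫ ω₂, g b (φ ω₂) (Real.exp (-s)) ∂Pm (-s)‖ ≤ G := fun {s b} φ hs => by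
    have := (hPm (-s) hs).1
    refine (norm_integral_le_of_norm_le_const (C := G) (.of_forall fun ω => hG _ _ _)).trans_eq ?_
    simp
  refine tendsto_integral_of_dominated_convergence (fun s => upDensity (L.map Prod.fst) s * G)
    (fun k => (blockLimit_eq hc h hP hPm hg hG k).1) (h.step.integrable_upDensity.mul_const G)
    (fun k => .of_forall fun s => ?_) (.of_forall fun s => ?_)
  · rw [norm_mul, Real.norm_of_nonneg (upDensity_nonneg _ _)]
    rcases le_or_gt s 0 with hs | hs
    · simp [upDensity, Set.indicator, hs.not_gt]
    refine mul_le_mul_of_nonneg_left ?_ (upDensity_nonneg _ _)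
    refine (norm_integral_le_of_norm_le_const (C := G)
      (.of_forall fun ω => hin (fun ω₂ => Bbwd k (ξ ω₂)) (by linarith))).trans_eq ?_
    simp
  · rcases le_or_gt s 0 with hs | hs
    · simp [upDensity, Set.indicator, hs.not_gt]
    refine Tendsto.const_mul _ ?_
    have hmin := hPm (-s) (by linarith)
    have hpr := hmin.1
    refine tendsto_integral_of_dominated_convergence (fun _ => G) (fun k => ?_) (integrable_const G)
      (fun k => .of_forall fun ω => hin (fun ω₂ => Bbwd k (ξ ω₂)) (by linarith)) ?_
    · have hb := measurable_Bbwd k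
      have hf := measurable_Bfwd k
      have hψ : Measurable fun b => ∫ ω, g b (Bbwd k (ξ ω)) (Real.exp (-s)) ∂Pm (-s) := by
        refine (StronglyMeasurable.integral_prod_right (f := fun b ω => g b (Bbwd k (ξ ω)) (Real.exp (-s)))
          (Measurable.stronglyMeasurable ?_)).measurable
        exact hgm.comp (f := fun q : ℝ × Ω => (q.1, Bbwd k (ξ q.2), Real.exp (-s))) (by fun_prop)
      exact (hψ.comp (hf.comp hξ)).aestronglyMeasurable
    · filter_upwards [hc.tendsto_Bfwd h hP] with ω₁ h1
      refine tendsto_integral_of_dominated_convergence (fun _ => G) (fun k => ?_) (integrable_const G)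
        (fun k => .of_forall fun ω => hG _ _ _) ?_
      · have hb := measurable_Bbwd k
        exact (hgm.comp (f := fun ω₂ : Ω => (Bfwd k (ξ ω₁), Bbwd k (ξ ω₂), Real.exp (-s)))
          (by fun_prop)).aestronglyMeasurable
      · filter_upwards [hc.tendsto_Bbwd h (by linarith) hmin] with ω₂ h2
        exact (hg.tendsto (BfwdInf (ξ ω₁), BbwdInf (ξ ω₂), Real.exp (-s))).comp
          (h1.prodMk_nhds (h2.prodMk_nhds tendsto_const_nhds))

end Limit

/-! ### The exact functional and its truncation -/

/-- The denominator of the exact functional. -/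
def denom (s l b p : ℝ) : ℝ := s * b + p * (1 + l * b)

lemma denom_one (l b p : ℝ) : denom 1 l b p = b + p * (1 + l * b) := by rw [denom, one_mul]

section Deterministic

variable {χ s₀ s l l' b b' p p' δ : ℝ}

lemma le_denom (hs : s₀ ≤ s) (hb : 0 ≤ b) (hl : 0 ≤ l) (hp : 0 ≤ p) : s₀ * b ≤ denom s l b p := by
  have h1 := mul_le_mul_of_nonneg_right hs hb
  have h2 : 0 ≤ p * (1 + l * b) := by positivity
  rw [denom]
  linarith

lemma abs_inv_denom_sub_le (hχ : 0 < χ) (hs₀ : 0 < s₀) (hs : s₀ ≤ s) (hs1 : s ≤ 1) (hl' : 0 ≤ l')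
    (hll : l' ≤ l) (hb' : χ ≤ b') (hbb : b' ≤ b) (hp' : 0 ≤ p') (hpp : p' ≤ p)
    (h1 : 1 - s ≤ δ) (h2 : l - l' ≤ δ) (h3 : b - b' ≤ δ) (h4 : p - p' ≤ δ) :
    |(denom s l' b p)⁻¹ - (denom 1 l b' p')⁻¹|
      ≤ ((1 + 2 * l) / (s₀ * χ) + 2 / (s₀ * χ ^ 2) + 1 / s₀) * δ := by
  have hl : 0 ≤ l := hl'.trans hll
  have hb : χ ≤ b := hb'.trans hbb
  have hp : 0 ≤ p := hp'.trans hpp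
  have hb0 : 0 < b := hχ.trans_le hb
  have hb'0 : 0 < b' := hχ.trans_le hb'
  have hD := le_denom hs hb0.le hl' hp
  set D := denom s l' b p with hDdef
  set D' := denom 1 l b' p' with hD'def
  have hD'b : χ ≤ D' := hb'.trans (by simpa using le_denom (le_refl (1 : ℝ)) hb'0.le hl hp')
  have hD'p : p' ≤ D' := by
    have : 0 ≤ p' * (l * b') := by positivity
    rw [hD'def, denom_one]
    linarith
  have hD0 : 0 < D := lt_of_lt_of_le (by positivity) hD
  have hD'0 : 0 < D' := hχ.trans_le hD'b
  have hδ : 0 ≤ δ := by linarith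
  have hbD : s₀ * b * D' ≤ D * D' := mul_le_mul_of_nonneg_right hD hD'0.le
  have e1 : b ≤ D * D' / (s₀ * χ) := by
    rw [le_div_iff₀ (by positivity)]
    nlinarith [mul_le_mul_of_nonneg_left hD'b (show 0 ≤ s₀ * b by positivity)]
  have e2 : 1 ≤ D * D' / (s₀ * χ ^ 2) := by
    rw [le_div_iff₀ (by positivity)]
    nlinarith [mul_le_mul_of_nonneg_left hD'b (show 0 ≤ s₀ * b by positivity),
      mul_le_mul_of_nonneg_left hb (show 0 ≤ s₀ * χ by positivity)]
  have e3 : p' ≤ D * D' / (s₀ * χ) := by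
    rw [le_div_iff₀ (by positivity)]
    nlinarith [mul_le_mul_of_nonneg_left hD'p (show 0 ≤ s₀ * b by positivity),
      mul_le_mul_of_nonneg_left hb (show 0 ≤ s₀ * p' by positivity)]
  have e4 : p' * b' ≤ D * D' / s₀ := by
    rw [le_div_iff₀ (by positivity)]
    nlinarith [mul_le_mul_of_nonneg_left hD'p (show 0 ≤ s₀ * b by positivity),
      mul_le_mul_of_nonneg_left hbb (show 0 ≤ s₀ * p' by positivity)]
  have key : D' - D = (1 - s) * b - (b - b') - (p - p') * (1 + l' * b) - p' * l' * (b - b')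
      + p' * (l - l') * b' := by
    rw [hDdef, hD'def, denom, denom]
    ring
  have habs : |D' - D| ≤ (b + 1 + (1 + l * b) + p' * l + p' * b') * δ := by
    have f1 : (1 - s) * b ≤ δ * b := mul_le_mul_of_nonneg_right h1 hb0.le
    have f1' : 0 ≤ (1 - s) * b := mul_nonneg (by linarith) hb0.le
    have f3 : (p - p') * (1 + l' * b) ≤ δ * (1 + l * b) :=
      mul_le_mul h4 (by gcongr) (by positivity) hδ
    have f3' : 0 ≤ (p - p') * (1 + l' * b) := mul_nonneg (by linarith) (by positivity)
    have f4 : p' * l' * (b - b') ≤ p' * l * δ := mul_le_mul (by gcongr) h3 (by linarith) (by positivity)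
    have f4' : 0 ≤ p' * l' * (b - b') := mul_nonneg (by positivity) (by linarith)
    have f5 : p' * (l - l') * b' ≤ p' * δ * b' := by gcongr
    have f5' : 0 ≤ p' * (l - l') * b' := mul_nonneg (mul_nonneg hp' (by linarith)) hb'0.le
    rw [key, abs_le]
    constructor <;> nlinarith
  rw [inv_sub_inv hD0.ne' hD'0.ne', abs_div, abs_of_pos (mul_pos hD0 hD'0), div_le_iff₀ (mul_pos hD0 hD'0)]
  refine habs.trans ?_
  have e5 : b + 1 + (1 + l * b) + p' * l + p' * b' ≤ D * D' / (s₀ * χ) + D * D' / (s₀ * χ ^ 2)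
      + (D * D' / (s₀ * χ ^ 2) + l * (D * D' / (s₀ * χ))) + D * D' / (s₀ * χ) * l + D * D' / s₀ := by
    gcongr
  refine (mul_le_mul_of_nonneg_right e5 hδ).trans_eq ?_
  field_simp
  ring

end Deterministic

lemma abs_discounted_prod_sub_le {y s A B A' B' κ K c E : ℝ} (hy0 : 0 ≤ y) (hs1 : s ≤ 1) (u2 : 0 ≤ A) (u3 : A ≤ κ)
    (v2 : 0 ≤ B) (v3 : B ≤ κ) (hv0 : 0 ≤ A') (hv1 : A' ≤ κ) (d1 : 1 - s ≤ c * E)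
    (u1 : |A - A'| ≤ K * (c * E)) (v1 : |B - B'| ≤ K * (c * E)) :
    |y * (s * (A * B)) - y * (A' * B')| ≤ (2 * K * κ + κ ^ 2) * c * (y * E) := by
  have e : y * (s * (A * B)) - y * (A' * B') = y * (-((1 - s) * (A * B)) + (A - A') * B + A' * (B - B')) := by
    ring
  rw [e, abs_mul, abs_of_nonneg hy0]
  have t1 : |(1 - s) * (A * B)| ≤ κ ^ 2 * (c * E) := by
    rw [abs_of_nonneg (mul_nonneg (by linarith) (mul_nonneg u2 v2)), mul_comm, sq]
    exact mul_le_mul (mul_le_mul u3 v3 v2 (u2.trans u3)) d1 (by linarith) (mul_nonneg (u2.trans u3) (v2.trans v3))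
  have t2 : |(A - A') * B| ≤ K * (c * E) * κ := by
    rw [abs_mul, abs_of_nonneg v2]
    exact mul_le_mul u1 v3 v2 ((abs_nonneg _).trans u1)
  have t3 : |A' * (B - B')| ≤ κ * (K * (c * E)) := by
    rw [abs_mul, abs_of_nonneg hv0]
    exact mul_le_mul hv1 v1 (abs_nonneg _) (u2.trans u3)
  have t4 : |-((1 - s) * (A * B)) + (A - A') * B + A' * (B - B')| ≤ (2 * K * κ + κ ^ 2) * c * E := by
    refine (abs_add_three _ _ _).trans ?_
    rw [abs_neg]
    linarith
  refine (mul_le_mul_of_nonneg_left t4 hy0).trans_eq ?_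
  ring

lemma exp_neg_le_quadratic {y : ℝ} (hy : 0 ≤ y) : Real.exp (-y) ≤ 1 - y + y ^ 2 := by
  have h1 := Real.add_one_le_exp y
  rw [Real.exp_neg, inv_le_comm₀ (Real.exp_pos _) (by nlinarith)]
  refine le_trans ?_ h1
  rw [inv_le_iff_one_le_mul₀ (by nlinarith)]
  nlinarith [pow_nonneg hy 3]

/-- The effective rate `(1 - e^{-λx}) / x`. -/
def effRate (lam x : ℝ) : ℝ := (1 - Real.exp (-lam * x)) / x

lemma effRate_nonneg {lam x : ℝ} (hl : 0 ≤ lam) (hx : 0 < x) : 0 ≤ effRate lam x := by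
  refine div_nonneg ?_ hx.le
  have : Real.exp (-lam * x) ≤ 1 := Real.exp_le_one_iff.2 (by nlinarith)
  linarith

lemma effRate_le {lam x : ℝ} (hx : 0 < x) : effRate lam x ≤ lam := by
  rw [effRate, div_le_iff₀ hx]
  have := Real.add_one_le_exp (-lam * x)
  linarith

lemma sub_effRate_le {lam x : ℝ} (hl : 0 ≤ lam) (hx : 0 < x) : lam - effRate lam x ≤ lam ^ 2 * x := by
  have h := exp_neg_le_quadratic (mul_nonneg hl hx.le)
  rw [← neg_mul] at h
  have : lam - lam ^ 2 * x ≤ effRate lam x := by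
    rw [effRate, le_div_iff₀ hx]
    linarith
  linarith

/-- The contribution of the environment after time `j` to the exact functional. -/
def gapTerm (a β lam ρ : ℝ) (M N : ℕ) (w : ℕ → ℝ × ℝ) : ℝ :=
  Real.exp (-walk stp N w) * (Real.exp (-lam * (a * Real.exp (-walk stp M w))) *
    ((denom (Real.exp (-lam * (a * Real.exp (-walk stp M w)))) (effRate lam (a * Real.exp (-walk stp M w)))
        (β + a * Bfwd M w) (a * (Real.exp (-walk stp N w) * ρ + (Bfwd N w - Bfwd M w))))⁻¹ *
      (denom (Real.exp (-lam * (a * Real.exp (-walk stp M w)))) (effRate lam (a * Real.exp (-walk stp M w)))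
        (β + a * Bfwd M w) (a * (Real.exp (-walk stp N w) * 1 + (Bfwd N w - Bfwd M w))))⁻¹))

/-- The continuous version of `(b + (1 + λ b) p)⁻¹`. -/
def recip (χ lam b p : ℝ) : ℝ := (denom 1 lam (max b χ) (max p 0))⁻¹

lemma continuous_recip {χ lam : ℝ} (hχ : 0 < χ) (hl : 0 ≤ lam) :
    Continuous fun q : ℝ × ℝ => recip χ lam q.1 q.2 := by
  unfold recip denom
  refine Continuous.inv₀ (by fun_prop) fun q => ne_of_gt ?_
  have h1 : 0 < max q.1 χ := lt_max_of_lt_right hχ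
  have h2 : 0 ≤ max q.2 0 := le_max_right _ _
  positivity

lemma recip_nonneg {χ lam : ℝ} (hχ : 0 < χ) (hl : 0 ≤ lam) (b p : ℝ) : 0 ≤ recip χ lam b p := by
  have h1 : 0 < max b χ := lt_max_of_lt_right hχ
  have h2 : 0 ≤ max p 0 := le_max_right _ _
  rw [recip, denom]
  positivity

lemma recip_le {χ lam : ℝ} (hχ : 0 < χ) (hl : 0 ≤ lam) (b p : ℝ) : recip χ lam b p ≤ χ⁻¹ := by
  have h1 : 0 < max b χ := lt_max_of_lt_right hχ
  have h2 : 0 ≤ max p 0 := le_max_right _ _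
  have h3 := le_denom (le_refl (1 : ℝ)) h1.le hl h2
  exact inv_anti₀ hχ (by linarith [le_max_right b χ])

/-- The limiting functional. -/
def limTerm (χ a β lam ρ B B' y : ℝ) : ℝ :=
  recip χ lam (β + a * B) (a * (y * (ρ + B'))) * recip χ lam (β + a * B) (a * (y * (1 + B')))

lemma continuous_limTerm {χ lam : ℝ} (hχ : 0 < χ) (hl : 0 ≤ lam) (a β ρ : ℝ) :
    Continuous fun q : ℝ × ℝ × ℝ => limTerm χ a β lam ρ q.1 q.2.1 q.2.2 := by
  have h := continuous_recip hχ hl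
  unfold limTerm
  exact (h.comp (f := fun q : ℝ × ℝ × ℝ => (β + a * q.1, a * (q.2.2 * (ρ + q.2.1)))) (by fun_prop)).mul
    (h.comp (f := fun q : ℝ × ℝ × ℝ => (β + a * q.1, a * (q.2.2 * (1 + q.2.1)))) (by fun_prop))

lemma limTerm_nonneg {χ lam : ℝ} (hχ : 0 < χ) (hl : 0 ≤ lam) (a β ρ B B' y : ℝ) :
    0 ≤ limTerm χ a β lam ρ B B' y :=
  mul_nonneg (recip_nonneg hχ hl _ _) (recip_nonneg hχ hl _ _)

lemma limTerm_le {χ lam : ℝ} (hχ : 0 < χ) (hl : 0 ≤ lam) (a β ρ B B' y : ℝ) :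
    limTerm χ a β lam ρ B B' y ≤ χ⁻¹ * χ⁻¹ :=
  mul_le_mul (recip_le hχ hl _ _) (recip_le hχ hl _ _) (recip_nonneg hχ hl _ _) (inv_nonneg.2 hχ.le)

lemma exp_mul_Bbwd_revSeq {k N : ℕ} (hk : k ≤ N) (w : ℕ → ℝ × ℝ) :
    Real.exp (-walk stp N w) * Bbwd k (revSeq N w) = Bfwd N w - Bfwd (N - k) w := by
  induction k with
  | zero => simp [Bbwd]
  | succ k ih =>
    have h1 : ∀ i ≤ N, walk stp i (revSeq N w) = walk stp N w - walk stp (N - i) w := by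
      intro i hi
      induction i with
      | zero => simp [walk_zero]
      | succ i ih =>
        rw [walk_succ, ih (by omega), show N - i = N - (i + 1) + 1 by omega, walk_succ]
        simp only [stp, revSeq]
        rw [show N + 1 - (i + 1) = N - (i + 1) + 1 by omega]
        ring
    have h2 : Bbwd (k + 1) (revSeq N w) = Bbwd k (revSeq N w) + (revSeq N w (k + 1)).2 *
        Real.exp (walk stp (k + 1) (revSeq N w)) := Finset.sum_range_succ _ _
    have h3 : Bfwd (N - k) w = Bfwd (N - (k + 1)) w + (w (N - k)).2 * Real.exp (-walk stp (N - (k + 1)) w) := by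
      rw [show N - k = N - (k + 1) + 1 by omega]
      exact Finset.sum_range_succ _ _
    rw [h2, mul_add, ih (by omega), h1 _ hk, h3, revSeq, show N + 1 - (k + 1) = N - k by omega,
      mul_left_comm, ← Real.exp_add]
    ring_nf

/-- The sequences for which the bounds on the environment and the walk hold. -/
def Good (χ : ℝ) (N : ℕ) (w : ℕ → ℝ × ℝ) : Prop :=
  (∀ i, χ ≤ (w i).2 ∧ (w i).2 ≤ χ⁻¹) ∧ ∀ i ≤ N, 0 ≤ walk stp i w

section Good

variable {χ a β lam ρ : ℝ} {N : ℕ} {w : ℕ → ℝ × ℝ}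

lemma Bfwd_sub_le (hχ : 0 < χ) (hw : Good χ N w) {k M : ℕ} (hkM : k ≤ M) :
    0 ≤ Bfwd M w - Bfwd k w ∧ Bfwd M w - Bfwd k w ≤ χ⁻¹ * ∑ i ∈ Finset.Ico k M, Real.exp (-walk stp i w) := by
  rw [Bfwd, Bfwd, ← Finset.sum_Ico_eq_sub _ hkM, Finset.mul_sum]
  exact ⟨Finset.sum_nonneg fun i _ => mul_nonneg (hχ.le.trans (hw.1 _).1) (Real.exp_pos _).le,
    Finset.sum_le_sum fun i _ => mul_le_mul_of_nonneg_right (hw.1 _).2 (Real.exp_pos _).le⟩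

lemma le_Bfwd (hχ : 0 < χ) (hw : Good χ N w) {k : ℕ} (hk : 1 ≤ k) : χ ≤ Bfwd k w := by
  have h1 := (Bfwd_sub_le hχ hw hk).1
  have h2 : Bfwd 1 w = (w 1).2 := by simp [Bfwd, walk_zero]
  have := (hw.1 1).1
  linarith

/-- The Lipschitz constant of the truncation. -/
def truncConst (χ a lam : ℝ) : ℝ :=
  (2 * ((1 + 2 * lam) / (Real.exp (-lam * a) * χ) + 2 / (Real.exp (-lam * a) * χ ^ 2) +
    1 / Real.exp (-lam * a)) * (Real.exp (-lam * a) * χ)⁻¹ + (Real.exp (-lam * a) * χ)⁻¹ ^ 2) *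
    (lam * a + a * χ⁻¹ + lam ^ 2 * a)

set_option maxHeartbeats 1000000 in
lemma abs_gapTerm_sub_truncated_le (hχ : 0 < χ) (hχ1 : χ < 1) (ha : 1 ≤ a) (hβ : 0 ≤ β) (hl : 0 ≤ lam) (hρ : 0 ≤ ρ)
    (hw : Good χ N w) {k M : ℕ} (hk : 1 ≤ k) (hkM : k ≤ M) (hMN : M ≤ N - k) (hkN : k ≤ N) :
    |gapTerm a β lam ρ M N w - truncated (limTerm χ a β lam ρ) k N w|
      ≤ truncConst χ a lam * ∑ i ∈ Finset.Icc k (N - k), Real.exp (-walk stp N w) * Real.exp (-walk stp i w) := by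
  have ha0 : 0 < a := by linarith
  have hM0 : Real.exp (-walk stp M w) ≤ 1 := Real.exp_le_one_iff.2 (by linarith [hw.2 M (by omega)])
  set x := a * Real.exp (-walk stp M w) with hx
  have hx0 : 0 < x := mul_pos ha0 (Real.exp_pos _)
  have hxa : x ≤ a := by nlinarith
  set s := Real.exp (-lam * x) with hs
  set s₀ := Real.exp (-lam * a) with hs₀
  have hs₀0 : 0 < s₀ := Real.exp_pos _
  have hss : s₀ ≤ s := Real.exp_le_exp.2 (by nlinarith)
  have hs1 : s ≤ 1 := Real.exp_le_one_iff.2 (by nlinarith)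
  have hs0 : 0 < s := Real.exp_pos _
  set E := ∑ i ∈ Finset.Icc k (N - k), Real.exp (-walk stp i w) with hE
  have hsub : ∀ t ⊆ Finset.Icc k (N - k), ∑ i ∈ t, Real.exp (-walk stp i w) ≤ E := fun t ht =>
    Finset.sum_le_sum_of_subset_of_nonneg ht fun i _ _ => (Real.exp_pos _).le
  have hE0 : 0 ≤ E := Finset.sum_nonneg fun i _ => (Real.exp_pos _).le
  have hEM : Real.exp (-walk stp M w) ≤ E := by
    simpa using hsub {M} (by simp [hkM, hMN])
  have hxE : x ≤ a * E := mul_le_mul_of_nonneg_left hEM ha0.le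
  obtain ⟨hb1, hb2⟩ := Bfwd_sub_le hχ hw hkM
  obtain ⟨hp1, hp2⟩ := Bfwd_sub_le hχ hw hMN
  obtain ⟨hq1, hq2⟩ := Bfwd_sub_le hχ hw (show N - k ≤ N by omega)
  have hb3 := hb2.trans (mul_le_mul_of_nonneg_left (hsub (Finset.Ico k M) fun i hi => by
    simp only [Finset.mem_Ico, Finset.mem_Icc] at hi ⊢; omega) (inv_nonneg.2 hχ.le))
  have hp3 := hp2.trans (mul_le_mul_of_nonneg_left (hsub (Finset.Ico M (N - k)) fun i hi => by
    simp only [Finset.mem_Ico, Finset.mem_Icc] at hi ⊢; omega) (inv_nonneg.2 hχ.le))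
  have hbk : χ ≤ β + a * Bfwd k w := by nlinarith [le_Bfwd hχ hw hk]
  set c := lam * a + a * χ⁻¹ + lam ^ 2 * a with hc
  have c1 : 0 ≤ lam * a * E := by positivity
  have c2 : 0 ≤ a * χ⁻¹ * E := by positivity
  have c3 : 0 ≤ lam ^ 2 * a * E := by positivity
  have hcE : c * E = lam * a * E + a * χ⁻¹ * E + lam ^ 2 * a * E := by rw [hc]; ring
  have d1 : 1 - s ≤ c * E := by
    have := Real.add_one_le_exp (-lam * x)
    linarith [mul_le_mul_of_nonneg_left hxE hl]
  have d2 : lam - effRate lam x ≤ c * E := by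
    have := sub_effRate_le hl hx0
    linarith [mul_le_mul_of_nonneg_left hxE (sq_nonneg lam)]
  have d3 : (β + a * Bfwd M w) - (β + a * Bfwd k w) ≤ c * E := by
    linarith [mul_le_mul_of_nonneg_left hb3 ha0.le]
  set K := (1 + 2 * lam) / (s₀ * χ) + 2 / (s₀ * χ ^ 2) + 1 / s₀ with hK
  have hK0 : 0 ≤ K := by positivity
  have hrev := exp_mul_Bbwd_revSeq hkN w
  set y := Real.exp (-walk stp N w) with hy
  have hy0 : 0 < y := Real.exp_pos _
  have hpk : ∀ r : ℝ, a * (y * (r + Bbwd k (revSeq N w))) = a * (y * r + (Bfwd N w - Bfwd (N - k) w)) :=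
    fun r => by rw [← hrev]; ring
  have hfac : ∀ r, 0 ≤ r → |(denom s (effRate lam x) (β + a * Bfwd M w) (a * (y * r + (Bfwd N w - Bfwd M w))))⁻¹
      - recip χ lam (β + a * Bfwd k w) (a * (y * (r + Bbwd k (revSeq N w))))| ≤ K * (c * E) ∧
      0 ≤ (denom s (effRate lam x) (β + a * Bfwd M w) (a * (y * r + (Bfwd N w - Bfwd M w))))⁻¹ ∧
      (denom s (effRate lam x) (β + a * Bfwd M w) (a * (y * r + (Bfwd N w - Bfwd M w))))⁻¹ ≤ (s₀ * χ)⁻¹ := by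
    intro r hr
    have hp0 : 0 ≤ a * (y * r + (Bfwd N w - Bfwd (N - k) w)) := by positivity
    have hpp : a * (y * r + (Bfwd N w - Bfwd (N - k) w)) ≤ a * (y * r + (Bfwd N w - Bfwd M w)) :=
      mul_le_mul_of_nonneg_left (by linarith) ha0.le
    have hbb : β + a * Bfwd k w ≤ β + a * Bfwd M w := by linarith [mul_le_mul_of_nonneg_left hb1 ha0.le]
    have d4 : a * (y * r + (Bfwd N w - Bfwd M w)) - a * (y * r + (Bfwd N w - Bfwd (N - k) w)) ≤ c * E := by
      linarith [mul_le_mul_of_nonneg_left hp3 ha0.le]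
    have hD := le_denom (l := effRate lam x) hss (hχ.le.trans (hbk.trans hbb)) (effRate_nonneg hl hx0)
      (hp0.trans hpp)
    have hD' := (mul_le_mul_of_nonneg_left (hbk.trans hbb) hs₀0.le).trans hD
    have hpos : 0 < s₀ * χ := by positivity
    refine ⟨?_, inv_nonneg.2 (hpos.le.trans hD'), inv_anti₀ hpos hD'⟩
    rw [recip, hpk, max_eq_left hbk, max_eq_left hp0]
    exact abs_inv_denom_sub_le hχ hs₀0 hss hs1 (effRate_nonneg hl hx0) (effRate_le hx0) hbk hbb hp0 hpp
      d1 d2 d3 d4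
  obtain ⟨u1, u2, u3⟩ := hfac ρ hρ
  obtain ⟨v1, v2, v3⟩ := hfac 1 zero_le_one
  rw [gapTerm, truncated, limTerm, ← hx, ← hs, ← hy, ← Finset.mul_sum, ← hE]
  have hv0 := recip_nonneg hχ hl (β + a * Bfwd k w) (a * (y * (ρ + Bbwd k (revSeq N w))))
  have hv1 := recip_le hχ hl (β + a * Bfwd k w) (a * (y * (ρ + Bbwd k (revSeq N w))))
  have hχs : χ⁻¹ ≤ (s₀ * χ)⁻¹ := inv_anti₀ (by positivity) (by
    have := hss.trans hs1
    nlinarith)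
  exact abs_discounted_prod_sub_le hy0.le hs1 u2 u3 v2 v3 hv0 (hv1.trans hχs) d1 u1 v1

lemma abs_gapTerm_le (hχ : 0 < χ) (ha : 1 ≤ a) (hβ : 0 ≤ β) (hl : 0 ≤ lam) (hρ : 0 ≤ ρ)
    (hw : Good χ N w) {M : ℕ} (hM : 1 ≤ M) (hMN : M ≤ N) :
    |gapTerm a β lam ρ M N w| ≤ (Real.exp (-lam * a) * χ)⁻¹ ^ 2 * Real.exp (-walk stp N w) := by
  have ha0 : 0 < a := by linarith
  have hM0 : Real.exp (-walk stp M w) ≤ 1 := Real.exp_le_one_iff.2 (by linarith [hw.2 M hMN])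
  rw [gapTerm]
  set x := a * Real.exp (-walk stp M w) with hx
  have hx0 : 0 < x := mul_pos ha0 (Real.exp_pos _)
  have hxa : x ≤ a := by nlinarith
  set s := Real.exp (-lam * x) with hs
  set s₀ := Real.exp (-lam * a) with hs₀
  have hs₀0 : 0 < s₀ := Real.exp_pos _
  have hss : s₀ ≤ s := Real.exp_le_exp.2 (by nlinarith)
  have hs1 : s ≤ 1 := Real.exp_le_one_iff.2 (by nlinarith)
  have hs0 : 0 < s := Real.exp_pos _
  have hb := le_Bfwd hχ hw hM
  have hbk : χ ≤ β + a * Bfwd M w := by nlinarith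
  obtain ⟨hq1, -⟩ := Bfwd_sub_le hχ hw hMN
  have hfac : ∀ r, 0 ≤ r →
      0 ≤ (denom s (effRate lam x) (β + a * Bfwd M w)
        (a * (Real.exp (-walk stp N w) * r + (Bfwd N w - Bfwd M w))))⁻¹ ∧
      (denom s (effRate lam x) (β + a * Bfwd M w)
        (a * (Real.exp (-walk stp N w) * r + (Bfwd N w - Bfwd M w))))⁻¹ ≤ (s₀ * χ)⁻¹ := by
    intro r hr
    have hp0 : 0 ≤ a * (Real.exp (-walk stp N w) * r + (Bfwd N w - Bfwd M w)) := by positivity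
    have hD := le_denom (l := effRate lam x) hss (hχ.le.trans hbk) (effRate_nonneg hl hx0) hp0
    have hD' := (mul_le_mul_of_nonneg_left hbk hs₀0.le).trans hD
    have hpos : 0 < s₀ * χ := by positivity
    exact ⟨inv_nonneg.2 (hpos.le.trans hD'), inv_anti₀ hpos hD'⟩
  obtain ⟨u2, u3⟩ := hfac ρ hρ
  obtain ⟨v2, v3⟩ := hfac 1 zero_le_one
  rw [abs_of_nonneg (by positivity), mul_comm _ (Real.exp _), sq]
  refine mul_le_mul_of_nonneg_left ?_ (Real.exp_pos _).le
  exact (mul_le_of_le_one_left (mul_nonneg u2 v2) hs1).trans (mul_le_mul u3 v3 v2 (u2.trans u3))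

end Good

/-! ### The limit of the exact functional for fixed parameters -/

lemma measurable_gapTerm (lam : ℝ) (M N : ℕ) :
    Measurable fun q : (ℝ × ℝ × ℝ) × (ℕ → ℝ × ℝ) => gapTerm q.1.1 q.1.2.1 lam q.1.2.2 M N q.2 := by
  have h1 := measurable_walk_stp N
  have h2 := measurable_walk_stp M
  have h3 := measurable_Bfwd N
  have h4 := measurable_Bfwd M
  unfold gapTerm denom effRate
  fun_prop

section Fixed

variable {L : Measure (ℝ × ℝ)} [IsProbabilityMeasure L] {χ σ a β lam ρ : ℝ}

lemma EnvLaw.ae_good (h : EnvLaw L χ σ) (N : ℕ) :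
    ∀ᵐ w ∂(seqLaw L).restrict (stayIn stp (Ici 0) 0 N), Good χ N w := by
  rw [ae_restrict_iff' (measurableSet_stayIn_stp measurableSet_Ici 0 N)]
  filter_upwards [ae_seqLaw h.le_eta, ae_seqLaw h.eta_le] with w h1 h2 hw
  exact ⟨fun i => ⟨h1 i, h2 i⟩, fun i hi => by simpa using nonneg_of_mem_stayIn_of_le le_rfl hi hw⟩

lemma integrableOn_exp_neg_walk (N : ℕ) :
    IntegrableOn (fun w => Real.exp (-walk stp N w)) (stayIn stp (Ici 0) 0 N) (seqLaw L) := by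
  have := measurable_walk_stp N
  refine integrableOn_stayIn_of_bound (C := 1) (by fun_prop) (.of_forall fun w hw => ?_)
  rw [abs_of_pos (Real.exp_pos _)]
  exact Real.exp_le_one_iff.2 (by linarith [nonneg_of_mem_stayIn le_rfl hw])

lemma integrableOn_exp_exp {N i : ℕ} (hi : i ≤ N) :
    IntegrableOn (fun w => Real.exp (-walk stp N w) * Real.exp (-walk stp i w)) (stayIn stp (Ici 0) 0 N)
      (seqLaw L) := by
  have h1 := measurable_walk_stp N
  have h2 := measurable_walk_stp i
  refine integrableOn_stayIn_of_bound (C := 1) (by fun_prop) (.of_forall fun w hw => ?_)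
  rw [← Real.exp_add, abs_of_pos (Real.exp_pos _)]
  exact Real.exp_le_one_iff.2 (by
    linarith [nonneg_of_mem_stayIn le_rfl hw, nonneg_of_mem_stayIn_of_le le_rfl hi hw])

lemma EnvLaw.integrableOn_gapTerm (h : EnvLaw L χ σ) (ha : 1 ≤ a) (hβ : 0 ≤ β) (hl : 0 ≤ lam) (hρ : 0 ≤ ρ)
    {M N : ℕ} (hM : 1 ≤ M) (hMN : M ≤ N) :
    IntegrableOn (gapTerm a β lam ρ M N) (stayIn stp (Ici 0) 0 N) (seqLaw L) := by
  have hm : Measurable (gapTerm a β lam ρ M N) :=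
    (measurable_gapTerm lam M N).comp (f := fun w => ((a, β, ρ), w)) (by fun_prop)
  refine ((integrableOn_exp_neg_walk (L := L) N).const_mul ((Real.exp (-lam * a) * χ)⁻¹ ^ 2)).mono' hm.aestronglyMeasurable ?_
  filter_upwards [h.ae_good N] with w hw using abs_gapTerm_le h.pos ha hβ hl hρ hw hM hMN

lemma sum_Icc_wt_mul_wt_le {k N : ℕ} (hkN : k ≤ N) :
    ∑ i ∈ Finset.Icc k (N - k), wt i * wt (N - i) ≤ 2 * 2 ^ (3 / 2 : ℝ) * (∑' i, wt (i + k)) * wt N := by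
  have hs := (summable_nat_add_iff k).2 summable_wt
  have h0 : ∀ i, 0 ≤ wt i := fun i => (wt_pos i).le
  have htail : ∑ i ∈ Finset.Icc k (N - k), wt i ≤ ∑' i, wt (i + k) := by
    rcases le_or_gt k (N - k) with h | h
    · have : ∑ i ∈ Finset.Icc k (N - k), wt i = ∑ i ∈ Finset.range (N - k + 1 - k), wt (i + k) := by
        rw [show Finset.Icc k (N - k) = Finset.Ico k (N - k + 1) from rfl, Finset.sum_Ico_eq_sum_range]
        simp only [add_comm]
      rw [this]
      exact hs.sum_le_tsum _ fun i _ => h0 _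
    · rw [Finset.Icc_eq_empty (by omega), Finset.sum_empty]
      exact tsum_nonneg fun i => h0 _
  have hrefl : ∑ i ∈ Finset.Icc k (N - k), wt (N - i) = ∑ i ∈ Finset.Icc k (N - k), wt i := by
    refine Finset.sum_nbij' (fun i => N - i) (fun i => N - i) ?_ ?_ ?_ ?_ ?_ <;> intro i hi <;>
      simp only [Finset.mem_Icc] at hi ⊢
    · omega
    · omega
    · omega
    · omega
  have h1 : ∀ i ∈ Finset.Icc k (N - k), wt i * wt (N - i) ≤ 2 ^ (3 / 2 : ℝ) * wt N * (wt i + wt (N - i)) := by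
    intro i hi
    have := wt_mul_wt_le i (N - i)
    rwa [show i + (N - i) = N by have := Finset.mem_Icc.1 hi; omega] at this
  refine (Finset.sum_le_sum h1).trans ?_
  rw [← Finset.mul_sum, Finset.sum_add_distrib, hrefl]
  have h2 : 0 ≤ (2 : ℝ) ^ (3 / 2 : ℝ) * wt N := mul_nonneg (by positivity) (h0 N)
  nlinarith [mul_le_mul_of_nonneg_left htail h2]

lemma truncConst_nonneg (hχ : 0 < χ) (ha : 1 ≤ a) (hl : 0 ≤ lam) : 0 ≤ truncConst χ a lam := by
  have h1 : 0 < a := by linarith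
  have h2 := Real.exp_pos (-lam * a)
  unfold truncConst
  positivity

lemma EnvLaw.exists_truncation_le (h : EnvLaw L χ σ) : ∃ C, 0 ≤ C ∧ ∀ {a β lam ρ : ℝ}, 1 ≤ a → 0 ≤ β → 0 ≤ lam →
    0 ≤ ρ → ∀ {k M N : ℕ}, 1 ≤ k → k ≤ M → M ≤ N - k → k ≤ N →
    |(∫ w in stayIn stp (Ici 0) 0 N, gapTerm a β lam ρ M N w ∂seqLaw L) -
      ∫ w in stayIn stp (Ici 0) 0 N, truncated (limTerm χ a β lam ρ) k N w ∂seqLaw L|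
      ≤ truncConst χ a lam * (C * (∑' i, wt (i + k)) * wt N) := by
  obtain ⟨C, hC, hle⟩ := exists_exp_exp_le h.step
  refine ⟨C * (2 * 2 ^ (3 / 2 : ℝ)), by positivity, fun {a β lam ρ} ha hβ hl hρ {k M N} hk hkM hMN hkN => ?_⟩
  have i1 := h.integrableOn_gapTerm ha hβ hl hρ (hk.trans hkM) (show M ≤ N by omega)
  have i2 := integrableOn_truncated (L := L) (continuous_limTerm h.pos hl a β ρ)
    (limTerm_nonneg h.pos hl a β ρ) (limTerm_le h.pos hl a β ρ) k N
  have i3 : ∀ i ∈ Finset.Icc k (N - k), IntegrableOn (fun w => Real.exp (-walk stp N w) *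
      Real.exp (-walk stp i w)) (stayIn stp (Ici 0) 0 N) (seqLaw L) := fun i hi =>
    integrableOn_exp_exp (by have := Finset.mem_Icc.1 hi; omega)
  rw [← integral_sub i1 i2, ← Real.norm_eq_abs]
  refine (norm_integral_le_of_norm_le ((integrable_finsetSum _ i3).const_mul (truncConst χ a lam)) ?_).trans ?_
  · filter_upwards [h.ae_good N] with w hw
    exact abs_gapTerm_sub_truncated_le h.pos h.lt_one ha hβ hl hρ hw hk hkM hMN hkN
  rw [integral_const_mul, integral_finsetSum _ i3]
  refine mul_le_mul_of_nonneg_left ?_ (truncConst_nonneg h.pos ha hl)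
  have h1 : ∀ i ∈ Finset.Icc k (N - k), ∫ w in stayIn stp (Ici 0) 0 N, Real.exp (-walk stp N w) *
      Real.exp (-walk stp i w) ∂seqLaw L ≤ C * (wt i * wt (N - i)) := fun i hi => by
    have := hle i (N - i)
    rwa [show i + (N - i) = N by have := Finset.mem_Icc.1 hi; omega] at this
  refine (Finset.sum_le_sum h1).trans ?_
  rw [← Finset.mul_sum]
  refine (mul_le_mul_of_nonneg_left (sum_Icc_wt_mul_wt_le hkN) hC).trans_eq (by ring)

theorem EnvLaw.tendsto_gapTerm (h : EnvLaw L χ σ)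
    (hu : ∀ k, ∫ w in stayIn stp (Ici 0) 0 k,
      ren (downSeq (L.map Prod.fst)) Iic (walk stp k w) ∂seqLaw L = 1)
    (ha : 1 ≤ a) (hβ : 0 ≤ β) (hl : 0 ≤ lam) (hρ : 0 ≤ ρ) {M : ℕ → ℕ} (hM : Tendsto M atTop atTop)
    (hM' : Tendsto (fun N => N - M N) atTop atTop) {ℓ : ℝ}
    (hℓ : Tendsto (blockLimit L (limTerm χ a β lam ρ)) atTop (𝓝 ℓ)) :
    DecayTo (3 / 2) (fun N => ∫ w in stayIn stp (Ici 0) 0 N, gapTerm a β lam ρ (M N) N w ∂seqLaw L)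
      (lltConst σ * ℓ) := by
  obtain ⟨C, hC, hle⟩ := h.exists_truncation_le
  set D := truncConst χ a lam * C with hD
  have htr := fun k => h.tendsto_truncated hu (continuous_limTerm h.pos hl a β ρ)
    (limTerm_nonneg h.pos hl a β ρ) (limTerm_le h.pos hl a β ρ) (k + 1)
  have hclose : ∀ k, ∀ᶠ N : ℕ in atTop,
      |((N : ℝ) + 1) ^ (3 / 2 : ℝ) * (∫ w in stayIn stp (Ici 0) 0 N, gapTerm a β lam ρ (M N) N w ∂seqLaw L) -
        ((N : ℝ) + 1) ^ (3 / 2 : ℝ) *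
          ∫ w in stayIn stp (Ici 0) 0 N, truncated (limTerm χ a β lam ρ) (k + 1) N w ∂seqLaw L|
        ≤ D * ∑' i, wt (i + (k + 1)) := fun k => by
    filter_upwards [hM.eventually_ge_atTop (k + 1), hM'.eventually_ge_atTop (k + 1)] with N h1 h2
    have h3 := hle ha hβ hl hρ (Nat.le_add_left 1 k) h1 (show M N ≤ N - (k + 1) by omega)
      (show k + 1 ≤ N by omega)
    rw [← mul_sub, abs_mul, abs_of_nonneg (by positivity)]
    refine (mul_le_mul_of_nonneg_left h3 (by positivity)).trans_eq ?_
    have := wt_mul N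
    linear_combination (D * ∑' i, wt (i + (k + 1))) * this
  have htail : Tendsto (fun k => D * ∑' i, wt (i + (k + 1))) atTop (𝓝 0) := by
    have := (tendsto_sum_nat_add wt).comp (tendsto_add_atTop_nat 1)
    simpa using this.const_mul D
  have hlim := (hℓ.comp (tendsto_add_atTop_nat 1)).const_mul (lltConst σ)
  refine tendsto_of_forall_le_tendsto
    (U := fun k N => ((N : ℝ) + 1) ^ (3 / 2 : ℝ) *
      (∫ w in stayIn stp (Ici 0) 0 N, truncated (limTerm χ a β lam ρ) (k + 1) N w ∂seqLaw L)
        + D * ∑' i, wt (i + (k + 1)))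
    (L := fun k N => ((N : ℝ) + 1) ^ (3 / 2 : ℝ) *
      (∫ w in stayIn stp (Ici 0) 0 N, truncated (limTerm χ a β lam ρ) (k + 1) N w ∂seqLaw L)
        - D * ∑' i, wt (i + (k + 1)))
    (fun k => ?_) (fun k => (htr k).add_const _) (by simpa using hlim.add htail) (fun k => ?_)
    (fun k => (htr k).sub_const _) (by simpa using hlim.sub htail)
  · filter_upwards [hclose k] with N hN
    linarith [(abs_le.1 hN).2]
  · filter_upwards [hclose k] with N hN
    linarith [(abs_le.1 hN).1]

end Fixed

/-! ### Cutting the walk at its first minimum -/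

lemma Bfwd_concat_add (n k : ℕ) (p : (ℕ → ℝ × ℝ) × (ℕ → ℝ × ℝ)) :
    Bfwd (n + k) (splice (concatAt n) p) = Bfwd n p.1 + Real.exp (-walk stp n p.1) * Bfwd k p.2 := by
  rw [Bfwd, Finset.sum_range_add, Bfwd, Bfwd, Finset.mul_sum]
  congr 1
  · refine Finset.sum_congr rfl fun i hi => ?_
    have := Finset.mem_range.1 hi
    rw [walk_concat_of_le this.le]
    simp [splice, concatAt, Nat.succ_le_of_lt this]
  · refine Finset.sum_congr rfl fun i _ => ?_
    rw [walk_concat_add, neg_add, Real.exp_add]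
    have : (splice (concatAt n) p (n + i + 1)) = p.2 (i + 1) := by
      have h : n + i + 1 - n = i + 1 := by omega
      simp [splice, concatAt, show ¬ n + i + 1 ≤ n by omega, h]
    rw [this]
    ring

lemma gapTerm_congr {a β lam ρ : ℝ} {M N : ℕ} (hMN : M ≤ N) {w w' : ℕ → ℝ × ℝ}
    (h : ∀ i, 1 ≤ i → i ≤ N → w i = w' i) : gapTerm a β lam ρ M N w = gapTerm a β lam ρ M N w' := by
  have h' : ∀ i, 1 ≤ i → i ≤ M → w i = w' i := fun i h1 h2 => h i h1 (h2.trans hMN)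
  unfold gapTerm
  rw [walk_congr h, walk_congr h', Bfwd_congr h, Bfwd_congr h']

lemma gapTerm_concat (lam ρ : ℝ) (j M N : ℕ) (p : (ℕ → ℝ × ℝ) × (ℕ → ℝ × ℝ)) :
    gapTerm 1 0 lam ρ (j + M) (j + N) (splice (concatAt j) p) =
      Real.exp (-walk stp j p.1) *
        gapTerm (Real.exp (-walk stp j p.1)) (Bfwd j p.1) lam ρ M N p.2 := by
  have he : ∀ i, Real.exp (-(walk stp j p.1 + walk stp i p.2)) =
      Real.exp (-walk stp j p.1) * Real.exp (-walk stp i p.2) := fun i => by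
    rw [neg_add, Real.exp_add]
  have hp : ∀ r, 1 * (Real.exp (-walk stp j p.1) * Real.exp (-walk stp N p.2) * r +
      (Bfwd j p.1 + Real.exp (-walk stp j p.1) * Bfwd N p.2 -
        (Bfwd j p.1 + Real.exp (-walk stp j p.1) * Bfwd M p.2))) =
      Real.exp (-walk stp j p.1) * (Real.exp (-walk stp N p.2) * r + (Bfwd N p.2 - Bfwd M p.2)) :=
    fun r => by ring
  unfold gapTerm
  simp only [walk_concat_add, Bfwd_concat_add, he]
  rw [hp ρ, hp 1, one_mul, zero_add, one_mul, mul_assoc]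

section Minimum

variable {Ω : Type*} {X : ℕ → Ω → ℝ} {n j : ℕ} {ω : Ω}

lemma tauWalk_eq_iff (hj : j ≤ n) :
    tauWalk X n ω = j ↔
      (∀ i < j, walk X j ω < walk X i ω) ∧ ∀ i ≤ n, walk X j ω ≤ walk X i ω := by
  have hle : ∀ i ≤ n, minWalk X n ω ≤ walk X i ω := fun i hi =>
    Finset.inf'_le (fun i => walk X i ω) (Finset.mem_range.2 (Nat.lt_succ_of_le hi))
  obtain ⟨m, hm, hmin⟩ := Finset.exists_mem_eq_inf' (s := Finset.range (n + 1)) (by simp) fun i => walk X i ω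
  have hne : {i : ℕ | walk X i ω = minWalk X n ω}.Nonempty := ⟨m, hmin.symm⟩
  constructor
  · rintro rfl
    have h1 : walk X (tauWalk X n ω) ω = minWalk X n ω := Nat.sInf_mem hne
    refine ⟨fun i hi => lt_of_le_of_ne (h1 ▸ hle i (hi.le.trans hj)) fun h => ?_, fun i hi => h1 ▸ hle i hi⟩
    exact (Nat.sInf_le (s := {i : ℕ | walk X i ω = minWalk X n ω}) (h.symm.trans h1)).not_gt hi
  · rintro ⟨h1, h2⟩
    have h3 : walk X j ω = minWalk X n ω :=
      le_antisymm (Finset.le_inf' _ _ fun i hi => h2 i (Nat.lt_succ_iff.1 (Finset.mem_range.1 hi))) (hle j hj)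
    refine le_antisymm (Nat.sInf_le h3) (le_of_not_gt fun h => (h1 _ h).ne' ?_)
    exact (Nat.sInf_mem hne : walk X (tauWalk X n ω) ω = _).trans h3.symm

lemma measurableSet_tauWalk [MeasurableSpace Ω] (hX : ∀ i, 1 ≤ i → Measurable (X i)) (hj : j ≤ n) :
    MeasurableSet {ω | tauWalk X n ω = j} := by
  simp_rw [tauWalk_eq_iff hj]
  have := measurable_walk hX
  refine .inter (measurableSet_setOfPred.2 ?_) (measurableSet_setOfPred.2 ?_)
  · exact .forall fun i => .forall fun _ => measurableSet_setOfPred.1 (measurableSet_lt (this j) (this i))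
  · exact .forall fun i => .forall fun _ => measurableSet_setOfPred.1 (measurableSet_le (this j) (this i))

end Minimum

lemma tauWalk_congr {w w' : ℕ → ℝ × ℝ} {n j : ℕ} (hj : j ≤ n) (h : ∀ i, 1 ≤ i → i ≤ n → w i = w' i) :
    tauWalk stp n w = j ↔ tauWalk stp n w' = j := by
  have hw : ∀ i ≤ n, walk stp i w = walk stp i w' := fun i hi =>
    walk_congr fun l h1 h2 => h l h1 (h2.trans hi)
  rw [tauWalk_eq_iff hj, tauWalk_eq_iff hj, hw j hj]
  refine and_congr (forall₂_congr fun i hi => ?_) (forall₂_congr fun i hi => ?_)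
  · rw [hw i (hi.le.trans hj)]
  · rw [hw i hi]

lemma tauWalk_concat {j N : ℕ} {p : (ℕ → ℝ × ℝ) × (ℕ → ℝ × ℝ)} :
    tauWalk stp (j + N) (splice (concatAt j) p) = j ↔
      tauWalk stp j p.1 = j ∧ p.2 ∈ stayIn stp (Ici 0) 0 N := by
  rw [tauWalk_eq_iff (Nat.le_add_right j N), tauWalk_eq_iff le_rfl, walk_concat_of_le le_rfl]
  simp only [stayIn, mem_ofPred_eq, Finset.mem_Icc, mem_Ici, zero_add]
  constructor
  · rintro ⟨h1, h2⟩
    refine ⟨⟨fun i hi => ?_, fun i hi => ?_⟩, fun i hi => ?_⟩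
    · simpa [walk_concat_of_le hi.le] using h1 i hi
    · simpa [walk_concat_of_le hi] using h2 i (by omega)
    · simpa [walk_concat_add] using h2 (j + i) (by omega)
  · rintro ⟨⟨h1, h2⟩, h3⟩
    refine ⟨fun i hi => ?_, fun i hi => ?_⟩
    · simpa [walk_concat_of_le hi.le] using h1 i hi
    · rcases le_or_gt i j with h | h
      · simpa [walk_concat_of_le h] using h2 i h
      · obtain ⟨k, rfl⟩ := Nat.exists_eq_add_of_le h.le
        simpa [walk_concat_add] using h3 k (by omega)

lemma walk_nonpos_of_tauWalk {w : ℕ → ℝ × ℝ} {j : ℕ} (h : tauWalk stp j w = j) : walk stp j w ≤ 0 := by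
  simpa [walk_zero] using ((tauWalk_eq_iff le_rfl).1 h).2 0 (Nat.zero_le j)

/-! ### An independent additional mark at time `n + 1` -/

/-- Follow the first sequence up to the index `j`, then the second one up to the index `n`; the term with
index `n + 1` is the term with index `0` of the first sequence. -/
def markAt (j n i : ℕ) : ℕ ⊕ ℕ :=
  if i = n + 1 then .inl 0 else if i = 0 ∨ n + 1 < i then .inr i else concatAt j i

lemma markAt_injective {j n : ℕ} : Function.Injective (markAt j n) := by
  intro i k h
  unfold markAt concatAt at h
  split_ifs at h <;> simp at h <;> omega

section Marked

lemma markAt_of_mem {j n i : ℕ} (h1 : 1 ≤ i) (h2 : i ≤ n) : markAt j n i = concatAt j i := by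
  simp [markAt, show i ≠ n + 1 by omega, show ¬ (i = 0 ∨ n + 1 < i) by omega]

lemma splice_map {E E' : Type*} (e : ℕ → ℕ ⊕ ℕ) (p : (ℕ → E) × (ℕ → E)) (f : E → E') (i : ℕ) :
    f (splice e p i) = splice e (fun i => f (p.1 i), fun i => f (p.2 i)) i := by
  unfold splice
  rcases e i with l | l <;> rfl

variable {E : Type*} [MeasurableSpace E]

lemma integral_eq_integral_splice {Ω : Type*} [MeasurableSpace Ω] {μ : Measure Ω} [IsProbabilityMeasure μ]
    {L : Measure E} [IsProbabilityMeasure L] {ξ : Ω → ℕ → E} (hξ : Measurable ξ) (hL : μ.map ξ = seqLaw L)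
    {e : ℕ → ℕ ⊕ ℕ} (he : Function.Injective e) {G : (ℕ → E) → ℝ} (hG : Measurable G)
    (hi : Integrable (fun ω => G (ξ ω)) μ) :
    ∫ ω, G (ξ ω) ∂μ = ∫ ω, (∫ w, G (splice e (ξ ω, w)) ∂seqLaw L) ∂μ := by
  have h1 : Integrable G (seqLaw L) := by
    rw [← hL, integrable_map_measure hG.aestronglyMeasurable hξ.aemeasurable]
    exact hi
  have h2 : Integrable (fun p => G (splice e p)) ((seqLaw L).prod (seqLaw L)) := by
    rw [← map_splice L he] at h1
    exact h1.comp_measurable (measurable_splice e)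
  have h3 : StronglyMeasurable fun v => ∫ w, G (splice e (v, w)) ∂seqLaw L :=
    (hG.comp (measurable_splice e)).stronglyMeasurable.integral_prod_right (f := fun v w => G (splice e (v, w)))
  rw [← integral_map (f := G) hξ.aemeasurable hG.aestronglyMeasurable,
    ← integral_map (f := fun v => ∫ w, G (splice e (v, w)) ∂seqLaw L) hξ.aemeasurable h3.aestronglyMeasurable,
    hL, ← integral_prod _ h2, ← integral_map (measurable_splice e).aemeasurable hG.aestronglyMeasurable,
    map_splice L he]

end Marked

/-! ### The limit of the marked functional on the event that the minimum is attained at `j` -/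

/-- The unmarked part of a marked sequence. -/
def unmark (v : ℕ → (ℝ × ℝ) × ℝ) (i : ℕ) : ℝ × ℝ := (v i).1

lemma measurable_unmark : Measurable unmark := by unfold unmark; fun_prop

lemma map_unmark_seqLaw {K : Measure ((ℝ × ℝ) × ℝ)} [IsProbabilityMeasure K]
    [IsProbabilityMeasure (K.map Prod.fst)] : (seqLaw K).map unmark = seqLaw (K.map Prod.fst) :=
  Measure.infinitePi_map_pi (f := fun _ : ℕ => Prod.fst) _ fun _ => measurable_fst

/-- The odds of the mark with index `i`. -/
def odds (i : ℕ) (v : ℕ → (ℝ × ℝ) × ℝ) : ℝ := (v i).2 / (1 - (v i).2)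

lemma measurable_odds (i : ℕ) : Measurable (odds i) := by unfold odds; fun_prop

/-- The value of `F_{n,t}` with `⌊nt⌋ = m` in terms of the marked sequence. -/
def markTerm (lam : ℝ) (m n : ℕ) (v : ℕ → (ℝ × ℝ) × ℝ) : ℝ :=
  odds (n + 1) v * gapTerm 1 0 lam (1 - (v (n + 1)).2)⁻¹ m n (unmark v)

lemma measurable_markTerm (lam : ℝ) (m n : ℕ) : Measurable (markTerm lam m n) :=
  (measurable_odds _).mul ((measurable_gapTerm lam m n).comp
    (f := fun v : ℕ → (ℝ × ℝ) × ℝ => ((1, 0, (1 - (v (n + 1)).2)⁻¹), unmark v))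
    (by have := measurable_unmark; fun_prop))

/-- The law of `gapTerm` for a walk staying nonnegative, as a function of the marked past. -/
def pastTerm (L : Measure (ℝ × ℝ)) [IsProbabilityMeasure L] (lam : ℝ) (j M N : ℕ)
    (v : ℕ → (ℝ × ℝ) × ℝ) : ℝ :=
  ∫ w in stayIn stp (Ici 0) 0 N, gapTerm (Real.exp (-walk stp j (unmark v))) (Bfwd j (unmark v)) lam
    (1 - (v 0).2)⁻¹ M N w ∂seqLaw L

section Past

variable {L : Measure (ℝ × ℝ)} [IsProbabilityMeasure L] {χ σ lam : ℝ}

lemma stronglyMeasurable_pastTerm (j M N : ℕ) : StronglyMeasurable (pastTerm L lam j M N) := by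
  have h1 := (measurable_walk_stp j).comp measurable_unmark
  have h2 := (measurable_Bfwd j).comp measurable_unmark
  have h3 : Measurable fun q : (ℕ → (ℝ × ℝ) × ℝ) × (ℕ → ℝ × ℝ) =>
      gapTerm (Real.exp (-walk stp j (unmark q.1))) (Bfwd j (unmark q.1)) lam (1 - (q.1 0).2)⁻¹ M N q.2 :=
    (measurable_gapTerm lam M N).comp
      (f := fun q : (ℕ → (ℝ × ℝ) × ℝ) × (ℕ → ℝ × ℝ) => ((Real.exp (-walk stp j (unmark q.1)),
        Bfwd j (unmark q.1), (1 - (q.1 0).2)⁻¹), q.2))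
      (((h1.comp measurable_fst).neg.exp.prodMk
        ((h2.comp measurable_fst).prodMk (by fun_prop))).prodMk measurable_snd)
  exact h3.stronglyMeasurable.integral_prod_right
    (f := fun (v : ℕ → (ℝ × ℝ) × ℝ) w =>
      gapTerm (Real.exp (-walk stp j (unmark v))) (Bfwd j (unmark v)) lam (1 - (v 0).2)⁻¹ M N w)

lemma EnvLaw.exists_gapTerm_le (h : EnvLaw L χ σ) (hl : 0 ≤ lam) :
    ∃ C, 0 ≤ C ∧ ∀ {a β ρ : ℝ}, 1 ≤ a → 0 ≤ β → 0 ≤ ρ → ∀ {M N : ℕ}, 1 ≤ M → M ≤ N →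
      |∫ w in stayIn stp (Ici 0) 0 N, gapTerm a β lam ρ M N w ∂seqLaw L| ≤
        (Real.exp (-lam * a) * χ)⁻¹ ^ 2 * (C * wt N) := by
  obtain ⟨C, hC, hle⟩ := h.step.lap_killed_le one_pos one_pos
  refine ⟨C, hC, fun {a β ρ} ha hβ hρ {M N} hM hMN => ?_⟩
  rw [← Real.norm_eq_abs]
  refine (norm_integral_le_of_norm_le ((integrableOn_exp_neg_walk (L := L) N).const_mul
    ((Real.exp (-lam * a) * χ)⁻¹ ^ 2)) ?_).trans ?_
  · filter_upwards [h.ae_good N] with w hw using abs_gapTerm_le h.pos ha hβ hl hρ hw hM hMN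
  rw [integral_const_mul]
  refine mul_le_mul_of_nonneg_left ?_ (by positivity)
  have := hle 0 le_rfl N
  rw [← setIntegral_exp_stayIn] at this
  simpa using this

end Past

section Marked

variable {Ω : Type*} [MeasurableSpace Ω] {μ : Measure Ω} [IsProbabilityMeasure μ]
  {K : Measure ((ℝ × ℝ) × ℝ)} [IsProbabilityMeasure K] [IsProbabilityMeasure (K.map Prod.fst)]
  {ζ : Ω → ℕ → (ℝ × ℝ) × ℝ} {χ σ lam : ℝ} {j : ℕ}

lemma measurableSet_tauWalk_unmark (hζ : Measurable ζ) {n : ℕ} (hj : j ≤ n) :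
    MeasurableSet {ω | tauWalk stp n (unmark (ζ ω)) = j} :=
  (measurable_unmark.comp hζ) (measurableSet_tauWalk (fun i _ => measurable_stp i) hj)

lemma markTerm_splice {M N : ℕ} (hMN : M ≤ N) (v w : ℕ → (ℝ × ℝ) × ℝ) :
    {w | tauWalk stp (j + N) (unmark w) = j}.indicator (markTerm lam (j + M) (j + N))
        (splice (markAt j (j + N)) (v, w)) =
      {v | tauWalk stp j (unmark v) = j}.indicator (fun v => Real.exp (-walk stp j (unmark v)) * odds 0 v *
        (stayIn stp (Ici 0) 0 N).indicator (gapTerm (Real.exp (-walk stp j (unmark v)))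
          (Bfwd j (unmark v)) lam (1 - (v 0).2)⁻¹ M N) (unmark w)) v := by
  have h1 : ∀ i, 1 ≤ i → i ≤ j + N → unmark (splice (markAt j (j + N)) (v, w)) i =
      splice (concatAt j) (unmark v, unmark w) i := fun i h1 h2 => by
    rw [unmark, splice_map _ _ Prod.fst, splice, splice, markAt_of_mem h1 h2]
    rfl
  have h2 : splice (markAt j (j + N)) (v, w) (j + N + 1) = v 0 := by simp [splice, markAt]
  have h3 : tauWalk stp (j + N) (unmark (splice (markAt j (j + N)) (v, w))) = j ↔
      tauWalk stp j (unmark v) = j ∧ unmark w ∈ stayIn stp (Ici 0) 0 N :=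
    (tauWalk_congr (Nat.le_add_right j N) h1).trans tauWalk_concat
  have h4 : markTerm lam (j + M) (j + N) (splice (markAt j (j + N)) (v, w)) =
      Real.exp (-walk stp j (unmark v)) * odds 0 v * gapTerm (Real.exp (-walk stp j (unmark v)))
          (Bfwd j (unmark v)) lam (1 - (v 0).2)⁻¹ M N (unmark w) := by
    rw [markTerm, odds, h2, gapTerm_congr (by omega) h1, gapTerm_concat, odds]
    ring
  by_cases hv : tauWalk stp j (unmark v) = j <;> by_cases hw : unmark w ∈ stayIn stp (Ici 0) 0 N <;>
    simp [Set.indicator, h3, h4, hv, hw]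

lemma setIntegral_markTerm (hζ : Measurable ζ) (hK : μ.map ζ = seqLaw K) {M N : ℕ} (hMN : M ≤ N)
    (hi : Integrable (fun ω => markTerm lam (j + M) (j + N) (ζ ω)) μ) :
    ∫ ω in {ω | tauWalk stp (j + N) (unmark (ζ ω)) = j}, markTerm lam (j + M) (j + N) (ζ ω) ∂μ =
      ∫ ω in {ω | tauWalk stp j (unmark (ζ ω)) = j},
        Real.exp (-walk stp j (unmark (ζ ω))) * odds 0 (ζ ω) *
          pastTerm (K.map Prod.fst) lam j M N (ζ ω) ∂μ := by
  have hm := measurableSet_tauWalk_unmark hζ (Nat.le_add_right j N)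
  have hm' : MeasurableSet {w : ℕ → (ℝ × ℝ) × ℝ | tauWalk stp (j + N) (unmark w) = j} :=
    measurableSet_tauWalk_unmark measurable_id (Nat.le_add_right j N)
  rw [← integral_indicator hm, ← integral_indicator (measurableSet_tauWalk_unmark hζ le_rfl)]
  have h1 := integral_eq_integral_splice (e := markAt j (j + N)) hζ hK markAt_injective
    ((measurable_markTerm lam (j + M) (j + N)).indicator hm') (hi.indicator hm)
  refine h1.trans (integral_congr_ae (.of_forall fun ω => ?_))
  simp_rw [markTerm_splice hMN]
  by_cases hω : tauWalk stp j (unmark (ζ ω)) = j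
  · simp only [Set.indicator, mem_ofPred_eq, hω, if_true]
    rw [integral_const_mul, pastTerm, ← integral_indicator (measurableSet_stayIn_stp measurableSet_Ici 0 N),
      ← map_unmark_seqLaw, integral_map (measurable_unmark.aemeasurable)]
    · rfl
    · refine (Measurable.indicator ?_ (measurableSet_stayIn_stp measurableSet_Ici 0 N)).aestronglyMeasurable
      exact (measurable_gapTerm lam M N).comp (f := fun w => ((_, _, _), w)) (by fun_prop)
  · simp [Set.indicator, hω]

theorem EnvLaw.tendsto_markTerm (h : EnvLaw (K.map Prod.fst) χ σ)
    (hu : ∀ k, ∫ w in stayIn stp (Ici 0) 0 k,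
      ren (downSeq ((K.map Prod.fst).map Prod.fst)) Iic (walk stp k w) ∂seqLaw (K.map Prod.fst) = 1)
    (hζ : Measurable ζ) (hK : μ.map ζ = seqLaw K)
    (hmark : ∀ᵐ ω ∂μ, 0 ≤ (ζ ω 0).2 ∧ (ζ ω 0).2 ≤ 1 - χ) (hl : 0 ≤ lam) {m : ℕ → ℕ}
    (hi : ∀ n, Integrable (fun ω => markTerm lam (m n) n (ζ ω)) μ) (hmn : ∀ n, m n ≤ n)
    (hm : Tendsto m atTop atTop) (hm' : Tendsto (fun n => n - m n) atTop atTop) {ℓ : Ω → ℝ}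
    (hℓ : ∀ᵐ ω ∂μ, Tendsto (blockLimit (K.map Prod.fst) (limTerm χ (Real.exp (-walk stp j (unmark (ζ ω))))
      (Bfwd j (unmark (ζ ω))) lam (1 - (ζ ω 0).2)⁻¹)) atTop (𝓝 (ℓ ω))) :
    DecayTo (3 / 2)
      (fun n => ∫ ω in {ω | tauWalk stp n (unmark (ζ ω)) = j}, markTerm lam (m n) n (ζ ω) ∂μ)
      (lltConst σ * ∫ ω in {ω | tauWalk stp j (unmark (ζ ω)) = j},
        Real.exp (-walk stp j (unmark (ζ ω))) * odds 0 (ζ ω) * ℓ ω ∂μ) := by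
  have hM : Tendsto (fun N => m (N + j) - j) atTop atTop :=
    (tendsto_sub_atTop_nat j).comp (hm.comp (tendsto_add_atTop_nat j))
  have hM' : Tendsto (fun N => N - (m (N + j) - j)) atTop atTop := by
    refine tendsto_atTop_mono' _ ?_ (hm'.comp (tendsto_add_atTop_nat j))
    filter_upwards [(hm.comp (tendsto_add_atTop_nat j)).eventually_ge_atTop j] with N hN
    simp only [Function.comp_apply] at hN ⊢
    omega
  have hlaw : ∀ᵐ ω ∂μ, ∀ i, χ ≤ (unmark (ζ ω) i).2 ∧ ∀ k, Real.exp (-walk stp k (unmark (ζ ω))) ≤ χ⁻¹ ^ k := by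
    have h1 : ∀ᵐ w ∂seqLaw (K.map Prod.fst), ∀ i, χ ≤ (w i).2 ∧ ∀ k, Real.exp (-walk stp k w) ≤ χ⁻¹ ^ k := by
      filter_upwards [ae_seqLaw h.le_eta, h.exp_neg_walk_le] with w h1 h2 i using ⟨h1 i, h2⟩
    rw [← map_unmark_seqLaw, ← hK, Measure.map_map measurable_unmark hζ] at h1
    exact ae_of_ae_map (measurable_unmark.comp hζ).aemeasurable h1
  obtain ⟨C, hC, hle⟩ := h.exists_gapTerm_le hl
  have hχ := h.pos
  refine DecayTo.of_shift (k := j) ?_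
  have hpast : ∀ᵐ ω ∂μ.restrict {ω | tauWalk stp j (unmark (ζ ω)) = j},
      1 ≤ Real.exp (-walk stp j (unmark (ζ ω))) ∧ 0 ≤ Bfwd j (unmark (ζ ω)) ∧ 0 ≤ (1 - (ζ ω 0).2)⁻¹ ∧
        Real.exp (-walk stp j (unmark (ζ ω))) ≤ χ⁻¹ ^ j ∧ 0 ≤ odds 0 (ζ ω) ∧ odds 0 (ζ ω) ≤ χ⁻¹ := by
    rw [ae_restrict_iff' (measurableSet_tauWalk_unmark hζ le_rfl)]
    filter_upwards [hlaw, hmark] with ω h1 h2 h3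
    have h4 : χ ≤ 1 - (ζ ω 0).2 := by linarith [h2.2]
    refine ⟨Real.one_le_exp (by linarith [walk_nonpos_of_tauWalk h3]),
      Finset.sum_nonneg fun i _ => mul_nonneg (hχ.le.trans (h1 _).1) (Real.exp_pos _).le,
      inv_nonneg.2 (by linarith), (h1 0).2 j, div_nonneg h2.1 (by linarith), ?_⟩
    rw [odds, div_le_iff₀ (by linarith)]
    calc (ζ ω 0).2 ≤ 1 := by linarith [h2.2]
      _ = χ⁻¹ * χ := by field_simp
      _ ≤ χ⁻¹ * (1 - (ζ ω 0).2) := by gcongr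
  have hd : Tendsto (fun N : ℕ => ∫ ω in {ω | tauWalk stp j (unmark (ζ ω)) = j},
      ((N : ℝ) + 1) ^ (3 / 2 : ℝ) * (Real.exp (-walk stp j (unmark (ζ ω))) * odds 0 (ζ ω) *
        pastTerm (K.map Prod.fst) lam j (m (N + j) - j) N (ζ ω)) ∂μ) atTop
      (𝓝 (∫ ω in {ω | tauWalk stp j (unmark (ζ ω)) = j},
        lltConst σ * (Real.exp (-walk stp j (unmark (ζ ω))) * odds 0 (ζ ω) * ℓ ω) ∂μ)) := by
    refine tendsto_integral_filter_of_dominated_convergence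
      (fun _ => χ⁻¹ ^ j * χ⁻¹ * ((Real.exp (-lam * χ⁻¹ ^ j) * χ)⁻¹ ^ 2 * C)) (.of_forall fun N => ?_) ?_
      (integrable_const _) ?_
    · have h1 := (measurable_walk_stp j).comp (measurable_unmark.comp hζ)
      have h2 := (measurable_odds 0).comp hζ
      have h3 := (stronglyMeasurable_pastTerm (L := K.map Prod.fst) (lam := lam) j (m (N + j) - j) N).measurable.comp hζ
      exact (((h1.neg.exp.mul h2).mul h3).const_mul _).aestronglyMeasurable
    · filter_upwards [hM.eventually_ge_atTop 1] with N hN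
      filter_upwards [hpast] with ω ⟨h1, h2, h3, h4, h5, h6⟩
      have h7 := hle h1 h2 h3 hN (show m (N + j) - j ≤ N by have := hmn (N + j); omega)
      have h8 : (Real.exp (-lam * Real.exp (-walk stp j (unmark (ζ ω)))) * χ)⁻¹ ^ 2 ≤
          (Real.exp (-lam * χ⁻¹ ^ j) * χ)⁻¹ ^ 2 := by
        have : -lam * χ⁻¹ ^ j ≤ -lam * Real.exp (-walk stp j (unmark (ζ ω))) := by nlinarith
        gcongr
      rw [← pastTerm] at h7
      rw [Real.norm_eq_abs, abs_mul, abs_mul, abs_of_nonneg (by positivity : (0:ℝ) ≤ ((N : ℝ) + 1) ^ (3 / 2 : ℝ)),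
        abs_of_nonneg (by positivity : 0 ≤ Real.exp (-walk stp j (unmark (ζ ω))) * odds 0 (ζ ω))]
      have h9 := (wt_pos N).le
      calc _ ≤ ((N : ℝ) + 1) ^ (3 / 2 : ℝ) * (χ⁻¹ ^ j * χ⁻¹ *
            ((Real.exp (-lam * χ⁻¹ ^ j) * χ)⁻¹ ^ 2 * (C * wt N))) := by
              gcongr
              exact h7.trans (by gcongr)
        _ = _ := by
          have := wt_mul N
          linear_combination (χ⁻¹ ^ j * χ⁻¹ * ((Real.exp (-lam * χ⁻¹ ^ j) * χ)⁻¹ ^ 2 * C)) * this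
    · filter_upwards [hpast, ae_restrict_of_ae hℓ] with ω ⟨h1, h2, h3, h4, h5, h6⟩ h7
      have h8 := h.tendsto_gapTerm hu h1 h2 hl h3 hM hM' h7
      have h9 : Tendsto (fun N : ℕ => Real.exp (-walk stp j (unmark (ζ ω))) * odds 0 (ζ ω) *
        (((N : ℝ) + 1) ^ (3 / 2 : ℝ) * pastTerm (K.map Prod.fst) lam j (m (N + j) - j) N (ζ ω))) atTop
          (𝓝 (Real.exp (-walk stp j (unmark (ζ ω))) * odds 0 (ζ ω) * (lltConst σ * ℓ ω))) := h8.const_mul _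
      rw [mul_left_comm] at h9
      exact h9.congr fun N => by ring
  rw [integral_const_mul] at hd
  refine hd.congr' ?_
  filter_upwards [(hm.comp (tendsto_add_atTop_nat j)).eventually_ge_atTop j] with N hN
  simp only [Function.comp_apply] at hN
  have e1 : j + (m (N + j) - j) = m (N + j) := by omega
  have h1 := setIntegral_markTerm (lam := lam) (j := j) (M := m (N + j) - j) (N := N) hζ hK
    (by have := hmn (N + j); omega) (by rw [e1, add_comm j N]; exact hi (N + j))
  rw [e1, add_comm j N] at h1
  rw [integral_const_mul, h1]

end Marked

/-! ### Identification of the limit -/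

lemma thetaStar_inv {χ α β lam u q : ℝ} (hχ : 0 < χ) (hα : 1 ≤ α) (hβ : 0 ≤ β) (hl : 0 ≤ lam) (hu : χ ≤ u)
    (hq : 1 ≤ q) (x : ℝ) :
    thetaStar α β lam u q⁻¹ x = recip χ lam (β + α * u) (α * (Real.exp (-x) * q)) := by
  have hx := Real.exp_pos (-x)
  have hq0 : 0 < q := by linarith
  have hu0 : 0 < u := by linarith
  have hb : χ ≤ β + α * u := by nlinarith
  have hp : 0 ≤ α * (Real.exp (-x) * q) := by positivity
  have h1 : lfun q⁻¹ = q⁻¹ := by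
    rw [lfun, if_neg (by positivity : 0 ≤ q⁻¹).not_gt, if_pos (inv_le_one_of_one_le₀ hq)]
  have h2 : kappa u = u := if_pos hu0
  rw [thetaStar, h1, h2, recip, max_eq_left hb, max_eq_left hp, denom_one]
  have hb0 : 0 < β + α * u := hχ.trans_le hb
  have h3 : 0 < β + α * u + α * (Real.exp (-x) * q) * (1 + lam * (β + α * u)) := by positivity
  have h4 : 0 < α * Real.exp (-x) + (lam * α * Real.exp (-x) + q⁻¹) * (β + α * u) := by positivity
  rw [eq_comm, inv_eq_one_div, div_eq_div_iff h3.ne' h4.ne']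
  field_simp
  ring

lemma DecayTo.tendsto_mul_rpow {α l : ℝ} {g : ℕ → ℝ} (h : DecayTo α g l) :
    Tendsto (fun n : ℕ => (n : ℝ) ^ α * g n) atTop (𝓝 l) := by
  rw [← tendsto_add_atTop_iff_nat 1]
  have h1 : Tendsto (fun n : ℕ => (((n + 1 : ℕ) : ℝ) + 1) ^ α * g (n + 1)) atTop (𝓝 l) :=
    (tendsto_add_atTop_iff_nat (f := fun n : ℕ => ((n : ℝ) + 1) ^ α * g n) 1).2 h
  have h2 := h1.div (tendsto_ratio_rpow α 1) one_ne_zero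
  rw [div_one] at h2
  refine h2.congr fun n => ?_
  have h3 : (0 : ℝ) < (((n + 1 : ℕ) : ℝ) + 1) ^ α := by positivity
  have h4 : (0 : ℝ) < ((n : ℝ) + 1) ^ α := by positivity
  simp only [Pi.div_apply]
  field_simp
  push_cast
  ring

section Limit

variable {Ω : Type*} [MeasurableSpace Ω] {μ P : Measure Ω}
  {ξ : Ω → ℕ → ℝ × ℝ} {F : ℕ → MeasurableSpace Ω} {Pm : ℝ → Measure Ω}
  {L : Measure (ℝ × ℝ)} [IsProbabilityMeasure L] {χ σ : ℝ}

lemma Coding.le_BfwdInf (hc : Coding μ ξ F L) (h : EnvLaw L χ σ)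
    (hP : IsPplus μ (fun i ω => stp i (ξ ω)) F 0 P) : ∀ᵐ ω ∂P, χ ≤ BfwdInf (ξ ω) := by
  have h1 : ∀ᵐ ω ∂P, ∀ i, χ ≤ (ξ ω (i + 1)).2 := ae_all_iff.2 fun i =>
    hc.ae_plus h hP (q := fun w => χ ≤ (w (i + 1)).2) ((upTo_eta i).comp (g := fun x => χ ≤ x)
      (measurableSet_setOfPred.1 measurableSet_Ici)) ((ae_seqLaw h.le_eta).mono fun w hw _ => hw (i + 1))
  filter_upwards [h1, hc.tendsto_Bfwd h hP] with ω h1 h2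
  refine ge_of_tendsto h2 ((eventually_ge_atTop 1).mono fun k hk => ?_)
  calc χ ≤ (ξ ω (0 + 1)).2 * Real.exp (-walk stp 0 (ξ ω)) := by simpa [walk_zero] using h1 0
    _ ≤ Bfwd k (ξ ω) := Finset.single_le_sum
      (f := fun i => (ξ ω (i + 1)).2 * Real.exp (-walk stp i (ξ ω)))
      (fun i _ => mul_nonneg (h.pos.le.trans (h1 i)) (Real.exp_pos _).le) (Finset.mem_range.2 (by omega))

lemma Coding.vFun_mul_exp (hc : Coding μ ξ F L) (h : EnvLaw L χ σ) {s : ℝ} (hs : 0 < s) :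
    Real.exp (-s) * vFun μ (fun i ω => stp i (ξ ω)) (-s) = upDensity (L.map Prod.fst) s := by
  rw [vFun_eq_ren hc.meas hc.map h.step (by linarith), neg_neg, upDensity, indicator_of_mem (mem_Ioi.2 hs),
    mul_comm]

lemma Coding.integral_exp_mul_vFun (hc : Coding μ ξ F L) (h : EnvLaw L χ σ) :
    ∫ z in Ioi (0 : ℝ), Real.exp (-z) * vFun μ (fun i ω => stp i (ξ ω)) (-z) =
      ∫ s, upDensity (L.map Prod.fst) s := by
  rw [setIntegral_congr_fun measurableSet_Ioi fun s hs => hc.vFun_mul_exp h hs]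
  exact setIntegral_eq_integral_of_forall_compl_eq_zero fun s hs => indicator_of_notMem hs _

lemma IsStep.integral_upDensity_pos {ν : Measure ℝ} (h : IsStep ν σ) : 0 < ∫ s, upDensity ν s := by
  have h1 : ∫ s in Ioi (0 : ℝ), Real.exp (-s) ≤ ∫ s, upDensity ν s := by
    rw [← integral_indicator measurableSet_Ioi]
    refine integral_mono ((integrableOn_exp_neg_Ioi 0).integrable_indicator measurableSet_Ioi)
      h.integrable_upDensity fun s => ?_
    by_cases hs : 0 < s
    · simpa [upDensity, Set.indicator, hs] using
        le_mul_of_one_le_left (Real.exp_pos (-s)).le (h.one_le_ren_up hs)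
    · simp [upDensity, Set.indicator, hs]
  rw [integral_exp_neg_Ioi_zero] at h1
  linarith

/-- The constant in the asymptotics of `E[exp (-S_n); L_n ≥ 0]`. -/
lemma EnvLaw.decayTo_exp (h : EnvLaw L χ σ) :
    DecayTo (3 / 2) (fun n => ∫ w in stayIn stp (Ici 0) 0 n, Real.exp (-walk stp n w) ∂seqLaw L)
      (lltConst σ * ∫ s, upDensity (L.map Prod.fst) s) := by
  have h1 := (h.step.lapConv_killed le_rfl).lim 0
  have h2 : lap (ENNReal.ofReal (lltConst σ * ren (downSeq (L.map Prod.fst)) Iic 0) •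
      renMeas (upSeq (L.map Prod.fst)) Iio) ((0 : ℕ) + 1) = lltConst σ * ∫ s, upDensity (L.map Prod.fst) s := by
    have h3 : LadderSeq (upSeq (L.map Prod.fst)) (lltConst σ) := h.step.ladderSeq_pos
    rw [h.step.ren_down_zero, mul_one, lap, integral_smul_measure, ENNReal.toReal_ofReal h3.const_nonneg,
      h.step.integral_upDensity, lap]
    simp
  rw [h2] at h1
  refine h1.congr fun n => ?_
  rw [← setIntegral_exp_stayIn]
  simp

lemma Coding.integral_limTerm (hc : Coding μ ξ F L) (h : EnvLaw L χ σ)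
    (hP : IsPplus μ (fun i ω => stp i (ξ ω)) F 0 P) (hpos : ∀ ω i, 0 ≤ (ξ ω (i + 1)).2)
    {α β lam ρ : ℝ} (hα : 1 ≤ α) (hβ : 0 ≤ β) (hl : 0 ≤ lam) (hρ : 1 ≤ ρ) :
    ∫ s, upDensity (L.map Prod.fst) s * ∫ ω₁, (∫ ω₂,
        limTerm χ α β lam ρ (BfwdInf (ξ ω₁)) (BbwdInf (ξ ω₂)) (Real.exp (-s)) ∂Pm (-s)) ∂P =
      (∫ z' in Ioi (0 : ℝ), Real.exp (-z') * vFun μ (fun i ω => stp i (ξ ω)) (-z')) *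
        ∫ z in Iio (0 : ℝ), ((∫ z' in Ioi (0 : ℝ), Real.exp (-z') * vFun μ (fun i ω => stp i (ξ ω)) (-z'))⁻¹ *
          Real.exp z * vFun μ (fun i ω => stp i (ξ ω)) z) *
          ∫ ω₁, (∫ ω₂, thetaStar α β lam (BfwdInf (ξ ω₁)) (BbwdInf (ξ ω₂) + ρ)⁻¹ (-z) *
            thetaStar α β lam (BfwdInf (ξ ω₁)) (BbwdInf (ξ ω₂) + 1)⁻¹ (-z) ∂Pm z) ∂P := by
  have hc0 := h.step.integral_upDensity_pos
  rw [hc.integral_exp_mul_vFun h, ← integral_const_mul]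
  set c := ∫ s, upDensity (L.map Prod.fst) s
  rw [← setIntegral_eq_integral_of_forall_compl_eq_zero (s := Ioi 0) fun s hs => by
    rw [upDensity, indicator_of_notMem hs, zero_mul], ← integral_Iic_eq_integral_Iio]
  rw [show Iic (0 : ℝ) = Iic (-0) by rw [neg_zero], ← integral_comp_neg_Ioi]
  refine setIntegral_congr_fun measurableSet_Ioi fun s hs => ?_
  have h1 : ∫ ω₁, (∫ ω₂, limTerm χ α β lam ρ (BfwdInf (ξ ω₁)) (BbwdInf (ξ ω₂)) (Real.exp (-s)) ∂Pm (-s)) ∂P =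
      ∫ ω₁, (∫ ω₂, thetaStar α β lam (BfwdInf (ξ ω₁)) (BbwdInf (ξ ω₂) + ρ)⁻¹ (- -s) *
            thetaStar α β lam (BfwdInf (ξ ω₁)) (BbwdInf (ξ ω₂) + 1)⁻¹ (- -s) ∂Pm (-s)) ∂P := by
    refine integral_congr_ae ((hc.le_BfwdInf h hP).mono fun ω₁ hω => integral_congr_ae (.of_forall fun ω₂ => ?_))
    have hB : 0 ≤ BbwdInf (ξ ω₂) := tsum_nonneg fun i => mul_nonneg (hpos ω₂ i) (Real.exp_pos _).le
    simp only
    rw [thetaStar_inv h.pos hα hβ hl hω (by linarith), thetaStar_inv h.pos hα hβ hl hω (by linarith), limTerm,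
      neg_neg, add_comm ρ, add_comm 1]
  rw [h1, ← hc.vFun_mul_exp h hs]
  field_simp

end Limit

/-! ### The environment as a marked sequence -/

/-- The triple `((log m(q), η(q)), f(0))` of an offspring law `q`. -/
def feat (q : Measure ℕ) : (ℝ × ℝ) × ℝ :=
  ((Real.log (∑' i : ℕ, (i : ℝ) * (q {i}).toReal),
    (∑' i : ℕ, ((i : ℝ) * ((i : ℝ) - 1)) * (q {i}).toReal) /
      (2 * (∑' i : ℕ, (i : ℝ) * (q {i}).toReal) ^ 2)),
    ∑' i : ℕ, (q {i}).toReal * 0 ^ i)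

lemma measurable_feat : Measurable feat := by
  have h : ∀ i : ℕ, Measurable fun q : Measure ℕ => (q {i}).toReal := fun i =>
    (Measure.measurable_coe (MeasurableSet.singleton i)).ennreal_toReal
  have h1 : Measurable fun q : Measure ℕ => ∑' i : ℕ, (i : ℝ) * (q {i}).toReal :=
    Measurable.tsum fun i => (h i).const_mul _
  have h2 : Measurable fun q : Measure ℕ => ∑' i : ℕ, ((i : ℝ) * ((i : ℝ) - 1)) * (q {i}).toReal :=
    Measurable.tsum fun i => (h i).const_mul _
  have h3 : Measurable fun q : Measure ℕ => ∑' i : ℕ, (q {i}).toReal * (0 : ℝ) ^ i :=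
    Measurable.tsum fun i => (h i).mul_const _
  exact (h1.log.prodMk (h2.div ((h1.pow_const 2).const_mul 2))).prodMk h3

/-- The marked sequence of an environment. -/
def marks {Ω : Type*} (Q : ℕ → Ω → Measure ℕ) (ω : Ω) (i : ℕ) : (ℝ × ℝ) × ℝ := feat (Q i ω)

section Env

variable {Ω : Type*} {Q : ℕ → Ω → Measure ℕ}

lemma pgf_nonneg (n : ℕ) (ω : Ω) {s : ℝ} (hs : 0 ≤ s) : 0 ≤ pgf Q n ω s :=
  tsum_nonneg fun i => by positivity

lemma etaEnv_nonneg (n : ℕ) (ω : Ω) : 0 ≤ etaEnv Q n ω := by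
  refine div_nonneg (tsum_nonneg fun i => mul_nonneg ?_ ENNReal.toReal_nonneg) (by positivity)
  rcases i with _ | i
  · simp
  · push_cast
    rw [add_sub_cancel_right]
    positivity

lemma FracLinear.pgf_lt_one (hfrac : FracLinear Q) {n : ℕ} (hn : 1 ≤ n) (ω : Ω) {s : ℝ} (hs : 0 ≤ s)
    (hs1 : s < 1) : pgf Q n ω s < 1 := by
  have h := hfrac n hn ω s hs hs1
  have h1 : 0 < Real.exp (-(Xenv Q n ω)) / (1 - s) + etaEnv Q n ω :=
    add_pos_of_pos_of_nonneg (div_pos (Real.exp_pos _) (by linarith)) (etaEnv_nonneg n ω)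
  rw [← h, inv_pos] at h1
  linarith

lemma pgfComp_self (j : ℕ) (ω : Ω) (s : ℝ) : pgfComp Q j j ω s = s := by
  cases j <;> simp [pgfComp]

lemma pgfComp_succ {j n : ℕ} (h : j ≤ n) (ω : Ω) (s : ℝ) :
    pgfComp Q j (n + 1) ω s = pgfComp Q j n ω (pgf Q (n + 1) ω s) := by
  rw [pgfComp, if_neg (by omega)]

lemma FracLinear.pgfComp_spec [MeasurableSpace Ω] (hfrac : FracLinear Q) (ω : Ω) {j n : ℕ} (hjn : j ≤ n) :
    ∀ s, 0 ≤ s → s < 1 → 0 ≤ pgfComp Q j n ω s ∧ pgfComp Q j n ω s < 1 ∧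
      Real.exp (-Senv Q j ω) * (1 - pgfComp Q j n ω s)⁻¹ =
        Real.exp (-Senv Q n ω) / (1 - s) + (bEnv Q n ω - bEnv Q j ω) := by
  induction n, hjn using Nat.le_induction with
  | base =>
    intro s hs hs1
    rw [pgfComp_self]
    exact ⟨hs, hs1, by ring⟩
  | succ n hjn ih =>
    intro s hs hs1
    obtain ⟨h1, h2, h3⟩ := ih (pgf Q (n + 1) ω s) (pgf_nonneg _ _ hs) (hfrac.pgf_lt_one (by omega) ω hs hs1)
    rw [pgfComp_succ hjn]
    refine ⟨h1, h2, ?_⟩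
    rw [h3, div_eq_mul_inv, hfrac (n + 1) (by omega) ω s hs hs1, bEnv, bEnv, bEnv, Finset.sum_range_succ,
      Senv, walk_succ, neg_add, Real.exp_add]
    ring

lemma one_sub_eq_of_moebius {x s b q g P : ℝ} (hx : 0 < x) (hs : 0 < s) (hs1 : s ≤ 1) (hb : 0 ≤ b)
    (hP : 0 < P) (hq : x * (1 - q)⁻¹ = P) (hq1 : q < 1) (hg : (1 - g)⁻¹ = x / (1 - s * q) + b) :
    1 - g = ((1 - s) / x * P + s) / denom s ((1 - s) / x) b P := by
  have h1 : 0 < 1 - q := by linarith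
  have h2 : 0 ≤ (1 - s) / x := div_nonneg (by linarith) hx.le
  have h3 : 0 < denom s ((1 - s) / x) b P := by unfold denom; positivity
  have h4 : 1 - s * q = x * ((1 - s) / x * P + s) / P := by
    rw [← hq]
    field_simp
    ring
  rw [← inv_inv (1 - g), hg, h4, inv_eq_iff_eq_inv, inv_div, denom]
  have h5 : 0 < (1 - s) / x * P + s := by positivity
  generalize (1 - s) / x = l at *
  field_simp
  ring

lemma FracLinear.fnt_eq [MeasurableSpace Ω] (hfrac : FracLinear Q) {t : ℝ} (ht1 : t ≤ 1) {lam : ℝ} (hl : 0 ≤ lam)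
    (n : ℕ) (ω : Ω) : Fnt Q t n lam ω = markTerm lam ⌊(n : ℝ) * t⌋₊ n (marks Q ω) := by
  have hmn : ⌊(n : ℝ) * t⌋₊ ≤ n := by
    refine (Nat.floor_mono (mul_le_of_le_one_right (Nat.cast_nonneg n) ht1)).trans (Nat.floor_natCast n).le
  rw [Fnt]
  generalize ⌊(n : ℝ) * t⌋₊ = m at *
  set x := Real.exp (-Senv Q m ω) with hx
  set s := Real.exp (-lam * x) with hs
  have hx0 : 0 < x := Real.exp_pos _
  have hs0 : 0 < s := Real.exp_pos _
  have hs1 : s ≤ 1 := Real.exp_le_one_iff.2 (by nlinarith)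
  set r := pgf Q (n + 1) ω 0 with hr
  have hr0 : 0 ≤ r := pgf_nonneg _ _ le_rfl
  have hr1 : r < 1 := hfrac.pgf_lt_one (by omega) ω le_rfl one_pos
  have hb : 0 ≤ bEnv Q m ω := Finset.sum_nonneg fun i _ => mul_nonneg (etaEnv_nonneg _ _) (Real.exp_pos _).le
  have hD : 0 ≤ bEnv Q n ω - bEnv Q m ω := by
    rw [sub_nonneg]
    exact Finset.sum_le_sum_of_subset_of_nonneg (Finset.range_mono hmn) fun i _ _ =>
      mul_nonneg (etaEnv_nonneg _ _) (Real.exp_pos _).le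
  have key : ∀ u, 0 ≤ u → u < 1 →
      1 - pgfComp Q 0 m ω (s * pgfComp Q m n ω u) =
        ((1 - s) / x * (Real.exp (-Senv Q n ω) / (1 - u) + (bEnv Q n ω - bEnv Q m ω)) + s) /
          denom s ((1 - s) / x) (bEnv Q m ω)
            (Real.exp (-Senv Q n ω) / (1 - u) + (bEnv Q n ω - bEnv Q m ω)) := fun u hu hu1 => by
    obtain ⟨h1, h2, h3⟩ := hfrac.pgfComp_spec ω hmn u hu hu1
    have hsq : s * pgfComp Q m n ω u < 1 := by nlinarith
    obtain ⟨h4, h5, h6⟩ := hfrac.pgfComp_spec ω (Nat.zero_le m) _ (mul_nonneg hs0.le h1) hsq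
    refine one_sub_eq_of_moebius hx0 hs0 hs1 hb
      (add_pos_of_pos_of_nonneg (div_pos (Real.exp_pos _) (by linarith)) hD) h3 h2 ?_
    simpa [hx, Senv, walk_zero, bEnv] using h6
  have h1 := key r hr0 hr1
  have h2 := key 0 le_rfl one_pos
  have e1 : markTerm lam m n (marks Q ω) = r / (1 - r) * (Real.exp (-Senv Q n ω) * (s *
      ((denom s ((1 - s) / x) (bEnv Q m ω) (Real.exp (-Senv Q n ω) / (1 - r) + (bEnv Q n ω - bEnv Q m ω)))⁻¹ *
      (denom s ((1 - s) / x) (bEnv Q m ω)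
        (Real.exp (-Senv Q n ω) / (1 - 0) + (bEnv Q n ω - bEnv Q m ω)))⁻¹))) := by
    have e2 : walk stp m (unmark (marks Q ω)) = Senv Q m ω := rfl
    have e3 : walk stp n (unmark (marks Q ω)) = Senv Q n ω := rfl
    have e4 : Bfwd m (unmark (marks Q ω)) = bEnv Q m ω := rfl
    have e5 : Bfwd n (unmark (marks Q ω)) = bEnv Q n ω := rfl
    have e6 : (marks Q ω (n + 1)).2 = r := rfl
    rw [markTerm, gapTerm, odds, e2, e3, e4, e5, e6, effRate]
    simp only [one_mul, zero_add, ← hx, ← hs, mul_one, sub_zero, div_eq_mul_inv, inv_one]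
  have h3 : pgfComp Q 0 m ω (s * pgfComp Q m n ω r) - pgfComp Q 0 m ω (s * pgfComp Q m n ω 0) =
      (1 - pgfComp Q 0 m ω (s * pgfComp Q m n ω 0)) - (1 - pgfComp Q 0 m ω (s * pgfComp Q m n ω r)) := by ring
  rw [h3, h1, h2, e1]
  have h4 : 0 ≤ (1 - s) / x := div_nonneg (by linarith) hx0.le
  have hr2 : 0 < 1 - r := by linarith
  have hP : ∀ u : ℝ, u < 1 → 0 < denom s ((1 - s) / x) (bEnv Q m ω)
        (Real.exp (-Senv Q n ω) / (1 - u) + (bEnv Q n ω - bEnv Q m ω)) := fun u hu => by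
    have : 0 < Real.exp (-Senv Q n ω) / (1 - u) := div_pos (Real.exp_pos _) (by linarith)
    unfold denom
    positivity
  have h5 := hP r hr1
  have h6 := hP 0 one_pos
  rw [div_sub_div _ _ h6.ne' h5.ne', div_eq_iff (mul_pos h6 h5).ne']
  rw [mul_assoc (r / (1 - r)), mul_assoc (Real.exp _), mul_assoc s, mul_comm _⁻¹ _⁻¹, ← mul_inv,
    inv_mul_cancel₀ (mul_pos h6 h5).ne']
  have h7 : r / (1 - r) = 1 / (1 - r) - 1 := by field_simp; ring
  rw [h7, denom, denom]
  simp only [div_eq_mul_inv]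
  ring

end Env

/-! ### The law of the environment -/

section Law

variable {Ω : Type*} [MeasurableSpace Ω] {μ : Measure Ω} {Q : ℕ → Ω → Measure ℕ} {χ : ℝ}

lemma IIDfam.measurable_marks (h : IIDseq μ Q) : Measurable (marks Q) :=
  measurable_pi_iff.2 fun i => measurable_feat.comp (h.1 i)

lemma IIDfam.map_marks (h : IIDseq μ Q) [IsProbabilityMeasure (μ.map fun ω => feat (Q 1 ω))] :
    μ.map (marks Q) = seqLaw (μ.map fun ω => feat (Q 1 ω)) := by
  have h1 : iIndepFun (fun i ω => feat (Q i ω)) μ := h.2.1.comp (fun _ => feat) fun _ => measurable_feat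
  have h2 := h1.map_fun_eq_infinitePi_map (X := fun i ω => feat (Q i ω)) fun i =>
    measurable_feat.comp (h.1 i)
  rw [show marks Q = fun ω i => feat (Q i ω) from rfl, h2, seqLaw]
  congr 1
  exact funext fun i => ((h.2.2 i).comp measurable_feat).map_eq

lemma IIDfam.map_fst (h : IIDseq μ Q) :
    (μ.map fun ω => feat (Q 1 ω)).map Prod.fst = μ.map fun ω => (Xenv Q 1 ω, etaEnv Q 1 ω) :=
  Measure.map_map measurable_fst (measurable_feat.comp (h.1 1))

lemma IIDfam.measurable_pair (h : IIDseq μ Q) (i : ℕ) :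
    Measurable fun ω => (Xenv Q i ω, etaEnv Q i ω) :=
  measurable_fst.comp (measurable_feat.comp (h.1 i))

lemma IIDfam.map_step (h : IIDseq μ Q) :
    ((μ.map fun ω => feat (Q 1 ω)).map Prod.fst).map Prod.fst = μ.map (Xenv Q 1) := by
  rw [IIDfam.map_fst h]
  exact Measure.map_map measurable_fst (IIDfam.measurable_pair h 1)

lemma IIDfam.envLaw [IsProbabilityMeasure μ] (h : IIDseq μ Q) (hfrac : FracLinear Q) (hA1 : AssumptionA1With μ Q χ)
    (hA2 : AssumptionA2 μ Q) :
    EnvLaw ((μ.map fun ω => feat (Q 1 ω)).map Prod.fst) χ (Real.sqrt (∫ ω, Xenv Q 1 ω ^ 2 ∂μ)) := by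
  obtain ⟨hχ, hχ2, hA⟩ := hA1
  have hX : Measurable (Xenv Q 1) := (IIDfam.measurable_pair h 1).fst
  have hb : ∀ᵐ ω ∂μ, etaEnv Q 1 ω ≤ χ⁻¹ ∧ Real.exp (-Xenv Q 1 ω) ≤ χ⁻¹ := by
    filter_upwards [hA 1 le_rfl] with ω ⟨h1, h2, h3⟩
    have h4 := hfrac 1 le_rfl ω 0 le_rfl one_pos
    rw [sub_zero, div_one] at h4
    have h5 : (1 - pgf Q 1 ω 0)⁻¹ ≤ χ⁻¹ := by gcongr; linarith
    have := Real.exp_pos (-Xenv Q 1 ω)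
    constructor <;> linarith
  have hm : AEMeasurable (fun ω => (Xenv Q 1 ω, etaEnv Q 1 ω)) μ := (IIDfam.measurable_pair h 1).aemeasurable
  refine ⟨?_, hχ, by linarith, ?_, ?_, ?_⟩
  · rw [IIDfam.map_step h]
    refine ⟨Measure.isProbabilityMeasure_map hX.aemeasurable, ?_, ?_, Real.sqrt_pos.2 hA2.2.2.2.1, hA2.2.2.2.2⟩
    · rw [integral_map hX.aemeasurable (by fun_prop)]
      exact hA2.2.1
    · rw [integral_map hX.aemeasurable (by fun_prop), Real.sq_sqrt hA2.2.2.2.1.le]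
  · rw [IIDfam.map_fst h, ae_map_iff hm (measurableSet_le measurable_const measurable_snd)]
    exact (hA 1 le_rfl).mono fun ω h => h.2.2
  · rw [IIDfam.map_fst h, ae_map_iff hm (measurableSet_le measurable_snd measurable_const)]
    exact hb.mono fun ω h => h.1
  · rw [IIDfam.map_fst h, ae_map_iff hm (measurableSet_le (by fun_prop) measurable_const)]
    exact hb.mono fun ω h => h.2

lemma IIDfam.coding (h : IIDseq μ Q) [IsProbabilityMeasure (μ.map fun ω => feat (Q 1 ω))]
    [IsProbabilityMeasure ((μ.map fun ω => feat (Q 1 ω)).map Prod.fst)] :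
    Coding μ (fun ω => unmark (marks Q ω)) (envFiltration Q) ((μ.map fun ω => feat (Q 1 ω)).map Prod.fst) := by
  have hm := IIDfam.measurable_marks h
  refine ⟨measurable_unmark.comp hm, ?_, fun k i hi hik => ?_⟩
  · rw [← map_unmark_seqLaw, ← IIDfam.map_marks h, Measure.map_map measurable_unmark hm]
    rfl
  · have h1 : Measurable[envFiltration Q k] (Q i) := Measurable.mono (comap_measurable (Q i))
      (le_iSup₂_of_le (f := fun i (_ : i ∈ Finset.Icc 1 k) => MeasurableSpace.comap (Q i) inferInstance) i
        (Finset.mem_Icc.2 ⟨hi, hik⟩) le_rfl) le_rfl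
    exact measurable_fst.comp (measurable_feat.comp h1)

lemma IIDfam.ae_pgf_zero (h : IIDseq μ Q) (hA1 : AssumptionA1With μ Q χ) :
    ∀ᵐ ω ∂μ, 0 ≤ pgf Q 0 ω 0 ∧ pgf Q 0 ω 0 ≤ 1 - χ := by
  have h1 := (h.2.2 0).comp (measurable_snd.comp measurable_feat)
  have h2 : ∀ᵐ ω ∂μ, (Prod.snd ∘ feat) (Q 1 ω) ≤ 1 - χ := (hA1.2.2 1 le_rfl).mono fun ω h => h.2.1
  have h3 := (h1.symm.ae_snd (p := fun x => x ≤ 1 - χ) measurableSet_Iic h2)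
  exact h3.mono fun ω hω => ⟨pgf_nonneg 0 ω le_rfl, hω⟩

lemma FracLinear.abs_fnt_le (hfrac : FracLinear Q) {t : ℝ} (ht1 : t ≤ 1) {lam : ℝ} (hl : 0 ≤ lam)
    (n : ℕ) (ω : Ω) : |Fnt Q t n lam ω| ≤ 1 := by
  have hmn : ⌊(n : ℝ) * t⌋₊ ≤ n := by
    refine (Nat.floor_mono (mul_le_of_le_one_right (Nat.cast_nonneg n) ht1)).trans (Nat.floor_natCast n).le
  have key : ∀ u, 0 ≤ u → u < 1 → pgfComp Q 0 ⌊(n : ℝ) * t⌋₊ ω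
      (Real.exp (-lam * Real.exp (-(Senv Q ⌊(n : ℝ) * t⌋₊ ω))) * pgfComp Q ⌊(n : ℝ) * t⌋₊ n ω u) ∈ Icc (0 : ℝ) 1 :=
    fun u hu hu1 => by
      obtain ⟨h1, h2, -⟩ := hfrac.pgfComp_spec ω hmn u hu hu1
      have hs1 : Real.exp (-lam * Real.exp (-(Senv Q ⌊(n : ℝ) * t⌋₊ ω))) ≤ 1 :=
        Real.exp_le_one_iff.2 (by nlinarith [Real.exp_pos (-(Senv Q ⌊(n : ℝ) * t⌋₊ ω))])
      have hs0 := Real.exp_pos (-lam * Real.exp (-(Senv Q ⌊(n : ℝ) * t⌋₊ ω)))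
      obtain ⟨h3, h4, -⟩ := hfrac.pgfComp_spec ω (Nat.zero_le _) _ (mul_nonneg hs0.le h1) (by nlinarith)
      exact ⟨h3, h4.le⟩
  have h1 := key _ (pgf_nonneg (n + 1) ω le_rfl) (hfrac.pgf_lt_one (by omega) ω le_rfl one_pos)
  have h2 := key 0 le_rfl one_pos
  rw [Fnt, abs_le]
  constructor <;> linarith [h1.1, h1.2, h2.1, h2.2]

/-- The limit of `n ^ (3/2) * E[F_{n,t}(λ); τ(n) = j]`. -/
lemma IIDfam.tendsto_fnt [IsProbabilityMeasure μ] (hiid : IIDseq μ Q) (hfrac : FracLinear Q)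
    (hA1 : AssumptionA1 μ Q) (hA2 : AssumptionA2 μ Q)
    {Pp0 : Measure Ω} (hPp0 : IsPplus μ (Xenv Q) (envFiltration Q) 0 Pp0) {Pm : ℝ → Measure Ω}
    (hPm : ∀ x : ℝ, x ≤ 0 → IsPminus μ (Xenv Q) (envFiltration Q) x (Pm x))
    {t : ℝ} (ht0 : 0 < t) (ht1 : t < 1) {lam : ℝ} (hlam : 0 ≤ lam) {K₁ : ℝ}
    (hK1 : Tendsto (fun n : ℕ => (∫ ω in posSet (Xenv Q) 0 n, Real.exp (-(Senv Q n ω)) ∂μ) *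
          (n : ℝ) ^ ((3 : ℝ) / 2)) atTop (𝓝 K₁)) (j : ℕ) :
    Tendsto (fun n : ℕ => (n : ℝ) ^ ((3 : ℝ) / 2) *
          ∫ ω in {ω | tauWalk (Xenv Q) n ω = j}, Fnt Q t n lam ω ∂μ)
      atTop (𝓝 (K₁ * ∫ ω in {ω | tauWalk (Xenv Q) j ω = j},
        (Real.exp (-(Senv Q j ω)) * (pgf Q 0 ω 0 / (1 - pgf Q 0 ω 0))) *
          (∫ z in Set.Iio (0 : ℝ),
            ((∫ z' in Set.Ioi (0 : ℝ), Real.exp (-z') * vFun μ (Xenv Q) (-z'))⁻¹ *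
                Real.exp z * vFun μ (Xenv Q) z) *
              ∫ ω₁, (∫ ω₂,
                  thetaStar (Real.exp (-(Senv Q j ω))) (bEnv Q j ω) lam
                      (Bplus Q ω₁) (Vinf Q (pgf Q 0 ω 0) ω₂) (-z) *
                    thetaStar (Real.exp (-(Senv Q j ω))) (bEnv Q j ω) lam
                      (Bplus Q ω₁) (Vinf Q 0 ω₂) (-z)
                ∂(Pm z)) ∂Pp0) ∂μ)) := by
  obtain ⟨χ, hA1⟩ := hA1
  have hK : IsProbabilityMeasure (μ.map fun ω => feat (Q 1 ω)) :=
    Measure.isProbabilityMeasure_map (measurable_feat.comp (hiid.1 1)).aemeasurable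
  have hKf : IsProbabilityMeasure ((μ.map fun ω => feat (Q 1 ω)).map Prod.fst) :=
    Measure.isProbabilityMeasure_map (by fun_prop)
  have hm := IIDfam.measurable_marks hiid
  have h := IIDfam.envLaw hiid hfrac hA1 hA2
  have hc := IIDfam.coding hiid
  have hmap := IIDfam.map_marks hiid
  have hpgf := IIDfam.ae_pgf_zero hiid hA1
  have hχ := h.pos
  generalize (μ.map fun ω => feat (Q 1 ω)) = K at *
  generalize Real.sqrt (∫ ω, Xenv Q 1 ω ^ 2 ∂μ) = σ at *
  have hfl : ∀ n : ℕ, ⌊(n : ℝ) * t⌋₊ ≤ n := fun n =>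
    (Nat.floor_mono (mul_le_of_le_one_right (Nat.cast_nonneg n) ht1.le)).trans (Nat.floor_natCast n).le
  have hfl1 : Tendsto (fun n : ℕ => ⌊(n : ℝ) * t⌋₊) atTop atTop :=
    tendsto_nat_floor_atTop.comp (tendsto_natCast_atTop_atTop.atTop_mul_const ht0)
  have hfl2 : Tendsto (fun n : ℕ => n - ⌊(n : ℝ) * t⌋₊) atTop atTop := by
    have h1 : Tendsto (fun n : ℕ => ⌊(n : ℝ) * (1 - t)⌋₊) atTop atTop :=
      tendsto_nat_floor_atTop.comp (tendsto_natCast_atTop_atTop.atTop_mul_const (by linarith))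
    refine tendsto_atTop_mono (fun n => ?_) h1
    have h2 := Nat.floor_le (show 0 ≤ (n : ℝ) * (1 - t) from mul_nonneg (Nat.cast_nonneg n) (by linarith))
    have h3 := Nat.floor_le (show 0 ≤ (n : ℝ) * t by positivity)
    have h4 : ((⌊(n : ℝ) * (1 - t)⌋₊ + ⌊(n : ℝ) * t⌋₊ : ℕ) : ℝ) ≤ (n : ℕ) := by push_cast; linarith
    have h5 := Nat.cast_le.1 h4
    omega
  have hlim := h.tendsto_markTerm (lam := lam) (j := j) (m := fun n => ⌊(n : ℝ) * t⌋₊) (hc.integral_ren_down h hPp0) hm hmap hpgf hlam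
    (fun n => ?_) hfl hfl1 hfl2 (.of_forall fun ω => tendsto_blockLimit hc h hPp0 hPm
      (continuous_limTerm hχ hlam _ _ _) fun a b c => by
        rw [abs_of_nonneg (limTerm_nonneg hχ hlam _ _ _ a b c)]
        exact limTerm_le hχ hlam _ _ _ a b c)
  swap
  · refine Integrable.of_bound (((measurable_markTerm lam _ n).comp hm).aestronglyMeasurable) 1
      (.of_forall fun ω => ?_)
    rw [Real.norm_eq_abs]
    rw [← hfrac.fnt_eq ht1.le hlam]
    exact hfrac.abs_fnt_le ht1.le hlam n ω
  have hK₁ : K₁ = lltConst σ * ∫ z' in Ioi (0 : ℝ), Real.exp (-z') * vFun μ (Xenv Q) (-z') := by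
    have h1 := h.decayTo_exp.tendsto_mul_rpow
    rw [← hc.integral_exp_mul_vFun h] at h1
    refine tendsto_nhds_unique hK1 (h1.congr fun n => ?_)
    have hs := setIntegral_map (μ := μ) (g := fun ω => unmark (marks Q ω))
      (f := fun w => Real.exp (-walk stp n w)) (measurableSet_stayIn_stp (measurableSet_Ici (a := (0 : ℝ))) 0 n)
      (measurable_walk_stp n).neg.exp.aestronglyMeasurable hc.meas.aemeasurable
    rw [← hc.map, hs, mul_comm]
    rfl
  have h1 := hlim.tendsto_mul_rpow
  refine (h1.congr fun n => ?_).trans_eq ?_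
  · congr 2
    exact funext fun ω => (hfrac.fnt_eq ht1.le hlam n ω).symm
  · rw [hK₁, mul_assoc (lltConst σ)]
    refine congrArg (fun x => 𝓝 (lltConst σ * x)) ?_
    rw [← integral_const_mul]
    refine setIntegral_congr_ae (measurableSet_tauWalk_unmark hm le_rfl) (hpgf.mono fun ω hω hτ => ?_)
    have hα : 1 ≤ Real.exp (-walk stp j (unmark (marks Q ω))) :=
      Real.one_le_exp (by linarith [walk_nonpos_of_tauWalk hτ])
    have hβ : 0 ≤ Bfwd j (unmark (marks Q ω)) :=
      Finset.sum_nonneg fun i _ => mul_nonneg (etaEnv_nonneg (i + 1) ω) (Real.exp_pos _).le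
    have hρ : 1 ≤ (1 - (marks Q ω 0).2)⁻¹ := (one_le_inv₀ (by linarith [hω.2] : 0 < 1 - pgf Q 0 ω 0)).2
      (by linarith [hω.1])
    rw [hc.integral_limTerm (Pm := Pm) h hPp0 (fun ω i => etaEnv_nonneg (i + 1) ω) hα hβ hlam hρ, mul_left_comm]
    congr 2
    simp only [Vinf, sub_zero, inv_one]
    rfl

end Law

/-! ### The law of the extinction moment -/

section Extinction

variable {Ω : Type*} {Q : ℕ → Ω → Measure ℕ} {Z : ℕ → Ω → ℕ}

lemma extinctTime_eq_succ_iff (hZ : ∀ n ω, Z n ω = 0 → Z (n + 1) ω = 0) {n : ℕ} {ω : Ω} :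
    extinctTime Z ω = n + 1 ↔ Z (n + 1) ω = 0 ∧ Z n ω ≠ 0 := by
  rw [extinctTime]
  constructor
  · intro h
    have hne : {k | Z k ω = 0}.Nonempty := by
      by_contra hne
      rw [not_nonempty_iff_eq_empty.1 hne, Nat.sInf_empty] at h
      omega
    have h1 := Nat.sInf_mem hne
    rw [h] at h1
    exact ⟨h1, fun h2 => by have := Nat.sInf_le (s := {k | Z k ω = 0}) h2; omega⟩
  · rintro ⟨h1, h2⟩
    refine le_antisymm (Nat.sInf_le h1) (Nat.succ_le_of_lt (not_le.1 fun h3 => h2 ?_))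
    have h4 : Z (sInf {k | Z k ω = 0}) ω = 0 := Nat.sInf_mem (s := {k | Z k ω = 0}) ⟨n + 1, h1⟩
    exact Nat.le_induction h4 (fun k _ hk => hZ k ω hk) n h3

lemma measurable_marks_envSigma (i : ℕ) : Measurable[envSigma Q] fun ω => feat (Q (i + 1) ω) :=
  measurable_feat.comp (Measurable.mono (comap_measurable (Q (i + 1)))
    (le_iSup (fun i => MeasurableSpace.comap (Q (i + 1)) inferInstance) i) le_rfl)

lemma measurable_Senv_envSigma (n : ℕ) : Measurable[envSigma Q] (Senv Q n) := by
  let _ := envSigma Q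
  refine measurable_walk (fun i hi => ?_) n
  obtain ⟨i, rfl⟩ := Nat.exists_eq_add_of_le' hi
  exact (measurable_marks_envSigma i).fst.fst

lemma measurable_bEnv_envSigma (n : ℕ) : Measurable[envSigma Q] (bEnv Q n) := by
  let _ := envSigma Q
  exact Finset.measurable_fun_sum _ fun i _ =>
    (measurable_marks_envSigma i).fst.snd.mul (measurable_Senv_envSigma i).neg.exp

lemma envSigma_le [mΩ : MeasurableSpace Ω] (hQ : ∀ i, Measurable (Q i)) : envSigma Q ≤ mΩ :=
  iSup_le fun i => (hQ (i + 1)).comap_le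

lemma FracLinear.pgfComp_eq [MeasurableSpace Ω] (hfrac : FracLinear Q) (ω : Ω) {j n : ℕ} (hjn : j ≤ n) {s : ℝ}
    (hs : 0 ≤ s) (hs1 : s < 1) : pgfComp Q j n ω s =
      1 - Real.exp (-Senv Q j ω) / (Real.exp (-Senv Q n ω) / (1 - s) + (bEnv Q n ω - bEnv Q j ω)) := by
  obtain ⟨-, h2, h3⟩ := hfrac.pgfComp_spec ω hjn s hs hs1
  have : 1 - pgfComp Q j n ω s ≠ 0 := by linarith
  have h4 := Real.exp_pos (-Senv Q j ω)
  rw [← h3]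
  field_simp
  ring

lemma FracLinear.measurable_pgfComp [MeasurableSpace Ω] (hfrac : FracLinear Q) {j n : ℕ} (hjn : j ≤ n) {m : MeasurableSpace Ω}
    (hm : envSigma Q ≤ m) {Y : Ω → ℝ} (hY : Measurable[m] Y) (hY0 : ∀ ω, 0 ≤ Y ω) (hY1 : ∀ ω, Y ω < 1) :
    Measurable[m] fun ω => pgfComp Q j n ω (Y ω) := by
  rw [funext fun ω => hfrac.pgfComp_eq ω hjn (hY0 ω) (hY1 ω)]
  have h1 : ∀ k, Measurable[m] (Senv Q k) := fun k => (measurable_Senv_envSigma k).mono hm le_rfl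
  have h2 : ∀ k, Measurable[m] (bEnv Q k) := fun k => (measurable_bEnv_envSigma k).mono hm le_rfl
  exact measurable_const.sub ((h1 j).neg.exp.div (((h1 n).neg.exp.div (measurable_const.sub hY)).add
    ((h2 n).sub (h2 j))))

lemma tendsto_floor_mul_div (y : ℝ) (hy : 0 ≤ y) :
    Tendsto (fun k : ℕ => (⌊((k : ℝ) + 1) * y⌋₊ : ℝ) / ((k : ℝ) + 1)) atTop (𝓝 y) := by
  have h := (tendsto_nat_floor_mul_div_atTop hy).comp
    (tendsto_natCast_atTop_atTop.comp (tendsto_add_atTop_nat 1) : Tendsto (fun k : ℕ => ((k + 1 : ℕ) : ℝ)) atTop atTop)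
  refine h.congr fun k => ?_
  simp [mul_comm]

lemma floor_mul_div_mem {y : ℝ} (hy : 0 ≤ y) (hy1 : y < 1) (k : ℕ) : ⌊((k : ℝ) + 1) * y⌋₊ < k + 1 := by
  rw [Nat.floor_lt (by positivity)]
  push_cast
  nlinarith

variable {m mΩ : MeasurableSpace Ω} {μ : Measure Ω} [IsProbabilityMeasure μ]

/-- Two functions of an environment-measurable parameter with the same conditional integrals for each fixed
value of the parameter have the same integral. -/
lemma integral_eq_of_forall_setIntegral (hm : m ≤ mΩ) {Y : Ω → ℝ} (hY : Measurable[m] Y)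
    (hY0 : ∀ ω, 0 ≤ Y ω) (hY1 : ∀ ω, Y ω < 1) {φ ψ : Ω → ℝ → ℝ}
    (hφ : ∀ ω, ContinuousOn (φ ω) (Ico 0 1)) (hψ : ∀ ω, ContinuousOn (ψ ω) (Ico 0 1))
    (hφm : ∀ y ∈ Ico (0 : ℝ) 1, Measurable fun ω => φ ω y) (hψm : ∀ y ∈ Ico (0 : ℝ) 1, Measurable fun ω => ψ ω y)
    (hφ1 : ∀ ω, ∀ y ∈ Ico (0 : ℝ) 1, |φ ω y| ≤ 1) (hψ1 : ∀ ω, ∀ y ∈ Ico (0 : ℝ) 1, |ψ ω y| ≤ 1)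
    (h : ∀ y ∈ Ico (0 : ℝ) 1, ∀ A, MeasurableSet[m] A → ∫ ω in A, φ ω y ∂μ = ∫ ω in A, ψ ω y ∂μ) :
    ∫ ω, φ ω (Y ω) ∂μ = ∫ ω, ψ ω (Y ω) ∂μ := by
  have hk : ∀ k i : ℕ, i < k + 1 → (i : ℝ) / ((k : ℝ) + 1) ∈ Ico (0 : ℝ) 1 := fun k i hi =>
    ⟨by positivity, (div_lt_one (by positivity)).2 (by exact_mod_cast hi)⟩
  set Yk : ℕ → Ω → ℝ := fun k ω => (⌊((k : ℝ) + 1) * Y ω⌋₊ : ℝ) / ((k : ℝ) + 1) with hYk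
  have hYkm : ∀ k ω, Yk k ω ∈ Ico (0 : ℝ) 1 := fun k ω => hk k _ (floor_mul_div_mem (hY0 ω) (hY1 ω) k)
  have hA : ∀ k i : ℕ, MeasurableSet[m] {ω | ⌊((k : ℝ) + 1) * Y ω⌋₊ = i} := fun k i =>
    (@Measurable.comp _ _ _ m _ _ _ _ Nat.measurable_floor (hY.const_mul _)) (measurableSet_singleton i)
  have dec : ∀ (f : Ω → ℝ → ℝ) k ω, f ω (Yk k ω) = ∑ i ∈ Finset.range (k + 1),
      {ω | ⌊((k : ℝ) + 1) * Y ω⌋₊ = i}.indicator (fun ω => f ω ((i : ℝ) / ((k : ℝ) + 1))) ω := fun f k ω => by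
    rw [Finset.sum_eq_single ⌊((k : ℝ) + 1) * Y ω⌋₊]
    · simp [hYk]
    · intro i _ hi
      simp [Set.indicator, Ne.symm hi]
    · intro hi
      exact absurd (Finset.mem_range.2 (floor_mul_div_mem (hY0 ω) (hY1 ω) k)) hi
  have hint : ∀ {f : Ω → ℝ → ℝ}, (∀ y ∈ Ico (0 : ℝ) 1, Measurable fun ω => f ω y) →
      (∀ ω, ∀ y ∈ Ico (0 : ℝ) 1, |f ω y| ≤ 1) → ∀ k, ∀ i ∈ Finset.range (k + 1), Integrable
        ({ω | ⌊((k : ℝ) + 1) * Y ω⌋₊ = i}.indicator (fun ω => f ω ((i : ℝ) / ((k : ℝ) + 1)))) μ :=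
    fun {f} hf hf1 k i hi => (Integrable.of_bound (hf _ (hk k i (Finset.mem_range.1 hi))).aestronglyMeasurable 1
      (.of_forall fun ω => hf1 ω _ (hk k i (Finset.mem_range.1 hi)))).indicator (hm _ (hA k i))
  have heq : ∀ k, ∫ ω, φ ω (Yk k ω) ∂μ = ∫ ω, ψ ω (Yk k ω) ∂μ := fun k => by
    simp_rw [dec φ, dec ψ]
    rw [integral_finsetSum _ (hint hφm hφ1 k), integral_finsetSum _ (hint hψm hψ1 k)]
    refine Finset.sum_congr rfl fun i hi => ?_
    rw [integral_indicator (hm _ (hA k i)), integral_indicator (hm _ (hA k i)),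
      h _ (hk k i (Finset.mem_range.1 hi)) _ (hA k i)]
  have hlim : ∀ {f : Ω → ℝ → ℝ}, (∀ ω, ContinuousOn (f ω) (Ico 0 1)) →
      (∀ y ∈ Ico (0 : ℝ) 1, Measurable fun ω => f ω y) → (∀ ω, ∀ y ∈ Ico (0 : ℝ) 1, |f ω y| ≤ 1) →
      Tendsto (fun k => ∫ ω, f ω (Yk k ω) ∂μ) atTop (𝓝 (∫ ω, f ω (Y ω) ∂μ)) := fun {f} hf hfm hf1 => by
    refine tendsto_integral_of_dominated_convergence (fun _ => 1) (fun k => ?_) (integrable_const _)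
      (fun k => .of_forall fun ω => hf1 ω _ (hYkm k ω)) (.of_forall fun ω => ?_)
    · simp_rw [dec f]
      exact (integrable_finsetSum _ (hint hfm hf1 k)).aestronglyMeasurable
    · exact (hf ω (Y ω) ⟨hY0 ω, hY1 ω⟩).tendsto.comp (tendsto_nhdsWithin_iff.2
        ⟨tendsto_floor_mul_div _ (hY0 ω), .of_forall fun k => hYkm k ω⟩)
  exact tendsto_nhds_unique (hlim hφ hφm hφ1) ((hlim hψ hψm hψ1).congr fun k => (heq k).symm)

end Extinction

section ExtinctionLaw

variable {Ω : Type*} [MeasurableSpace Ω] {μ : Measure Ω} [IsProbabilityMeasure μ]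
  {Q : ℕ → Ω → Measure ℕ} {Z : ℕ → Ω → ℕ}

lemma abs_pow_le_one_of_mem {y : ℝ} (hy : y ∈ Icc (0 : ℝ) 1) (k : ℕ) : |y ^ k| ≤ 1 := by
  rw [abs_of_nonneg (pow_nonneg hy.1 k)]
  exact pow_le_one₀ hy.1 hy.2

lemma BranchingProperty.integral_mul_pow (hb : BranchingProperty μ Q Z) (hQ : ∀ i, Measurable (Q i)) {k n : ℕ}
    (hkn : k ≤ n) {s : ℝ} (hs : 0 ≤ s) (hs1 : s ≤ 1) {g : Ω → ℝ}
    (hg : Measurable[envSigma Q ⊔ MeasurableSpace.comap (Z k) inferInstance] g) (hg1 : ∀ ω, |g ω| ≤ 1) :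
    ∫ ω, g ω * s ^ Z n ω ∂μ = ∫ ω, g ω * pgfComp Q k n ω s ^ Z k ω ∂μ := by
  have hle := sup_le (envSigma_le hQ) (hb.2.1 k).comap_le
  have hint : Integrable (fun ω => s ^ Z n ω) μ :=
    .of_bound (measurable_const.pow (hb.2.1 n)).aestronglyMeasurable 1
      (.of_forall fun ω => abs_pow_le_one_of_mem ⟨hs, hs1⟩ _)
  have h1 := condExp_stronglyMeasurable_mul_of_bound hle hg.stronglyMeasurable hint 1 (.of_forall hg1)
  rw [← integral_condExp hle]
  refine integral_congr_ae ?_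
  filter_upwards [h1, hb.2.2.2 k n hkn s hs hs1] with ω h1 h2
  exact h1.trans (congrArg (g ω * ·) h2)

lemma FracLinear.continuousOn_pgfComp (hfrac : FracLinear Q) {j n : ℕ} (hjn : j ≤ n) (ω : Ω) :
    ContinuousOn (pgfComp Q j n ω) (Ico 0 1) := by
  have hpos : ∀ y ∈ Ico (0 : ℝ) 1,
      0 < Real.exp (-Senv Q n ω) / (1 - y) + (bEnv Q n ω - bEnv Q j ω) := fun y hy => by
    obtain ⟨-, h2, h3⟩ := hfrac.pgfComp_spec ω hjn y hy.1 hy.2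
    rw [← h3]
    exact mul_pos (Real.exp_pos _) (inv_pos.2 (by linarith))
  refine ContinuousOn.congr (f := fun y => 1 - Real.exp (-Senv Q j ω) /
    (Real.exp (-Senv Q n ω) / (1 - y) + (bEnv Q n ω - bEnv Q j ω))) ?_
    fun y hy => hfrac.pgfComp_eq ω hjn hy.1 hy.2
  refine continuousOn_const.sub (continuousOn_const.div ((continuousOn_const.div
    (continuousOn_const.sub continuousOn_id) fun y hy => ?_).add continuousOn_const) fun y hy => (hpos y hy).ne')
  exact (sub_pos.2 hy.2).ne'

lemma FracLinear.abs_pgfComp_le (hfrac : FracLinear Q) {j n : ℕ} (hjn : j ≤ n) (ω : Ω) {s : ℝ} (hs : 0 ≤ s)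
    (hs1 : s < 1) : |pgfComp Q j n ω s| ≤ 1 := by
  obtain ⟨h1, h2, -⟩ := hfrac.pgfComp_spec ω hjn s hs hs1
  rw [abs_of_nonneg h1]
  exact h2.le

lemma BranchingProperty.integral_pow_eq (hb : BranchingProperty μ Q Z) (hQ : ∀ i, Measurable (Q i))
    (hfrac : FracLinear Q) (m : ℕ) {Y : Ω → ℝ} (hY : Measurable[envSigma Q] Y) (hY0 : ∀ ω, 0 ≤ Y ω)
    (hY1 : ∀ ω, Y ω < 1) : ∫ ω, Y ω ^ Z m ω ∂μ = ∫ ω, pgfComp Q 0 m ω (Y ω) ∂μ := by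
  refine integral_eq_of_forall_setIntegral (φ := fun ω y => y ^ Z m ω) (ψ := fun ω y => pgfComp Q 0 m ω y)
    (envSigma_le hQ) hY hY0 hY1 (fun ω => (continuous_pow _).continuousOn)
    (fun ω => hfrac.continuousOn_pgfComp (Nat.zero_le m) ω) (fun y _ => measurable_const.pow (hb.2.1 m))
    (fun y hy => (hfrac.measurable_pgfComp (Nat.zero_le m) le_rfl (Y := fun _ => y) measurable_const
      (fun _ => hy.1) (fun _ => hy.2)).mono (envSigma_le hQ) le_rfl)
    (fun ω y hy => abs_pow_le_one_of_mem ⟨hy.1, hy.2.le⟩ _)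
    (fun ω y hy => hfrac.abs_pgfComp_le (Nat.zero_le m) ω hy.1 hy.2) fun y hy A hA => ?_
  have h := hb.integral_mul_pow hQ (Nat.zero_le m) hy.1 hy.2.le (g := A.indicator fun _ => 1)
    ((@measurable_const _ _ _ (_) (1 : ℝ)).indicator ((le_sup_left : envSigma Q ≤ _) A hA)) fun ω => by
      by_cases hω : ω ∈ A <;> simp [hω]
  simp only [hb.1, pow_one] at h
  have hA' := envSigma_le hQ A hA
  rw [← integral_indicator hA', ← integral_indicator hA']
  convert h using 3 with ω ω <;> by_cases hω : ω ∈ A <;> simp [hω]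

/-- Integrating `s ^ Z m` over `{Z k = 0}`, for an environment-measurable `s`. -/
lemma BranchingProperty.integral_pow_mul_zero_pow (hb : BranchingProperty μ Q Z) (hQ : ∀ i, Measurable (Q i))
    (hfrac : FracLinear Q) {m k : ℕ} (hmk : m ≤ k) {s : Ω → ℝ} (hs : Measurable[envSigma Q] s)
    (hs0 : ∀ ω, 0 ≤ s ω) (hs1 : ∀ ω, s ω ≤ 1) :
    ∫ ω, s ω ^ Z m ω * 0 ^ Z k ω ∂μ = ∫ ω, pgfComp Q 0 m ω (s ω * pgfComp Q m k ω 0) ∂μ := by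
  have h0 := fun ω => hfrac.pgfComp_spec ω hmk 0 le_rfl one_pos
  rw [hb.integral_mul_pow hQ hmk le_rfl zero_le_one
      (Measurable.pow (hs.mono le_sup_left le_rfl) ((comap_measurable (Z m)).mono le_sup_right le_rfl))
      fun ω => abs_pow_le_one_of_mem ⟨hs0 ω, hs1 ω⟩ _,
    ← hb.integral_pow_eq hQ hfrac m (Y := fun ω => s ω * pgfComp Q m k ω 0)
      (hs.mul (hfrac.measurable_pgfComp hmk le_rfl measurable_const (fun _ => le_rfl) fun _ => one_pos))
      (fun ω => mul_nonneg (hs0 ω) (h0 ω).1)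
      fun ω => (mul_le_of_le_one_left (h0 ω).1 (hs1 ω)).trans_lt (h0 ω).2.1]
  simp_rw [mul_pow]

lemma BranchingProperty.setIntegral_extinctTime_eq (hb : BranchingProperty μ Q Z) (hQ : ∀ i, Measurable (Q i))
    (hfrac : FracLinear Q) {t lam : ℝ} (ht1 : t ≤ 1) (hlam : 0 ≤ lam) (n : ℕ) :
    ∫ ω in {ω | extinctTime Z ω = n + 1}, Real.exp (-lam * ((Z ⌊(n : ℝ) * t⌋₊ ω : ℝ) *
        Real.exp (-(Senv Q ⌊(n : ℝ) * t⌋₊ ω)))) ∂μ = ∫ ω, Fnt Q t n lam ω ∂μ := by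
  unfold Fnt
  have hmn : ⌊(n : ℝ) * t⌋₊ ≤ n :=
    Nat.floor_le_of_le (mul_le_of_le_one_right (Nat.cast_nonneg n) ht1)
  set m := ⌊(n : ℝ) * t⌋₊
  set s : Ω → ℝ := fun ω => Real.exp (-lam * Real.exp (-(Senv Q m ω))) with hs
  have hsm : Measurable[envSigma Q] s :=
    (@Measurable.const_mul _ _ _ _ _ (_) _ (measurable_Senv_envSigma m).neg.exp (-lam)).exp
  have hs0 : ∀ ω, 0 ≤ s ω := fun ω => (Real.exp_pos _).le
  have hs1 : ∀ ω, s ω ≤ 1 := fun ω => Real.exp_le_one_iff.2 (by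
    have := mul_nonneg hlam (Real.exp_pos (-(Senv Q m ω))).le
    linarith)
  have hT : ∀ ω, {ω | extinctTime Z ω = n + 1}.indicator
      (fun ω => Real.exp (-lam * ((Z m ω : ℝ) * Real.exp (-(Senv Q m ω))))) ω =
      s ω ^ Z m ω * 0 ^ Z (n + 1) ω - s ω ^ Z m ω * 0 ^ Z n ω := fun ω => by
    have he : Real.exp (-lam * ((Z m ω : ℝ) * Real.exp (-(Senv Q m ω)))) = s ω ^ Z m ω := by
      rw [hs, ← Real.exp_nat_mul]
      congr 1
      ring
    simp only [Set.indicator_apply, mem_ofPred_eq, extinctTime_eq_succ_iff hb.2.2.1, he]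
    by_cases h1 : Z n ω = 0
    · simp [h1, hb.2.2.1 n ω h1]
    · by_cases h2 : Z (n + 1) ω = 0 <;> simp [h1, h2]
  have hTm : MeasurableSet {ω | extinctTime Z ω = n + 1} := by
    have : {ω | extinctTime Z ω = n + 1} = Z (n + 1) ⁻¹' {0} ∩ (Z n ⁻¹' {0})ᶜ := by
      ext ω
      exact extinctTime_eq_succ_iff hb.2.2.1
    rw [this]
    exact (hb.2.1 (n + 1) (measurableSet_singleton 0)).inter (hb.2.1 n (measurableSet_singleton 0)).compl
  have hint : ∀ k, Integrable (fun ω => s ω ^ Z m ω * 0 ^ Z k ω) μ := fun k =>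
    .of_bound (((hsm.mono (envSigma_le hQ) le_rfl).pow (hb.2.1 m)).mul
      (measurable_const.pow (hb.2.1 k))).aestronglyMeasurable 1 (.of_forall fun ω => by
        rw [Real.norm_eq_abs, abs_mul]
        exact mul_le_one₀ (abs_pow_le_one_of_mem ⟨hs0 ω, hs1 ω⟩ _) (abs_nonneg _)
          (abs_pow_le_one_of_mem ⟨le_rfl, zero_le_one⟩ _))
  have hint' : ∀ k, m ≤ k → Integrable (fun ω => pgfComp Q 0 m ω (s ω * pgfComp Q m k ω 0)) μ := fun k hk => by
    have h0 := fun ω => hfrac.pgfComp_spec ω hk 0 le_rfl one_pos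
    have hY0 : ∀ ω, 0 ≤ s ω * pgfComp Q m k ω 0 := fun ω => mul_nonneg (hs0 ω) (h0 ω).1
    have hY1 : ∀ ω, s ω * pgfComp Q m k ω 0 < 1 := fun ω =>
      (mul_le_of_le_one_left (h0 ω).1 (hs1 ω)).trans_lt (h0 ω).2.1
    exact .of_bound ((hfrac.measurable_pgfComp (Nat.zero_le m) le_rfl (hsm.mul (hfrac.measurable_pgfComp hk le_rfl
      measurable_const (fun _ => le_rfl) fun _ => one_pos)) hY0 hY1).mono (envSigma_le hQ) le_rfl).aestronglyMeasurable
      1 (.of_forall fun ω => hfrac.abs_pgfComp_le (Nat.zero_le m) ω (hY0 ω) (hY1 ω))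
  have hn : m ≤ n + 1 := hmn.trans n.le_succ
  rw [← integral_indicator hTm, funext hT, integral_sub (hint _) (hint _),
    hb.integral_pow_mul_zero_pow hQ hfrac hn hsm hs0 hs1, hb.integral_pow_mul_zero_pow hQ hfrac hmn hsm hs0 hs1,
    ← integral_sub (hint' _ hn) (hint' _ hmn)]
  simp_rw [pgfComp_succ hmn]
  rfl

end ExtinctionLaw

/-- **Lemma `Lfuncjleft`.** Under A1–A3 for the fractional-linear BPRE, with
`F_{n,t}(λ)` as above one has `E[e^{-λ Z_{⌊nt⌋} e^{-S_{⌊nt⌋}}}; T = n+1] = E[F_{n,t}(λ)]`,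
and for each fixed `j`,
`lim_n n^{3/2} E[F_{n,t}(λ); τ(n) = j]
  = K₁ E[e^{-S_j} 1{τ(j)=j} X_f(1) A_j*(λ)]`, where
`A_j*(λ) = ⨌ Θ*(a_j, b_j, λ; u, v, -z) P⁺(B⁺ ∈ du) P_z⁻(V_∞(f(0),0) ∈ dv) ν₁(dz)`
(the independent copy `f` being `pgf Q 0`). -/
theorem statement17
    {Ω : Type*} [MeasurableSpace Ω] (μ : Measure Ω) [IsProbabilityMeasure μ]
    (Q : ℕ → Ω → Measure ℕ) (Z : ℕ → Ω → ℕ)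
    (hQprob : ∀ n ω, IsProbabilityMeasure (Q n ω))
    (hiid : IIDseq μ Q) (hfrac : FracLinear Q)
    (hbranch : BranchingProperty μ Q Z)
    (hA1 : AssumptionA1 μ Q) (hA2 : AssumptionA2 μ Q) (hA3 : AssumptionA3 μ Q)
    (Pp0 : Measure Ω) (hPp0 : IsPplus μ (Xenv Q) (envFiltration Q) 0 Pp0)
    (Pm : ℝ → Measure Ω)
    (hPm : ∀ x : ℝ, x ≤ 0 → IsPminus μ (Xenv Q) (envFiltration Q) x (Pm x))
    (t : ℝ) (ht0 : 0 < t) (ht1 : t < 1) (lam : ℝ) (hlam : 0 ≤ lam)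
    (K₁ : ℝ)
    (hK1 : Tendsto (fun n : ℕ =>
        (∫ ω in posSet (Xenv Q) 0 n, Real.exp (-(Senv Q n ω)) ∂μ) *
          (n : ℝ) ^ ((3 : ℝ) / 2)) atTop (𝓝 K₁)) :
    (∀ n : ℕ, 1 ≤ n →
      ∫ ω in {ω | extinctTime Z ω = n + 1},
          Real.exp (-lam * ((Z ⌊(n : ℝ) * t⌋₊ ω : ℝ) *
            Real.exp (-(Senv Q ⌊(n : ℝ) * t⌋₊ ω)))) ∂μ
        = ∫ ω, Fnt Q t n lam ω ∂μ) ∧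
    ∀ j : ℕ, Tendsto (fun n : ℕ =>
        (n : ℝ) ^ ((3 : ℝ) / 2) *
          ∫ ω in {ω | tauWalk (Xenv Q) n ω = j}, Fnt Q t n lam ω ∂μ)
      atTop (𝓝 (K₁ * ∫ ω in {ω | tauWalk (Xenv Q) j ω = j},
        (Real.exp (-(Senv Q j ω)) * (pgf Q 0 ω 0 / (1 - pgf Q 0 ω 0))) *
          (∫ z in Set.Iio (0 : ℝ),
            ((∫ z' in Set.Ioi (0 : ℝ), Real.exp (-z') * vFun μ (Xenv Q) (-z'))⁻¹ *
                Real.exp z * vFun μ (Xenv Q) z) *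
              ∫ ω₁, (∫ ω₂,
                  thetaStar (Real.exp (-(Senv Q j ω))) (bEnv Q j ω) lam
                      (Bplus Q ω₁) (Vinf Q (pgf Q 0 ω 0) ω₂) (-z) *
                    thetaStar (Real.exp (-(Senv Q j ω))) (bEnv Q j ω) lam
                      (Bplus Q ω₁) (Vinf Q 0 ω₂) (-z)
                ∂(Pm z)) ∂Pp0) ∂μ)) :=
  ⟨fun n _ => hbranch.setIntegral_extinctTime_eq hiid.1 hfrac ht1.le hlam n,
    IIDfam.tendsto_fnt hiid hfrac hA1 hA2 hPp0 hPm ht0 ht1 hlam hK1⟩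

end BPREpaper
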